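/- Let d ≥ 5 be an integer and let R ⊂ (0,∞) be a lacunary set of admissible radii. Suppose R admits an admissible good/bad prime dichotomy (G,B) with parameter s ∈ (0,1]. Then for every real p < ∞ satisfying p ≥ d/(d−(1+s)) and p > (d−1)/(d−2), the maximal operator is bounded on ℓ^p(ℤ^d): there exists C such that ‖sup_{r∈R}|A_r f|‖_{ℓ^p(ℤ^d)} ≤ C‖f‖_{ℓ^p(ℤ^d)} for all f : ℤ^d → ℂ with ‖f‖_{ℓ^p} < ∞. -/

import Mathlib

open scoped ENNReal NNReal BigOperators
open MeasureTheory

noncomputable section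

/-- `e(t) = exp(2πit)`. -/
def eC (t : ℝ) : ℂ := Complex.exp (2 * Real.pi * Complex.I * t)

/-- `|x|²` for `x ∈ ℤ^d`. -/
def normSqZ {d : ℕ} (x : Fin d → ℤ) : ℤ := ∑ i, (x i) ^ 2

/-- The natural number `r²` of an admissible radius `r`. -/
def radSq (r : ℝ) : ℕ := ⌊r ^ 2⌋₊

/-- `r` is an admissible radius: `r > 0` and `r² ∈ ℕ`. -/
def IsAdmissible (r : ℝ) : Prop := 0 < r ∧ ∃ n : ℕ, r ^ 2 = (n : ℝ)

/-- A set of positive reals is lacunary. -/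
def Lacunary (R : Set ℝ) : Prop := ∃ c : ℝ, 1 < c ∧ ∀ r ∈ R, ∀ s ∈ R, r < s → c * r ≤ s

/-- `N_d(r)`: the number of lattice points on the sphere of radius `r` in `ℤ^d`. -/
def sphereCount (d : ℕ) (r : ℝ) : ℕ := Nat.card {x : Fin d → ℤ // normSqZ x = (radSq r : ℤ)}

/-- The discrete spherical average `A_r f`. -/
def sphAvg (d : ℕ) (r : ℝ) (f : (Fin d → ℤ) → ℂ) (x : Fin d → ℤ) : ℂ :=
  (sphereCount d r : ℂ)⁻¹ *
    ∑' y : Fin d → ℤ, if normSqZ y = (radSq r : ℤ) then f (x - y) else 0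

/-- The `ℓ^p(ℤ^d)` norm, valued in `ℝ≥0∞`. -/
def lpNorm (d : ℕ) (p : ℝ) (f : (Fin d → ℤ) → ℂ) : ℝ≥0∞ :=
  (∑' x : Fin d → ℤ, (‖f x‖₊ : ℝ≥0∞) ^ p) ^ (1 / p)

/-- `(G, B)` is an admissible good/bad prime dichotomy for the set of radii `R`,
with parameter `s`. -/
def GoodBadDichotomy (R : Set ℝ) (G B : Set ℕ) (s : ℝ) : Prop :=
  (∀ p : ℕ, p.Prime → p ∈ G ∪ B) ∧
  (∀ p ∈ G, Nat.Prime p) ∧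
  (∀ p ∈ B, Nat.Prime p) ∧
  (∀ p ∈ G, ∀ r ∈ R, IsUnit ((radSq r : ZMod p))) ∧
  (∀ ε : ℝ, 0 < ε → ∃ C : ℝ, 0 < C ∧ ∀ p ∈ G,
    (({z : ZMod p | ∃ r ∈ R, z = (radSq r : ZMod p)}.ncard : ℝ)) ≤ C * (p : ℝ) ^ ε) ∧
  Summable (fun q : B => (q : ℝ) ^ (-s))

/-- `∏_{i ≤ T} p_i`, the product of the first `⌊T⌋` primes. -/
def primorialUpTo (T : ℝ) : ℕ := ∏ i ∈ Finset.range ⌊T⌋₊, Nat.nth Nat.Prime i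

/-- `∏_{j₀ ≤ i ≤ T} p_i` where `p_i` is the `i`-th prime (`1`-indexed). -/
def prodPrimesFrom (j₀ : ℕ) (T : ℝ) : ℕ :=
  ∏ i ∈ Finset.Icc j₀ ⌊T⌋₊, Nat.nth Nat.Prime (i - 1)

/-- `n_j = 1 + ∏_{i ≤ 2^{j^η}} p_i`. -/
def nseq (η : ℝ) (j : ℕ) : ℕ := 1 + primorialUpTo ((2 : ℝ) ^ ((j : ℝ) ^ η))

/-- The normalized Kloosterman sum `K(q, N; n)`. -/
def kloosterman (d q : ℕ) (N : ℤ) (n : Fin d → ℤ) : ℂ :=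
  ((q : ℂ)⁻¹) ^ d *
    ∑ u : Fin q,
      if Nat.Coprime (u : ℕ) q then
        eC (-(((u : ℕ) : ℝ) * (N : ℝ)) / q) *
          ∑ b : Fin d → Fin q,
            eC ((((u : ℕ) : ℝ) * ∑ i, (((b i : ℕ) : ℝ)) ^ 2
                + ∑ i, ((b i : ℕ) : ℝ) * ((n i : ℝ))) / q)
      else 0

/-- The Ramanujan sum `c_q(N)`. -/
def ramanujanSum (q : ℕ) (N : ℤ) : ℂ :=
  ∑ u : Fin q, if Nat.Coprime (u : ℕ) q then eC ((((u : ℕ) : ℝ) * (N : ℝ)) / q) else 0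

/-- The measure `dσ_r = (2 r^{d-1})⁻¹ ℋ^{d-1} ⌞ {|x| = r}` on `ℝ^d`. -/
def sphMeasure (d : ℕ) (r : ℝ) : Measure (EuclideanSpace ℝ (Fin d)) :=
  (ENNReal.ofReal (2 * r ^ (d - 1)))⁻¹ •
    (μH[((d : ℝ) - 1)] : Measure (EuclideanSpace ℝ (Fin d))).restrict (Metric.sphere 0 r)

/-- The Fourier transform `𝓕dσ_r(ξ) = ∫ e(x·ξ) dσ_r(x)`. -/
def fourierSphMeasure (d : ℕ) (r : ℝ) (ξ : Fin d → ℝ) : ℂ :=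
  ∫ x : EuclideanSpace ℝ (Fin d), eC (∑ i, x i * ξ i) ∂(sphMeasure d r)

/-- `Ψ` is a smooth bump: supported in `[-1/4,1/4]^d` and `1` on `[-1/8,1/8]^d`. -/
def IsBump (d : ℕ) (Ψ : (Fin d → ℝ) → ℝ) : Prop :=
  ContDiff ℝ (⊤ : ℕ∞) Ψ ∧
  (∀ x, x ∉ Set.Icc (fun _ => -(1/4 : ℝ)) (fun _ => (1/4 : ℝ)) → Ψ x = 0) ∧
  (∀ x ∈ Set.Icc (fun _ => -(1/8 : ℝ)) (fun _ => (1/8 : ℝ)), Ψ x = 1)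

/-- `Ψ'` is a smooth cutoff with `1_{[-1/4,1/4]^d} ≤ Ψ' ≤ 1_{[-1/2,1/2]^d}`. -/
def IsCutoff (d : ℕ) (Ψ' : (Fin d → ℝ) → ℝ) : Prop :=
  ContDiff ℝ (⊤ : ℕ∞) Ψ' ∧
  (∀ x, Set.indicator (Set.Icc (fun _ => -(1/4 : ℝ)) (fun _ => (1/4 : ℝ)))
      (fun _ => (1 : ℝ)) x ≤ Ψ' x) ∧
  (∀ x, Ψ' x ≤ Set.indicator (Set.Icc (fun _ => -(1/2 : ℝ)) (fun _ => (1/2 : ℝ)))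
      (fun _ => (1 : ℝ)) x)

/-- The Fourier transform of `f : ℤ^d → ℂ`, `f̂(ξ) = ∑_n f(n) e(n·ξ)`. -/
def ftZ {d : ℕ} (f : (Fin d → ℤ) → ℂ) (ξ : Fin d → ℝ) : ℂ :=
  ∑' n : Fin d → ℤ, f n * eC (∑ i, (n i : ℝ) * ξ i)

/-- The Fourier multiplier operator on `ℤ^d` with 1-periodic multiplier `m`. -/
def mulOp (d : ℕ) (m : (Fin d → ℝ) → ℂ) (f : (Fin d → ℤ) → ℂ) (x : Fin d → ℤ) : ℂ :=
  ∫ ξ in Set.Icc (0 : Fin d → ℝ) 1, m ξ * ftZ f ξ * eC (-∑ i, (x i : ℝ) * ξ i)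

/-- The multiplier of `H^q_r`. -/
def mHqr (d q : ℕ) (r : ℝ) (Ψ : (Fin d → ℝ) → ℝ) (ξ : Fin d → ℝ) : ℂ :=
  ∑' n : Fin d → ℤ,
    kloosterman d q ((radSq r : ℤ)) n * ((Ψ (fun i => (q : ℝ) * ξ i - (n i : ℝ)) : ℝ) : ℂ) *
      fourierSphMeasure d r (fun i => ξ i - (n i : ℝ) / q)

/-- The multiplier of `U^{1,q}_r` for `q = q₁q₂`. -/
def mU1 (d q₁ q₂ : ℕ) (r : ℝ) (Ψ' : (Fin d → ℝ) → ℝ) (ξ : Fin d → ℝ) : ℂ :=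
  ∑' n : Fin d → ℤ,
    kloosterman d q₁ ((radSq r : ℤ)) n *
      ((Ψ' (fun i => ((q₁ * q₂ : ℕ) : ℝ) * ξ i - (n i : ℝ)) : ℝ) : ℂ)

/-- The `ℓ^p(ℤ^d) → ℓ^p(ℤ^d)` operator norm (as a supremum over finitely supported
functions in the unit ball). -/
def opNormLp (d : ℕ) (p : ℝ) (T : ((Fin d → ℤ) → ℂ) → ((Fin d → ℤ) → ℂ)) : ℝ≥0∞ :=
  ⨆ f : {f : (Fin d → ℤ) → ℂ // (Function.support f).Finite ∧ lpNorm d p f ≤ 1},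
    lpNorm d p (T f.1)

/-- `𝓕Ψ_q(ζ) = ∫_{ℝ^d} Ψ(qy) e(y·ζ) dy`. -/
def ftPsiQ (d q : ℕ) (Ψ : (Fin d → ℝ) → ℝ) (ζ : Fin d → ℝ) : ℂ :=
  ∫ y : Fin d → ℝ, ((Ψ (fun i => (q : ℝ) * y i) : ℝ) : ℂ) * eC (∑ i, y i * ζ i)

/-- The kernel `K^q_r(x) = c_q(r² - |x|²) · ((𝓕Ψ_q) * dσ_r)(x)`. -/
def kernelK (d q : ℕ) (r : ℝ) (Ψ : (Fin d → ℝ) → ℝ) (x : Fin d → ℤ) : ℂ :=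
  ramanujanSum q ((radSq r : ℤ) - normSqZ x) *
    ∫ y : EuclideanSpace ℝ (Fin d), ftPsiQ d q Ψ (fun i => ((x i : ℝ)) - y i) ∂(sphMeasure d r)

/-- Discrete convolution on `ℤ^d`. -/
def dconv {d : ℕ} (f g : (Fin d → ℤ) → ℂ) (x : Fin d → ℤ) : ℂ :=
  ∑' y : Fin d → ℤ, f y * g (x - y)

/-- `Ã_r f = f * σ_r` with `σ_r = r^{2-d} 1_{sphere}`. -/
def tildeAvg (d : ℕ) (r : ℝ) (f : (Fin d → ℤ) → ℂ) (x : Fin d → ℤ) : ℂ :=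
  (r : ℂ) ^ ((2 : ℤ) - (d : ℤ)) *
    ∑' y : Fin d → ℤ, if normSqZ y = (radSq r : ℤ) then f (x - y) else 0

/-- The error operator `E_r f = Ã_r f - ∑_{1 ≤ q ≤ r} C^q_r f`. -/
def errOp (d : ℕ) (r : ℝ) (Ψ : (Fin d → ℝ) → ℝ) (f : (Fin d → ℤ) → ℂ) (x : Fin d → ℤ) : ℂ :=
  tildeAvg d r f x - ∑ q ∈ Finset.Icc 1 ⌊r⌋₊, dconv f (kernelK d q r Ψ) x

/-- The Euclidean norm `|x|` of `x ∈ ℤ^d`. -/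
def euclNormZ {d : ℕ} (x : Fin d → ℤ) : ℝ := Real.sqrt (∑ i, ((x i : ℝ)) ^ 2)

namespace LSph

open ENNReal (coe_finset_sup coe_le_coe coe_ne_top mul_rpow_of_nonneg mul_top natCast_ne_top
  ofReal ofReal_add ofReal_coe_nnreal ofReal_le_ofReal ofReal_mul ofReal_natCast ofReal_one
  ofReal_pow ofReal_rpow_of_nonneg ofReal_sum_of_nonneg ofReal_tsum_of_nonneg pow_ne_top
  rpow_le_rpow sum_le_tsum summable toReal_nonneg tsum_add tsum_comm tsum_le_tsum)
open Real (add_one_le_exp cos div_rpow exp exp_add exp_le_exp exp_le_one_iff exp_neg exp_pos log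
  log_pos logb mul_rpow norm_eq_abs norm_of_nonneg one_rpow pi pi_pos rpow_add
  rpow_le_rpow_of_exponent_le rpow_le_rpow_of_nonpos rpow_mul rpow_natCast rpow_neg rpow_nonneg
  rpow_one rpow_pos_of_pos rpow_sub_one rpow_two sin sq_sqrt sqrt sqrt_eq_rpow zero_rpow)
open Finset (add_sum_erase card_le_card card_nsmul_le_sum card_univ filter_filter induction_on
  le_sup mem_Icc mem_Ioc mem_coe mem_filter mem_image mem_product mem_range mem_univ mul_sum
  prod_congr prod_const prod_le_prod prod_mul_distrib prod_univ_sum range single_le_sum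
  sum_add_distrib sum_comm sum_congr sum_const sum_const_zero sum_div sum_eq_zero sum_filter
  sum_image sum_insert sum_le_sum sum_mul sum_mul_sum sum_nonneg sum_singleton sum_sub_distrib
  univ)
open ZMod (natCast_zmod_val stdAddChar)
open Complex (inv_im mul_conj normSq normSq_eq_norm_sq norm_real ofReal_sub ofReal_tsum star_def
  summable_ofReal)
open Filter.Eventually (of_forall)
open Metric (closedBall)
open MeasureTheory.Measure (count)
open Fintype (card card_fin card_pi card_piFinset piFinset piFinset_univ sum_equiv)
open Summable (of_nonneg_of_le of_norm of_norm_bounded tsum_finsetSum)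
open Function (mem_support)
open Nat (cast_mul cast_nonneg cast_one floor_le floor_pos le_of_dvd)
open Function.Embedding (coeFn_mk)
open Nat.Coprime (coprime_dvd_left pow_left)
open NNReal (coe_nonneg)
open Real.HolderConjugate (conjExponent)
open Filter (atTop)
open Set (indicator)
open AddCircle (haarAddCircle)
open Function.Injective (injOn)

local notation:max "Λ" d:max => Fin d → ℤ
local notation:max "Ξ" d:max => Fin d → ℝ
local notation:max "Γ" d:max m:max => Fin d → ZMod m

variable {d m : ℕ} [NeZero m]

/-- The `ℓ^p` norm of an extended nonnegative function on a discrete set. -/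
def nP {X : Type*} (p : ℝ) (F : X → ℝ≥0∞) : ℝ≥0∞ := (∑' x, F x ^ p) ^ (1 / p)

lemma lintegral_rpow_below {a c p : ℝ} (ha : 0 ≤ a) (hc : 0 < c) (hp : 0 < p) :
    ∫⁻ t in Set.Ioi (0 : ℝ), (if c * t < a then ofReal (t ^ (p - 1)) else 0)
      = ofReal ((a / c) ^ p / p) := by
  have h1 : ∫⁻ t in Set.Ioi (0 : ℝ), (if c * t < a then ofReal (t ^ (p - 1)) else 0)
      = ∫⁻ t in Set.Ioo (0 : ℝ) (a / c), ofReal (t ^ (p - 1)) := by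
    have : Set.Ioo (0 : ℝ) (a / c) = Set.Iio (a / c) ∩ Set.Ioi 0 := by
      ext t; simp [and_comm]
    rw [this, ← Measure.restrict_restrict measurableSet_Iio,
      ← lintegral_indicator measurableSet_Iio]
    refine lintegral_congr fun t => ?_
    simp only [indicator, Set.mem_Iio, lt_div_iff₀ hc, mul_comm c]
  have hac : 0 ≤ a / c := by positivity
  rw [h1, Measure.restrict_congr_set Ioo_ae_eq_Ioc,
    ← ofReal_integral_eq_lintegral_ofReal, ← intervalIntegral.integral_of_le hac,
    integral_rpow (Or.inl (by linarith))]
  · simp [zero_rpow hp.ne']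
  · exact (intervalIntegrable_iff_integrableOn_Ioc_of_le hac).1
      (intervalIntegral.intervalIntegrable_rpow' (by linarith))
  · refine (ae_restrict_iff' measurableSet_Ioc).2 (of_forall fun t ht => ?_)
    exact rpow_nonneg ht.1.le _

lemma lintegral_rpow_above {a c p : ℝ} (ha : 0 < a) (hc : 0 < c) (hp : p < 0) :
    ∫⁻ t in Set.Ioi (0 : ℝ), (if a ≤ c * t then ofReal (t ^ (p - 1)) else 0)
      = ofReal ((a / c) ^ p / (-p)) := by
  have hac : 0 < a / c := by positivity
  have h1 : ∫⁻ t in Set.Ioi (0 : ℝ), (if a ≤ c * t then ofReal (t ^ (p - 1)) else 0)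
      = ∫⁻ t in Set.Ici (a / c), ofReal (t ^ (p - 1)) := by
    have : Set.Ici (a / c) = Set.Ici (a / c) ∩ Set.Ioi 0 := by
      ext t; simp only [Set.mem_Ici, Set.mem_inter_iff, Set.mem_Ioi, iff_self_and]
      intro h; linarith
    rw [this, ← Measure.restrict_restrict measurableSet_Ici,
      ← lintegral_indicator measurableSet_Ici]
    refine lintegral_congr fun t => ?_
    simp only [indicator, Set.mem_Ici, div_le_iff₀ hc, mul_comm c]
  rw [h1, Measure.restrict_congr_set Ioi_ae_eq_Ici.symm,
    ← ofReal_integral_eq_lintegral_ofReal, integral_Ioi_rpow_of_lt (by linarith) hac]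
  · congr 1
    rw [sub_add_cancel, div_neg, neg_div]
  · exact integrableOn_Ioi_rpow_of_lt (by linarith) hac
  · refine (ae_restrict_iff' measurableSet_Ioi).2 (of_forall fun t ht => ?_)
    exact rpow_nonneg (hac.le.trans (le_of_lt ht)) _

lemma tsum_rpow_le_of_distribution {X : Type*} [Countable X] {F φ : X → ℝ} (hF : ∀ x, 0 ≤ F x)
    (hφ : ∀ x, 0 ≤ φ x) {p p0 p1 c A0 A1 : ℝ} (hp0 : 0 < p0) (hp : p0 < p) (hp1 : p < p1)
    (hc : 0 < c) (hA0 : 0 ≤ A0) (hA1 : 0 ≤ A1)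
    (h : ∀ t : ℝ, 0 < t → (∑' x, if 2 * t < F x then (1 : ℝ≥0∞) else 0) ≤
      ofReal (A0 * t ^ (-p0)) *
        (∑' x, if c * t < φ x then ofReal (φ x ^ p0) else 0) +
      ofReal (A1 * t ^ (-p1)) *
        (∑' x, if φ x ≤ c * t then ofReal (φ x ^ p1) else 0)) :
    ∑' x, ofReal (F x ^ p) ≤ ofReal
      (2 ^ p * p * (A0 * c ^ (p0 - p) / (p - p0) + A1 * c ^ (p1 - p) / (p1 - p))) *
        ∑' x, ofReal (φ x ^ p) := by
  have hpp : 0 < p := hp0.trans hp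
  have e1 : ∀ x, ofReal (F x ^ p) = ofReal (2 ^ p * p) *
      ∫⁻ t in Set.Ioi (0 : ℝ), (if 2 * t < F x then ofReal (t ^ (p - 1)) else 0) := by
    intro x
    rw [lintegral_rpow_below (hF x) two_pos hpp, ← ofReal_mul (by positivity)]
    congr 1
    rw [div_rpow (hF x) two_pos.le]
    field_simp
  have m1 : ∀ (c e : ℝ) (a : X → ℝ) (x : X), AEMeasurable
      (fun t : ℝ => if c * t < a x then ofReal (t ^ e) else 0)
      (volume.restrict (Set.Ioi 0)) := fun c e a x =>
    (Measurable.ite (measurableSet_lt (by fun_prop) (by fun_prop)) (by fun_prop)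
      (by fun_prop)).aemeasurable
  have m2 : ∀ (c e : ℝ) (a : X → ℝ) (x : X), AEMeasurable
      (fun t : ℝ => if a x ≤ c * t then ofReal (t ^ e) else 0)
      (volume.restrict (Set.Ioi 0)) := fun c e a x =>
    (Measurable.ite (measurableSet_le (by fun_prop) (by fun_prop)) (by fun_prop)
      (by fun_prop)).aemeasurable
  simp_rw [e1]
  rw [ENNReal.tsum_mul_left, ← lintegral_tsum (m1 _ _ _)]
  have key : ∀ t ∈ Set.Ioi (0 : ℝ),
      (∑' x, if 2 * t < F x then ofReal (t ^ (p - 1)) else 0) ≤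
      (∑' x, ofReal (A0 * φ x ^ p0) *
        (if c * t < φ x then ofReal (t ^ (p - p0 - 1)) else 0)) +
      ∑' x, ofReal (A1 * φ x ^ p1) *
        (if φ x ≤ c * t then ofReal (t ^ (p - p1 - 1)) else 0) := by
    intro t ht
    have ht : 0 < t := ht
    have : (∑' x, if 2 * t < F x then ofReal (t ^ (p - 1)) else 0) =
        ofReal (t ^ (p - 1)) * ∑' x, if 2 * t < F x then (1 : ℝ≥0∞) else 0 := by
      rw [← ENNReal.tsum_mul_left]; simp
    rw [this]
    refine (mul_le_mul_right (h t ht) _).trans (le_of_eq ?_)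
    rw [mul_add, ← mul_assoc, ← mul_assoc, ← ENNReal.tsum_mul_left, ← ENNReal.tsum_mul_left]
    have hx : ∀ (A q y : ℝ), 0 ≤ A → 0 ≤ y →
        ofReal (t ^ (p - 1)) * ofReal (A * t ^ (-q)) * ofReal (y ^ q)
        = ofReal (A * y ^ q) * ofReal (t ^ (p - q - 1)) := by
      intro A q y hA hy
      rw [← ofReal_mul (by positivity), ← ofReal_mul (by positivity),
        ← ofReal_mul (by positivity)]
      congr 1
      rw [show p - q - 1 = (p - 1) + (-q) by ring, rpow_add ht]; ring
    congr 1 <;> refine tsum_congr fun x => ?_ <;> split_ifs <;> simp [hx _ _ _ hA0 (hφ x), hx _ _ _ hA1 (hφ x)]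
  refine (mul_le_mul_right (setLIntegral_mono' measurableSet_Ioi key) _).trans ?_
  rw [lintegral_add_left', lintegral_tsum, lintegral_tsum]
  rotate_left
  · exact fun x => (m2 _ _ _ x).const_mul _
  · exact fun x => (m1 _ _ _ x).const_mul _
  · exact AEMeasurable.tsum fun x => (m1 _ _ _ x).const_mul _
  simp_rw [lintegral_const_mul'' _ (m1 _ _ _ _), lintegral_const_mul'' _ (m2 _ _ _ _)]
  rw [← tsum_add, ← ENNReal.tsum_mul_left, ← ENNReal.tsum_mul_left]
  refine tsum_le_tsum fun x => ?_
  rw [lintegral_rpow_below (hφ x) hc (by linarith)]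
  rcases (hφ x).eq_or_lt with h0 | h0
  · simp [← h0, zero_rpow hp0.ne', zero_rpow (by linarith : p1 ≠ 0)]
  rw [lintegral_rpow_above h0 hc (by linarith)]
  have q2 : 0 < -(p - p1) := by linarith
  rw [← ofReal_mul (by positivity), ← ofReal_mul (by positivity),
    ← ofReal_add (by positivity) (by positivity), ← ofReal_mul (by positivity),
    ← ofReal_mul (by positivity)]
  apply le_of_eq
  congr 1
  have k : ∀ q, φ x ^ q * (φ x / c) ^ (p - q) = c ^ (q - p) * φ x ^ p := by
    intro q
    rw [div_rpow h0.le hc.le, show q - p = -(p - q) by ring, rpow_neg hc.le,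
      mul_div_assoc', ← rpow_add h0]
    rw [show q + (p - q) = p by ring]; ring
  have k0 := k p0
  have k1 := k p1
  calc _ = 2 ^ p * p * (A0 * (φ x ^ p0 * (φ x / c) ^ (p - p0)) / (p - p0) +
        A1 * (φ x ^ p1 * (φ x / c) ^ (p - p1)) / -(p - p1)) := by ring
    _ = _ := by rw [k0, k1]; rw [neg_sub]; ring

lemma tsum_chebyshev {X : Type*} (G : X → ℝ≥0) {q t : ℝ} (hq : 0 < q) (ht : 0 < t) :
    (∑' x, if t < G x then (1 : ℝ≥0∞) else 0) ≤
      ofReal (t ^ (-q)) * ∑' x, (G x : ℝ≥0∞) ^ q := by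
  rw [← ENNReal.tsum_mul_left]
  refine tsum_le_tsum fun x => ?_
  split_ifs with h
  · have : (G x : ℝ≥0∞) ^ q = ofReal ((G x : ℝ) ^ q) := by
      rw [← ofReal_rpow_of_nonneg (coe_nonneg _) hq.le, ofReal_coe_nnreal]
    rw [this, ← ofReal_mul (by positivity), ← ofReal_one]
    refine ofReal_le_ofReal ?_
    rw [rpow_neg ht.le, ← div_eq_inv_mul, one_le_div (by positivity)]
    exact Real.rpow_le_rpow ht.le h.le hq.le
  · exact zero_le

/-- The constant in the Marcinkiewicz interpolation theorem. -/
def mC (p0 p p1 : ℝ) : ℝ := 2 ^ p * p * (1 / (p - p0) + 1 / (p1 - p))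

lemma mC_pos {p0 p p1 : ℝ} (hp0 : 0 < p0) (hp : p0 < p) (hp1 : p < p1) : 0 < mC p0 p p1 := by
  have : 0 < p := by linarith
  unfold mC; positivity

lemma enorm_rpow_eq {z : ℂ} {q : ℝ} (hq : 0 ≤ q) : ‖z‖ₑ ^ q = ofReal (‖z‖ ^ q) := by
  rw [← ofReal_rpow_of_nonneg (norm_nonneg _) hq, ofReal_norm]

lemma coe_rpow_eq {a : ℝ≥0} {q : ℝ} (hq : 0 ≤ q) :
    (a : ℝ≥0∞) ^ q = ofReal ((a : ℝ) ^ q) := by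
  rw [← ofReal_rpow_of_nonneg a.coe_nonneg hq, ofReal_coe_nnreal]

/-- Marcinkiewicz interpolation between two strong type bounds, for sublinear operators acting on
finitely supported functions. -/
lemma marcinkiewicz {X : Type*} [Countable X] {p0 p p1 A0 A1 : ℝ} (hp0 : 0 < p0) (hp : p0 < p)
    (hp1 : p < p1) (hA0 : 0 < A0) (hA1 : 0 < A1) (S : (X → ℂ) → X → ℝ≥0)
    (hS : ∀ f g : X → ℂ, f.support.Finite → g.support.Finite →
      ∀ x, S (f + g) x ≤ S f x + S g x)
    (h0 : ∀ f : X → ℂ, f.support.Finite →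
      ∑' x, (S f x : ℝ≥0∞) ^ p0 ≤ ofReal A0 * ∑' x, ‖f x‖ₑ ^ p0)
    (h1 : ∀ f : X → ℂ, f.support.Finite →
      ∑' x, (S f x : ℝ≥0∞) ^ p1 ≤ ofReal A1 * ∑' x, ‖f x‖ₑ ^ p1)
    (f : X → ℂ) (hf : f.support.Finite) :
    ∑' x, (S f x : ℝ≥0∞) ^ p ≤
      ofReal (mC p0 p p1 * (A0 ^ ((p1 - p) / (p1 - p0)) * A1 ^ ((p - p0) / (p1 - p0)))) *
        ∑' x, ‖f x‖ₑ ^ p := by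
  have hpp : 0 < p := hp0.trans hp
  have hpp1 : 0 < p1 := hpp.trans hp1
  have d0 : 0 < p1 - p0 := by linarith
  set c : ℝ := (A0 / A1) ^ (1 / (p1 - p0)) with hc
  have hcpos : 0 < c := by positivity
  have hq := tsum_rpow_le_of_distribution (F := fun x => (S f x : ℝ)) (φ := fun x => ‖f x‖)
    (fun x => (S f x).2) (fun x => norm_nonneg _) hp0 hp hp1 hcpos hA0.le hA1.le ?_
  · simp_rw [← coe_rpow_eq hpp.le, ← enorm_rpow_eq hpp.le] at hq
    refine hq.trans (le_of_eq ?_)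
    congr 2
    have c0 : A0 * c ^ (p0 - p) = A0 ^ ((p1 - p) / (p1 - p0)) * A1 ^ ((p - p0) / (p1 - p0)) := by
      rw [hc, ← rpow_mul (by positivity), div_rpow hA0.le hA1.le,
        show (1 / (p1 - p0) * (p0 - p)) = -((p - p0) / (p1 - p0)) by ring,
        rpow_neg hA1.le, div_inv_eq_mul, ← mul_assoc]
      congr 1
      nth_rewrite 1 [← rpow_one A0]
      rw [← rpow_add hA0]
      congr 1; field_simp; ring
    have c1 : A1 * c ^ (p1 - p) = A0 ^ ((p1 - p) / (p1 - p0)) * A1 ^ ((p - p0) / (p1 - p0)) := by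
      rw [hc, ← rpow_mul (by positivity), div_rpow hA0.le hA1.le,
        show (1 / (p1 - p0) * (p1 - p)) = ((p1 - p) / (p1 - p0)) by ring,
        mul_div_assoc', mul_comm A1, mul_div_assoc]
      congr 1
      nth_rewrite 1 [← rpow_one A1]
      rw [← Real.rpow_sub hA1]
      congr 1; field_simp; ring
    rw [c0, c1, mC]; ring
  · intro t ht
    set f0 : X → ℂ := fun x => if c * t < ‖f x‖ then f x else 0
    set f1 : X → ℂ := fun x => if ‖f x‖ ≤ c * t then f x else 0
    have e : f = f0 + f1 := by
      funext x
      by_cases h : c * t < ‖f x‖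
      · simp [f0, f1, h]
      · simp [f0, f1, h, not_lt.1 h]
    have s0 : f0.support.Finite := hf.subset fun x hx => by
      simp only [f0, mem_support, ne_eq, ite_eq_right_iff, not_forall] at hx ⊢
      exact hx.2
    have s1 : f1.support.Finite := hf.subset fun x hx => by
      simp only [f1, mem_support, ne_eq, ite_eq_right_iff, not_forall] at hx ⊢
      exact hx.2
    have step : (∑' x, if 2 * t < (S f x : ℝ) then (1 : ℝ≥0∞) else 0) ≤
        (∑' x, if t < S f0 x then (1 : ℝ≥0∞) else 0) +
          ∑' x, if t < S f1 x then (1 : ℝ≥0∞) else 0 := by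
      rw [← tsum_add]
      refine tsum_le_tsum fun x => ?_
      have := hS f0 f1 s0 s1 x
      rw [← e] at this
      split_ifs with h h' h'' h''
      any_goals simp
      exact (by linarith [not_lt.1 h', not_lt.1 h''] : False).elim
    refine step.trans (add_le_add ?_ ?_)
    · refine (tsum_chebyshev _ hp0 ht).trans ?_
      refine (mul_le_mul_right (h0 f0 s0) _).trans (le_of_eq ?_)
      rw [← mul_assoc, ← ofReal_mul (by positivity), mul_comm A0]
      congr 1
      refine tsum_congr fun x => ?_
      simp only [f0]
      split_ifs
      · rw [enorm_rpow_eq hp0.le]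
      · simp [hp0]
    · refine (tsum_chebyshev _ hpp1 ht).trans ?_
      refine (mul_le_mul_right (h1 f1 s1) _).trans (le_of_eq ?_)
      rw [← mul_assoc, ← ofReal_mul (by positivity), mul_comm A1]
      congr 1
      refine tsum_congr fun x => ?_
      simp only [f1]
      split_ifs
      · rw [enorm_rpow_eq hpp1.le]
      · simp [hpp1]

lemma nP_add_le {X : Type*} {p : ℝ} (hp : 1 ≤ p) (F G : X → ℝ≥0∞) :
    nP p (fun x => F x + G x) ≤ nP p F + nP p G := by
  let _ : MeasurableSpace X := ⊤
  have := ENNReal.lintegral_Lp_add_le (μ := count) (f := F) (g := G)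
    measurable_from_top.aemeasurable measurable_from_top.aemeasurable hp
  simp only [lintegral_count, Pi.add_apply] at this
  exact this

lemma nP_mono {X : Type*} {p : ℝ} (hp : 0 ≤ p) {F G : X → ℝ≥0∞} (h : ∀ x, F x ≤ G x) :
    nP p F ≤ nP p G :=
  rpow_le_rpow (tsum_le_tsum fun x => rpow_le_rpow (h x) hp) (by positivity)

lemma nP_zero {X : Type*} {p : ℝ} (hp : 0 < p) : nP p (fun _ : X => 0) = 0 := by
  simp [nP, hp]

lemma nP_sum_le {X ι : Type*} {p : ℝ} (hp : 1 ≤ p) (s : Finset ι) (F : ι → X → ℝ≥0∞) :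
    nP p (fun x => ∑ i ∈ s, F i x) ≤ ∑ i ∈ s, nP p (F i) := by
  classical
  induction s using induction_on with
  | empty => simp [nP_zero (zero_lt_one.trans_le hp)]
  | insert a s ha ih =>
    simp_rw [sum_insert ha]
    exact (nP_add_le hp _ _).trans (add_le_add le_rfl ih)

lemma nP_rpow {X : Type*} {p : ℝ} (hp : 0 < p) (F : X → ℝ≥0∞) :
    nP p F ^ p = ∑' x, F x ^ p := by
  rw [nP, ← ENNReal.rpow_mul, one_div_mul_cancel hp.ne', ENNReal.rpow_one]

lemma nP_const_mul {X : Type*} {p : ℝ} (hp : 0 < p) (a : ℝ≥0∞) (F : X → ℝ≥0∞) :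
    nP p (fun x => a * F x) = a * nP p F := by
  simp_rw [nP, mul_rpow_of_nonneg _ _ hp.le, ENNReal.tsum_mul_left]
  rw [mul_rpow_of_nonneg _ _ (by positivity), ← ENNReal.rpow_mul,
    mul_one_div_cancel hp.ne', ENNReal.rpow_one]

lemma nP_le_iff {X Y : Type*} {p A : ℝ} (hp : 0 < p) (hA : 0 ≤ A) (F : X → ℝ≥0∞)
    (G : Y → ℝ≥0∞) :
    nP p F ≤ ofReal A * nP p G ↔
      ∑' x, F x ^ p ≤ ofReal (A ^ p) * ∑' x, G x ^ p := by
  rw [← ENNReal.rpow_le_rpow_iff hp, mul_rpow_of_nonneg _ _ hp.le, nP_rpow hp, nP_rpow hp,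
    ofReal_rpow_of_nonneg hA hp.le]

lemma tsum_sup_rpow_le {X ι : Type*} {p : ℝ} (hp : 0 < p) (s : Finset ι) (F : ι → X → ℝ≥0∞)
    (G : X → ℝ≥0∞) (h : ∀ x, G x ≤ s.sup fun i => F i x) :
    ∑' x, G x ^ p ≤ ∑ i ∈ s, ∑' x, F i x ^ p := by
  rw [← tsum_finsetSum fun i _ => summable]
  refine tsum_le_tsum fun x => ?_
  refine (rpow_le_rpow (h x) hp.le).trans ?_
  have : (s.sup fun i => F i x) ≤ (∑ i ∈ s, F i x ^ p) ^ (1 / p) := by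
    refine Finset.sup_le fun i hi => ?_
    have h2 := rpow_le_rpow (single_le_sum (f := fun i => F i x ^ p)
      (fun _ _ => zero_le) hi) (by positivity : 0 ≤ 1 / p)
    rwa [← ENNReal.rpow_mul, mul_one_div_cancel hp.ne', ENNReal.rpow_one] at h2
  refine (rpow_le_rpow this hp.le).trans (le_of_eq ?_)
  rw [← ENNReal.rpow_mul, one_div_mul_cancel hp.ne', ENNReal.rpow_one]

lemma int_closedBall_eq (x : Λ d) (k : ℕ) :
    closedBall x (k : ℝ) = ↑(Finset.Icc (fun i => x i - k) (fun i => x i + k)) := by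
  ext y
  simp only [Metric.mem_closedBall, dist_pi_le_iff (cast_nonneg k), Int.dist_eq,
    Finset.coe_Icc, Set.mem_Icc, Pi.le_def, ← forall_and]
  refine forall_congr' fun i => ?_
  rw [abs_le]
  constructor
  · rintro ⟨h1, h2⟩
    have h1 : -(k : ℤ) ≤ y i - x i := mod_cast h1
    have h2 : y i - x i ≤ (k : ℤ) := mod_cast h2
    constructor <;> linarith
  · rintro ⟨h1, h2⟩
    have h1 : -(k : ℤ) ≤ y i - x i := by linarith
    have h2 : y i - x i ≤ (k : ℤ) := by linarith
    exact ⟨mod_cast h1, mod_cast h2⟩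

lemma count_closedBall (x : Λ d) (k : ℕ) :
    count (closedBall x (k : ℝ)) = ((2 * k + 1 : ℕ) : ℝ≥0∞) ^ d := by
  rw [int_closedBall_eq, Measure.count_apply_finset, Pi.card_Icc]
  simp only [Int.card_Icc]
  have : ∀ i : Fin d, (x i + k + 1 - (x i - k)).toNat = 2 * k + 1 := fun i => by omega
  simp [this]

/-- The centred Hardy–Littlewood maximal function on `ℤ^d`. -/
def hlM (f : Λ d → ℝ≥0∞) (x : Λ d) : ℝ≥0∞ :=
  ⨆ k : ℕ, (((2 * k + 1 : ℕ) : ℝ≥0∞) ^ d)⁻¹ *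
    ∫⁻ y in closedBall x (k : ℝ), f y ∂count

lemma hlM_weak (hd : 0 < d) (f : Λ d → ℝ≥0∞) (t : ℝ≥0) (ht : 0 < t) :
    count {x | (t : ℝ≥0∞) < hlM f x} ≤
      ofReal (5 ^ d) * ((t : ℝ≥0∞)⁻¹ * ∑' x, f x) := by
  by_cases hfin : ∑' x, f x = ⊤
  · rw [hfin, mul_top (ENNReal.inv_ne_zero.2 coe_ne_top), mul_top]
    · exact le_top
    · simp
  have ht0 : (t : ℝ≥0∞) ≠ 0 := mod_cast ht.ne'
  have ex : ∀ x : {x | (t : ℝ≥0∞) < hlM f x}, ∃ k : ℕ, (t : ℝ≥0∞) <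
      (((2 * k + 1 : ℕ) : ℝ≥0∞) ^ d)⁻¹ *
        ∫⁻ y in closedBall (x : Λ d) (k : ℝ), f y ∂count := fun x =>
    lt_iSup_iff.1 x.2
  choose k hk using ex
  have hk' : ∀ x, (t : ℝ≥0∞) * ((2 * k x + 1 : ℕ) : ℝ≥0∞) ^ d ≤
      ∫⁻ y in closedBall (x : Λ d) (k x : ℝ), f y ∂count := by
    intro x
    have h := (hk x).le
    rw [mul_comm, ← div_eq_mul_inv] at h
    exact ENNReal.mul_le_of_le_div h
  have hle : ∀ x : {x | (t : ℝ≥0∞) < hlM f x}, ∫⁻ y in closedBall (x : Λ d) (k x : ℝ), f y ∂count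
      ≤ ∑' x, f x := fun x => by
    rw [← lintegral_count]
    exact setLIntegral_le_lintegral _ _
  have bdd : ∀ x ∈ (Set.univ : Set {x | (t : ℝ≥0∞) < hlM f x}),
      (k x : ℝ) ≤ ((t : ℝ≥0∞)⁻¹ * ∑' x, f x).toReal := by
    intro x _
    have hne : (t : ℝ≥0∞)⁻¹ * ∑' x, f x ≠ ⊤ :=
      ENNReal.mul_ne_top (ENNReal.inv_ne_top.2 ht0) hfin
    rw [← ENNReal.ofReal_le_iff_le_toReal hne, ofReal_natCast]
    calc (k x : ℝ≥0∞) ≤ ((2 * k x + 1 : ℕ) : ℝ≥0∞) := mod_cast (by omega)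
      _ ≤ ((2 * k x + 1 : ℕ) : ℝ≥0∞) ^ d := by
          exact_mod_cast Nat.le_self_pow hd.ne' _
      _ = (t : ℝ≥0∞)⁻¹ * (t * ((2 * k x + 1 : ℕ) : ℝ≥0∞) ^ d) := by
          rw [← mul_assoc, ENNReal.inv_mul_cancel ht0 coe_ne_top, one_mul]
      _ ≤ _ := mul_le_mul_right ((hk' x).trans (hle x)) _
  obtain ⟨u, -, hdisj, hcov⟩ := Vitali.exists_disjoint_subfamily_covering_enlargement_closedBall
    Set.univ (fun x : {x | (t : ℝ≥0∞) < hlM f x} => (x : Λ d)) (fun x => (k x : ℝ)) _ bdd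
    5 (by norm_num)
  have hsub : {x | (t : ℝ≥0∞) < hlM f x} ⊆
      ⋃ b ∈ u, closedBall (b : Λ d) (((5 * k b : ℕ)) : ℝ) := by
    intro x hx
    obtain ⟨b, hb, h⟩ := hcov ⟨x, hx⟩ trivial
    refine Set.mem_biUnion hb ?_
    push_cast
    exact h (Metric.mem_closedBall_self (cast_nonneg _))
  have hu : u.Countable := Set.to_countable u
  have hunion : ∑' b : u, ∫⁻ y in closedBall ((b : {x | (t : ℝ≥0∞) < hlM f x}) :
      Λ d) (k b : ℝ), f y ∂count ≤ ∑' x, f x := by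
    rw [← lintegral_biUnion hu (fun _ _ => MeasurableSet.of_discrete) hdisj, ← lintegral_count]
    exact setLIntegral_le_lintegral _ _
  calc _ ≤ count (⋃ b ∈ u, closedBall (b : Λ d) (((5 * k b : ℕ)) : ℝ)) :=
        measure_mono hsub
    _ ≤ ∑' b : u, count (closedBall ((b : {x | (t : ℝ≥0∞) < hlM f x}) :
          Λ d) (((5 * k b : ℕ)) : ℝ)) := measure_biUnion_le _ hu _
    _ ≤ ∑' b : u, ofReal (5 ^ d) * ((t : ℝ≥0∞)⁻¹ *
          ∫⁻ y in closedBall ((b : {x | (t : ℝ≥0∞) < hlM f x}) :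
            Λ d) (k b : ℝ), f y ∂count) := by
        refine tsum_le_tsum fun b => ?_
        rw [count_closedBall]
        refine le_trans ?_ (mul_le_mul_right (mul_le_mul_right (hk' b) _) _)
        rw [← mul_assoc (t : ℝ≥0∞)⁻¹, ENNReal.inv_mul_cancel ht0 coe_ne_top, one_mul,
          ofReal_pow (by norm_num), ← mul_pow,
          show ofReal 5 = ((5 : ℕ) : ℝ≥0∞) by simp]
        refine pow_le_pow_left' ?_ d
        exact_mod_cast (by omega)
    _ = ofReal (5 ^ d) * ((t : ℝ≥0∞)⁻¹ * ∑' b : u,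
          ∫⁻ y in closedBall ((b : {x | (t : ℝ≥0∞) < hlM f x}) :
            Λ d) (k b : ℝ), f y ∂count) := by
        rw [ENNReal.tsum_mul_left, ENNReal.tsum_mul_left]
    _ ≤ _ := by gcongr

lemma hlM_le_add {f g : Λ d → ℝ≥0∞} {t : ℝ≥0∞} (h : ∀ x, f x ≤ g x + t)
    (x : Λ d) : hlM f x ≤ hlM g x + t := by
  refine iSup_le fun k => ?_
  have h1 : ∫⁻ y in closedBall x (k : ℝ), f y ∂count ≤
      (∫⁻ y in closedBall x (k : ℝ), g y ∂count) +
        t * ((2 * k + 1 : ℕ) : ℝ≥0∞) ^ d := by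
    rw [← count_closedBall x k, ← setLIntegral_const, ← lintegral_add_left (by fun_prop)]
    gcongr
    exact h _
  refine (mul_le_mul_right h1 _).trans ?_
  rw [mul_add]
  gcongr
  · exact le_iSup (fun k : ℕ => (((2 * k + 1 : ℕ) : ℝ≥0∞) ^ d)⁻¹ *
      ∫⁻ y in closedBall x (k : ℝ), g y ∂count) k
  · rw [mul_comm t, ← mul_assoc, ENNReal.inv_mul_cancel, one_mul]
    · simp
    · exact pow_ne_top (natCast_ne_top _)

lemma hlM_le_tsum (f : Λ d → ℝ≥0∞) (x : Λ d) : hlM f x ≤ ∑' y, f y := by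
  refine iSup_le fun k => ?_
  rw [← lintegral_count]
  refine (mul_le_mul_right (setLIntegral_le_lintegral _ _) _).trans ?_
  refine mul_le_of_le_one_left zero_le (ENNReal.inv_le_one.2 ?_)
  exact_mod_cast Nat.one_le_pow _ _ (by omega)

lemma hlM_strong (hd : 0 < d) {p : ℝ} (hp : 1 < p) : ∃ C : ℝ, 0 < C ∧
    ∀ f : Λ d → ℂ, f.support.Finite →
      ∑' x, hlM (fun y => ‖f y‖ₑ) x ^ p ≤ ofReal C * ∑' x, ‖f x‖ₑ ^ p := by
  refine ⟨2 ^ p * p * (5 ^ d * 1 ^ (1 - p) / (p - 1) + 0 * 1 ^ (p + 1 - p) / (p + 1 - p)),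
    by have : 0 < p + 1 - p := (by linarith); positivity, fun f hf => ?_⟩
  have fin : ∑' y, ‖f y‖ₑ ≠ ⊤ := by
    rw [tsum_eq_sum (s := hf.toFinset) fun b hb => by simpa using hb]
    exact ENNReal.sum_ne_top.2 fun _ _ => by simp
  have fin' : ∀ x, hlM (fun y => ‖f y‖ₑ) x ≠ ⊤ := fun x =>
    ne_top_of_le_ne_top fin (hlM_le_tsum _ x)
  have hq := tsum_rpow_le_of_distribution (F := fun x => (hlM (fun y => ‖f y‖ₑ) x).toReal)
    (φ := fun x => ‖f x‖) (fun x => toReal_nonneg) (fun x => norm_nonneg _) one_pos hp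
    (show p < p + 1 by linarith) one_pos (show (0 : ℝ) ≤ 5 ^ d by positivity) le_rfl ?_
  · refine le_trans (le_of_eq ?_) (hq.trans (le_of_eq ?_))
    · refine tsum_congr fun x => ?_
      rw [← ofReal_rpow_of_nonneg toReal_nonneg (by linarith),
        ENNReal.ofReal_toReal (fin' x)]
    · congr 1
      exact tsum_congr fun x => (enorm_rpow_eq (by linarith)).symm
  · intro t ht
    simp only [rpow_one, one_mul, zero_mul, ENNReal.ofReal_zero, add_zero]
    set g : Λ d → ℝ≥0∞ := fun x => if t < ‖f x‖ then ‖f x‖ₑ else 0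
    have hg : ∀ x, ‖f x‖ₑ ≤ g x + ofReal t := by
      intro x
      simp only [g]
      split_ifs with h
      · exact le_self_add
      · rw [zero_add, ← ofReal_norm]
        exact ofReal_le_ofReal (not_lt.1 h)
    have w := hlM_weak hd g t.toNNReal (by simpa using ht)
    have e : ((t.toNNReal : ℝ≥0) : ℝ≥0∞) = ofReal t := rfl
    rw [e] at w
    refine le_trans ?_ (w.trans (le_of_eq ?_))
    · rw [← lintegral_count, ← lintegral_indicator_one MeasurableSet.of_discrete]
      refine lintegral_mono fun x => ?_
      simp only [indicator, Set.mem_ofPred_eq, Pi.one_apply]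
      split_ifs with h1 h2
      · exact le_rfl
      · exfalso
        apply h2
        by_contra hcon
        have h3 := (hlM_le_add hg x).trans (add_le_add (not_lt.1 hcon) le_rfl)
        rw [← ofReal_add ht.le ht.le] at h3
        have := ENNReal.toReal_le_of_le_ofReal (by linarith) h3
        linarith
      · exact zero_le
      · exact le_rfl
    · rw [ofReal_mul (by positivity), Real.rpow_neg_one, ENNReal.ofReal_inv_of_pos ht,
        ← mul_assoc]
      congr 1
      exact tsum_congr fun x => by simp only [g]; split_ifs <;> simp [ofReal_norm]

/-- The Gaussian `ρ^{-d} e^{-|z|²/ρ²}` on `ℤ^d`. -/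
def gam (ρ : ℝ) (z : Λ d) : ℝ := (ρ ^ d)⁻¹ * exp (-(normSqZ z : ℝ) / ρ ^ 2)

lemma exp_neg_four_pow_le (n j : ℕ) :
    exp (-(4 : ℝ) ^ j / 4) ≤ (n.factorial * 4 ^ n : ℝ) * (2 : ℝ)⁻¹ ^ (j * n) := by
  have h := Real.pow_div_factorial_le_exp ((4 : ℝ) ^ j / 4) (by positivity) n
  rw [neg_div, exp_neg]
  have hpos : 0 < ((4 : ℝ) ^ j / 4) ^ n / n.factorial := by positivity
  refine (inv_anti₀ hpos h).trans ?_
  rw [inv_div, div_pow, ← pow_mul, div_div_eq_mul_div]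
  rw [inv_pow, div_eq_mul_inv]
  gcongr
  norm_num

lemma sq_norm_le_normSqZ (x y : Λ d) :
    dist x y ^ 2 ≤ (normSqZ (x - y) : ℝ) := by
  have h0 : (0 : ℝ) ≤ normSqZ (x - y) := by
    unfold normSqZ; push_cast; positivity
  have : dist x y ≤ sqrt (normSqZ (x - y)) := by
    refine (dist_pi_le_iff (Real.sqrt_nonneg _)).2 fun i => Real.le_sqrt_of_sq_le ?_
    rw [Int.dist_eq, sq_abs]
    unfold normSqZ
    push_cast
    have := single_le_sum (f := fun i => (((x - y) i : ℤ) : ℝ) ^ 2)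
      (fun _ _ => sq_nonneg _) (mem_univ i)
    simpa using this
  calc dist x y ^ 2 ≤ sqrt (normSqZ (x - y)) ^ 2 := by gcongr
    _ = _ := sq_sqrt h0

lemma gam_conv_le_hlM : ∃ C : ℝ, 0 < C ∧ ∀ ρ : ℝ, 1 ≤ ρ →
    ∀ (f : Λ d → ℝ≥0∞) (x : Λ d),
      ∑' y, f y * ofReal (gam ρ (x - y)) ≤ ofReal C * hlM f x := by
  set n := d + 1
  set c : ℝ := n.factorial * 4 ^ n
  have hc1 : 1 ≤ c := by
    have h1 : (1 : ℝ) ≤ n.factorial := mod_cast n.factorial_pos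
    have h2 : (1 : ℝ) ≤ 4 ^ n := one_le_pow₀ (by norm_num)
    exact one_le_mul_of_one_le_of_one_le h1 h2
  refine ⟨c * 5 ^ d * 2, by positivity, fun ρ hρ f x => ?_⟩
  set k : ℕ → ℕ := fun j => ⌈2 ^ j * ρ⌉₊
  have pt : ∀ y, ofReal (gam ρ (x - y)) ≤ ∑' j : ℕ,
      ofReal ((ρ ^ d)⁻¹ * (c * (2 : ℝ)⁻¹ ^ (j * n))) *
        (closedBall x (k j : ℝ)).indicator 1 y := by
    intro y
    have hex : ∃ j : ℕ, dist x y ≤ 2 ^ j * ρ := by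
      obtain ⟨j, hj⟩ := pow_unbounded_of_one_lt (dist x y) (one_lt_two)
      exact ⟨j, hj.le.trans (le_mul_of_one_le_right (by positivity) hρ)⟩
    classical
    set j := Nat.find hex
    have hj : dist x y ≤ 2 ^ j * ρ := Nat.find_spec hex
    refine le_trans ?_ (ENNReal.le_tsum j)
    have hmem : y ∈ closedBall x (k j : ℝ) := by
      rw [Metric.mem_closedBall, dist_comm]
      exact hj.trans (Nat.le_ceil _)
    rw [Set.indicator_of_mem hmem, Pi.one_apply, mul_one]
    refine ofReal_le_ofReal ?_
    unfold gam
    gcongr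
    rcases Nat.eq_zero_or_pos j with h0 | h0
    · rw [h0]
      simp only [zero_mul, pow_zero, mul_one]
      refine le_trans (exp_le_one_iff.2 ?_) hc1
      refine div_nonpos_of_nonpos_of_nonneg ?_ (by positivity)
      have := (sq_nonneg (dist x y)).trans (sq_norm_le_normSqZ x y)
      linarith
    · refine le_trans (exp_le_exp.2 ?_) (exp_neg_four_pow_le n j)
      have hlt : 2 ^ (j - 1) * ρ < dist x y := not_le.1 (Nat.find_min hex (by omega : j - 1 < j))
      have h2 : (2 ^ (j - 1) * ρ) ^ 2 ≤ normSqZ (x - y) :=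
        (pow_le_pow_left₀ (by positivity) hlt.le 2).trans (sq_norm_le_normSqZ x y)
      rw [neg_div, neg_div, neg_le_neg_iff, le_div_iff₀ (by positivity)]
      refine le_trans (le_of_eq ?_) h2
      obtain ⟨i, hi⟩ : ∃ i, j = i + 1 := ⟨j - 1, by omega⟩
      rw [hi]
      simp only [Nat.add_sub_cancel]
      rw [mul_pow, ← pow_mul, mul_comm i, pow_mul, pow_succ]
      norm_num
  calc ∑' y, f y * ofReal (gam ρ (x - y))
      ≤ ∑' y, f y * ∑' j : ℕ, ofReal ((ρ ^ d)⁻¹ * (c * (2 : ℝ)⁻¹ ^ (j * n))) *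
        (closedBall x (k j : ℝ)).indicator 1 y := by gcongr with y; exact pt y
    _ = ∑' j : ℕ, ofReal ((ρ ^ d)⁻¹ * (c * (2 : ℝ)⁻¹ ^ (j * n))) *
          ∫⁻ y in closedBall x (k j : ℝ), f y ∂count := by
        simp_rw [← ENNReal.tsum_mul_left]
        rw [tsum_comm]
        refine tsum_congr fun j => ?_
        rw [← lintegral_indicator MeasurableSet.of_discrete, lintegral_count,
          ← ENNReal.tsum_mul_left]
        refine tsum_congr fun y => ?_
        by_cases h : y ∈ closedBall x (k j : ℝ)
        · simp only [Set.indicator_of_mem h, Pi.one_apply]; ring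
        · simp only [Set.indicator_of_notMem h]; ring
    _ ≤ ∑' j : ℕ, ofReal (c * 5 ^ d * (2 : ℝ)⁻¹ ^ j) * hlM f x := by
        refine tsum_le_tsum fun j => ?_
        have h1 : ∫⁻ y in closedBall x (k j : ℝ), f y ∂count ≤
            ((2 * k j + 1 : ℕ) : ℝ≥0∞) ^ d * hlM f x := by
          have := le_iSup (fun k : ℕ => (((2 * k + 1 : ℕ) : ℝ≥0∞) ^ d)⁻¹ *
            ∫⁻ y in closedBall x (k : ℝ), f y ∂count) (k j)
          refine le_trans (le_of_eq ?_) (mul_le_mul_right this _)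
          rw [← mul_assoc, ENNReal.mul_inv_cancel, one_mul]
          · simp
          · exact pow_ne_top (natCast_ne_top _)
        refine (mul_le_mul_right h1 _).trans ?_
        rw [← mul_assoc]
        refine mul_le_mul_left ?_ _
        rw [← ofReal_natCast, ← ofReal_pow (by positivity),
          ← ofReal_mul (by positivity)]
        refine ofReal_le_ofReal ?_
        have hk : ((2 * k j + 1 : ℕ) : ℝ) ≤ 5 * (2 ^ j * ρ) := by
          have h3 : (k j : ℝ) < 2 ^ j * ρ + 1 := Nat.ceil_lt_add_one (by positivity)
          have h4 : 1 ≤ 2 ^ j * ρ :=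
            one_le_mul_of_one_le_of_one_le (one_le_pow₀ one_le_two) hρ
          push_cast
          linarith
        calc _ ≤ (ρ ^ d)⁻¹ * (c * (2 : ℝ)⁻¹ ^ (j * n)) * (5 * (2 ^ j * ρ)) ^ d := by gcongr
          _ = c * 5 ^ d * (2 : ℝ)⁻¹ ^ j * (((2 : ℝ)⁻¹ ^ (j * d) * (2 ^ j) ^ d)
                * ((ρ ^ d)⁻¹ * ρ ^ d)) := by
              rw [show j * n = j * d + j by simp only [n]; ring]; ring
          _ = _ := by
              rw [inv_mul_cancel₀ (by positivity), ← pow_mul, ← mul_pow]; norm_num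
    _ = _ := by
        rw [ENNReal.tsum_mul_right, ← ofReal_tsum_of_nonneg (fun j => by positivity),
          tsum_mul_left, tsum_geometric_of_lt_one (by norm_num) (by norm_num)]
        · norm_num
        · exact (summable_geometric_of_lt_one (by norm_num) (by norm_num)).mul_left _

/-- Convolution `k * f` on `ℤ^d`. -/
def conv (k f : Λ d → ℂ) (x : Λ d) : ℂ := ∑' y, f y * k (x - y)

lemma eC_add (s t : ℝ) : eC (s + t) = eC s * eC t := by
  unfold eC; rw [← Complex.exp_add]; push_cast; ring_nf

lemma norm_eC (t : ℝ) : ‖eC t‖ = 1 := by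
  unfold eC
  rw [show 2 * (pi : ℂ) * Complex.I * t = ((2 * pi * t : ℝ) : ℂ) * Complex.I by
    push_cast; ring, Complex.norm_exp_ofReal_mul_I]

lemma eC_zero : eC 0 = 1 := by simp [eC]

lemma eC_sum {ι : Type*} (s : Finset ι) (f : ι → ℝ) : eC (∑ i ∈ s, f i) = ∏ i ∈ s, eC (f i) := by
  classical
  induction s using induction_on with
  | empty => simp [eC_zero]
  | insert a s ha ih => rw [sum_insert ha, eC_add, ih, Finset.prod_insert ha]

/-- The absolutely convergent trigonometric series with coefficients `g`. -/
def trigSeries (g : Λ d → ℂ) : C(UnitAddTorus (Fin d), ℂ) :=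
  ∑' n, g n • UnitAddTorus.mFourier n

lemma hasSum_trigSeries {g : Λ d → ℂ} (hg : Summable g) :
    HasSum (fun n => g n • UnitAddTorus.mFourier n) (trigSeries g) := by
  refine Summable.hasSum (of_norm ?_)
  simpa [norm_smul, UnitAddTorus.mFourier_norm] using hg.norm

lemma hasSum_trigSeries_apply {g : Λ d → ℂ} (hg : Summable g)
    (t : UnitAddTorus (Fin d)) :
    HasSum (fun n => g n * UnitAddTorus.mFourier n t) (trigSeries g t) := by
  have := (hasSum_trigSeries hg).mapL (ContinuousMap.evalCLM ℂ t)
  simpa using this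

lemma mFourier_coe (n : Λ d) (ξ : Ξ d) :
    UnitAddTorus.mFourier n (fun i => (ξ i : UnitAddCircle)) = eC (∑ i, (n i : ℝ) * ξ i) := by
  rw [eC_sum]
  simp only [UnitAddTorus.mFourier, ContinuousMap.coe_mk]
  refine prod_congr rfl fun i _ => ?_
  rw [fourier_coe_apply, eC]
  congr 1
  push_cast
  ring

lemma trigSeries_coe {g : Λ d → ℂ} (hg : Summable g) (ξ : Ξ d) :
    trigSeries g (fun i => (ξ i : UnitAddCircle)) = ftZ g ξ := by
  rw [← (hasSum_trigSeries_apply hg _).tsum_eq]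
  simp_rw [mFourier_coe]
  rfl

/-- The Haar probability measure on the torus. -/
def torusMeasure (d : ℕ) : Measure (UnitAddTorus (Fin d)) :=
  Measure.pi fun _ => haarAddCircle

instance (d : ℕ) : IsProbabilityMeasure (torusMeasure d) := by
  unfold torusMeasure; infer_instance

lemma orthonormal_fourier_torus (m n : Λ d) :
    ∫ t, UnitAddTorus.mFourier n t * (starRingEnd ℂ) (UnitAddTorus.mFourier m t)
      ∂(torusMeasure d) = if n = m then 1 else 0 := by
  have e : ∀ t : UnitAddTorus (Fin d), UnitAddTorus.mFourier n t *
      (starRingEnd ℂ) (UnitAddTorus.mFourier m t)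
      = ∏ i, (fourier (n i - m i) (t i) : ℂ) := by
    intro t
    simp only [UnitAddTorus.mFourier, ContinuousMap.coe_mk, map_prod, ← prod_mul_distrib]
    refine prod_congr rfl fun i _ => ?_
    rw [sub_eq_add_neg, fourier_add, fourier_neg]
  simp_rw [e]
  unfold torusMeasure
  rw [integral_fintype_prod_eq_prod (fun i (x : UnitAddCircle) => (fourier (n i - m i) x : ℂ))]
  have h1 : ∀ k : ℤ, ∫ x : UnitAddCircle, (fourier k x : ℂ) ∂haarAddCircle
      = if k = 0 then 1 else 0 := by
    intro k
    have := orthonormal_iff_ite.1 (orthonormal_fourier (T := 1)) 0 k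
    rw [ContinuousMap.inner_toLp] at this
    simp only [fourier_zero, mul_one, map_one] at this
    rw [this]
    simp [eq_comm]
  simp_rw [h1]
  rw [Finset.prod_ite_zero]
  simp [funext_iff, sub_eq_zero]

lemma parseval_trigSeries {g : Λ d → ℂ} (hg : Summable g) :
    HasSum (fun n => ‖g n‖ ^ 2) (∫ t, ‖trigSeries g t‖ ^ 2 ∂(torusMeasure d)) := by
  have hcont : ∀ F : C(UnitAddTorus (Fin d), ℂ), Integrable (fun t => F t) (torusMeasure d) :=
    fun F => F.continuous.integrable_of_hasCompactSupport (HasCompactSupport.of_compactSpace _)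
  have key : ∀ (F : C(UnitAddTorus (Fin d), ℂ)),
      HasSum (fun n => g n * ∫ t, UnitAddTorus.mFourier n t * F t ∂(torusMeasure d))
        (∫ t, trigSeries g t * F t ∂(torusMeasure d)) := by
    intro F
    let Φ : C(UnitAddTorus (Fin d), ℂ) →L[ℂ] ℂ := LinearMap.mkContinuous {
        toFun := fun G => ∫ t, G t * F t ∂(torusMeasure d)
        map_add' := fun G H => by
          simp only [ContinuousMap.add_apply, add_mul]
          exact integral_add (hcont (G * F)) (hcont (H * F))
        map_smul' := fun c G => by
          simp only [ContinuousMap.smul_apply, smul_eq_mul, mul_assoc, RingHom.id_apply]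
          exact integral_const_mul _ _ } ‖F‖ (fun G => by
          refine (norm_integral_le_of_norm_le_const (C := ‖F‖ * ‖G‖)
            (of_forall fun t => ?_)).trans (by simp)
          rw [norm_mul, mul_comm]
          exact mul_le_mul (F.norm_coe_le_norm t) (G.norm_coe_le_norm t) (norm_nonneg _)
            (norm_nonneg _))
    have h := (hasSum_trigSeries hg).mapL Φ
    simp only [map_smul, smul_eq_mul] at h
    exact h
  have h1 : ∀ n, ∫ t, UnitAddTorus.mFourier n t * (starRingEnd ℂ) (trigSeries g t)
      ∂(torusMeasure d) = (starRingEnd ℂ) (g n) := by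
    intro n
    have h := key (star (UnitAddTorus.mFourier n))
    have e2 : ∀ m, g m * ∫ t, UnitAddTorus.mFourier m t * (star (UnitAddTorus.mFourier n)) t
        ∂(torusMeasure d) = if m = n then g n else 0 := by
      intro m
      have := orthonormal_fourier_torus n m
      simp only [ContinuousMap.star_apply, star_def]
      rw [this]
      by_cases hmn : m = n <;> simp [hmn]
    simp_rw [e2] at h
    have h3 := h.unique (hasSum_ite_eq n (g n))
    rw [← h3, ← integral_conj]
    refine integral_congr_ae (of_forall fun t => ?_)
    simp [mul_comm]
  have h2 := key (star (trigSeries g))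
  simp only [ContinuousMap.star_apply, star_def] at h2
  simp_rw [h1, mul_conj, normSq_eq_norm_sq] at h2
  have h3 := integral_ofReal (𝕜 := ℂ) (μ := torusMeasure d) (f := fun t => ‖trigSeries g t‖ ^ 2)
  refine Complex.hasSum_ofReal.1 ?_
  convert h2 using 1
  exact h3.symm

lemma enorm_tsum_sq_trigSeries {g : Λ d → ℂ} (hg : Summable g) :
    ∑' n, ‖g n‖ₑ ^ (2 : ℝ) = ofReal (∫ t, ‖trigSeries g t‖ ^ 2 ∂(torusMeasure d)) := by
  have h := parseval_trigSeries hg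
  rw [← h.tsum_eq, ofReal_tsum_of_nonneg (fun n => by positivity) h.summable]
  refine tsum_congr fun n => ?_
  rw [enorm_rpow_eq zero_le_two]
  norm_cast

lemma summable_conv {k f : Λ d → ℂ} (hk : Summable k) (hf : Summable f) :
    Summable fun p : Λ d × Λ d => f p.2 * k (p.1 - p.2) := by
  have h := summable_mul_of_summable_norm hf.norm hk.norm
  have e : (fun p : Λ d × Λ d => f p.2 * k (p.1 - p.2)) =
      (fun p : Λ d × Λ d => f p.1 * k p.2) ∘
        (⟨fun p => (p.2, p.1 - p.2), fun p => (p.2 + p.1, p.1), fun p => by simp,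
          fun p => by simp⟩ : (Λ d × Λ d) ≃ (Λ d × Λ d)) := rfl
  rw [e]
  exact (Equiv.summable_iff _).2 h

lemma ftZ_summable {g : Λ d → ℂ} (hg : Summable g) (ξ : Ξ d) :
    Summable fun n : Λ d => g n * eC (∑ i, (n i : ℝ) * ξ i) :=
  of_norm (by simpa [norm_eC] using hg.norm)

lemma ftZ_conv {k f : Λ d → ℂ} (hk : Summable k) (hf : Summable f)
    (ξ : Ξ d) : ftZ (conv k f) ξ = ftZ k ξ * ftZ f ξ := by
  obtain ⟨E, hEd⟩ : ∃ E : Λ d → ℂ, E = fun n => eC (∑ i, (n i : ℝ) * ξ i) := ⟨_, rfl⟩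
  have hE : ∀ x y, E x = E y * E (x - y) := by
    intro x y
    simp only [hEd]
    rw [← eC_add, ← sum_add_distrib]
    congr 1
    refine sum_congr rfl fun i _ => ?_
    simp; ring
  have hft : ∀ g : Λ d → ℂ, ftZ g ξ = ∑' n, g n * E n := fun g => by rw [hEd]; rfl
  have sk : Summable fun n => k n * E n := by rw [hEd]; exact ftZ_summable hk ξ
  have sf : Summable fun n => f n * E n := by rw [hEd]; exact ftZ_summable hf ξ
  have s1 := summable_conv sk sf
  have e1 : ∀ x, conv k f x * E x = ∑' y, (f y * E y) * (k (x - y) * E (x - y)) := by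
    intro x
    rw [conv, ← tsum_mul_right]
    refine tsum_congr fun y => ?_
    rw [hE x y]; ring
  have s2 : ∑' x, ∑' y, (f y * E y) * (k (x - y) * E (x - y)) =
      ∑' y, ∑' x, (f y * E y) * (k (x - y) * E (x - y)) :=
    (Summable.tsum_comm (f := fun y x => (f y * E y) * (k (x - y) * E (x - y)))
      s1.prod_symm)
  rw [hft, hft, hft, tsum_congr e1, s2, mul_comm, ← tsum_mul_right]
  refine tsum_congr fun y => ?_
  rw [tsum_mul_left]
  congr 1
  exact (Equiv.subRight y).tsum_eq (fun z => k z * E z)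

lemma conv_summable {k f : Λ d → ℂ} (hk : Summable k) (hf : Summable f) :
    Summable (conv k f) := (summable_conv hk hf).prod

/-- `ℓ²` bound for a finite family of convolution operators. -/
lemma sum_conv_sq_le {ι : Type*} (I : Finset ι) (k : ι → Λ d → ℂ)
    (hk : ∀ i ∈ I, Summable (k i)) {B : ℝ} (hB0 : 0 ≤ B)
    (hB : ∀ ξ : Ξ d, ∑ i ∈ I, ‖ftZ (k i) ξ‖ ^ 2 ≤ B) (f : Λ d → ℂ)
    (hf : Summable f) :
    ∑ i ∈ I, ∑' x, ‖conv (k i) f x‖ₑ ^ (2 : ℝ) ≤ ofReal B * ∑' x, ‖f x‖ₑ ^ (2 : ℝ) := by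
  have hint : ∀ F : C(UnitAddTorus (Fin d), ℂ), Integrable (fun t => ‖F t‖ ^ 2) (torusMeasure d) :=
    fun F => (by fun_prop : Continuous fun t => ‖F t‖ ^ 2).integrable_of_hasCompactSupport
      (HasCompactSupport.of_compactSpace _)
  rw [sum_congr rfl fun i hi => enorm_tsum_sq_trigSeries (conv_summable (hk i hi) hf),
    enorm_tsum_sq_trigSeries hf, ← ofReal_mul hB0,
    ← ofReal_sum_of_nonneg fun i _ => integral_nonneg fun t => by positivity]
  refine ofReal_le_ofReal ?_
  rw [← integral_finsetSum _ fun i _ => hint _, ← integral_const_mul]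
  refine integral_mono (integrable_finsetSum _ fun i _ => hint _) ((hint _).const_mul _)
    fun t => ?_
  obtain ⟨ξ, rfl⟩ : ∃ ξ : Ξ d, (fun i => (ξ i : UnitAddCircle)) = t := by
    choose ξ hξ using fun i => QuotientAddGroup.mk_surjective (t i)
    exact ⟨ξ, funext hξ⟩
  simp only
  rw [sum_congr rfl fun i hi => by
    rw [trigSeries_coe (conv_summable (hk i hi) hf), ftZ_conv (hk i hi) hf, norm_mul, mul_pow],
    ← sum_mul, trigSeries_coe hf]
  gcongr
  exact hB ξ

/-- The Gaussian-weighted quadratic exponential sum `∑ e^{-m²/ρ²} e(um²/ρ² + mx)`. -/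
def thetaW (ρ u x : ℝ) : ℂ :=
  ∑' m : ℤ, (exp (-(m : ℝ) ^ 2 / ρ ^ 2) : ℂ) * eC (u * (m : ℝ) ^ 2 / ρ ^ 2 + m * x)

lemma summable_exp_int_sq {a : ℝ} (ha : 0 < a) (x : ℝ) :
    Summable fun m : ℤ => exp (-pi * a * (x + m) ^ 2) := by
  have h := (summable_jacobiTheta₂_term_iff (Complex.I * a * x) (Complex.I * a)).2 (by simpa using ha)
  have h1 := (h.norm).mul_left (exp (-pi * a * x ^ 2))
  refine h1.congr fun m => ?_
  rw [norm_jacobiTheta₂_term, ← exp_add]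
  congr 1
  simp
  ring

/-- The constant `∑ e^{-πm²}`. -/
def gaussC : ℝ := ∑' m : ℤ, exp (-pi * 1 * (0 + (m : ℝ)) ^ 2)

lemma one_le_gaussC : 1 ≤ gaussC := by
  have := (summable_exp_int_sq one_pos 0).le_tsum 0 (fun j _ => (exp_pos _).le)
  simpa [gaussC] using this

lemma tsum_exp_int_sq_le {a : ℝ} (ha : 0 < a) :
    ∑' m : ℤ, exp (-pi * a * (0 + (m : ℝ)) ^ 2) ≤ gaussC * max 1 (a ^ (-(1 / 2) : ℝ)) := by
  have hg := one_le_gaussC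
  rcases le_total 1 a with h | h
  · refine (Summable.tsum_le_tsum (fun m : ℤ => ?_) (summable_exp_int_sq ha 0)
      (summable_exp_int_sq one_pos 0)).trans (le_mul_of_one_le_right
        (zero_le_one.trans hg) (le_max_left _ _))
    refine exp_le_exp.2 ?_
    nlinarith [mul_nonneg pi_pos.le (mul_nonneg (sub_nonneg.2 h) (sq_nonneg (0 + (m : ℝ))))]
  · have e := Real.tsum_exp_neg_mul_int_sq ha
    simp only [zero_add]
    rw [e, one_div (a ^ (1 / 2 : ℝ)), ← rpow_neg ha.le, mul_comm]
    refine mul_le_mul ?_ (le_max_right _ _) (by positivity) (by linarith)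
    have hs := summable_exp_int_sq (inv_pos.2 ha) 0
    simp only [zero_add] at hs
    refine Summable.tsum_le_tsum (fun m : ℤ => ?_) (hs.congr fun m => by ring_nf)
      (summable_exp_int_sq one_pos 0)
    refine exp_le_exp.2 ?_
    rw [zero_add, mul_one, div_eq_mul_inv]
    have h2 : 1 ≤ a⁻¹ := (one_le_inv₀ ha).2 h
    have := mul_nonneg pi_pos.le (mul_nonneg (sub_nonneg.2 h2) (sq_nonneg (m : ℝ)))
    linarith

lemma tsum_exp_int_sq_shift_le {a x : ℝ} (ha : 0 < a) (hx : |x| ≤ 1 / 2) :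
    ∑' m : ℤ, exp (-pi * a * (x + m) ^ 2) ≤
      gaussC * max 1 ((a / 8) ^ (-(1 / 2) : ℝ)) * exp (-pi * a * x ^ 2 / 2) := by
  have h8 : 0 < a / 8 := by positivity
  refine le_trans ?_ (mul_le_mul_of_nonneg_right (tsum_exp_int_sq_le h8) (exp_pos _).le)
  rw [← tsum_mul_right]
  refine Summable.tsum_le_tsum (fun m : ℤ => ?_) (summable_exp_int_sq ha x)
    ((summable_exp_int_sq h8 0).mul_right _)
  rw [← exp_add]
  gcongr
  have key : x ^ 2 / 2 + (m : ℝ) ^ 2 / 8 ≤ (x + m) ^ 2 := by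
    rcases eq_or_ne m 0 with rfl | hm
    · simp; nlinarith [sq_nonneg x]
    · have hm1 : (1 : ℝ) ≤ |(m : ℝ)| := mod_cast Int.one_le_abs hm
      have h2 : |(m : ℝ)| / 2 ≤ |x + m| := by
        have := abs_sub_abs_le_abs_sub (m : ℝ) (-x)
        rw [abs_neg, sub_neg_eq_add, add_comm (m : ℝ)] at this
        linarith
      have h3 : |x| ≤ |x + m| := by linarith
      nlinarith [sq_abs x, sq_abs (m : ℝ), sq_abs (x + m), abs_nonneg x, abs_nonneg (m : ℝ),
        mul_self_le_mul_self (abs_nonneg x) h3,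
        mul_self_le_mul_self (by positivity) h2]
  have := mul_le_mul_of_nonneg_left key (mul_pos pi_pos ha).le
  nlinarith

lemma tsum_exp_int_sq_le' {a : ℝ} (ha : 0 < a) (x : ℝ) :
    ∑' m : ℤ, exp (-pi * a * (x + m) ^ 2) ≤
      gaussC * max 1 ((a / 8) ^ (-(1 / 2) : ℝ)) := by
  have h1 : ∑' m : ℤ, exp (-pi * a * (x + m) ^ 2) =
      ∑' m : ℤ, exp (-pi * a * ((x - round x) + m) ^ 2) := by
    rw [← (Equiv.subRight (round x)).tsum_eq]
    refine tsum_congr fun m => ?_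
    simp only [Equiv.subRight_apply]
    push_cast
    ring_nf
  rw [h1]
  refine (tsum_exp_int_sq_shift_le ha (abs_sub_round x)).trans ?_
  refine mul_le_of_le_one_right (mul_nonneg (by linarith [one_le_gaussC]) (by positivity)) ?_
  rw [exp_le_one_iff]
  have := mul_nonneg (mul_pos pi_pos ha).le (sq_nonneg (x - round x))
  linarith

lemma thetaW_eq {ρ : ℝ} (hρ : 0 < ρ) (u x : ℝ) :
    thetaW ρ u x = jacobiTheta₂ x ((2 * u + Complex.I / pi) / ρ ^ 2) := by
  unfold thetaW jacobiTheta₂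
  refine tsum_congr fun m => ?_
  rw [eC, jacobiTheta₂_term, Complex.ofReal_exp, ← Complex.exp_add]
  congr 1
  have hp : (pi : ℂ) ≠ 0 := mod_cast Real.pi_ne_zero
  have hr : (ρ : ℂ) ≠ 0 := mod_cast hρ.ne'
  push_cast
  field_simp
  ring_nf
  rw [Complex.I_sq]
  ring

lemma norm_thetaW_le {ρ : ℝ} (hρ : 0 < ρ) (u x : ℝ) :
    ‖thetaW ρ u x‖ ≤ ρ * (4 * u ^ 2 + (pi ^ 2)⁻¹) ^ (-(1 / 4) : ℝ) *
      ∑' m : ℤ, exp (-pi * (ρ ^ 2 / (pi * (4 * u ^ 2 + (pi ^ 2)⁻¹))) *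
        (x + m) ^ 2) := by
  set D : ℝ := 4 * u ^ 2 + (pi ^ 2)⁻¹ with hD
  have hD0 : 0 < D := by have := pi_pos; positivity
  set τ : ℂ := (2 * u + Complex.I / pi) / ρ ^ 2 with hτ
  have hτ' : τ = ((2 * u / ρ ^ 2 : ℝ) : ℂ) + ((1 / (pi * ρ ^ 2) : ℝ) : ℂ) * Complex.I := by
    have hp : (pi : ℂ) ≠ 0 := mod_cast Real.pi_ne_zero
    have hr : (ρ : ℂ) ≠ 0 := mod_cast hρ.ne'
    rw [hτ]; push_cast; field_simp
  have hre : τ.re = 2 * u / ρ ^ 2 := by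
    rw [hτ', Complex.add_re, Complex.re_ofReal_mul, Complex.ofReal_re, Complex.I_re]; ring
  have him : τ.im = 1 / (pi * ρ ^ 2) := by
    rw [hτ', Complex.add_im, Complex.im_ofReal_mul, Complex.ofReal_im, Complex.I_im]; ring
  have him0 : 0 < τ.im := by rw [him]; have := pi_pos; positivity
  have hns : normSq τ = D / ρ ^ 4 := by
    rw [Complex.normSq_apply, hre, him, hD]
    field_simp
    ring
  have hnorm : ‖τ‖ = D ^ (1 / 2 : ℝ) / ρ ^ 2 := by
    rw [Complex.norm_def, hns, Real.sqrt_div hD0.le, sqrt_eq_rpow, show ρ ^ 4 = (ρ ^ 2) ^ 2 by ring,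
      Real.sqrt_sq (by positivity)]
  rw [thetaW_eq hρ, ← hτ, jacobiTheta₂_functional_equation, mul_assoc, norm_mul]
  have hτ0 : τ ≠ 0 := by intro h; rw [h] at him0; simp at him0
  have e1 : ‖1 / (-Complex.I * τ) ^ (1 / 2 : ℂ)‖ = ρ * D ^ (-(1 / 4) : ℝ) := by
    rw [norm_div, norm_one, show (1 / 2 : ℂ) = ((1 / 2 : ℝ) : ℂ) by push_cast; ring,
      Complex.norm_cpow_real, norm_mul, norm_neg, Complex.norm_I, one_mul, hnorm,
      div_rpow (by positivity) (by positivity), ← rpow_mul hD0.le,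
      ← sqrt_eq_rpow (ρ ^ 2), Real.sqrt_sq hρ.le, rpow_neg hD0.le]
    norm_num
    ring
  rw [e1]
  refine mul_le_mul_of_nonneg_left ?_ (by positivity)
  have himI : 0 < (-1 / τ).im := by
    rw [neg_div, one_div, Complex.neg_im, inv_im, neg_div, neg_neg]
    exact div_pos him0 (Complex.normSq_pos.2 hτ0)
  have hterm : ∀ m : ℤ, ‖Complex.exp (-pi * Complex.I * (x : ℂ) ^ 2 / τ) *
      jacobiTheta₂_term m (x / τ) (-1 / τ)‖ =
      exp (-pi * (ρ ^ 2 / (pi * D)) * (x - m) ^ 2) := by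
    intro m
    rw [jacobiTheta₂_term, ← Complex.exp_add, Complex.norm_exp]
    congr 1
    have : -pi * Complex.I * (x : ℂ) ^ 2 / τ +
        (2 * pi * Complex.I * m * (x / τ) + pi * Complex.I * m ^ 2 * (-1 / τ)) =
        ((-pi * (x - m) ^ 2 : ℝ) : ℂ) * (Complex.I * τ⁻¹) := by
      push_cast; field_simp; ring
    rw [this, Complex.re_ofReal_mul, Complex.mul_re, Complex.I_re, Complex.I_im, inv_im,
      him, hns]
    field_simp
    ring
  have hsum := ((summable_jacobiTheta₂_term_iff ((x : ℂ) / τ) (-1 / τ)).2 himI).mul_left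
    (Complex.exp (-pi * Complex.I * (x : ℂ) ^ 2 / τ))
  rw [jacobiTheta₂, ← tsum_mul_left]
  refine (norm_tsum_le_tsum_norm hsum.norm).trans (le_of_eq ?_)
  simp_rw [hterm]
  rw [← (Equiv.neg ℤ).tsum_eq]
  refine tsum_congr fun m => ?_
  simp

/-- The normalised quadratic Gauss sum `q⁻¹ ∑_b e((ab² - bℓ)/q)`. -/
def gaussSumN {q : ℕ} [NeZero q] (a ℓ : ZMod q) : ℂ :=
  (q : ℂ)⁻¹ * ∑ b : ZMod q, stdAddChar (a * b ^ 2 - b * ℓ)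

lemma eC_div_eq {q : ℕ} [NeZero q] (j : ℤ) : eC (j / q) = stdAddChar (j : ZMod q) := by
  rw [ZMod.stdAddChar_coe, eC]
  congr 1
  push_cast
  ring

lemma card_two_mul_eq_zero (q : ℕ) [NeZero q] :
    (univ.filter fun h : ZMod q => 2 * h = 0).card ≤ 2 := by
  have := IsAddCyclic.card_nsmul_eq_zero_le (α := ZMod q) (n := 2) two_pos
  simpa using this

lemma norm_gaussSumN_sq_le {q : ℕ} [NeZero q] (a ℓ : ZMod q) :
    ‖gaussSumN a ℓ‖ ^ 2 ≤ ((univ.filter fun h : ZMod q => 2 * a * h = 0).card : ℝ) / q := by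
  classical
  have hq : (0 : ℝ) < q := mod_cast Nat.pos_of_ne_zero (NeZero.ne q)
  let ψ : AddChar (ZMod q) ℂ := stdAddChar
  let G : ℂ := ∑ b : ZMod q, ψ (a * b ^ 2 - b * ℓ)
  have h1 : G * (starRingEnd ℂ) G =
      ∑ h : ZMod q, if 2 * a * h = 0 then q * ψ (a * h ^ 2 - h * ℓ) else 0 := by
    calc G * (starRingEnd ℂ) G
        = ∑ c : ZMod q, ∑ b : ZMod q, ψ (a * b ^ 2 - b * ℓ) * ψ (-(a * c ^ 2 - c * ℓ)) := by
          simp only [G, map_sum]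
          rw [sum_mul_sum, sum_comm]
          refine sum_congr rfl fun c _ => sum_congr rfl fun b _ => ?_
          rw [AddChar.map_neg_eq_conj]
      _ = ∑ c : ZMod q, ∑ h : ZMod q, ψ (a * h ^ 2 - h * ℓ) * ψ (c * (2 * a * h)) := by
          refine sum_congr rfl fun c _ => ?_
          rw [← Equiv.sum_comp (Equiv.addRight c)]
          refine sum_congr rfl fun h _ => ?_
          rw [← AddChar.map_add_eq_mul, ← AddChar.map_add_eq_mul]
          congr 1
          simp only [Equiv.coe_addRight]
          ring
      _ = ∑ h : ZMod q, if 2 * a * h = 0 then q * ψ (a * h ^ 2 - h * ℓ) else 0 := by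
          rw [sum_comm]
          refine sum_congr rfl fun h _ => ?_
          rw [← mul_sum, AddChar.sum_mulShift _ (ZMod.isPrimitive_stdAddChar q), ZMod.card]
          split_ifs <;> ring
  have h2 : ‖G‖ ^ 2 ≤ (univ.filter fun h : ZMod q => 2 * a * h = 0).card * q := by
    rw [← normSq_eq_norm_sq, ← norm_of_nonneg (Complex.normSq_nonneg G),
      ← norm_real, ← mul_conj, h1]
    refine (norm_sum_le _ _).trans (le_of_eq ?_)
    rw [← nsmul_eq_mul, ← sum_const, sum_filter]
    refine sum_congr rfl fun h _ => ?_
    split_ifs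
    · rw [norm_mul, AddChar.norm_apply, mul_one, Complex.norm_natCast]
    · exact norm_zero
  rw [gaussSumN, norm_mul, norm_inv, Complex.norm_natCast, mul_pow, inv_pow, le_div_iff₀ hq]
  calc ((q : ℝ) ^ 2)⁻¹ * ‖G‖ ^ 2 * q
      ≤ ((q : ℝ) ^ 2)⁻¹ * ((univ.filter fun h : ZMod q => 2 * a * h = 0).card * q) * q := by
        gcongr
    _ = _ := by field_simp

lemma norm_gaussSumN_le {q : ℕ} [NeZero q] {a : ZMod q} (ha : IsUnit a) (ℓ : ZMod q) :
    ‖gaussSumN a ℓ‖ ≤ sqrt 2 * (q : ℝ) ^ (-(1 / 2) : ℝ) := by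
  have hq : (0 : ℝ) < q := mod_cast Nat.pos_of_ne_zero (NeZero.ne q)
  refine (Real.le_sqrt_of_sq_le (norm_gaussSumN_sq_le a ℓ)).trans ?_
  rw [rpow_neg hq.le, ← sqrt_eq_rpow, ← div_eq_mul_inv, ← Real.sqrt_div zero_le_two]
  refine Real.sqrt_le_sqrt (div_le_div_of_nonneg_right ?_ hq.le)
  refine le_trans (Nat.cast_le.2 (card_le_card fun h hh => ?_))
    (mod_cast card_two_mul_eq_zero q)
  rw [mem_filter] at hh ⊢
  rw [← ha.mul_right_eq_zero, ← hh.2]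
  exact ⟨hh.1, by ring⟩

lemma sum_gaussSumN_mul {q : ℕ} [NeZero q] (a m : ZMod q) :
    ∑ ℓ : ZMod q, gaussSumN a ℓ * stdAddChar (ℓ * m) = stdAddChar (a * m ^ 2) := by
  classical
  have hq : (q : ℂ) ≠ 0 := mod_cast NeZero.ne q
  simp only [gaussSumN, mul_sum, sum_mul]
  rw [sum_comm]
  have : ∀ b : ZMod q, ∑ ℓ : ZMod q, (q : ℂ)⁻¹ * stdAddChar (a * b ^ 2 - b * ℓ) *
      stdAddChar (ℓ * m) = if b = m then stdAddChar (a * m ^ 2) else 0 := by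
    intro b
    have e : ∀ ℓ : ZMod q, (q : ℂ)⁻¹ * stdAddChar (a * b ^ 2 - b * ℓ) *
      stdAddChar (ℓ * m) = (q : ℂ)⁻¹ * stdAddChar (a * b ^ 2) *
        stdAddChar (ℓ * (m - b)) := by
      intro ℓ
      rw [mul_assoc, mul_assoc, ← AddChar.map_add_eq_mul, ← AddChar.map_add_eq_mul]
      congr 2
      ring
    simp_rw [e]
    rw [← mul_sum, AddChar.sum_mulShift _ (ZMod.isPrimitive_stdAddChar q), ZMod.card]
    by_cases h : b = m
    · subst h
      simp
      field_simp
    · have : m - b ≠ 0 := fun h' => h (sub_eq_zero.1 h').symm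
      simp [h, this]
  simp_rw [this]
  simp

lemma summable_thetaW {ρ : ℝ} (hρ : 0 < ρ) (u x : ℝ) :
    Summable fun m : ℤ => (exp (-(m : ℝ) ^ 2 / ρ ^ 2) : ℂ) *
      eC (u * (m : ℝ) ^ 2 / ρ ^ 2 + m * x) := by
  refine of_norm ?_
  have := summable_exp_int_sq (a := 1 / (pi * ρ ^ 2)) (by have := pi_pos; positivity) 0
  refine this.congr fun m => ?_
  rw [norm_mul, norm_eC, mul_one, norm_real, norm_of_nonneg (exp_pos _).le]
  congr 1
  field_simp
  ring

lemma thetaW_arc_expand {ρ : ℝ} (hρ : 0 < ρ) {q : ℕ} [NeZero q] (a : ℤ) (u x : ℝ) :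
    thetaW ρ (ρ ^ 2 * (a / q) + u) x =
      ∑ ℓ : ZMod q, gaussSumN (a : ZMod q) ℓ * thetaW ρ u (x + (ℓ.val : ℝ) / q) := by
  have hq : (q : ℝ) ≠ 0 := mod_cast NeZero.ne q
  simp only [thetaW]
  simp_rw [← tsum_mul_left]
  rw [← tsum_finsetSum fun ℓ _ => (summable_thetaW hρ u _).mul_left _]
  refine tsum_congr fun m => ?_
  have e1 : eC ((ρ ^ 2 * (a / q) + u) * (m : ℝ) ^ 2 / ρ ^ 2 + m * x) =
      eC (u * (m : ℝ) ^ 2 / ρ ^ 2 + m * x) * stdAddChar ((a : ZMod q) * (m : ZMod q) ^ 2) := by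
    rw [show ((a : ZMod q) * (m : ZMod q) ^ 2) = ((a * m ^ 2 : ℤ) : ZMod q) by push_cast; rfl,
      ← eC_div_eq, ← eC_add]
    congr 1
    push_cast
    field_simp
    ring
  rw [e1, ← sum_gaussSumN_mul, mul_sum, mul_sum]
  refine sum_congr rfl fun ℓ _ => ?_
  have e2 : eC (u * (m : ℝ) ^ 2 / ρ ^ 2 + m * (x + (ℓ.val : ℝ) / q)) =
      eC (u * (m : ℝ) ^ 2 / ρ ^ 2 + m * x) * stdAddChar (ℓ * (m : ZMod q)) := by
    rw [show ℓ * (m : ZMod q) = ((ℓ.val * m : ℤ) : ZMod q) by push_cast; simp,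
      ← eC_div_eq, ← eC_add]
    congr 1
    push_cast
    ring
  rw [e2]
  ring

/-- The decay parameter of the dual theta series. -/
def thetaD (u : ℝ) : ℝ := 4 * u ^ 2 + (pi ^ 2)⁻¹

lemma thetaD_pos (u : ℝ) : 0 < thetaD u := by
  have := pi_pos; unfold thetaD; positivity

lemma thetaD_le (u : ℝ) : thetaD u ≤ 4 * (1 + |u|) ^ 2 := by
  have h : (pi ^ 2)⁻¹ ≤ 1 := inv_le_one_of_one_le₀ (by nlinarith [Real.pi_gt_three])
  unfold thetaD
  nlinarith [sq_abs u, abs_nonneg u]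

lemma le_thetaD (u : ℝ) : (1 + |u|) ^ 2 / 16 ≤ thetaD u := by
  have h : (1 : ℝ) / 12 ≤ (pi ^ 2)⁻¹ := by
    rw [one_div]
    exact inv_anti₀ (by have := pi_pos; positivity) (by nlinarith [Real.pi_lt_d2, pi_pos])
  unfold thetaD
  nlinarith [sq_abs u, abs_nonneg u, sq_nonneg (60 * |u| - 1)]

lemma thetaD_rpow_le (u : ℝ) : (thetaD u) ^ (-(1 / 4) : ℝ) ≤ 2 * (1 + |u|) ^ (-(1 / 2) : ℝ) := by
  have h0 : (0 : ℝ) < 1 + |u| := by positivity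
  calc (thetaD u) ^ (-(1 / 4) : ℝ) ≤ ((1 + |u|) ^ 2 / 16) ^ (-(1 / 4) : ℝ) :=
        rpow_le_rpow_of_nonpos (by positivity) (le_thetaD u) (by norm_num)
    _ = 2 * (1 + |u|) ^ (-(1 / 2) : ℝ) := by
        rw [div_rpow (by positivity) (by norm_num), ← rpow_natCast (1 + |u|) 2,
          ← rpow_mul h0.le, show (16 : ℝ) = 2 ^ (4 : ℝ) by norm_num,
          ← rpow_mul zero_le_two]
        norm_num
        ring

lemma max_one_rpow_le {Y : ℝ} (hY : 1 / (16 * pi) ≤ Y) :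
    max 1 ((Y / 8) ^ (-(1 / 2) : ℝ)) ≤ 32 := by
  have h1 : (1 / 1024 : ℝ) ≤ Y / 8 := by
    have : 1 / (16 * 4) ≤ 1 / (16 * pi) := by
      gcongr; exact Real.pi_le_four
    linarith
  refine max_le (by norm_num) ((rpow_le_rpow_of_nonpos (by norm_num) h1 (by norm_num)).trans ?_)
  rw [show (1 / 1024 : ℝ) = 32 ^ (-2 : ℝ) by
    rw [rpow_neg (by norm_num)]; norm_num, ← rpow_mul (by norm_num)]
  norm_num

lemma exists_norm_thetaW_le : ∃ C : ℝ, 0 < C ∧ ∀ ρ u x : ℝ, 0 < ρ → 1 + |u| ≤ 2 * ρ →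
    |x| ≤ 1 / 2 → ‖thetaW ρ u x‖ ≤ C * ρ * (1 + |u|) ^ (-(1 / 2) : ℝ) *
      exp (-(ρ ^ 2 * x ^ 2 / (8 * (1 + |u|) ^ 2))) := by
  have hg := one_le_gaussC
  refine ⟨2 * (gaussC * 32), by positivity, fun ρ u x hρ hu hx => ?_⟩
  have hp := pi_pos
  have hD := thetaD_pos u
  have hU : 0 < 1 + |u| := by positivity
  set Y := ρ ^ 2 / (pi * thetaD u) with hY
  have hYl : ρ ^ 2 / (4 * pi * (1 + |u|) ^ 2) ≤ Y := by
    rw [hY]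
    refine div_le_div_of_nonneg_left (by positivity) (by positivity) ?_
    nlinarith [thetaD_le u]
  have hY1 : 1 / (16 * pi) ≤ Y := by
    refine le_trans ?_ hYl
    rw [div_le_div_iff₀ (by positivity) (by positivity)]
    nlinarith [mul_self_le_mul_self hU.le hu]
  have hY0 : 0 < Y := by positivity
  refine (norm_thetaW_le hρ u x).trans ?_
  change ρ * (thetaD u) ^ (-(1 / 4) : ℝ) * ∑' m : ℤ, exp (-pi * Y * (x + m) ^ 2) ≤ _
  calc ρ * (thetaD u) ^ (-(1 / 4) : ℝ) * ∑' m : ℤ, exp (-pi * Y * (x + m) ^ 2)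
      ≤ ρ * (2 * (1 + |u|) ^ (-(1 / 2) : ℝ)) * (gaussC * 32 *
        exp (-(ρ ^ 2 * x ^ 2 / (8 * (1 + |u|) ^ 2)))) := by
        gcongr
        · exact thetaD_rpow_le u
        · refine (tsum_exp_int_sq_shift_le hY0 hx).trans ?_
          gcongr
          · exact max_one_rpow_le hY1
          · have := mul_le_mul_of_nonneg_left hYl (mul_nonneg hp.le (sq_nonneg x))
            have e : pi * x ^ 2 * (ρ ^ 2 / (4 * pi * (1 + |u|) ^ 2)) =
              2 * (ρ ^ 2 * x ^ 2 / (8 * (1 + |u|) ^ 2)) := by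
                field_simp; ring
            rw [e] at this
            linarith
    _ = _ := by ring

lemma sum_zmod_tsum {q : ℕ} [NeZero q] {F : ℝ → ℝ} (hF : Summable fun j : ℤ => F (j / q)) :
    ∑ ℓ : ZMod q, ∑' m : ℤ, F ((ℓ.val : ℝ) / q + m) = ∑' j : ℤ, F (j / q) := by
  have hq : (q : ℝ) ≠ 0 := mod_cast NeZero.ne q
  have h1 : ∀ p : ℤ × Fin q, F ((((Int.divModEquiv q).symm p : ℤ) : ℝ) / q) =
      F (((p.2 : ℕ) : ℝ) / q + p.1) := by
    intro p
    congr 1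
    rw [Int.divModEquiv_symm_apply]
    push_cast
    field_simp
    ring
  have hs := (Equiv.summable_iff (Int.divModEquiv q).symm).2 hF
  have hs' : Summable fun p : ℤ × Fin q => F (((p.2 : ℕ) : ℝ) / q + p.1) := hs.congr h1
  have h2 : ∑ ℓ : ZMod q, ∑' m : ℤ, F ((ℓ.val : ℝ) / q + m) =
      ∑ ℓ : Fin q, ∑' m : ℤ, F (((ℓ : ℕ) : ℝ) / q + m) := by
    obtain ⟨k, rfl⟩ : ∃ k, q = k + 1 := ⟨q - 1, by have := NeZero.ne q; omega⟩
    rfl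
  rw [h2, ← (Int.divModEquiv q).symm.tsum_eq (fun j : ℤ => F (j / q)), tsum_congr h1,
    ← (Equiv.prodComm (Fin q) ℤ).tsum_eq]
  have hs2 : Summable fun p : Fin q × ℤ => F (((p.1 : ℕ) : ℝ) / q + p.2) :=
    (Equiv.summable_iff (Equiv.prodComm (Fin q) ℤ)).2 hs'
  rw [← tsum_fintype (L := .unconditional _)]
  exact hs2.tsum_prod.symm

lemma exists_norm_thetaW_arc_le : ∃ C : ℝ, 0 < C ∧ ∀ (r u x : ℝ) (q : ℕ) [NeZero q] (a : ℤ),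
    0 < r → q * (1 + |u|) ≤ 2 * r → IsUnit (a : ZMod q) →
    ‖thetaW r (r ^ 2 * (a / q) + u) x‖ ≤ C * (q : ℝ) ^ (-(1 / 2) : ℝ) * r *
      (1 + |u|) ^ (-(1 / 2) : ℝ) := by
  have hg := one_le_gaussC
  refine ⟨sqrt 2 * 2 * (gaussC * 32), by positivity, fun r u x q _ a hr hu ha => ?_⟩
  have hq : (0 : ℝ) < q := mod_cast Nat.pos_of_ne_zero (NeZero.ne q)
  have hp := pi_pos
  have hD := thetaD_pos u
  set Y := r ^ 2 / (pi * thetaD u) with hY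
  have hY1 : 1 / (16 * pi) ≤ Y / q ^ 2 := by
    have hYl : r ^ 2 / (4 * pi * (1 + |u|) ^ 2) ≤ Y := by
      rw [hY]
      refine div_le_div_of_nonneg_left (by positivity) (by positivity) ?_
      nlinarith [thetaD_le u]
    have : 1 / (16 * pi) ≤ r ^ 2 / (4 * pi * (1 + |u|) ^ 2) / q ^ 2 := by
      rw [div_div, div_le_div_iff₀ (by positivity) (by positivity)]
      nlinarith [mul_self_le_mul_self (by positivity) hu]
    exact this.trans (by gcongr)
  have hY0 : 0 < Y := by positivity
  have hYq : 0 < Y / q ^ 2 := by positivity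
  rw [thetaW_arc_expand hr]
  have hFe : ∀ j : ℤ, exp (-pi * Y * (x + (j : ℝ) / q) ^ 2) =
      exp (-pi * (Y / q ^ 2) * (q * x + j) ^ 2) := by
    intro j
    congr 1
    field_simp
  have hF : ∑ ℓ : ZMod q, ∑' m : ℤ, exp (-pi * Y * (x + ((ℓ.val : ℝ) / q + m)) ^ 2) =
      ∑' j : ℤ, exp (-pi * (Y / q ^ 2) * (q * x + j) ^ 2) :=
    (sum_zmod_tsum (F := fun t : ℝ => exp (-pi * Y * (x + t) ^ 2))
      ((summable_exp_int_sq hYq (q * x)).congr fun j => (hFe j).symm)).trans (tsum_congr hFe)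
  calc ‖∑ ℓ : ZMod q, gaussSumN (a : ZMod q) ℓ * thetaW r u (x + (ℓ.val : ℝ) / q)‖
      ≤ ∑ ℓ : ZMod q, (sqrt 2 * (q : ℝ) ^ (-(1 / 2) : ℝ)) * (r * (thetaD u) ^ (-(1 / 4) : ℝ) *
        ∑' m : ℤ, exp (-pi * Y * (x + ((ℓ.val : ℝ) / q + m)) ^ 2)) := by
        refine (norm_sum_le _ _).trans (sum_le_sum fun ℓ _ => ?_)
        rw [norm_mul]
        refine mul_le_mul (norm_gaussSumN_le ha ℓ) ?_ (norm_nonneg _) (by positivity)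
        have := norm_thetaW_le hr u (x + (ℓ.val : ℝ) / q)
        simp only [← add_assoc]
        exact this
    _ = (sqrt 2 * (q : ℝ) ^ (-(1 / 2) : ℝ)) * (r * (thetaD u) ^ (-(1 / 4) : ℝ) *
        ∑' j : ℤ, exp (-pi * (Y / q ^ 2) * (q * x + j) ^ 2)) := by
        rw [← mul_sum, ← mul_sum, hF]
    _ ≤ (sqrt 2 * (q : ℝ) ^ (-(1 / 2) : ℝ)) * (r * (2 * (1 + |u|) ^ (-(1 / 2) : ℝ)) *
        (gaussC * 32)) := by
        gcongr
        · exact thetaD_rpow_le u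
        · refine (tsum_exp_int_sq_le' hYq _).trans ?_
          gcongr
          exact max_one_rpow_le hY1
    _ = _ := by ring

lemma hasSum_pi_prod : ∀ {d : ℕ} {F : Fin d → ℤ → ℂ}, (∀ i, Summable (F i)) →
    HasSum (fun z : Λ d => ∏ i, F i (z i)) (∏ i, ∑' m, F i m)
  | 0, F, _ => by
    simp
  | d + 1, F, hF => by
    have ih := hasSum_pi_prod (F := fun i : Fin d => F i.succ) fun i => hF i.succ
    rw [← (Fin.consEquiv fun _ => ℤ).hasSum_iff]
    have e : (fun z : Fin (d + 1) → ℤ => ∏ i, F i (z i)) ∘ (Fin.consEquiv fun _ => ℤ) =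
        fun p : ℤ × Λ d => F 0 p.1 * ∏ i : Fin d, F i.succ (p.2 i) := by
      funext p
      simp [Fin.prod_univ_succ, Fin.consEquiv]
    rw [e, Fin.prod_univ_succ, ← ih.tsum_eq,
      tsum_mul_tsum_of_summable_norm (hF 0).norm ih.summable.norm]
    exact (summable_mul_of_summable_norm (hF 0).norm ih.summable.norm).hasSum

lemma hasSum_gauss_eC {ρ : ℝ} (hρ : 0 < ρ) (u : ℝ) (ξ : Ξ d) :
    HasSum (fun z : Λ d => (exp (-(normSqZ z : ℝ) / ρ ^ 2) : ℂ) *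
      eC (u * ((normSqZ z : ℝ) / ρ ^ 2)) * eC (∑ i, (z i : ℝ) * ξ i))
      (∏ i, thetaW ρ u (ξ i)) := by
  have h := hasSum_pi_prod fun i => summable_thetaW hρ u (ξ i)
  refine h.congr_fun fun z => ?_
  rw [prod_mul_distrib, ← eC_sum, mul_assoc, ← eC_add, ← Complex.ofReal_prod, ← Real.exp_sum]
  congr 4
  · rw [normSqZ]; push_cast
    rw [← Finset.sum_neg_distrib, sum_div]
  · rw [sum_add_distrib, normSqZ]; push_cast
    rw [sum_div, mul_sum]
    simp_rw [mul_div_assoc]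

lemma summable_gauss {ρ : ℝ} (hρ : 0 < ρ) :
    Summable fun z : Λ d => exp (-(normSqZ z : ℝ) / ρ ^ 2) := by
  have := (hasSum_gauss_eC (d := d) hρ 0 0).summable.norm
  refine this.congr fun z => ?_
  rw [norm_mul, norm_mul, norm_eC, norm_eC, mul_one, mul_one, norm_real,
    norm_of_nonneg (exp_pos _).le]

lemma exists_tsum_gauss_le (d : ℕ) : ∃ C : ℝ, 0 < C ∧ ∀ ρ : ℝ, 1 ≤ ρ →
    ∑' z : Λ d, exp (-(normSqZ z : ℝ) / ρ ^ 2) ≤ C * ρ ^ d := by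
  obtain ⟨C, hC, h⟩ := exists_norm_thetaW_le
  refine ⟨C ^ d, by positivity, fun ρ hρ => ?_⟩
  have h0 : 0 < ρ := by linarith
  have h1 := (hasSum_gauss_eC (d := d) h0 0 0).tsum_eq
  simp only [Pi.zero_apply, zero_mul, mul_zero, sum_const_zero, eC_zero, mul_one] at h1
  have h2 : ∑' z : Λ d, (exp (-(normSqZ z : ℝ) / ρ ^ 2) : ℂ) =
      ∏ _i : Fin d, thetaW ρ 0 0 := by
    rw [← h1]
  rw [← ofReal_tsum] at h2
  have h3 : (0 : ℝ) ≤ ∑' z : Λ d, exp (-(normSqZ z : ℝ) / ρ ^ 2) :=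
    tsum_nonneg fun z => (exp_pos _).le
  rw [← norm_of_nonneg h3, ← norm_real, h2, prod_const, card_univ,
    card_fin, norm_pow, ← mul_pow]
  gcongr
  have := h ρ 0 0 h0 (by simp; linarith) (by simp)
  simpa using this

lemma exists_tsum_gauss_mul_le (d : ℕ) : ∃ C : ℝ, 0 < C ∧ ∀ ρ : ℝ, 1 ≤ ρ →
    (Summable fun z : Λ d => exp (-(normSqZ z : ℝ) / ρ ^ 2) * ∑ i, |(z i : ℝ)|) ∧
    ∑' z : Λ d, exp (-(normSqZ z : ℝ) / ρ ^ 2) * ∑ i, |(z i : ℝ)| ≤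
      C * ρ ^ d * ρ := by
  obtain ⟨C, hC, h⟩ := exists_tsum_gauss_le d
  refine ⟨C * (sqrt 2) ^ d * (d + 1), by positivity, fun ρ hρ => ?_⟩
  have h0 : 0 < ρ := by linarith
  set σ := sqrt 2 * ρ with hσ
  have hs2 : (1 : ℝ) ≤ sqrt 2 := Real.one_le_sqrt.2 (by norm_num)
  have hσ1 : 1 ≤ σ := by nlinarith
  have hσ2 : σ ^ 2 = 2 * ρ ^ 2 := by rw [hσ, mul_pow, sq_sqrt zero_le_two]
  have pt : ∀ z : Λ d, exp (-(normSqZ z : ℝ) / ρ ^ 2) * ∑ i, |(z i : ℝ)| ≤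
      (d + 1) * ρ * exp (-(normSqZ z : ℝ) / σ ^ 2) := by
    intro z
    have h1 : ∀ i, |(z i : ℝ)| ≤ ρ * exp ((normSqZ z : ℝ) / (2 * ρ ^ 2)) := by
      intro i
      have hz : (z i : ℝ) ^ 2 ≤ (normSqZ z : ℝ) := by
        unfold normSqZ
        push_cast
        exact single_le_sum (f := fun i => (z i : ℝ) ^ 2) (fun _ _ => sq_nonneg _)
          (mem_univ i)
      have h2 : |(z i : ℝ)| / ρ ≤ (normSqZ z : ℝ) / (2 * ρ ^ 2) + 1 := by
        have : (|(z i : ℝ)| / ρ) ^ 2 / 2 ≤ (normSqZ z : ℝ) / (2 * ρ ^ 2) := by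
          rw [div_pow, sq_abs, div_div, mul_comm (ρ ^ 2)]
          gcongr
        nlinarith [sq_nonneg (|(z i : ℝ)| / ρ - 1)]
      have h3 := h2.trans (add_one_le_exp _)
      rwa [div_le_iff₀ h0, mul_comm] at h3
    calc exp (-(normSqZ z : ℝ) / ρ ^ 2) * ∑ i, |(z i : ℝ)|
        ≤ exp (-(normSqZ z : ℝ) / ρ ^ 2) *
          (d * (ρ * exp ((normSqZ z : ℝ) / (2 * ρ ^ 2)))) := by
          gcongr
          refine (sum_le_sum fun i _ => h1 i).trans (by simp)
      _ = d * ρ * (exp (-(normSqZ z : ℝ) / ρ ^ 2) *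
          exp ((normSqZ z : ℝ) / (2 * ρ ^ 2))) := by ring
      _ = d * ρ * exp (-(normSqZ z : ℝ) / σ ^ 2) := by
          rw [← exp_add, hσ2]
          congr 2
          field_simp
          ring
      _ ≤ _ := by gcongr; linarith
  have hsum := (summable_gauss (d := d) (by linarith : 0 < σ)).mul_left (((d : ℝ) + 1) * ρ)
  have hS : Summable fun z : Λ d => exp (-(normSqZ z : ℝ) / ρ ^ 2) * ∑ i, |(z i : ℝ)| :=
    of_nonneg_of_le (fun z => by positivity) pt hsum
  refine ⟨hS, (hS.tsum_le_tsum pt hsum).trans ?_⟩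
  rw [tsum_mul_left]
  calc ((d : ℝ) + 1) * ρ * ∑' z : Λ d, exp (-(normSqZ z : ℝ) / σ ^ 2)
      ≤ ((d : ℝ) + 1) * ρ * (C * σ ^ d) := by gcongr; exact h σ hσ1
    _ = _ := by rw [hσ, mul_pow]; ring

lemma norm_eC_sub_one_le (t : ℝ) : ‖eC t - 1‖ ≤ 2 * pi * |t| := by
  have := Real.norm_exp_I_mul_ofReal_sub_one_le (x := 2 * pi * t)
  rw [eC, show 2 * (pi : ℂ) * Complex.I * t = Complex.I * ((2 * pi * t : ℝ) : ℂ) by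
    push_cast; ring]
  refine this.trans (le_of_eq ?_)
  rw [norm_eq_abs, abs_mul, abs_of_pos (by positivity)]

lemma abs_dot_le (z : Λ d) (ξ : Ξ d) :
    |∑ i, (z i : ℝ) * ξ i| ≤ (∑ i, |(z i : ℝ)|) * ‖ξ‖ := by
  refine (Finset.abs_sum_le_sum_abs _ _).trans ?_
  rw [sum_mul]
  refine sum_le_sum fun i _ => ?_
  rw [abs_mul]
  gcongr
  exact norm_le_pi_norm ξ i

lemma exists_prod_thetaW_sub_le (d : ℕ) : ∃ C : ℝ, 0 < C ∧ ∀ (ρ u : ℝ) (ξ : Ξ d), 1 ≤ ρ →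
    ‖∏ i, thetaW ρ u (ξ i) - ∏ _i : Fin d, thetaW ρ u 0‖ ≤ C * ρ ^ d * (ρ * ‖ξ‖) := by
  obtain ⟨C, hC, h⟩ := exists_tsum_gauss_mul_le d
  refine ⟨2 * pi * C, by have := pi_pos; positivity, fun ρ u ξ hρ => ?_⟩
  have h0 : 0 < ρ := by linarith
  obtain ⟨hS, hle⟩ := h ρ hρ
  have h1 := (hasSum_gauss_eC h0 u ξ).sub (hasSum_gauss_eC (d := d) h0 u 0)
  simp only [Pi.zero_apply] at h1
  rw [← h1.tsum_eq]
  have hbd : ∀ z : Λ d, ‖(exp (-(normSqZ z : ℝ) / ρ ^ 2) : ℂ) *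
      eC (u * ((normSqZ z : ℝ) / ρ ^ 2)) * eC (∑ i, (z i : ℝ) * ξ i) -
      (exp (-(normSqZ z : ℝ) / ρ ^ 2) : ℂ) *
      eC (u * ((normSqZ z : ℝ) / ρ ^ 2)) * eC (∑ i, (z i : ℝ) * 0)‖ ≤
      2 * pi * ‖ξ‖ * (exp (-(normSqZ z : ℝ) / ρ ^ 2) * ∑ i, |(z i : ℝ)|) := by
    intro z
    simp only [mul_zero, sum_const_zero, eC_zero]
    rw [← mul_sub, norm_mul, norm_mul, norm_eC, norm_real,
      norm_of_nonneg (exp_pos _).le, mul_one]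
    calc exp (-(normSqZ z : ℝ) / ρ ^ 2) * ‖eC (∑ i, (z i : ℝ) * ξ i) - 1‖
        ≤ exp (-(normSqZ z : ℝ) / ρ ^ 2) * (2 * pi * ((∑ i, |(z i : ℝ)|) * ‖ξ‖)) := by
          gcongr
          refine (norm_eC_sub_one_le _).trans ?_
          gcongr
          exact abs_dot_le z ξ
      _ = _ := by ring
  refine (tsum_of_norm_bounded (hS.mul_left (2 * pi * ‖ξ‖)).hasSum hbd).trans ?_
  rw [tsum_mul_left]
  calc 2 * pi * ‖ξ‖ * _ ≤ 2 * pi * ‖ξ‖ * (C * ρ ^ d * ρ) := by gcongr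
    _ = _ := by ring

lemma exists_prod_thetaW_le (d : ℕ) (hd : 0 < d) : ∃ C : ℝ, 0 < C ∧ ∀ (ρ u : ℝ) (ξ : Ξ d), 0 < ρ →
    1 + |u| ≤ 2 * ρ → ‖ξ‖ ≤ 1 / 2 →
    ‖∏ i, thetaW ρ u (ξ i)‖ ≤ C * ρ ^ d * (1 + |u|) ^ (-((d : ℝ) / 2)) *
      exp (-(ρ ^ 2 * ‖ξ‖ ^ 2 / (8 * (1 + |u|) ^ 2))) := by
  obtain ⟨C, hC, h⟩ := exists_norm_thetaW_le
  refine ⟨C ^ d, by positivity, fun ρ u ξ hρ hu hξ => ?_⟩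
  have : Nonempty (Fin d) := ⟨⟨0, hd⟩⟩
  obtain ⟨j, hj⟩ : ∃ j, ‖ξ‖ = |ξ j| := by
    obtain ⟨j, -, hj⟩ := Finset.exists_mem_eq_sup univ Finset.univ_nonempty
      (fun i => ‖ξ i‖₊)
    exact ⟨j, by rw [Pi.norm_def, hj]; rfl⟩
  have hU : 0 < 1 + |u| := by positivity
  have hi : ∀ i, |ξ i| ≤ 1 / 2 := fun i => (norm_le_pi_norm ξ i).trans hξ
  rw [norm_prod]
  calc ∏ i, ‖thetaW ρ u (ξ i)‖ ≤ ∏ i, (C * ρ * (1 + |u|) ^ (-(1 / 2) : ℝ) *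
        (if i = j then exp (-(ρ ^ 2 * ‖ξ‖ ^ 2 / (8 * (1 + |u|) ^ 2))) else 1)) := by
        refine prod_le_prod (fun i _ => norm_nonneg _) fun i _ => ?_
        refine (h ρ u (ξ i) hρ hu (hi i)).trans ?_
        gcongr
        split_ifs with hij
        · rw [hij, hj, sq_abs]
        · rw [exp_le_one_iff, neg_nonpos]
          positivity
    _ = _ := by
        rw [prod_mul_distrib, prod_const, card_univ, card_fin]
        simp only [Finset.prod_ite_eq', mem_univ, if_true]
        rw [mul_pow, mul_pow, ← rpow_natCast ((1 + |u|) ^ (-(1 / 2) : ℝ)), ← rpow_mul hU.le]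
        congr 3
        ring

lemma continuous_eC : Continuous eC := by
  unfold eC
  fun_prop

lemma gam_nonneg {ρ : ℝ} (hρ : 0 < ρ) (z : Λ d) : 0 ≤ gam ρ z := by
  unfold gam
  positivity

lemma summable_gam {ρ : ℝ} (hρ : 0 < ρ) : Summable (gam ρ : Λ d → ℝ) :=
  (summable_gauss hρ).mul_left _

/-- The Gaussian at scale `ρ`, localised to the shell `|z| = ρ` with frequency weight `w`. -/
def hk (ρ : ℝ) (w : ℝ → ℝ) (z : Λ d) : ℂ :=
  gam ρ z * ∫ u, (w u : ℂ) * eC (u * ((normSqZ z : ℝ) / ρ ^ 2 - 1))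

lemma norm_hk_le {ρ : ℝ} (hρ : 0 < ρ) {w : ℝ → ℝ} (z : Λ d) :
    ‖hk ρ w z‖ ≤ gam ρ z * ∫ u, |w u| := by
  rw [hk, norm_mul, norm_real, norm_of_nonneg (gam_nonneg hρ z)]
  gcongr
  · exact gam_nonneg hρ z
  · refine (norm_integral_le_integral_norm _).trans (le_of_eq ?_)
    simp [norm_eC]

lemma summable_hk {ρ : ℝ} (hρ : 0 < ρ) {w : ℝ → ℝ} :
    Summable (hk ρ w : Λ d → ℂ) :=
  of_norm_bounded ((summable_gam hρ).mul_right _) (norm_hk_le hρ)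

lemma integrable_mul_eC {w : ℝ → ℝ} (hw : Integrable w) (s : ℝ) :
    Integrable fun u => (w u : ℂ) * eC (u * s) := by
  refine hw.ofReal.mul_bdd (c := 1) ?_ ?_
  · exact (continuous_eC.comp (continuous_id.mul continuous_const)).aestronglyMeasurable
  · exact of_forall fun u => (norm_eC _).le

lemma hk_add {ρ : ℝ} {w v : ℝ → ℝ} (hw : Integrable w) (hv : Integrable v)
    (z : Λ d) : hk ρ (fun u => w u + v u) z = hk ρ w z + hk ρ v z := by
  rw [hk, hk, hk, ← mul_add, ← integral_add (integrable_mul_eC hw _) (integrable_mul_eC hv _)]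
  simp [add_mul]

lemma hk_sum {ρ : ℝ} {ι : Type*} (s : Finset ι) {w : ι → ℝ → ℝ}
    (hw : ∀ i ∈ s, Integrable (w i)) (z : Λ d) :
    hk ρ (fun u => ∑ i ∈ s, w i u) z = ∑ i ∈ s, hk ρ (w i) z := by
  simp only [hk]
  rw [← mul_sum, ← integral_finsetSum _ fun i hi => integrable_mul_eC (hw i hi) _]
  simp [sum_mul]

lemma ftZ_hasSum {ρ : ℝ} (hρ : 0 < ρ) {w : ℝ → ℝ} (hw : Integrable w)
    (ξ : Ξ d) :
    HasSum (fun z : Λ d => hk ρ w z * eC (∑ i, (z i : ℝ) * ξ i))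
      (((ρ ^ d)⁻¹ : ℝ) * ∫ u, (w u : ℂ) * eC (-u) * ∏ i, thetaW ρ u (ξ i)) := by
  set F : Λ d → ℝ → ℂ := fun z u => (w u : ℂ) * eC (-u) *
    ((exp (-(normSqZ z : ℝ) / ρ ^ 2) : ℂ) * eC (u * ((normSqZ z : ℝ) / ρ ^ 2)) *
      eC (∑ i, (z i : ℝ) * ξ i)) with hF
  have e : ∀ z u, F z u = (exp (-(normSqZ z : ℝ) / ρ ^ 2) : ℂ) * eC (∑ i, (z i : ℝ) * ξ i) *
      ((w u : ℂ) * eC (u * ((normSqZ z : ℝ) / ρ ^ 2 - 1))) := by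
    intro z u
    have : eC (u * ((normSqZ z : ℝ) / ρ ^ 2 - 1)) = eC (-u) * eC (u * ((normSqZ z : ℝ) / ρ ^ 2)) := by
      rw [← eC_add]; congr 1; ring
    simp only [hF]
    rw [this]; ring
  have hint : ∀ z, Integrable (F z) := by
    intro z
    simp_rw [funext (e z)]
    exact (integrable_mul_eC hw _).const_mul _
  have hn : ∀ z u, ‖F z u‖ = exp (-(normSqZ z : ℝ) / ρ ^ 2) * |w u| := by
    intro z u
    rw [e, norm_mul, norm_mul, norm_mul, norm_eC, norm_eC, mul_one, mul_one, norm_real,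
      norm_real, norm_of_nonneg (exp_pos _).le, norm_eq_abs]
  have h := hasSum_integral_of_summable_integral_norm (μ := volume) hint (by
    simp_rw [hn, integral_const_mul]
    exact (summable_gauss hρ).mul_right _)
  have h2 := h.mul_left ((((ρ ^ d)⁻¹ : ℝ)) : ℂ)
  have e2 : (∫ u, ∑' z, F z u) = ∫ u, (w u : ℂ) * eC (-u) * ∏ i, thetaW ρ u (ξ i) := by
    refine integral_congr_ae (of_forall fun u => ?_)
    exact ((hasSum_gauss_eC hρ u ξ).mul_left _).tsum_eq
  rw [e2] at h2
  refine h2.congr_fun fun z => ?_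
  simp_rw [e]
  rw [integral_const_mul, hk, gam]
  push_cast
  ring

lemma ftZ_hk {ρ : ℝ} (hρ : 0 < ρ) {w : ℝ → ℝ} (hw : Integrable w) (ξ : Ξ d) :
    ftZ (hk ρ w) ξ = ((ρ ^ d)⁻¹ : ℝ) * ∫ u, (w u : ℂ) * eC (-u) * ∏ i, thetaW ρ u (ξ i) :=
  (ftZ_hasSum hρ hw ξ).tsum_eq

lemma continuous_prod_thetaW {ρ : ℝ} (hρ : 0 < ρ) (ξ : Ξ d) :
    Continuous fun u => ∏ i, thetaW ρ u (ξ i) := by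
  have : (fun u => ∏ i, thetaW ρ u (ξ i)) = fun u => ∑' z : Λ d,
      ((exp (-(normSqZ z : ℝ) / ρ ^ 2) : ℂ) *
      eC (u * ((normSqZ z : ℝ) / ρ ^ 2)) * eC (∑ i, (z i : ℝ) * ξ i)) :=
    funext fun u => (hasSum_gauss_eC hρ u ξ).tsum_eq.symm
  rw [this]
  refine continuous_tsum (fun z => ?_) (summable_gauss hρ) fun z u => ?_
  · exact (continuous_const.mul (continuous_eC.comp (continuous_id.mul continuous_const))).mul
      continuous_const
  · rw [norm_mul, norm_mul, norm_eC, norm_eC, mul_one, mul_one, norm_real,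
      norm_of_nonneg (exp_pos _).le]

lemma ftZ_gam {ρ : ℝ} (hρ : 0 < ρ) (ξ : Ξ d) :
    ftZ (fun z => (gam ρ z : ℂ)) ξ = ((ρ ^ d)⁻¹ : ℝ) * ∏ i, thetaW ρ 0 (ξ i) := by
  refine HasSum.tsum_eq ?_
  refine ((hasSum_gauss_eC hρ 0 ξ).mul_left _).congr_fun fun z => ?_
  simp only [gam, zero_mul, eC_zero]
  push_cast
  ring

lemma eC_int (n : ℤ) : eC n = 1 := by
  rw [eC, show 2 * (pi : ℂ) * Complex.I * ((n : ℝ) : ℂ) = n * (2 * pi * Complex.I) by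
    push_cast; ring]
  exact Complex.exp_int_mul_two_pi_mul_I n

lemma ftZ_sub_int (f : Λ d → ℂ) (ξ : Ξ d) (n : Λ d) :
    ftZ f (fun i => ξ i - n i) = ftZ f ξ := by
  unfold ftZ
  refine tsum_congr fun z => ?_
  have : eC (∑ i, (z i : ℝ) * ξ i) = eC (∑ i, (z i : ℝ) * (ξ i - n i)) := by
    rw [← mul_one (eC (∑ i, (z i : ℝ) * (ξ i - n i))), ← eC_int (∑ i, z i * n i), ← eC_add]
    congr 1
    push_cast
    rw [← sum_add_distrib]
    exact sum_congr rfl fun i _ => by ring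
  rw [this]

lemma exists_reduce (ξ : Ξ d) :
    ∃ n : Λ d, ‖fun i => ξ i - n i‖ ≤ 1 / 2 :=
  ⟨fun i => round (ξ i), (pi_norm_le_iff_of_nonneg (by norm_num)).2 fun i => abs_sub_round (ξ i)⟩

/-- `w` is a frequency weight bounded by one and living at `1 + |u| ∼ b`, below the scale `ρ`. -/
structure IsPiece (ρ b : ℝ) (w : ℝ → ℝ) : Prop where
  meas : Measurable w
  bdd : ∀ u, |w u| ≤ 1
  supp : ∀ u, w u ≠ 0 → b ≤ 2 * (1 + |u|) ∧ 1 + |u| ≤ 2 * b ∧ 1 + |u| ≤ 2 * ρ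

lemma IsPiece.le_indicator {ρ b : ℝ} {w : ℝ → ℝ} (h : IsPiece ρ b w) (u : ℝ) :
    |w u| ≤ (Set.Icc (-(2 * b)) (2 * b)).indicator (fun _ => (1 : ℝ)) u := by
  by_cases hu : w u = 0
  · rw [hu, abs_zero]
    exact Set.indicator_nonneg (fun _ _ => zero_le_one) _
  · have h1 := (h.supp u hu).2.1
    rw [Set.indicator_of_mem]
    · exact h.bdd u
    · rw [Set.mem_Icc]
      exact abs_le.1 (by linarith)

lemma integrable_indicator_Icc (a b : ℝ) :
    Integrable ((Set.Icc a b).indicator fun _ => (1 : ℝ)) :=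
  (integrable_indicator_iff measurableSet_Icc).2 (by simp)

lemma IsPiece.integrable {ρ b : ℝ} {w : ℝ → ℝ} (h : IsPiece ρ b w) : Integrable w :=
  (integrable_indicator_Icc (-(2 * b)) (2 * b)).mono' h.meas.aestronglyMeasurable
    (of_forall h.le_indicator)

lemma IsPiece.integral_le {ρ b : ℝ} (hb : 0 ≤ b) {w : ℝ → ℝ} (h : IsPiece ρ b w) :
    ∫ u, |w u| ≤ 4 * b := by
  refine (integral_mono h.integrable.abs (integrable_indicator_Icc _ _) h.le_indicator).trans ?_
  rw [integral_indicator measurableSet_Icc, setIntegral_const, smul_eq_mul, mul_one,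
    Real.volume_real_Icc_of_le (by linarith)]
  linarith

lemma IsPiece.norm_integral_le {ρ b M : ℝ} (hb : 0 ≤ b) (hM : 0 ≤ M) {w : ℝ → ℝ}
    (h : IsPiece ρ b w) {G : ℝ → ℂ} (hG : ∀ u, w u ≠ 0 → ‖G u‖ ≤ M) :
    ‖∫ u, (w u : ℂ) * eC (-u) * G u‖ ≤ 4 * b * M := by
  refine (norm_integral_le_of_norm_le (h.integrable.abs.mul_const M)
    (of_forall fun u => ?_)).trans ?_
  · rw [norm_mul, norm_mul, norm_eC, mul_one, norm_real, norm_eq_abs]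
    by_cases hu : w u = 0
    · simp [hu]
    · gcongr
      exact hG u hu
  · rw [integral_mul_const]
    gcongr
    exact h.integral_le hb

lemma exists_ftZ_hk_le (d : ℕ) (hd : 2 ≤ d) : ∃ C : ℝ, 0 < C ∧ ∀ (ρ b : ℝ) (w : ℝ → ℝ), 1 ≤ ρ → 1 ≤ b →
    IsPiece ρ b w → ∀ ξ : Ξ d, ‖ξ‖ ≤ 1 / 2 →
    ‖ftZ (hk ρ w) ξ‖ ≤ C * b ^ (1 - (d : ℝ) / 2) ∧
    ‖ftZ (hk ρ w) ξ - ftZ (hk ρ w) (0 : Ξ d)‖ ≤ C * b * (ρ * ‖ξ‖) ∧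
    ‖ftZ (hk ρ w) ξ‖ * (ρ * ‖ξ‖) ≤ C * b := by
  obtain ⟨C, hC, h⟩ := exists_prod_thetaW_le d (by omega)
  obtain ⟨C', hC', h'⟩ := exists_prod_thetaW_sub_le d
  set D : ℝ := 4 * C * 2 ^ ((d : ℝ) / 2) with hD
  have hd2 : (1 : ℝ) ≤ (d : ℝ) / 2 := by
    have : (2 : ℝ) ≤ d := mod_cast hd
    linarith
  have hDp : 0 < D := by positivity
  refine ⟨D + 4 * C' + 8 * C, by positivity, fun ρ b w hρ hb hw ξ hξ => ?_⟩
  have h0 : 0 < ρ := by linarith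
  have hb0 : 0 < b := by linarith
  have hρd : 0 < (ρ ^ d)⁻¹ := by positivity
  have hexp : ∀ u, exp (-(ρ ^ 2 * ‖ξ‖ ^ 2 / (8 * (1 + |u|) ^ 2))) ≤ 1 := fun u =>
    exp_le_one_iff.2 (neg_nonpos.2 (by positivity))
  refine ⟨?_, ?_, ?_⟩
  · rw [ftZ_hk h0 hw.integrable, norm_mul, norm_real, norm_of_nonneg hρd.le]
    have : ‖∫ u, (w u : ℂ) * eC (-u) * ∏ i, thetaW ρ u (ξ i)‖ ≤
        4 * b * (C * ρ ^ d * (2 ^ ((d : ℝ) / 2) * b ^ (-((d : ℝ) / 2)))) := by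
      refine hw.norm_integral_le hb0.le (by positivity) fun u hu => ?_
      obtain ⟨h1, h2, h3⟩ := hw.supp u hu
      refine (h ρ u ξ h0 h3 hξ).trans ?_
      calc C * ρ ^ d * (1 + |u|) ^ (-((d : ℝ) / 2)) * _
          ≤ C * ρ ^ d * (1 + |u|) ^ (-((d : ℝ) / 2)) * 1 := by gcongr; exact hexp u
        _ ≤ _ := by
          rw [mul_one]
          gcongr
          have : (b / 2) ^ (-((d : ℝ) / 2)) = 2 ^ ((d : ℝ) / 2) * b ^ (-((d : ℝ) / 2)) := by
            rw [div_rpow hb0.le zero_le_two, rpow_neg zero_le_two, div_inv_eq_mul, mul_comm]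
          rw [← this]
          exact rpow_le_rpow_of_nonpos (by positivity) (by linarith) (by linarith)
    refine (mul_le_mul_of_nonneg_left this hρd.le).trans ?_
    calc (ρ ^ d)⁻¹ * (4 * b * (C * ρ ^ d * (2 ^ ((d : ℝ) / 2) * b ^ (-((d : ℝ) / 2)))))
        = D * b ^ (1 - (d : ℝ) / 2) := by
          rw [sub_eq_add_neg, rpow_add hb0, rpow_one, hD]
          field_simp
      _ ≤ _ := by gcongr; nlinarith
  · rw [ftZ_hk h0 hw.integrable, ftZ_hk h0 hw.integrable, ← mul_sub, norm_mul, norm_real,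
      norm_of_nonneg hρd.le]
    have hi : ∀ η : Ξ d, Integrable fun u => (w u : ℂ) * eC (-u) * ∏ i, thetaW ρ u (η i) := by
      intro η
      refine Integrable.mul_bdd (c := ∑' z : Λ d, exp (-(normSqZ z : ℝ) / ρ ^ 2)) (by
        simpa using integrable_mul_eC hw.integrable (-1))
        (continuous_prod_thetaW h0 η).aestronglyMeasurable ?_
      refine of_forall fun u => ?_
      rw [← (hasSum_gauss_eC h0 u η).tsum_eq]
      refine tsum_of_norm_bounded (summable_gauss h0).hasSum fun z => ?_
      rw [norm_mul, norm_mul, norm_eC, norm_eC, mul_one, mul_one, norm_real,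
        norm_of_nonneg (exp_pos _).le]
    rw [← integral_sub (hi ξ) (hi 0)]
    simp_rw [← mul_sub]
    have := hw.norm_integral_le hb0.le (M := C' * ρ ^ d * (ρ * ‖ξ‖)) (by positivity)
      (G := fun u => ∏ i, thetaW ρ u (ξ i) - ∏ i, thetaW ρ u ((0 : Ξ d) i))
      fun u _ => h' ρ u ξ hρ
    refine (mul_le_mul_of_nonneg_left this hρd.le).trans ?_
    calc (ρ ^ d)⁻¹ * (4 * b * (C' * ρ ^ d * (ρ * ‖ξ‖)))
        = 4 * C' * b * (ρ * ‖ξ‖) := by field_simp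
      _ ≤ _ := by gcongr; linarith
  · rw [ftZ_hk h0 hw.integrable, norm_mul, norm_real, norm_of_nonneg hρd.le]
    rcases eq_or_lt_of_le (norm_nonneg ξ) with hz | hz
    · rw [← hz]; simp; positivity
    have hx : 0 < ρ * ‖ξ‖ := by positivity
    have : ‖∫ u, (w u : ℂ) * eC (-u) * ∏ i, thetaW ρ u (ξ i)‖ ≤
        4 * b * (C * ρ ^ d * (2 / (ρ * ‖ξ‖))) := by
      refine hw.norm_integral_le hb0.le (by positivity) fun u hu => ?_
      obtain ⟨h1, h2, h3⟩ := hw.supp u hu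
      refine (h ρ u ξ h0 h3 hξ).trans ?_
      have hU1 : 1 ≤ 1 + |u| := by linarith [abs_nonneg u]
      rw [mul_assoc (C * ρ ^ d)]
      gcongr
      rw [le_div_iff₀ hx]
      set y := ρ * ‖ξ‖ / (1 + |u|) with hy
      have e1 : exp (-(ρ ^ 2 * ‖ξ‖ ^ 2 / (8 * (1 + |u|) ^ 2))) * y ≤ 2 := by
        have : ρ ^ 2 * ‖ξ‖ ^ 2 / (8 * (1 + |u|) ^ 2) = y ^ 2 / 8 := by rw [hy]; field_simp
        rw [this, exp_neg, inv_mul_le_iff₀ (exp_pos _)]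
        nlinarith [add_one_le_exp (y ^ 2 / 8), sq_nonneg (y - 2)]
      have e2 : (1 + |u|) ^ (-((d : ℝ) / 2)) ≤ (1 + |u|)⁻¹ := by
        rw [← Real.rpow_neg_one]
        exact rpow_le_rpow_of_exponent_le hU1 (by linarith)
      calc (1 + |u|) ^ (-((d : ℝ) / 2)) *
            exp (-(ρ ^ 2 * ‖ξ‖ ^ 2 / (8 * (1 + |u|) ^ 2))) * (ρ * ‖ξ‖)
          ≤ (1 + |u|)⁻¹ *
            exp (-(ρ ^ 2 * ‖ξ‖ ^ 2 / (8 * (1 + |u|) ^ 2))) * (ρ * ‖ξ‖) := by gcongr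
        _ = exp (-(ρ ^ 2 * ‖ξ‖ ^ 2 / (8 * (1 + |u|) ^ 2))) * y := by
            rw [hy]; field_simp
        _ ≤ 2 := e1
    refine (mul_le_mul_of_nonneg_right (mul_le_mul_of_nonneg_left this hρd.le) hx.le).trans ?_
    calc (ρ ^ d)⁻¹ * (4 * b * (C * ρ ^ d * (2 / (ρ * ‖ξ‖)))) * (ρ * ‖ξ‖)
        = 8 * C * b := by field_simp; norm_num
      _ ≤ _ := by gcongr; linarith

lemma le_norm_thetaW_zero {ρ : ℝ} (hρ : 0 < ρ) : exp (-1) * ρ ≤ ‖thetaW ρ 0 0‖ := by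
  have hs := (summable_thetaW hρ 0 0)
  have e : (fun m : ℤ => (exp (-(m : ℝ) ^ 2 / ρ ^ 2) : ℂ) *
      eC (0 * (m : ℝ) ^ 2 / ρ ^ 2 + m * 0)) =
      fun m : ℤ => ((exp (-(m : ℝ) ^ 2 / ρ ^ 2) : ℝ) : ℂ) := by
    funext m
    rw [zero_mul, zero_div, mul_zero, add_zero, eC_zero, mul_one]
  rw [thetaW, e, ← ofReal_tsum, norm_real]
  rw [e] at hs
  have hs' : Summable fun m : ℤ => exp (-(m : ℝ) ^ 2 / ρ ^ 2) := summable_ofReal.1 hs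
  refine le_trans ?_ (le_abs_self _)
  set s : Finset ℤ := (range ⌈ρ⌉₊).image fun n : ℕ => (n : ℤ) with hsd
  have hcard : s.card = ⌈ρ⌉₊ := by
    rw [hsd, Finset.card_image_of_injective _ Nat.cast_injective, Finset.card_range]
  calc exp (-1) * ρ ≤ s.card • exp (-1) := by
        rw [hcard, nsmul_eq_mul, mul_comm]
        gcongr
        exact Nat.le_ceil ρ
    _ ≤ ∑ m ∈ s, exp (-(m : ℝ) ^ 2 / ρ ^ 2) := by
        refine card_nsmul_le_sum _ _ _ fun m hm => ?_
        obtain ⟨n, hn, rfl⟩ := mem_image.1 hm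
        have h1 : (n : ℝ) < ρ := Nat.lt_ceil.1 (mem_range.1 hn)
        refine exp_le_exp.2 ?_
        rw [neg_div, neg_le_neg_iff, div_le_one (by positivity)]
        push_cast
        gcongr
    _ ≤ _ := hs'.sum_le_tsum _ fun m _ => (exp_pos _).le

lemma exists_ftZ_gam_le (d : ℕ) (hd : 2 ≤ d) : ∃ C c : ℝ, 0 < C ∧ 0 < c ∧ ∀ ρ : ℝ, 1 ≤ ρ →
    ∀ ξ : Ξ d, ‖ξ‖ ≤ 1 / 2 →
    ‖ftZ (fun z => (gam ρ z : ℂ)) ξ‖ ≤ C ∧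
    ‖ftZ (fun z => (gam ρ z : ℂ)) ξ - ftZ (fun z => (gam ρ z : ℂ)) (0 : Ξ d)‖ ≤
      C * (ρ * ‖ξ‖) ∧
    ‖ftZ (fun z => (gam ρ z : ℂ)) ξ‖ * (ρ * ‖ξ‖) ≤ C ∧
    c ≤ ‖ftZ (fun z => (gam ρ z : ℂ)) (0 : Ξ d)‖ := by
  obtain ⟨C, hC, h⟩ := exists_prod_thetaW_le d (by omega)
  obtain ⟨C', hC', h'⟩ := exists_prod_thetaW_sub_le d
  refine ⟨3 * C + C', exp (-1) ^ d, by positivity, by positivity, fun ρ hρ ξ hξ => ?_⟩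
  have h0 : 0 < ρ := by linarith
  have hρd : 0 < (ρ ^ d)⁻¹ := by positivity
  have hb := h ρ 0 ξ h0 (by simp; linarith) hξ
  simp only [abs_zero, add_zero, one_rpow, mul_one, one_pow] at hb
  simp only [ftZ_gam h0]
  rw [← mul_sub]
  simp only [norm_mul, norm_real, norm_of_nonneg hρd.le]
  set y := ρ * ‖ξ‖ with hy
  rw [show ρ ^ 2 * ‖ξ‖ ^ 2 / 8 = y ^ 2 / 8 by rw [hy]; ring] at hb
  have hb2 : (ρ ^ d)⁻¹ * ‖∏ i, thetaW ρ 0 (ξ i)‖ ≤ C * exp (-(y ^ 2 / 8)) := by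
    refine (mul_le_mul_of_nonneg_left hb hρd.le).trans (le_of_eq ?_)
    field_simp
  refine ⟨?_, ?_, ?_, ?_⟩
  · have : exp (-(y ^ 2 / 8)) ≤ 1 := exp_le_one_iff.2 (neg_nonpos.2 (by positivity))
    nlinarith
  · refine (mul_le_mul_of_nonneg_left (h' ρ 0 ξ hρ) hρd.le).trans ?_
    rw [show (ρ ^ d)⁻¹ * (C' * ρ ^ d * (ρ * ‖ξ‖)) = C' * y by rw [hy]; field_simp]
    gcongr
    linarith
  · have e1 : exp (-(y ^ 2 / 8)) * y ≤ 2 := by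
      rw [exp_neg, inv_mul_le_iff₀ (exp_pos _)]
      nlinarith [add_one_le_exp (y ^ 2 / 8), sq_nonneg (y - 2)]
    calc (ρ ^ d)⁻¹ * ‖∏ i, thetaW ρ 0 (ξ i)‖ * y ≤ C * exp (-(y ^ 2 / 8)) * y := by gcongr
      _ = C * (exp (-(y ^ 2 / 8)) * y) := by ring
      _ ≤ C * 2 := by gcongr
      _ ≤ _ := by linarith
  · rw [inv_mul_eq_div, le_div_iff₀ (by positivity), ← mul_pow, norm_prod]
    simp only [Pi.zero_apply, prod_const, card_univ, card_fin]
    gcongr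
    exact le_norm_thetaW_zero h0

/-- The kernel `hk ρ w`, made to have integral zero by subtracting a multiple of the Gaussian. -/
def hkMod (ρ : ℝ) (w : ℝ → ℝ) (z : Λ d) : ℂ :=
  hk ρ w z - ftZ (hk ρ w) (0 : Ξ d) / ftZ (fun z => (gam ρ z : ℂ)) (0 : Ξ d) * gam ρ z

lemma summable_gamC {ρ : ℝ} (hρ : 0 < ρ) :
    Summable fun z : Λ d => (gam ρ z : ℂ) := summable_ofReal.2 (summable_gam hρ)

lemma summable_mul_eC {k : Λ d → ℂ} (hk : Summable k) (ξ : Ξ d) :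
    Summable fun z => k z * eC (∑ i, (z i : ℝ) * ξ i) :=
  of_norm_bounded hk.norm fun z => by rw [norm_mul, norm_eC, mul_one]

lemma ftZ_sub {k l : Λ d → ℂ} (hk : Summable k) (hl : Summable l)
    (ξ : Ξ d) : ftZ (fun z => k z - l z) ξ = ftZ k ξ - ftZ l ξ := by
  simp only [ftZ, sub_mul]
  exact (summable_mul_eC hk ξ).tsum_sub (summable_mul_eC hl ξ)

lemma ftZ_const_mul (c : ℂ) (k : Λ d → ℂ) (ξ : Ξ d) :
    ftZ (fun z => c * k z) ξ = c * ftZ k ξ := by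
  simp only [ftZ, mul_assoc, tsum_mul_left]

lemma summable_hkMod {ρ : ℝ} (hρ : 0 < ρ) {w : ℝ → ℝ} :
    Summable (hkMod ρ w : Λ d → ℂ) :=
  (summable_hk hρ).sub ((summable_gamC hρ).mul_left _)

lemma ftZ_hkMod {ρ : ℝ} (hρ : 0 < ρ) {w : ℝ → ℝ} (ξ : Ξ d) :
    ftZ (hkMod ρ w) ξ = ftZ (hk ρ w) ξ - ftZ (hk ρ w) (0 : Ξ d) /
      ftZ (fun z => (gam ρ z : ℂ)) (0 : Ξ d) * ftZ (fun z => (gam ρ z : ℂ)) ξ := by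
  unfold hkMod
  rw [ftZ_sub (summable_hk hρ) ((summable_gamC hρ).mul_left _), ftZ_const_mul]

lemma exists_ftZ_hkMod_le (d : ℕ) (hd : 2 ≤ d) : ∃ C : ℝ, 0 < C ∧ ∀ (ρ b : ℝ) (w : ℝ → ℝ), 1 ≤ ρ →
    1 ≤ b → IsPiece ρ b w →
    ‖ftZ (hk ρ w) (0 : Ξ d) / ftZ (fun z => (gam ρ z : ℂ)) (0 : Ξ d)‖ ≤
      C * b ^ (1 - (d : ℝ) / 2) ∧
    ∀ ξ : Ξ d, ‖ξ‖ ≤ 1 / 2 →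
    ‖ftZ (hkMod ρ w) ξ‖ ≤ C * b ^ (1 - (d : ℝ) / 2) ∧
    ‖ftZ (hkMod ρ w) ξ‖ ≤ C * b * (ρ * ‖ξ‖) ∧
    ‖ftZ (hkMod ρ w) ξ‖ * (ρ * ‖ξ‖) ≤ C * b := by
  obtain ⟨C, hC, h⟩ := exists_ftZ_hk_le d hd
  obtain ⟨D, c, hD, hc, h'⟩ := exists_ftZ_gam_le d hd
  refine ⟨C + C / c + C / c * D, by positivity, fun ρ b w hρ hb hw => ?_⟩
  have h0 : 0 < ρ := by linarith
  set B := b ^ (1 - (d : ℝ) / 2) with hB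
  have hBp : 0 < B := by positivity
  have hBb : B ≤ b := by
    conv_rhs => rw [← rpow_one b]
    refine rpow_le_rpow_of_exponent_le hb ?_
    have : (0 : ℝ) ≤ d := cast_nonneg d
    linarith
  have h00 : ‖(0 : Ξ d)‖ ≤ 1 / 2 := by simp
  have hcc : ‖ftZ (hk ρ w) (0 : Ξ d) / ftZ (fun z => (gam ρ z : ℂ)) (0 : Ξ d)‖ ≤
      C / c * B := by
    rw [norm_div, div_mul_eq_mul_div]
    exact div_le_div₀ (by positivity) (h ρ b w hρ hb hw 0 h00).1 hc (h' ρ hρ 0 h00).2.2.2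
  set q := ftZ (hk ρ w) (0 : Ξ d) / ftZ (fun z => (gam ρ z : ℂ)) (0 : Ξ d) with hq
  have hcc' : ‖q‖ ≤ C / c * b := hcc.trans (by gcongr)
  have hc' : 0 < C / c := by positivity
  have hg0 : ftZ (fun z => (gam ρ z : ℂ)) (0 : Ξ d) ≠ 0 := by
    rw [← norm_pos_iff]
    exact hc.trans_le (h' ρ hρ 0 h00).2.2.2
  refine ⟨hcc.trans (by gcongr; nlinarith), fun ξ hξ => ?_⟩
  obtain ⟨a1, a2, a3⟩ := h ρ b w hρ hb hw ξ hξ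
  obtain ⟨g1, g2, g3, -⟩ := h' ρ hρ ξ hξ
  have hf := ftZ_hkMod h0 (w := w) ξ
  rw [← hq] at hf
  have hn : ‖ftZ (hkMod ρ w) ξ‖ ≤ ‖ftZ (hk ρ w) ξ‖ + ‖q‖ * ‖ftZ (fun z => (gam ρ z : ℂ)) ξ‖ := by
    rw [hf, ← norm_mul]
    exact norm_sub_le _ _
  refine ⟨?_, ?_, ?_⟩
  · calc _ ≤ _ := hn
      _ ≤ C * B + C / c * B * D := by gcongr
      _ ≤ _ := by nlinarith [mul_pos hc' hBp]
  · have hf2 : ftZ (hkMod ρ w) ξ = (ftZ (hk ρ w) ξ - ftZ (hk ρ w) (0 : Ξ d)) -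
        q * (ftZ (fun z => (gam ρ z : ℂ)) ξ - ftZ (fun z => (gam ρ z : ℂ)) (0 : Ξ d)) := by
      rw [hf, mul_sub, hq, div_mul_cancel₀ _ hg0]
      ring
    rw [hf2]
    calc _ ≤ _ := norm_sub_le _ _
      _ ≤ C * b * (ρ * ‖ξ‖) + C / c * b * (D * (ρ * ‖ξ‖)) := by
        rw [norm_mul]
        gcongr
      _ = (C + 0 + C / c * D) * b * (ρ * ‖ξ‖) := by ring
      _ ≤ _ := by gcongr
  · calc _ ≤ (‖ftZ (hk ρ w) ξ‖ + ‖q‖ * ‖ftZ (fun z => (gam ρ z : ℂ)) ξ‖) * (ρ * ‖ξ‖) := by gcongr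
      _ = ‖ftZ (hk ρ w) ξ‖ * (ρ * ‖ξ‖) + ‖q‖ * (‖ftZ (fun z => (gam ρ z : ℂ)) ξ‖ * (ρ * ‖ξ‖)) := by
        ring
      _ ≤ C * b + C / c * b * D := by gcongr
      _ = (C + 0 + C / c * D) * b := by ring
      _ ≤ _ := by gcongr

/-- Lacunary sums of `min x x⁻¹` are bounded. -/
lemma exists_lacunary_sum_le {c a : ℝ} (hc : 1 < c) (ha : 0 < a) : ∃ C : ℝ, 0 < C ∧
    ∀ {ι : Type} (I : Finset ι) (ρ : ι → ℝ) (e : ι → ℤ), Set.InjOn e I →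
    (∀ i ∈ I, c ^ (e i : ℝ) ≤ ρ i ∧ ρ i ≤ c ^ ((e i : ℝ) + 1)) → ∀ t : ℝ, 0 < t →
    ∑ i ∈ I, (min (ρ i * t) (ρ i * t)⁻¹) ^ a ≤ C := by
  have hc0 : 0 < c := by linarith
  have hq : c ^ (-a) < 1 := Real.rpow_lt_one_of_one_lt_of_neg hc (by linarith)
  have hq0 : 0 < c ^ (-a) := by positivity
  have hS : Summable fun m : ℤ => (c ^ (-a)) ^ m.natAbs := by
    refine Summable.of_nat_of_neg ?_ ?_
    · simpa using summable_geometric_of_lt_one hq0.le hq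
    · simpa using summable_geometric_of_lt_one hq0.le hq
  refine ⟨c ^ (2 * a) * ∑' m : ℤ, (c ^ (-a)) ^ m.natAbs + 1, ?_, ?_⟩
  · positivity
  intro ι I ρ e he hρ t ht
  set s := logb c t with hs
  have hts : t = c ^ s := (Real.rpow_logb hc0 hc.ne' ht).symm
  set n := ⌊s⌋ with hn
  have h1 : (n : ℝ) ≤ s := Int.floor_le s
  have h2 : s < n + 1 := Int.lt_floor_add_one s
  have key : ∀ i ∈ I, (min (ρ i * t) (ρ i * t)⁻¹) ^ a ≤
      c ^ (2 * a) * (c ^ (-a)) ^ (e i + n).natAbs := by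
    intro i hi
    obtain ⟨r1, r2⟩ := hρ i hi
    have hp : 0 < ρ i := (rpow_pos_of_pos hc0 _).trans_le r1
    have u1 : c ^ ((e i : ℝ) + s) ≤ ρ i * t := by
      rw [hts, rpow_add hc0]; gcongr
    have u2 : ρ i * t ≤ c ^ ((e i : ℝ) + 1 + s) := by
      rw [hts, rpow_add hc0 (_ + 1)]; gcongr
    have hm : min (ρ i * t) (ρ i * t)⁻¹ ≤ c ^ (2 - ((e i + n).natAbs : ℝ)) := by
      rw [Nat.cast_natAbs]
      rcases le_total 0 (e i + n) with hh | hh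
      · refine (min_le_right _ _).trans ((inv_anti₀ (by positivity) u1).trans ?_)
        rw [← rpow_neg hc0.le]
        refine rpow_le_rpow_of_exponent_le hc.le ?_
        rw [abs_of_nonneg hh]
        push_cast
        linarith
      · refine (min_le_left _ _).trans (u2.trans ?_)
        refine rpow_le_rpow_of_exponent_le hc.le ?_
        rw [abs_of_nonpos hh]
        push_cast
        linarith
    calc _ ≤ (c ^ (2 - ((e i + n).natAbs : ℝ))) ^ a := by
          gcongr
      _ = _ := by
          rw [← rpow_mul hc0.le, ← rpow_natCast, ← rpow_mul hc0.le,
            ← rpow_add hc0]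
          congr 1
          ring
  calc _ ≤ ∑ i ∈ I, c ^ (2 * a) * (c ^ (-a)) ^ (e i + n).natAbs := sum_le_sum key
    _ = c ^ (2 * a) * ∑ m ∈ I.image fun i => e i + n, (c ^ (-a)) ^ m.natAbs := by
        rw [← mul_sum, sum_image]
        intro i hi j hj hij
        exact he hi hj (by simpa using hij)
    _ ≤ c ^ (2 * a) * ∑' m : ℤ, (c ^ (-a)) ^ m.natAbs := by
        gcongr
        exact hS.sum_le_tsum _ fun m _ => by positivity
    _ ≤ _ := by linarith

/-- The maximal function of a finite family of convolution operators. -/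
def maxConv {ι : Type} (I : Finset ι) (k : ι → Λ d → ℂ) (f : Λ d → ℂ)
    (x : Λ d) : ℝ≥0 := I.sup fun i => ‖conv (k i) f x‖₊

lemma conv_eq_sum (k : Λ d → ℂ) {f : Λ d → ℂ} {s : Finset Λ d}
    (hs : f.support ⊆ s) (x : Λ d) : conv k f x = ∑ y ∈ s, f y * k (x - y) :=
  tsum_eq_sum fun y hy => by
    rw [Function.notMem_support.1 fun h => hy (hs h), zero_mul]

lemma summable_of_finite_support' {f : Λ d → ℂ} (hf : f.support.Finite) :
    Summable f := summable_of_hasFiniteSupport hf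

lemma summable_conv_term (k : Λ d → ℂ) {f : Λ d → ℂ}
    (hf : f.support.Finite) (x : Λ d) : Summable fun y => f y * k (x - y) :=
  summable_of_hasFiniteSupport (hf.subset fun y hy => by
    rw [mem_support] at hy ⊢
    exact left_ne_zero_of_mul hy)

lemma conv_add (k : Λ d → ℂ) {f g : Λ d → ℂ}
    (hf : f.support.Finite) (hg : g.support.Finite) (x : Λ d) :
    conv k (f + g) x = conv k f x + conv k g x := by
  unfold conv
  rw [← (summable_conv_term k hf x).tsum_add (summable_conv_term k hg x)]
  simp [add_mul]

lemma conv_add_left (k l : Λ d → ℂ) {f : Λ d → ℂ}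
    (hf : f.support.Finite) (x : Λ d) :
    conv (fun z => k z + l z) f x = conv k f x + conv l f x := by
  unfold conv
  rw [← (summable_conv_term k hf x).tsum_add (summable_conv_term l hf x)]
  simp [mul_add]

lemma conv_sum_left {ι : Type*} (s : Finset ι) (k : ι → Λ d → ℂ)
    {f : Λ d → ℂ} (hf : f.support.Finite) (x : Λ d) :
    conv (fun z => ∑ i ∈ s, k i z) f x = ∑ i ∈ s, conv (k i) f x := by
  unfold conv
  rw [← tsum_finsetSum fun i _ => summable_conv_term (k i) hf x]
  simp [mul_sum]

lemma conv_const_mul_left (c : ℂ) (k f : Λ d → ℂ) (x : Λ d) :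
    conv (fun z => c * k z) f x = c * conv k f x := by
  unfold conv
  rw [← tsum_mul_left]
  exact tsum_congr fun y => by ring

lemma maxConv_add_le {ι : Type} (I : Finset ι) (k : ι → Λ d → ℂ)
    (f g : Λ d → ℂ) (hf : f.support.Finite) (hg : g.support.Finite) (x : Λ d) :
    maxConv I k (f + g) x ≤ maxConv I k f x + maxConv I k g x := by
  refine Finset.sup_le fun i hi => ?_
  rw [conv_add _ hf hg]
  exact (nnnorm_add_le _ _).trans (add_le_add (le_sup (f := fun i => ‖conv (k i) f x‖₊) hi)
    (le_sup (f := fun i => ‖conv (k i) g x‖₊) hi))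

lemma enorm_conv_le (k f : Λ d → ℂ) (x : Λ d) :
    ‖conv k f x‖ₑ ≤ ∑' y, ‖f y‖ₑ * ‖k (x - y)‖ₑ := by
  refine (enorm_tsum_le_tsum_enorm ..).trans (le_of_eq (tsum_congr fun y => ?_))
  rw [enorm_mul]

lemma exists_enorm_conv_gam_le (d : ℕ) : ∃ C : ℝ, 0 < C ∧ ∀ (ρ A : ℝ) (k : Λ d → ℂ), 1 ≤ ρ →
    0 ≤ A → (∀ z, ‖k z‖ ≤ A * gam ρ z) → ∀ (f : Λ d → ℂ) (x : Λ d),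
    ‖conv k f x‖ₑ ≤ ofReal (C * A) * hlM (fun y => ‖f y‖ₑ) x := by
  obtain ⟨C, hC, h⟩ := gam_conv_le_hlM (d := d)
  refine ⟨C, hC, fun ρ A k hρ hA hk f x => ?_⟩
  calc ‖conv k f x‖ₑ ≤ _ := enorm_conv_le _ _ _
    _ ≤ ∑' y, ofReal A * (‖f y‖ₑ * ofReal (gam ρ (x - y))) := by
        refine tsum_le_tsum fun y => ?_
        rw [mul_left_comm, ← ofReal_mul hA, ← ofReal_norm (k (x - y))]
        gcongr
        exact hk _
    _ = ofReal A * ∑' y, ‖f y‖ₑ * ofReal (gam ρ (x - y)) := ENNReal.tsum_mul_left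
    _ ≤ ofReal A * (ofReal C * hlM (fun y => ‖f y‖ₑ) x) := by
        gcongr
        exact h ρ hρ _ x
    _ = _ := by rw [← mul_assoc, ← ofReal_mul hA, mul_comm A]

lemma nP_hlM_le (hd : 0 < d) {p : ℝ} (hp : 1 < p) : ∃ C : ℝ, 0 < C ∧
    ∀ f : Λ d → ℂ, f.support.Finite →
      nP p (hlM fun y => ‖f y‖ₑ) ≤ ofReal C * nP p fun x => ‖f x‖ₑ := by
  obtain ⟨C, hC, h⟩ := hlM_strong hd hp
  have hp0 : 0 < p := by linarith
  refine ⟨C ^ (1 / p), by positivity, fun f hf => ?_⟩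
  rw [nP_le_iff hp0 (by positivity), ← rpow_mul hC.le, one_div_mul_cancel hp0.ne',
    rpow_one]
  exact h f hf

lemma coe_maxConv_le {ι : Type} {I : Finset ι} {k : ι → Λ d → ℂ}
    {f : Λ d → ℂ} {x : Λ d} {B : ℝ≥0∞} (h : ∀ i ∈ I, ‖conv (k i) f x‖ₑ ≤ B) :
    (maxConv I k f x : ℝ≥0∞) ≤ B := by
  rw [maxConv, coe_finset_sup]
  exact Finset.sup_le h

lemma exists_maxConv_piece_le (d : ℕ) (hd : 0 < d) {p : ℝ} (hp : 1 < p) : ∃ C : ℝ, 0 < C ∧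
    ∀ {ι : Type} (I : Finset ι) (ρ : ι → ℝ) (b : ℝ) (w : ι → ℝ → ℝ), 1 ≤ b →
    (∀ i ∈ I, 1 ≤ ρ i ∧ IsPiece (ρ i) b (w i)) → ∀ f : Λ d → ℂ, f.support.Finite →
    nP p (fun x => (maxConv I (fun i => hk (ρ i) (w i)) f x : ℝ≥0∞)) ≤
      ofReal (C * b) * nP p fun x => ‖f x‖ₑ := by
  obtain ⟨C, hC, h⟩ := exists_enorm_conv_gam_le d
  obtain ⟨D, hD, h'⟩ := nP_hlM_le hd hp
  refine ⟨C * 4 * D, by positivity, fun {ι} I ρ b w hb hw f hf => ?_⟩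
  have hp0 : 0 < p := by linarith
  have hb0 : 0 ≤ b := by linarith
  calc _ ≤ nP p (fun x => ofReal (C * (4 * b)) * hlM (fun y => ‖f y‖ₑ) x) := by
        refine nP_mono hp0.le fun x => coe_maxConv_le fun i hi => ?_
        obtain ⟨h1, h2⟩ := hw i hi
        refine h (ρ i) (4 * b) _ h1 (by positivity) (fun z => ?_) f x
        refine (norm_hk_le (by linarith) z).trans ?_
        rw [mul_comm]
        gcongr
        · exact gam_nonneg (by linarith) z
        · exact h2.integral_le hb0
    _ ≤ ofReal (C * (4 * b)) * (ofReal D * nP p fun x => ‖f x‖ₑ) := by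
        rw [nP_const_mul hp0]
        gcongr
        exact h' f hf
    _ = _ := by
        rw [← mul_assoc, ← ofReal_mul (by positivity)]
        congr 2
        ring

lemma norm_le_interp {m x B b ε : ℝ} (hm : 0 ≤ m) (hb : 0 < b) (hB : 0 < B) (hε0 : 0 ≤ ε)
    (hε1 : ε ≤ 1) (hx : 0 < x) (h1 : m ≤ B) (h2 : m ≤ b * x) (h3 : m * x ≤ b) :
    m ≤ B ^ (1 - ε) * b ^ ε * (min x x⁻¹) ^ ε := by
  have h4 : m ≤ b * min x x⁻¹ := by
    rw [mul_min_of_nonneg _ _ hb.le]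
    refine le_min h2 ?_
    rwa [← div_eq_mul_inv, le_div_iff₀ hx]
  have hmin : 0 ≤ min x x⁻¹ := le_min hx.le (inv_nonneg.2 hx.le)
  calc m = m ^ (1 - ε) * m ^ ε := by
        rw [← Real.rpow_add_of_nonneg hm (by linarith) hε0, sub_add_cancel, rpow_one]
    _ ≤ B ^ (1 - ε) * (b * min x x⁻¹) ^ ε := by gcongr
    _ = _ := by rw [mul_rpow hb.le hmin, mul_assoc]

lemma exists_maxConv_piece_two_le (d : ℕ) (hd : 2 ≤ d) {c ε : ℝ} (hc : 1 < c) (hε0 : 0 < ε)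
    (hε1 : ε < 1) : ∃ C : ℝ, 0 < C ∧
    ∀ {ι : Type} (I : Finset ι) (ρ : ι → ℝ) (b : ℝ) (w : ι → ℝ → ℝ) (e : ι → ℤ), 1 ≤ b →
    (∀ i ∈ I, 1 ≤ ρ i ∧ IsPiece (ρ i) b (w i)) → Set.InjOn e I →
    (∀ i ∈ I, c ^ (e i : ℝ) ≤ ρ i ∧ ρ i ≤ c ^ ((e i : ℝ) + 1)) →
    ∀ f : Λ d → ℂ, f.support.Finite →
    nP 2 (fun x => (maxConv I (fun i => hk (ρ i) (w i)) f x : ℝ≥0∞)) ≤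
      ofReal (C * b ^ ((1 - (d : ℝ) / 2) * (1 - ε) + ε)) * nP 2 fun x => ‖f x‖ₑ := by
  obtain ⟨C, hC, h⟩ := exists_enorm_conv_gam_le d
  obtain ⟨D, hD, h'⟩ := nP_hlM_le (d := d) (by omega) (one_lt_two)
  obtain ⟨M, hM, hm⟩ := exists_ftZ_hkMod_le d hd
  obtain ⟨L, hL, hl⟩ := exists_lacunary_sum_le hc (a := 2 * ε) (by positivity)
  refine ⟨M * sqrt L + C * M * D, by positivity,
    fun {ι} I ρ b w e hb hw he hρ f hf => ?_⟩
  have hb0 : 0 < b := by linarith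
  set B := b ^ ((1 - (d : ℝ) / 2) * (1 - ε) + ε) with hB
  have hBle : b ^ (1 - (d : ℝ) / 2) ≤ B := by
    refine rpow_le_rpow_of_exponent_le hb ?_
    have : (2 : ℝ) ≤ d := mod_cast hd
    nlinarith
  have hpos : ∀ i ∈ I, 0 < ρ i := fun i hi => by linarith [(hw i hi).1]
  have hmain : nP 2 (fun x => (maxConv I (fun i => hkMod (ρ i) (w i)) f x : ℝ≥0∞)) ≤
      ofReal (M * sqrt L * B) * nP 2 fun x => ‖f x‖ₑ := by
    rw [nP_le_iff two_pos (by positivity)]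
    refine (tsum_sup_rpow_le two_pos I (fun i x => ‖conv (hkMod (ρ i) (w i)) f x‖ₑ) _
      fun x => coe_maxConv_le fun i hi =>
        le_sup (f := fun i => ‖conv (hkMod (ρ i) (w i)) f x‖ₑ) hi).trans ?_
    refine sum_conv_sq_le I _ (fun i hi => summable_hkMod (hpos i hi)) (by positivity)
      (fun ξ => ?_) f (summable_of_finite_support' hf)
    obtain ⟨n, hn⟩ := exists_reduce ξ
    simp_rw [← ftZ_sub_int _ ξ n]
    set η : Ξ d := fun i => ξ i - n i with hη
    rcases eq_or_lt_of_le (norm_nonneg η) with hz | hz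
    · have : ∀ i ∈ I, ‖ftZ (hkMod (ρ i) (w i)) η‖ ^ 2 = 0 := by
        intro i hi
        have := ((hm (ρ i) b (w i) (hw i hi).1 hb (hw i hi).2).2 η hn).2.1
        rw [← hz, mul_zero, mul_zero] at this
        rw [le_antisymm this (norm_nonneg _)]
        norm_num
      rw [sum_congr rfl this]
      simp only [sum_const_zero]
      positivity
    · calc _ ≤ ∑ i ∈ I, (M * B) ^ 2 * (min (ρ i * ‖η‖) (ρ i * ‖η‖)⁻¹) ^ (2 * ε) := by
            refine sum_le_sum fun i hi => ?_
            obtain ⟨k1, k2, k3⟩ := (hm (ρ i) b (w i) (hw i hi).1 hb (hw i hi).2).2 η hn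
            have hx : 0 < ρ i * ‖η‖ := mul_pos (hpos i hi) hz
            have hmin : 0 ≤ min (ρ i * ‖η‖) (ρ i * ‖η‖)⁻¹ := le_min hx.le (inv_nonneg.2 hx.le)
            have := norm_le_interp (norm_nonneg _) (by positivity : 0 < M * b)
              (by positivity : 0 < M * b ^ (1 - (d : ℝ) / 2)) hε0.le hε1.le hx k1 k2 k3
            have e1 : (M * b ^ (1 - (d : ℝ) / 2)) ^ (1 - ε) * (M * b) ^ ε = M * B := by
              rw [mul_rpow hM.le (by positivity), mul_rpow hM.le hb0.le, hB,
                rpow_add hb0, rpow_mul hb0.le]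
              have : M ^ (1 - ε) * M ^ ε = M := by
                rw [← rpow_add hM, sub_add_cancel, rpow_one]
              linear_combination ((b ^ (1 - (d : ℝ) / 2)) ^ (1 - ε) * b ^ ε) * this
            rw [e1] at this
            calc _ ≤ (M * B * (min (ρ i * ‖η‖) (ρ i * ‖η‖)⁻¹) ^ ε) ^ 2 := by gcongr
              _ = _ := by
                rw [mul_pow, ← rpow_natCast (_ ^ ε), ← rpow_mul hmin]
                congr 2
                push_cast
                ring
        _ ≤ (M * B) ^ 2 * L := by
            rw [← mul_sum]
            gcongr
            exact hl I ρ e he hρ ‖η‖ hz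
        _ = _ := by
            rw [rpow_two, mul_pow, mul_pow, mul_pow, sq_sqrt hL.le]
            ring
  have hgam : ∀ x, (maxConv I (fun i z => ftZ (hk (ρ i) (w i)) (0 : Ξ d) /
      ftZ (fun z => (gam (ρ i) z : ℂ)) (0 : Ξ d) * gam (ρ i) z) f x : ℝ≥0∞) ≤
      ofReal (C * (M * B)) * hlM (fun y => ‖f y‖ₑ) x := by
    intro x
    refine coe_maxConv_le fun i hi => h (ρ i) (M * B) _ (hw i hi).1 (by positivity) (fun z => ?_) f x
    rw [norm_mul, norm_real, norm_of_nonneg (gam_nonneg (hpos i hi) z)]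
    gcongr
    · exact gam_nonneg (hpos i hi) z
    · exact (hm (ρ i) b (w i) (hw i hi).1 hb (hw i hi).2).1.trans (by gcongr)
  calc _ ≤ nP 2 (fun x => (maxConv I (fun i => hkMod (ρ i) (w i)) f x : ℝ≥0∞) +
        ofReal (C * (M * B)) * hlM (fun y => ‖f y‖ₑ) x) := by
        refine nP_mono zero_le_two fun x => ?_
        refine le_trans ?_ (add_le_add le_rfl (hgam x))
        refine coe_maxConv_le fun i hi => ?_
        have e1 : (hk (ρ i) (w i) : Λ d → ℂ) = fun z => hkMod (ρ i) (w i) z +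
            ftZ (hk (ρ i) (w i)) (0 : Ξ d) /
            ftZ (fun z => (gam (ρ i) z : ℂ)) (0 : Ξ d) * gam (ρ i) z := by
          funext z
          rw [hkMod]; ring
        rw [e1, conv_add_left _ _ hf]
        refine (enorm_add_le _ _).trans (add_le_add ?_ ?_)
        · rw [maxConv, coe_finset_sup]
          exact le_sup (f := fun i => ‖conv (hkMod (ρ i) (w i)) f x‖ₑ) hi
        · rw [maxConv, coe_finset_sup]
          exact le_sup (f := fun i => ‖conv (fun z => ftZ (hk (ρ i) (w i)) (0 : Ξ d) /
            ftZ (fun z => (gam (ρ i) z : ℂ)) (0 : Ξ d) * gam (ρ i) z) f x‖ₑ) hi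
    _ ≤ _ := nP_add_le one_le_two _ _
    _ ≤ ofReal (M * sqrt L * B) * nP 2 (fun x => ‖f x‖ₑ) +
        ofReal (C * (M * B)) * (ofReal D * nP 2 fun x => ‖f x‖ₑ) := by
        rw [nP_const_mul two_pos]
        gcongr
        exact h' f hf
    _ = _ := by
        rw [← mul_assoc, ← ofReal_mul (by positivity), ← add_mul,
          ← ofReal_add (by positivity) (by positivity)]
        congr 2
        ring

/-- Marcinkiewicz interpolation, for norms. -/
lemma nP_interp {X : Type*} [Countable X] {p0 p p1 A0 A1 : ℝ} (hp0 : 0 < p0) (hp : p0 < p)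
    (hp1 : p < p1) (hA0 : 0 < A0) (hA1 : 0 < A1) (S : (X → ℂ) → X → ℝ≥0)
    (hS : ∀ f g : X → ℂ, f.support.Finite → g.support.Finite →
      ∀ x, S (f + g) x ≤ S f x + S g x)
    (h0 : ∀ f : X → ℂ, f.support.Finite →
      nP p0 (fun x => (S f x : ℝ≥0∞)) ≤ ofReal A0 * nP p0 fun x => ‖f x‖ₑ)
    (h1 : ∀ f : X → ℂ, f.support.Finite →
      nP p1 (fun x => (S f x : ℝ≥0∞)) ≤ ofReal A1 * nP p1 fun x => ‖f x‖ₑ)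
    {θ : ℝ} (hθ : θ = p0 * (p1 - p) / ((p1 - p0) * p))
    (f : X → ℂ) (hf : f.support.Finite) :
    nP p (fun x => (S f x : ℝ≥0∞)) ≤
      ofReal (mC p0 p p1 ^ (1 / p) * (A0 ^ θ * A1 ^ (1 - θ))) * nP p fun x => ‖f x‖ₑ := by
  have hpp : 0 < p := hp0.trans hp
  have hpp1 : 0 < p1 := hpp.trans hp1
  have hm := mC_pos hp0 hp hp1
  have d0 : p1 - p0 ≠ 0 := by linarith
  rw [nP_le_iff hpp (by positivity)]
  have := marcinkiewicz hp0 hp hp1 (rpow_pos_of_pos hA0 p0) (rpow_pos_of_pos hA1 p1) S hS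
    (fun f hf => (nP_le_iff hp0 hA0.le _ _).1 (h0 f hf))
    (fun f hf => (nP_le_iff hpp1 hA1.le _ _).1 (h1 f hf)) f hf
  convert this using 3
  rw [mul_rpow (by positivity) (by positivity), mul_rpow (by positivity) (by positivity),
    ← rpow_mul hm.le, one_div_mul_cancel hpp.ne', rpow_one, ← rpow_mul hA0.le,
    ← rpow_mul hA1.le, ← rpow_mul hA0.le, ← rpow_mul hA1.le]
  congr 3
  · rw [hθ]; field_simp
  · rw [hθ]; field_simp; ring

lemma exists_interp_parameters (d : ℕ) {p : ℝ} (hp : (d : ℝ) / (d - 1) < p) (hd : 2 ≤ d)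
    (hp2 : p < 2) : ∃ ε : ℝ, 0 < ε ∧ ε < 1 ∧ 1 + ε < p ∧
      (1 + ε) * (2 - p) / ((2 - (1 + ε)) * p) + ((1 - (d : ℝ) / 2) * (1 - ε) + ε) *
        (1 - (1 + ε) * (2 - p) / ((2 - (1 + ε)) * p)) < 0 := by
  have hd' : (2 : ℝ) ≤ d := mod_cast hd
  have hd1 : (0 : ℝ) < d - 1 := by linarith
  rw [div_lt_iff₀ hd1] at hp
  have hp1 : 1 < p := by nlinarith
  have hp0 : p ≠ 0 := by linarith
  set F : ℝ → ℝ := fun ε => (1 + ε) * (2 - p) / ((2 - (1 + ε)) * p) +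
    ((1 - (d : ℝ) / 2) * (1 - ε) + ε) * (1 - (1 + ε) * (2 - p) / ((2 - (1 + ε)) * p)) with hF
  have hcont : ContinuousAt F 0 := by
    have h1 : ContinuousAt (fun ε : ℝ => (1 + ε) * (2 - p) / ((2 - (1 + ε)) * p)) 0 := by
      refine ContinuousAt.div (by fun_prop) (by fun_prop) ?_
      norm_num
      exact hp0
    exact h1.add ((by fun_prop : ContinuousAt (fun ε : ℝ => (1 - (d : ℝ) / 2) * (1 - ε) + ε) 0).mul
      (continuousAt_const.sub h1))
  have hF0 : F 0 < 0 := by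
    have : F 0 = (d - p * (d - 1)) / p := by
      simp only [hF]; field_simp; ring
    rw [this]
    exact div_neg_of_neg_of_pos (by linarith) (by linarith)
  have h1 : ∀ᶠ ε in nhdsWithin (0 : ℝ) (Set.Ioi 0), F ε < 0 :=
    (hcont.eventually_lt continuousAt_const hF0).filter_mono nhdsWithin_le_nhds
  have h2 : ∀ᶠ ε in nhdsWithin (0 : ℝ) (Set.Ioi 0), ε ∈ Set.Ioo 0 (p - 1) :=
    Ioo_mem_nhdsGT (by linarith)
  obtain ⟨ε, e1, e2, e3⟩ := (h1.and h2).exists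
  exact ⟨ε, e2, by linarith, by linarith, e1⟩

lemma exists_maxConv_piece_decay (d : ℕ) (hd : 2 ≤ d) {c p : ℝ} (hc : 1 < c)
    (hp : (d : ℝ) / (d - 1) < p) (hp2 : p < 2) : ∃ C δ : ℝ, 0 < C ∧ 0 < δ ∧
    ∀ {ι : Type} (I : Finset ι) (ρ : ι → ℝ) (b : ℝ) (w : ι → ℝ → ℝ) (e : ι → ℤ), 1 ≤ b →
    (∀ i ∈ I, 1 ≤ ρ i ∧ IsPiece (ρ i) b (w i)) → Set.InjOn e I →
    (∀ i ∈ I, c ^ (e i : ℝ) ≤ ρ i ∧ ρ i ≤ c ^ ((e i : ℝ) + 1)) →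
    ∀ f : Λ d → ℂ, f.support.Finite →
    nP p (fun x => (maxConv I (fun i => hk (ρ i) (w i)) f x : ℝ≥0∞)) ≤
      ofReal (C * b ^ (-δ)) * nP p fun x => ‖f x‖ₑ := by
  obtain ⟨ε, hε0, hε1, hεp, hE⟩ := exists_interp_parameters d hp hd hp2
  obtain ⟨C, hC, h⟩ := exists_maxConv_piece_le d (by omega) (p := 1 + ε) (by linarith)
  obtain ⟨D, hD, h'⟩ := exists_maxConv_piece_two_le d hd hc hε0 hε1
  set θ := (1 + ε) * (2 - p) / ((2 - (1 + ε)) * p) with hθ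
  set α := (1 - (d : ℝ) / 2) * (1 - ε) + ε with hα
  have hm := mC_pos (by linarith : 0 < 1 + ε) hεp hp2
  refine ⟨mC (1 + ε) p 2 ^ (1 / p) * (C ^ θ * D ^ (1 - θ)), -(θ + α * (1 - θ)), by positivity,
    by linarith, fun {ι} I ρ b w e hb hw he hρ f hf => ?_⟩
  have hb0 : 0 < b := by linarith
  have := nP_interp (by linarith : 0 < 1 + ε) hεp hp2 (by positivity : 0 < C * b)
    (by positivity : 0 < D * b ^ α) _ (maxConv_add_le I fun i => hk (ρ i) (w i))
    (fun f hf => h I ρ b w hb hw f hf) (fun f hf => h' I ρ b w e hb hw he hρ f hf) hθ f hf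
  refine this.trans (le_of_eq ?_)
  congr 2
  rw [mul_rpow hC.le hb0.le, mul_rpow hD.le (by positivity), ← rpow_mul hb0.le,
    neg_neg, rpow_add hb0]
  ring

/-- The part of a frequency weight `w` at `1 + |u| ∼ 2 ^ k`. -/
def dyadicPart (w : ℝ → ℝ) (k : ℕ) (u : ℝ) : ℝ :=
  if Nat.log 2 ⌊1 + |u|⌋₊ = k then w u else 0

lemma isPiece_dyadicPart {ρ : ℝ} (hρ : 1 ≤ ρ) {w : ℝ → ℝ} (hm : Measurable w)
    (hw : ∀ u, |w u| ≤ 1) (hs : ∀ u, w u ≠ 0 → |u| ≤ ρ) (k : ℕ) :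
    IsPiece ρ (2 ^ k) (dyadicPart w k) where
  meas := by
    refine Measurable.ite ?_ hm measurable_const
    have h1 : Measurable fun u : ℝ => ⌊1 + |u|⌋₊ :=
      Nat.measurable_floor.comp (measurable_const.add measurable_id.abs)
    exact (measurable_from_top (f := Nat.log 2)).comp h1 (measurableSet_singleton k)
  bdd u := by
    unfold dyadicPart
    split_ifs
    · exact hw u
    · simp
  supp u hu := by
    unfold dyadicPart at hu
    split_ifs at hu with h
    · have h1 : (1 : ℝ) ≤ 1 + |u| := by linarith [abs_nonneg u]
      have h2 : ⌊1 + |u|⌋₊ ≠ 0 := (floor_pos.2 h1).ne'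
      have h3 := Nat.pow_log_le_self 2 h2
      have h4 := Nat.lt_pow_succ_log_self one_lt_two ⌊1 + |u|⌋₊
      rw [h] at h3 h4
      have h5 : (2 : ℝ) ^ k ≤ 1 + |u| := by
        refine le_trans ?_ (floor_le (by linarith))
        exact_mod_cast h3
      have h6 : 1 + |u| < (2 : ℝ) ^ (k + 1) := by
        have := (Nat.floor_lt (by linarith)).1 h4
        exact_mod_cast this
      refine ⟨by linarith, by rw [pow_succ] at h6; linarith, ?_⟩
      linarith [hs u hu]
    · exact absurd rfl hu

lemma exists_maxConv_hk_le (d : ℕ) (hd : 2 ≤ d) {c p : ℝ} (hc : 1 < c)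
    (hp : (d : ℝ) / (d - 1) < p) (hp2 : p < 2) : ∃ C : ℝ, 0 < C ∧
    ∀ {ι : Type} (I : Finset ι) (ρ : ι → ℝ) (w : ι → ℝ → ℝ) (e : ι → ℤ),
    (∀ i ∈ I, 1 ≤ ρ i ∧ Measurable (w i) ∧ (∀ u, |w i u| ≤ 1) ∧ ∀ u, w i u ≠ 0 → |u| ≤ ρ i) →
    Set.InjOn e I →
    (∀ i ∈ I, c ^ (e i : ℝ) ≤ ρ i ∧ ρ i ≤ c ^ ((e i : ℝ) + 1)) →
    ∀ f : Λ d → ℂ, f.support.Finite →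
    nP p (fun x => (maxConv I (fun i => hk (ρ i) (w i)) f x : ℝ≥0∞)) ≤
      ofReal C * nP p fun x => ‖f x‖ₑ := by
  obtain ⟨C, δ, hC, hδ, h⟩ := exists_maxConv_piece_decay d hd hc hp hp2
  have hp1 : 1 ≤ p := by
    have hd' : (2 : ℝ) ≤ d := mod_cast hd
    rw [div_lt_iff₀ (by linarith)] at hp
    nlinarith
  have hq : (2 : ℝ) ^ (-δ) < 1 := Real.rpow_lt_one_of_one_lt_of_neg one_lt_two (by linarith)
  have hq0 : 0 < (2 : ℝ) ^ (-δ) := by positivity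
  refine ⟨C * (1 - (2 : ℝ) ^ (-δ))⁻¹, mul_pos hC (inv_pos.2 (by linarith)),
    fun {ι} I ρ w e hw he hρ f hf => ?_⟩
  set K := I.sup (fun i => Nat.log 2 ⌊1 + ρ i⌋₊) + 1 with hK
  have hpiece : ∀ k, ∀ i ∈ I, IsPiece (ρ i) (2 ^ k) (dyadicPart (w i) k) := fun k i hi =>
    isPiece_dyadicPart (hw i hi).1 (hw i hi).2.1 (hw i hi).2.2.1 (hw i hi).2.2.2 k
  have hdec : ∀ i ∈ I, (hk (ρ i) (w i) : Λ d → ℂ) =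
      fun z => ∑ k ∈ range K, hk (ρ i) (dyadicPart (w i) k) z := by
    intro i hi
    funext z
    rw [← hk_sum _ fun k _ => (hpiece k i hi).integrable]
    congr 1
    funext u
    unfold dyadicPart
    rw [Finset.sum_ite_eq]
    split_ifs with h0
    · rfl
    · by_contra hne
      apply h0
      rw [mem_range, hK, Nat.lt_succ_iff]
      refine le_trans ?_ (le_sup (f := fun i => Nat.log 2 ⌊1 + ρ i⌋₊) hi)
      refine Nat.log_mono_right (Nat.floor_le_floor ?_)
      linarith [(hw i hi).2.2.2 u hne]
  calc _ ≤ nP p (fun x => ∑ k ∈ range K,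
        (maxConv I (fun i => hk (ρ i) (dyadicPart (w i) k)) f x : ℝ≥0∞)) := by
        refine nP_mono (by linarith) fun x => coe_maxConv_le fun i hi => ?_
        rw [hdec i hi, conv_sum_left _ _ hf]
        refine (enorm_sum_le _ _).trans (sum_le_sum fun k _ => ?_)
        rw [maxConv, coe_finset_sup]
        exact le_sup (f := fun i => ‖conv (hk (ρ i) (dyadicPart (w i) k)) f x‖ₑ) hi
    _ ≤ _ := nP_sum_le hp1 _ _
    _ ≤ ∑ k ∈ range K, ofReal (C * ((2 : ℝ) ^ (-δ)) ^ k) *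
          nP p fun x => ‖f x‖ₑ := by
        refine sum_le_sum fun k _ => ?_
        have := h I ρ (2 ^ k) (fun i => dyadicPart (w i) k) e (one_le_pow₀ one_le_two)
          (fun i hi => ⟨(hw i hi).1, hpiece k i hi⟩) he hρ f hf
        rwa [← rpow_natCast, ← rpow_mul zero_le_two, mul_comm (k : ℝ),
          rpow_mul zero_le_two, rpow_natCast] at this
    _ ≤ _ := by
        rw [← sum_mul, ← ofReal_sum_of_nonneg fun k _ => by positivity,
          ← mul_sum]
        gcongr
        rw [← tsum_geometric_of_lt_one hq0.le hq]
        exact (summable_geometric_of_lt_one hq0.le hq).sum_le_tsum _ fun k _ => by positivity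

/-- The triangular weight of width `κ`. -/
def tri (κ u : ℝ) : ℝ := max 0 (1 - |u| / κ)

lemma tri_nonneg (κ u : ℝ) : 0 ≤ tri κ u := le_max_left _ _

lemma tri_le_one {κ : ℝ} (hκ : 0 < κ) (u : ℝ) : tri κ u ≤ 1 := by
  have : 0 ≤ |u| / κ := by positivity
  exact max_le zero_le_one (by linarith)

lemma abs_tri_le_one {κ : ℝ} (hκ : 0 < κ) (u : ℝ) : |tri κ u| ≤ 1 := by
  rw [abs_of_nonneg (tri_nonneg _ _)]
  exact tri_le_one hκ u

lemma abs_le_of_tri_ne_zero {κ : ℝ} (hκ : 0 < κ) {u : ℝ} (h : tri κ u ≠ 0) : |u| ≤ κ := by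
  by_contra! hu
  refine h (max_eq_left ?_)
  have : 1 < |u| / κ := (one_lt_div hκ).2 hu
  linarith

lemma continuous_tri (κ : ℝ) : Continuous (tri κ) := by
  unfold tri
  fun_prop

lemma tri_neg (κ u : ℝ) : tri κ (-u) = tri κ u := by rw [tri, tri, abs_neg]

lemma tri_le_indicator {κ : ℝ} (hκ : 0 < κ) (u : ℝ) :
    tri κ u ≤ (Set.Icc (-κ) κ).indicator (fun _ => (1 : ℝ)) u := by
  by_cases hu : tri κ u = 0
  · rw [hu]
    exact Set.indicator_nonneg (fun _ _ => zero_le_one) _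
  · rw [Set.indicator_of_mem]
    · exact tri_le_one hκ u
    · exact abs_le.1 (abs_le_of_tri_ne_zero hκ hu)

lemma integrable_tri {κ : ℝ} (hκ : 0 < κ) : Integrable (tri κ) :=
  (integrable_indicator_Icc (-κ) κ).mono' (continuous_tri κ).aestronglyMeasurable
    (of_forall fun u => (abs_of_nonneg (tri_nonneg κ u)).le.trans
      (tri_le_indicator hκ u))

lemma integral_tri_le {κ : ℝ} (hκ : 0 < κ) : ∫ u, tri κ u ≤ 2 * κ := by
  refine (integral_mono (integrable_tri hκ) (integrable_indicator_Icc _ _)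
    (tri_le_indicator hκ)).trans ?_
  rw [integral_indicator measurableSet_Icc, setIntegral_const, smul_eq_mul, mul_one,
    Real.volume_real_Icc_of_le (by linarith)]
  linarith

/-- The Fejér kernel: the Fourier transform of the triangular weight. -/
def fej (κ s : ℝ) : ℝ := ∫ u, tri κ u * cos (2 * pi * (u * s))

lemma integrable_tri_mul {κ : ℝ} (hκ : 0 < κ) {g : ℝ → ℝ} (hg : Continuous g)
    (hb : ∀ u, |g u| ≤ 1) : Integrable fun u => tri κ u * g u :=
  (integrable_tri hκ).mul_bdd (c := 1) hg.aestronglyMeasurable (of_forall hb)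

lemma integral_tri_eC {κ : ℝ} (hκ : 0 < κ) (s : ℝ) :
    ∫ u, (tri κ u : ℂ) * eC (u * s) = (fej κ s : ℂ) := by
  have h1 : ∀ u : ℝ, (tri κ u : ℂ) * eC (u * s) =
      ((tri κ u * cos (2 * pi * (u * s)) : ℝ) : ℂ) +
        ((tri κ u * sin (2 * pi * (u * s)) : ℝ) : ℂ) * Complex.I := by
    intro u
    rw [eC, show 2 * (pi : ℂ) * Complex.I * ((u * s : ℝ) : ℂ) =
      ((2 * pi * (u * s) : ℝ) : ℂ) * Complex.I by push_cast; ring, Complex.exp_mul_I,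
      ← Complex.ofReal_cos, ← Complex.ofReal_sin]
    push_cast
    ring
  have hc := integrable_tri_mul hκ (g := fun u => cos (2 * pi * (u * s)))
    (by fun_prop) fun u => Real.abs_cos_le_one _
  have hs := integrable_tri_mul hκ (g := fun u => sin (2 * pi * (u * s)))
    (by fun_prop) fun u => Real.abs_sin_le_one _
  have hodd : ∫ u, tri κ u * sin (2 * pi * (u * s)) = 0 := by
    have := integral_neg_eq_self (fun u => tri κ u * sin (2 * pi * (u * s))) volume
    have h2 : ∀ u, tri κ (-u) * sin (2 * pi * (-u * s)) =
        -(tri κ u * sin (2 * pi * (u * s))) := by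
      intro u
      rw [tri_neg, show 2 * pi * (-u * s) = -(2 * pi * (u * s)) by ring, Real.sin_neg]
      ring
    simp only [h2, integral_neg] at this
    linarith
  simp only [h1]
  rw [integral_add hc.ofReal (hs.ofReal.mul_const _), integral_mul_const, integral_complex_ofReal,
    integral_complex_ofReal, hodd, fej]
  simp

lemma fej_eq_interval {κ : ℝ} (hκ : 0 < κ) (s : ℝ) :
    fej κ s = 2 * ∫ u in (0 : ℝ)..κ, (1 - u / κ) * cos (2 * pi * (u * s)) := by
  have h1 : ∀ u : ℝ, tri κ u * cos (2 * pi * (u * s)) =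
      (fun v => max 0 (1 - v / κ) * cos (2 * pi * (v * s))) |u| := by
    intro u
    rcases abs_choice u with h | h
    · simp only [tri, h]
    · simp only [tri, h]
      rw [show 2 * pi * (-u * s) = -(2 * pi * (u * s)) by ring, Real.cos_neg]
  have h2 : ∫ u in Set.Ioi (0 : ℝ), max 0 (1 - u / κ) * cos (2 * pi * (u * s)) =
      ∫ u in Set.Ioc (0 : ℝ) κ, max 0 (1 - u / κ) * cos (2 * pi * (u * s)) := by
    refine (setIntegral_eq_of_subset_of_forall_sdiff_eq_zero measurableSet_Ioi
      (fun u hu => hu.1) fun u hu => ?_)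
    have : κ < u := by
      by_contra! h
      exact hu.2 ⟨hu.1, h⟩
    rw [max_eq_left, zero_mul]
    have : 1 < u / κ := (one_lt_div hκ).2 this
    linarith
  rw [fej, integral_congr_ae (of_forall h1), integral_comp_abs
    (f := fun v => max 0 (1 - v / κ) * cos (2 * pi * (v * s))), h2,
    intervalIntegral.integral_of_le hκ.le]
  congr 1
  refine setIntegral_congr_fun measurableSet_Ioc fun u hu => ?_
  have : u / κ ≤ 1 := (div_le_one hκ).2 hu.2
  rw [max_eq_right (by linarith)]

lemma fej_nonneg {κ : ℝ} (hκ : 0 < κ) (s : ℝ) : 0 ≤ fej κ s := by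
  rw [fej_eq_interval hκ]
  refine mul_nonneg zero_le_two ?_
  rcases eq_or_ne s 0 with rfl | hs
  · refine intervalIntegral.integral_nonneg hκ.le fun u hu => ?_
    have : u / κ ≤ 1 := (div_le_one hκ).2 hu.2
    simp only [mul_zero, Real.cos_zero, mul_one]
    linarith
  · set ω : ℝ := 2 * pi * s with hω
    have hω0 : ω ≠ 0 := by positivity
    have hd : ∀ u ∈ Set.uIcc 0 κ, HasDerivAt
        (fun u => (1 - u / κ) * (sin (ω * u) / ω) - cos (ω * u) / (κ * ω ^ 2))
        ((1 - u / κ) * cos (2 * pi * (u * s))) u := by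
      intro u _
      have h1 : HasDerivAt (fun u : ℝ => ω * u) ω u := by
        simpa using (hasDerivAt_id u).const_mul ω
      have h2 : HasDerivAt (fun u : ℝ => 1 - u / κ) (-(1 / κ)) u := by
        simpa using ((hasDerivAt_id u).div_const κ).const_sub 1
      have h3 := (h2.mul (h1.sin.div_const ω)).sub (h1.cos.div_const (κ * ω ^ 2))
      refine h3.congr_deriv ?_
      rw [show 2 * pi * (u * s) = ω * u by rw [hω]; ring]
      field_simp
      ring
    rw [intervalIntegral.integral_eq_sub_of_hasDerivAt hd
      (Continuous.intervalIntegrable (by fun_prop) _ _)]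
    have h4 := Real.cos_le_one (ω * κ)
    have h5 : (1 - κ / κ) * (sin (ω * κ) / ω) - cos (ω * κ) / (κ * ω ^ 2) -
        ((1 - 0 / κ) * (sin (ω * 0) / ω) - cos (ω * 0) / (κ * ω ^ 2)) =
        (1 - cos (ω * κ)) / (κ * ω ^ 2) := by
      rw [div_self hκ.ne', mul_zero, Real.cos_zero, Real.sin_zero]
      ring
    rw [h5]
    positivity

lemma fej_le {κ : ℝ} (hκ : 0 < κ) (s : ℝ) : fej κ s ≤ 2 * κ := by
  refine (integral_mono (integrable_tri_mul hκ (by fun_prop) fun u => Real.abs_cos_le_one _)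
    (integrable_tri hκ) fun u => ?_).trans (integral_tri_le hκ)
  exact mul_le_of_le_one_right (tri_nonneg _ _) (Real.cos_le_one _)

lemma le_fej {κ : ℝ} (hκ : 0 < κ) {s : ℝ} (hs : |s| ≤ 1 / (8 * κ)) : κ / 2 ≤ fej κ s := by
  have h1 : ∀ u ∈ Set.Icc (0 : ℝ) κ, (1 - u / κ) * (1 / 2) ≤
      (1 - u / κ) * cos (2 * pi * (u * s)) := by
    intro u hu
    have : u / κ ≤ 1 := (div_le_one hκ).2 hu.2
    refine mul_le_mul_of_nonneg_left ?_ (by linarith)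
    have h2 : |2 * pi * (u * s)| ≤ pi / 3 := by
      rw [abs_mul, abs_mul u, abs_of_pos (by positivity : 0 < 2 * pi), abs_of_nonneg hu.1]
      have : u * |s| ≤ κ * (1 / (8 * κ)) := mul_le_mul hu.2 hs (abs_nonneg _) hκ.le
      have h3 : κ * (1 / (8 * κ)) = 1 / 8 := by field_simp
      nlinarith [pi_pos]
    rw [← Real.cos_pi_div_three, ← Real.cos_abs (2 * pi * (u * s))]
    exact Real.cos_le_cos_of_nonneg_of_le_pi (abs_nonneg _) (by linarith [pi_pos]) h2
  have h2 : ∫ u in (0 : ℝ)..κ, (1 - u / κ) * (1 / 2) = κ / 4 := by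
    rw [intervalIntegral.integral_mul_const, intervalIntegral.integral_sub
      (by simp) (Continuous.intervalIntegrable (by fun_prop) _ _), intervalIntegral.integral_div,
      integral_id]
    simp
    field_simp
    ring
  have h3 : ∫ u in (0 : ℝ)..κ, (1 - u / κ) * (1 / 2) ≤
      ∫ u in (0 : ℝ)..κ, (1 - u / κ) * cos (2 * pi * (u * s)) :=
    intervalIntegral.integral_mono_on hκ.le (Continuous.intervalIntegrable (by fun_prop) _ _)
      (Continuous.intervalIntegrable (by fun_prop) _ _) h1
  rw [h2] at h3
  rw [fej_eq_interval hκ]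
  linarith

lemma abs_fej_sub_le {κ : ℝ} (hκ : 0 < κ) (s t : ℝ) :
    |fej κ s - fej κ t| ≤ 4 * pi * κ ^ 2 * |s - t| := by
  have hs := integrable_tri_mul hκ (g := fun u => cos (2 * pi * (u * s)))
    (by fun_prop) fun u => Real.abs_cos_le_one _
  have ht := integrable_tri_mul hκ (g := fun u => cos (2 * pi * (u * t)))
    (by fun_prop) fun u => Real.abs_cos_le_one _
  rw [fej, fej, ← integral_sub hs ht, ← norm_eq_abs]
  refine (norm_integral_le_of_norm_le ((integrable_tri hκ).mul_const
    (2 * pi * κ * |s - t|)) (of_forall fun u => ?_)).trans ?_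
  · rw [← mul_sub, norm_mul, norm_of_nonneg (tri_nonneg _ _)]
    rcases eq_or_ne (tri κ u) 0 with h | h
    · rw [h, zero_mul, zero_mul]
    refine mul_le_mul_of_nonneg_left ?_ (tri_nonneg _ _)
    have h1 := abs_le_of_tri_ne_zero hκ h
    have h2 : ‖cos (2 * pi * (u * s)) - cos (2 * pi * (u * t))‖ ≤
        ‖2 * pi * (u * s) - 2 * pi * (u * t)‖ := by
      have := Real.lipschitzWith_cos.dist_le_mul (2 * pi * (u * s)) (2 * pi * (u * t))
      simpa [dist_eq_norm] using this
    refine h2.trans ?_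
    rw [show 2 * pi * (u * s) - 2 * pi * (u * t) = 2 * pi * u * (s - t) by ring,
      norm_eq_abs, abs_mul, abs_mul, abs_of_pos (by positivity : 0 < 2 * pi)]
    gcongr
  · rw [integral_mul_const]
    have := integral_tri_le hκ
    calc _ ≤ 2 * κ * (2 * pi * κ * |s - t|) := by gcongr
      _ = _ := by ring

/-- The smooth positive approximation, at relative width `1/κ`, to the sphere of radius `ρ`. -/
def shell (ρ κ : ℝ) (z : Λ d) : ℝ :=
  gam ρ z * fej κ ((normSqZ z : ℝ) / ρ ^ 2 - 1)

lemma hk_tri (ρ : ℝ) {κ : ℝ} (hκ : 0 < κ) (z : Λ d) :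
    hk ρ (tri κ) z = (shell ρ κ z : ℂ) := by
  rw [hk, integral_tri_eC hκ, shell, Complex.ofReal_mul]

lemma shell_nonneg {ρ κ : ℝ} (hρ : 0 < ρ) (hκ : 0 < κ) (z : Λ d) :
    0 ≤ shell ρ κ z :=
  mul_nonneg (gam_nonneg hρ z) (fej_nonneg hκ _)

lemma shell_le {ρ κ : ℝ} (hρ : 0 < ρ) (hκ : 0 < κ) (z : Λ d) :
    shell ρ κ z ≤ 2 * κ * gam ρ z := by
  rw [shell, mul_comm (2 * κ)]
  exact mul_le_mul_of_nonneg_left (fej_le hκ _) (gam_nonneg hρ z)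

lemma summable_shell {ρ κ : ℝ} (hρ : 0 < ρ) (hκ : 0 < κ) :
    Summable (shell ρ κ : Λ d → ℝ) :=
  of_nonneg_of_le (shell_nonneg hρ hκ) (shell_le hρ hκ) ((summable_gam hρ).mul_left _)

lemma shell_smul {ρ κ : ℝ} (hρ : 0 < ρ) {L : ℕ} (hL : 0 < L) (z : Λ d) :
    shell ρ κ (fun i => (L : ℤ) * z i) = ((L : ℝ) ^ d)⁻¹ * shell (ρ / L) κ z := by
  have h1 : ((normSqZ fun i => (L : ℤ) * z i : ℤ) : ℝ) = (L : ℝ) ^ 2 * normSqZ z := by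
    simp only [normSqZ, mul_pow]
    rw [← mul_sum]
    push_cast
    rfl
  have h2 : (L : ℝ) ^ 2 * (normSqZ z : ℝ) / ρ ^ 2 = normSqZ z / (ρ / L) ^ 2 := by
    field_simp
  rw [shell, shell, gam, gam, h1, h2, neg_div, h2, neg_div, div_pow ρ (L : ℝ) d, inv_div]
  have h3 : (ρ ^ d)⁻¹ = ((L : ℝ) ^ d)⁻¹ * ((L : ℝ) ^ d / ρ ^ d) := by field_simp
  rw [h3]
  ring

lemma one_add_rpow_le {t u : ℝ} (ht : 0 ≤ t) (ht1 : t ≤ 1) (hu : 1 < u) (hu2 : u ≤ 2) :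
    (1 + t) ^ u ≤ 1 + u * t + t ^ u := by
  rcases ht.eq_or_lt with rfl | h0
  · simp [zero_rpow (by linarith : u ≠ 0)]
  have h1 : (1 + t) ^ (u - 1) ≤ 1 + (u - 1) * t :=
    rpow_one_add_le_one_add_mul_self (by linarith) (by linarith) (by linarith)
  have h2 : t ^ (2 : ℝ) ≤ t ^ u := Real.rpow_le_rpow_of_exponent_ge h0 ht1 hu2
  rw [rpow_two] at h2
  have h3 : (1 + t) ^ u = (1 + t) * (1 + t) ^ (u - 1) := by
    rw [rpow_sub_one (by linarith)]
    field_simp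
  rw [h3]
  nlinarith [mul_le_mul_of_nonneg_left h1 (by linarith : 0 ≤ 1 + t), sq_nonneg t]

lemma add_rpow_le_taylor {m y u : ℝ} (hm : 0 < m) (hy : 0 ≤ y) (hu : 1 < u) (hu2 : u ≤ 2) :
    (m + y) ^ u ≤ m ^ u + u * (m ^ (u - 1) * y) + y ^ u := by
  have key : ∀ {m y : ℝ}, 0 < m → 0 ≤ y → y ≤ m →
      (m + y) ^ u ≤ m ^ u + u * (m ^ (u - 1) * y) + y ^ u := by
    intro m y hm hy hym
    have h1 := one_add_rpow_le (by positivity) ((div_le_one hm).2 hym) hu hu2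
    have h2 : (m + y) ^ u = m ^ u * (1 + y / m) ^ u := by
      rw [← mul_rpow hm.le (by positivity)]
      congr 1
      field_simp
    have h3 : m ^ u * (y / m) ^ u = y ^ u := by
      rw [← mul_rpow hm.le (by positivity)]
      congr 1
      field_simp
    have h4 : m ^ (u - 1) = m ^ u / m := rpow_sub_one hm.ne' u
    rw [h2, h4, ← h3]
    calc m ^ u * (1 + y / m) ^ u ≤ m ^ u * (1 + u * (y / m) + (y / m) ^ u) := by gcongr
      _ = _ := by ring
  rcases le_total y m with h | h
  · exact key hm hy h
  · have hy' : 0 < y := hm.trans_le h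
    have h1 := key hy' hm.le h
    have h2 : y ^ (u - 1) * m ≤ m ^ (u - 1) * y := by
      have h3 : y ^ (u - 1) = y * y ^ (u - 2) := by
        rw [← Real.rpow_one_add' hy'.le (by linarith)]
        ring_nf
      have h4 : m ^ (u - 1) = m * m ^ (u - 2) := by
        rw [← Real.rpow_one_add' hm.le (by linarith)]
        ring_nf
      have h5 : y ^ (u - 2) ≤ m ^ (u - 2) := rpow_le_rpow_of_nonpos hm h (by linarith)
      rw [h3, h4]
      calc y * y ^ (u - 2) * m ≤ y * m ^ (u - 2) * m := by gcongr
        _ = _ := by ring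
    rw [add_comm m y]
    nlinarith

lemma exists_tangent_gap {u : ℝ} (hu : 1 < u) : ∃ c : ℝ, 0 < c ∧ c ≤ 1 ∧ ∀ t : ℝ, 0 ≤ t →
    1 + u * (t - 1) + c * (if 2 < t then t ^ u else 0) ≤ t ^ u := by
  have h0 : 1 + u < 2 ^ u := by
    have := one_add_mul_self_lt_rpow_one_add (s := 1) (by norm_num) one_ne_zero hu
    norm_num at this
    exact this
  refine ⟨1 - (1 + u) / 2 ^ u, ?_, ?_, fun t ht => ?_⟩
  · rw [sub_pos, div_lt_one (by positivity)]
    exact h0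
  · have : 0 ≤ (1 + u) / 2 ^ u := by positivity
    linarith
  · split_ifs with h
    · have h1 := one_add_mul_self_le_rpow_one_add (s := t / 2 - 1) (by linarith) hu.le
      rw [show 1 + (t / 2 - 1) = t / 2 by ring, div_rpow ht zero_le_two] at h1
      have h2 : 1 + u * (t - 1) ≤ (1 + u) * (1 + u * (t / 2 - 1)) := by
        have : 0 ≤ u * (t / 2 - 1) * (u - 1) :=
          mul_nonneg (mul_nonneg (by linarith) (by linarith)) (by linarith)
        nlinarith
      have h3 : (1 + u) * (1 + u * (t / 2 - 1)) ≤ (1 + u) * (t ^ u / 2 ^ u) := by gcongr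
      have h4 : (1 + u) * (t ^ u / 2 ^ u) = (1 + u) / 2 ^ u * t ^ u := by ring
      linarith
    · have := one_add_mul_self_le_rpow_one_add (s := t - 1) (by linarith) hu.le
      rw [add_sub_cancel] at this
      linarith

lemma rpow_le_add_sq {y τ e : ℝ} (hy : 0 ≤ y) (hτ : 0 < τ) (he : 0 < e) (he2 : e ≤ 2) :
    y ^ e ≤ τ ^ e + τ ^ (e - 2) * y ^ 2 := by
  rcases le_total y τ with h | h
  · have h1 : y ^ e ≤ τ ^ e := Real.rpow_le_rpow hy h he.le
    have : 0 ≤ τ ^ (e - 2) * y ^ 2 := by positivity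
    linarith
  · have hy' : 0 < y := hτ.trans_le h
    have h1 : y ^ e = y ^ (e - 2) * y ^ 2 := by
      rw [← rpow_two, ← rpow_add hy']
      ring_nf
    have h2 : y ^ (e - 2) ≤ τ ^ (e - 2) := rpow_le_rpow_of_nonpos hτ h (by linarith)
    have h3 : y ^ (e - 2) * y ^ 2 ≤ τ ^ (e - 2) * y ^ 2 := by gcongr
    have : 0 ≤ τ ^ e := by positivity
    linarith

lemma mean_add_algebra {u k E D a β P b q w : ℝ} (hu : 0 ≤ u) (hk : 0 ≤ k) (hE : 0 ≤ E) (hD : 0 ≤ D)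
    (ha : 0 ≤ a) (hβ : 0 ≤ β) (hP : 0 ≤ P) (hb : 0 ≤ b) (hq : q ≤ 5 * E * a * P)
    (hw : w + b / 4 ≤ b + D * β * b) :
    P + u * (5 * a * P) + (u * k * β * P) + 2 * q + w + b / 4 ≤
      (1 + (5 * u + u * k + 10 * E + D) * (a + β)) * (P + b) := by
  have h1 : 0 ≤ ((5 * u + u * k + 10 * E + D) * a + (5 * u + u * k + 10 * E) * β) * b := by
    positivity
  have h2 : 0 ≤ (u * k * a + D * a + 5 * u * β + 10 * E * β + D * β) * P := by positivity
  linarith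

set_option maxHeartbeats 1000000 in
/-- A sublinear perturbation of the mean that gains on `L²` and on `L^u` has `L^u` norm close to
one: the perturbation is orthogonal to first order to the large values. -/
lemma exists_mean_add_le {u v A : ℝ} (hu : 1 < u) (hu2 : u ≤ 2) (huv : v.HolderConjugate u)
    (hA : 0 < A) : ∃ C : ℝ, 0 < C ∧ ∀ {X : Type} [Fintype X] [Nonempty X] (a b : ℝ), 0 < a → a ≤ A →
      0 < b → b ≤ A → ∀ S : (X → ℝ) → X → ℝ, (∀ f x, 0 ≤ S f x) →
      (∀ f g x, S (f + g) x ≤ S f x + S g x) →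
      (∀ f : X → ℝ, ∑ x, (S f x) ^ 2 ≤ a ^ 2 * ∑ x, (f x) ^ 2) →
      (∀ f : X → ℝ, ∑ x, (S f x) ^ u ≤ b ^ u * ∑ x, |f x| ^ u) →
      ∀ f : X → ℝ, (∀ x, 0 ≤ f x) →
        ∑ x, ((card X : ℝ)⁻¹ * ∑ y, f y + S f x) ^ u ≤
          (1 + C * (a + b ^ v)) * ∑ x, f x ^ u := by
  obtain ⟨c, hc0, hc1, hc⟩ := exists_tangent_gap hu
  have hu0 : 0 < u := by linarith
  have hv0 : 0 < v := huv.pos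
  set K : ℝ := (4 * u / c) ^ (1 / u) with hK
  have hK0 : 0 < K := by positivity
  have hKu : K ^ u = 4 * u / c := by
    rw [hK, ← rpow_mul (by positivity), one_div_mul_cancel hu0.ne', rpow_one]
  set c1 : ℝ := (3 / 8 * c) ^ (v / u) with hcc
  have hc1' : 0 < c1 := by positivity
  refine ⟨5 * u + u * K ^ v + 10 * A ^ (u - 1) + 2 * A ^ u / (c * c1), by positivity, ?_⟩
  intro X _ _ a b ha haA hb hbA S hS0 hSadd hS2 hSu f hf
  set n : ℝ := (card X : ℝ) with hn
  have hn0 : 0 < n := by rw [hn]; exact_mod_cast Fintype.card_pos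
  set m : ℝ := n⁻¹ * ∑ y, f y with hm
  have hm0 : 0 ≤ m := mul_nonneg (by positivity) (sum_nonneg fun x _ => hf x)
  have hsum : ∑ y, f y = n * m := by rw [hm]; field_simp
  rcases hm0.eq_or_lt with hm1 | hm1
  · have h1 : ∑ y, f y = 0 := by rw [hsum, ← hm1, mul_zero]
    have h2 : ∀ x, f x = 0 := fun x =>
      (Finset.sum_eq_zero_iff_of_nonneg fun x _ => hf x).1 h1 x (mem_univ x)
    have h3 := hSu f
    simp only [h2, abs_zero, zero_rpow hu0.ne', sum_const_zero, mul_zero] at h3 ⊢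
    simpa [← hm1] using h3
  set f1 : X → ℝ := fun x => if 2 * m < f x then 0 else f x with hf1
  set f2 : X → ℝ := fun x => if 2 * m < f x then f x else 0 with hf2
  have hf12 : f = f1 + f2 := by
    funext x
    simp only [hf1, hf2, Pi.add_apply]
    split_ifs <;> simp
  set B : ℝ := ∑ x, |f2 x| ^ u with hB
  have hB0 : 0 ≤ B := sum_nonneg fun x _ => by positivity
  -- the tangent inequality
  have hlow : n * m ^ u + c * B ≤ ∑ x, f x ^ u := by
    have h1 : ∀ x, m ^ u * (1 + u * (f x / m - 1)) + c * |f2 x| ^ u ≤ f x ^ u := by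
      intro x
      have h2 := hc (f x / m) (div_nonneg (hf x) hm0)
      have h3 : m ^ u * (f x / m) ^ u = f x ^ u := by
        rw [← mul_rpow hm0 (div_nonneg (hf x) hm0)]
        congr 1
        field_simp
      have h4 : m ^ u * (if 2 < f x / m then (f x / m) ^ u else 0) = |f2 x| ^ u := by
        simp only [hf2, lt_div_iff₀ hm1]
        split_ifs with h
        · rw [h3, abs_of_nonneg (hf x)]
        · rw [mul_zero, abs_zero, zero_rpow hu0.ne']
      rw [← h4, ← h3]
      have : 0 < m ^ u := by positivity
      nlinarith
    have h5 := sum_le_sum fun x (_ : x ∈ univ) => h1 x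
    refine le_trans (le_of_eq ?_) h5
    rw [sum_add_distrib, ← mul_sum, ← mul_sum, sum_add_distrib,
      ← mul_sum, sum_sub_distrib, ← sum_div, hsum]
    simp only [sum_const, card_univ, nsmul_eq_mul, mul_one, ← hn]
    field_simp
    ring
  -- moments of the bounded part
  have hmom : ∀ e : ℝ, 0 < e → e ≤ 2 → ∑ x, (S f1 x) ^ e ≤ 5 * n * (a * m) ^ e := by
    intro e he he2
    have hτ : 0 < a * m := by positivity
    have h1 : ∑ x, (S f1 x) ^ 2 ≤ 4 * n * (a * m) ^ 2 := by
      refine (hS2 f1).trans ?_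
      have : ∑ x, (f1 x) ^ 2 ≤ ∑ _x : X, (2 * m) ^ 2 := by
        refine sum_le_sum fun x _ => ?_
        simp only [hf1]
        split_ifs with h
        · rw [zero_pow two_ne_zero]
          positivity
        · exact pow_le_pow_left₀ (hf x) (not_lt.1 h) 2
      rw [sum_const, card_univ, nsmul_eq_mul, ← hn] at this
      calc a ^ 2 * ∑ x, f1 x ^ 2 ≤ a ^ 2 * (n * (2 * m) ^ 2) := by gcongr
        _ = _ := by ring
    calc ∑ x, (S f1 x) ^ e
        ≤ ∑ x, ((a * m) ^ e + (a * m) ^ (e - 2) * (S f1 x) ^ 2) :=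
          sum_le_sum fun x _ => rpow_le_add_sq (hS0 _ _) hτ he he2
      _ = n * (a * m) ^ e + (a * m) ^ (e - 2) * ∑ x, (S f1 x) ^ 2 := by
          rw [sum_add_distrib, sum_const, card_univ, nsmul_eq_mul, ← hn,
            mul_sum]
      _ ≤ n * (a * m) ^ e + (a * m) ^ (e - 2) * (4 * n * (a * m) ^ 2) := by gcongr
      _ = n * (a * m) ^ e + 4 * n * ((a * m) ^ (e - 2) * (a * m) ^ (2 : ℝ)) := by
          rw [rpow_two]; ring
      _ = 5 * n * (a * m) ^ e := by
          rw [← rpow_add hτ]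
          ring_nf
  have hmom1 : ∑ x, S f1 x ≤ 5 * n * (a * m) := by
    simpa using hmom 1 one_pos one_le_two
  have hpoint : ∀ x, (m + S f x) ^ u ≤ m ^ u + u * (m ^ (u - 1) * S f1 x) +
      u * (m ^ u * (b * K) ^ v + (S f2 x / (b * K)) ^ u) + 2 * ((S f1 x) ^ u + (S f2 x) ^ u) := by
    intro x
    have h0 : S f x ≤ S f1 x + S f2 x := by
      conv_lhs => rw [hf12]
      exact hSadd _ _ _
    have h1 := hS0 f1 x
    have h2 := hS0 f2 x
    have h3 := add_rpow_le_taylor hm1 (add_nonneg h1 h2) hu hu2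
    have h4 : (m + S f x) ^ u ≤ (m + (S f1 x + S f2 x)) ^ u :=
      Real.rpow_le_rpow (add_nonneg hm0 (hS0 _ _)) (by linarith) hu0.le
    have h5 : (S f1 x + S f2 x) ^ u ≤ 2 * ((S f1 x) ^ u + (S f2 x) ^ u) := by
      have h6 := NNReal.rpow_add_le_mul_rpow_add_rpow ⟨_, h1⟩ ⟨_, h2⟩ hu.le
      have h7 : (S f1 x + S f2 x) ^ u ≤ 2 ^ (u - 1) * ((S f1 x) ^ u + (S f2 x) ^ u) := by
        exact_mod_cast h6
      refine h7.trans ?_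
      have h8 : (2 : ℝ) ^ (u - 1) ≤ 2 ^ (1 : ℝ) :=
        rpow_le_rpow_of_exponent_le one_le_two (by linarith)
      rw [rpow_one] at h8
      gcongr
    have h6 : m ^ (u - 1) * S f2 x ≤ m ^ u * (b * K) ^ v + (S f2 x / (b * K)) ^ u := by
      have h7 := Real.young_inequality_of_nonneg (a := m ^ (u - 1) * (b * K))
        (b := S f2 x / (b * K)) (by positivity) (by positivity) huv
      have h8 : m ^ (u - 1) * (b * K) * (S f2 x / (b * K)) = m ^ (u - 1) * S f2 x := by field_simp
      have h9 : (m ^ (u - 1) * (b * K)) ^ v = m ^ u * (b * K) ^ v := by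
        rw [mul_rpow (by positivity) (by positivity), ← rpow_mul hm0]
        congr 2
        have := huv.symm.sub_one_mul_conj
        exact this
      rw [h8, h9] at h7
      refine h7.trans (add_le_add ?_ ?_)
      · exact div_le_self (by positivity) huv.lt.le
      · exact div_le_self (by positivity) hu.le
    nlinarith
  have hS2u : ∑ x, (S f2 x) ^ u ≤ b ^ u * B := hSu f2
  have htot : ∑ x, (m + S f x) ^ u ≤ n * m ^ u + u * (m ^ (u - 1) * (5 * n * (a * m))) +
      u * (n * (m ^ u * (b * K) ^ v) + b ^ u * B / (b * K) ^ u) +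
      2 * (5 * n * (a * m) ^ u + b ^ u * B) := by
    refine (sum_le_sum fun x _ => hpoint x).trans ?_
    rw [sum_add_distrib, sum_add_distrib, sum_add_distrib, ← mul_sum,
      ← mul_sum, ← mul_sum, ← mul_sum, sum_add_distrib,
      sum_add_distrib, sum_const, sum_const, card_univ, nsmul_eq_mul,
      nsmul_eq_mul, ← hn]
    have h1 : ∑ x, (S f2 x / (b * K)) ^ u = (∑ x, (S f2 x) ^ u) / (b * K) ^ u := by
      rw [sum_div]
      exact sum_congr rfl fun x _ => div_rpow (hS0 _ _) (by positivity) _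
    rw [h1]
    have := hmom u hu0 hu2
    gcongr
  refine htot.trans ?_
  have e1 : m ^ (u - 1) * (5 * n * (a * m)) = 5 * a * (n * m ^ u) := by
    rw [rpow_sub_one hm1.ne']
    field_simp
  have e2 : b ^ u * B / (b * K) ^ u = c / (4 * u) * B := by
    rw [mul_rpow hb.le hK0.le, hKu]
    field_simp
  have e3 : (a * m) ^ u ≤ A ^ (u - 1) * a * m ^ u := by
    rw [mul_rpow ha.le hm0]
    have h1 : a ^ u = a ^ (u - 1) * a := by
      rw [rpow_sub_one ha.ne']
      field_simp
    rw [h1]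
    have : a ^ (u - 1) ≤ A ^ (u - 1) := Real.rpow_le_rpow ha.le haA (by linarith)
    gcongr
  have e4 : 2 * (b ^ u * B) ≤ 3 / 4 * c * B + 2 * A ^ u / (c * c1) * b ^ v * (c * B) := by
    rcases le_total (b ^ u) (3 / 8 * c) with h | h
    · have h1 : 0 ≤ 2 * A ^ u / (c * c1) * b ^ v * (c * B) := by positivity
      nlinarith
    · have h1 : c1 ≤ b ^ v := by
        have : c1 ≤ (b ^ u) ^ (v / u) := Real.rpow_le_rpow (by positivity) h (by positivity)
        rwa [← rpow_mul hb.le, mul_div_cancel₀ _ hu0.ne'] at this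
      have h2 : b ^ u ≤ A ^ u := Real.rpow_le_rpow hb.le hbA hu0.le
      have h3 : 2 * A ^ u / (c * c1) * b ^ v * (c * B) = 2 * A ^ u * B * (b ^ v / c1) := by
        field_simp
      have h4 : 1 ≤ b ^ v / c1 := (one_le_div hc1').2 h1
      have h5 : 2 * A ^ u * B * 1 ≤ 2 * A ^ u * B * (b ^ v / c1) := by gcongr
      have h6 : b ^ u * B ≤ A ^ u * B := by gcongr
      have h7 : 0 ≤ 3 / 4 * c * B := by positivity
      linarith
  have e5 : (b * K) ^ v = K ^ v * b ^ v := by rw [mul_rpow hb.le hK0.le]; ring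
  rw [e1, e2, e5]
  set P : ℝ := n * m ^ u with hP
  have hP0 : 0 ≤ P := by positivity
  set β : ℝ := b ^ v with hβ
  have hβ0 : 0 ≤ β := by positivity
  set D : ℝ := 2 * A ^ u / (c * c1) with hD
  have hD0 : 0 ≤ D := by positivity
  set E : ℝ := A ^ (u - 1) with hE
  have hE0 : 0 ≤ E := by positivity
  set k : ℝ := K ^ v with hk
  have hk0 : 0 ≤ k := by positivity
  have e6 : n * (a * m) ^ u ≤ E * a * P := by
    calc n * (a * m) ^ u ≤ n * (E * a * m ^ u) := by gcongr
      _ = _ := by rw [hP]; ring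
  have e7 : u * (c / (4 * u) * B) = c / 4 * B := by field_simp
  have e8 : n * (m ^ u * (k * β)) = k * β * P := by rw [hP]; ring
  rw [e8]
  have hC : (1 + (5 * u + u * k + 10 * E + D) * (a + β)) * (P + c * B) ≤
      (1 + (5 * u + u * k + 10 * E + D) * (a + β)) * ∑ x, f x ^ u := by gcongr
  refine le_trans ?_ hC
  have e9 : u * (k * β * P + c / (4 * u) * B) = u * k * β * P + c / 4 * B := by
    rw [mul_add, e7]
    ring
  rw [e9]
  refine le_trans (le_of_eq ?_) (mean_add_algebra (q := 5 * n * (a * m) ^ u)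
    (w := 2 * (b ^ u * B)) hu0.le hk0 hE0 hD0 ha.le hβ0 hP0 (mul_nonneg hc0.le hB0)
    (by linarith) (by linarith))
  ring

lemma sum_sq_conv_le {X : Type*} [Fintype X] [AddCommGroup X] (k f : X → ℂ) :
    ∑ x, ‖∑ y, k y * f (x - y)‖ ^ 2 ≤
      (∑ w, ‖∑ y, k (y + w) * (starRingEnd ℂ) (k y)‖) * ∑ x, ‖f x‖ ^ 2 := by
  set K : X → ℂ := fun w => ∑ y, k (y + w) * (starRingEnd ℂ) (k y) with hK
  have h1 : ∀ x, ∑ y, k y * f (x - y) = ∑ z, k (x - z) * f z := fun x =>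
    sum_equiv (Equiv.subLeft x) _ _ fun y => by simp
  have h2 : ((∑ x, ‖∑ y, k y * f (x - y)‖ ^ 2 : ℝ) : ℂ) =
      ∑ z, ∑ z', f z * (starRingEnd ℂ) (f z') * K (z' - z) := by
    have h3 : ∀ x, ((‖∑ y, k y * f (x - y)‖ ^ 2 : ℝ) : ℂ) = ∑ z, ∑ z',
        f z * (starRingEnd ℂ) (f z') * (k (x - z) * (starRingEnd ℂ) (k (x - z'))) := by
      intro x
      rw [h1 x]
      push_cast
      rw [← Complex.mul_conj', map_sum, sum_mul_sum]
      refine sum_congr rfl fun z _ => sum_congr rfl fun z' _ => ?_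
      rw [map_mul]
      ring
    push_cast at h3 ⊢
    simp only [h3]
    rw [sum_comm]
    refine sum_congr rfl fun z _ => ?_
    rw [sum_comm]
    refine sum_congr rfl fun z' _ => ?_
    rw [← mul_sum]
    congr 1
    refine sum_equiv (Equiv.subRight z') _ _ fun x => ?_
    simp
  have h4 : ∑ x, ‖∑ y, k y * f (x - y)‖ ^ 2 =
      ‖∑ z, ∑ z', f z * (starRingEnd ℂ) (f z') * K (z' - z)‖ := by
    rw [← h2, norm_real, norm_of_nonneg]
    exact sum_nonneg fun x _ => by positivity
  rw [h4]
  have h5 : ∑ z, ∑ z', ‖K (z' - z)‖ * ‖f z‖ ^ 2 = (∑ w, ‖K w‖) * ∑ x, ‖f x‖ ^ 2 := by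
    rw [mul_sum]
    refine sum_congr rfl fun z _ => ?_
    rw [← sum_mul]
    congr 1
    exact sum_equiv (Equiv.subRight z) _ _ fun x => by simp
  have h6 : ∑ z, ∑ z', ‖K (z' - z)‖ * ‖f z'‖ ^ 2 = (∑ w, ‖K w‖) * ∑ x, ‖f x‖ ^ 2 := by
    rw [sum_comm, mul_sum]
    refine sum_congr rfl fun z _ => ?_
    rw [← sum_mul]
    congr 1
    exact sum_equiv (Equiv.subLeft z) _ _ fun x => by simp
  calc ‖∑ z, ∑ z', f z * (starRingEnd ℂ) (f z') * K (z' - z)‖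
      ≤ ∑ z, ∑ z', ‖f z * (starRingEnd ℂ) (f z') * K (z' - z)‖ :=
        (norm_sum_le _ _).trans (sum_le_sum fun z _ => norm_sum_le _ _)
    _ ≤ ∑ z, ∑ z', (‖K (z' - z)‖ * ‖f z‖ ^ 2 / 2 + ‖K (z' - z)‖ * ‖f z'‖ ^ 2 / 2) := by
        refine sum_le_sum fun z _ => sum_le_sum fun z' _ => ?_
        rw [norm_mul, norm_mul, RCLike.norm_conj]
        have h7 := two_mul_le_add_sq ‖f z‖ ‖f z'‖
        have h8 := norm_nonneg (K (z' - z))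
        nlinarith
    _ = (∑ w, ‖K w‖) * ∑ x, ‖f x‖ ^ 2 := by
        simp only [sum_add_distrib, ← sum_div]
        rw [h5, h6]
        ring

/-- The kernel of the frequency `a` in the spherical averages modulo `m`. -/
def locK (a : ZMod m) (y : Γ d m) : ℂ :=
  ∏ i, ((m : ℂ)⁻¹ * stdAddChar (a * y i ^ 2))

def locOp (a : ZMod m) (f : Γ d m → ℂ) (x : Γ d m) : ℂ :=
  ∑ y, locK a y * f (x - y)

lemma norm_stdAddChar (j : ZMod m) : ‖stdAddChar j‖ = 1 := by
  rw [ZMod.stdAddChar_apply]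
  exact Circle.norm_coe _

lemma norm_locK (a : ZMod m) (y : Γ d m) :
    ‖locK a y‖ = ((m : ℝ)⁻¹) ^ d := by
  simp [locK, norm_prod]

lemma card_mul_eq_zero (a : ZMod m) :
    (univ.filter fun w : ZMod m => a * w = 0).card * addOrderOf a = m := by
  have h1 := (AddMonoidHom.mulLeft a).ker.card_mul_index
  rw [AddSubgroup.index_ker] at h1
  have h2 : (AddMonoidHom.mulLeft a).range = AddSubgroup.zmultiples a := by
    ext x
    simp only [AddMonoidHom.mem_range, AddMonoidHom.coe_mulLeft, AddSubgroup.mem_zmultiples_iff]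
    constructor
    · rintro ⟨y, rfl⟩
      exact ⟨y.val, by simp [mul_comm]⟩
    · rintro ⟨k, rfl⟩
      exact ⟨(k : ZMod m), by simp [mul_comm]⟩
  have h3 : Nat.card (AddMonoidHom.mulLeft a).ker =
      (univ.filter fun w : ZMod m => a * w = 0).card := by
    rw [Nat.card_eq_fintype_card, Fintype.card_subtype]
    congr 1
    ext w
    simp [AddMonoidHom.mem_ker]
  rw [h2, Nat.card_zmultiples, h3, Nat.card_eq_fintype_card, ZMod.card] at h1
  exact h1

lemma card_two_mul_mul_eq_zero_le (a : ZMod m) :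
    ((univ.filter fun w : ZMod m => 2 * a * w = 0).card : ℝ) / m ≤ 2 / addOrderOf a := by
  have hm : (0 : ℝ) < m := mod_cast Nat.pos_of_ne_zero (NeZero.ne m)
  have h0 : 0 < addOrderOf a := addOrderOf_pos a
  have h0' : (0 : ℝ) < addOrderOf a := mod_cast h0
  have h1 := card_mul_eq_zero (2 * a)
  have h2 : addOrderOf a ∣ 2 * addOrderOf (2 * a) := by
    rw [addOrderOf_dvd_iff_nsmul_eq_zero, mul_nsmul]
    have := addOrderOf_nsmul_eq_zero (2 * a)
    rwa [two_nsmul, ← two_mul]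
  have h4 : 0 < addOrderOf (2 * a) := addOrderOf_pos _
  have h3 : addOrderOf a ≤ 2 * addOrderOf (2 * a) := le_of_dvd (by omega) h2
  rw [div_le_div_iff₀ hm h0']
  set c := (univ.filter fun w : ZMod m => 2 * a * w = 0).card
  have : c * addOrderOf a ≤ 2 * m := by
    calc c * addOrderOf a ≤ c * (2 * addOrderOf (2 * a)) := Nat.mul_le_mul_left _ h3
      _ = 2 * (c * addOrderOf (2 * a)) := by ring
      _ = 2 * m := by rw [h1]
  exact_mod_cast this

lemma sum_locK_autocorr (a : ZMod m) :
    ∑ w : Γ d m, ‖∑ y, locK a (y + w) * (starRingEnd ℂ) (locK a y)‖ =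
      (((univ.filter fun w : ZMod m => 2 * a * w = 0).card : ℝ) / m) ^ d := by
  have hm : (m : ℝ) ≠ 0 := mod_cast NeZero.ne m
  have h1 : ∀ w : ZMod m, ‖∑ b : ZMod m, (m : ℂ)⁻¹ * stdAddChar (a * (b + w) ^ 2) *
      (starRingEnd ℂ) ((m : ℂ)⁻¹ * stdAddChar (a * b ^ 2))‖ =
      if 2 * a * w = 0 then (m : ℝ)⁻¹ else 0 := by
    intro w
    have h2 : ∀ b : ZMod m, (m : ℂ)⁻¹ * stdAddChar (a * (b + w) ^ 2) *
        (starRingEnd ℂ) ((m : ℂ)⁻¹ * stdAddChar (a * b ^ 2)) =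
        (m : ℂ)⁻¹ * (m : ℂ)⁻¹ * stdAddChar (a * w ^ 2) *
          stdAddChar (b * (2 * a * w)) := by
      intro b
      rw [map_mul (starRingEnd ℂ), ← AddChar.map_neg_eq_conj, map_inv₀, Complex.conj_natCast]
      have : stdAddChar (a * (b + w) ^ 2) * stdAddChar (-(a * b ^ 2)) =
          stdAddChar (a * w ^ 2) * stdAddChar (b * (2 * a * w)) := by
        rw [← AddChar.map_add_eq_mul, ← AddChar.map_add_eq_mul]
        congr 1
        ring
      linear_combination (m : ℂ)⁻¹ * (m : ℂ)⁻¹ * this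
    simp only [h2]
    rw [← mul_sum, AddChar.sum_mulShift _ (ZMod.isPrimitive_stdAddChar m), norm_mul, norm_mul,
      norm_mul, norm_stdAddChar, norm_inv, Complex.norm_natCast, ZMod.card]
    split_ifs with h
    · rw [Complex.norm_natCast]
      field_simp
    · simp
  have h3 : ∀ w : Γ d m, ‖∑ y, locK a (y + w) * (starRingEnd ℂ) (locK a y)‖ =
      ∏ i, if 2 * a * w i = 0 then (m : ℝ)⁻¹ else 0 := by
    intro w
    have : ∑ y : Γ d m, locK a (y + w) * (starRingEnd ℂ) (locK a y) =
        ∏ i, ∑ b : ZMod m, (m : ℂ)⁻¹ * stdAddChar (a * (b + w i) ^ 2) *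
          (starRingEnd ℂ) ((m : ℂ)⁻¹ * stdAddChar (a * b ^ 2)) := by
      rw [prod_univ_sum, piFinset_univ]
      refine sum_congr rfl fun y _ => ?_
      rw [locK, locK, map_prod, ← prod_mul_distrib]
      rfl
    rw [this, norm_prod]
    exact prod_congr rfl fun i _ => h1 (w i)
  simp only [h3]
  have h4 := prod_univ_sum (fun _ : Fin d => (univ : Finset (ZMod m)))
    (fun _ b => if 2 * a * b = 0 then (m : ℝ)⁻¹ else 0)
  rw [piFinset_univ] at h4
  rw [← h4]
  simp only [prod_const, card_univ, card_fin]
  congr 1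
  rw [← sum_filter, sum_const, nsmul_eq_mul, div_eq_mul_inv]

lemma sum_sq_locOp_le (a : ZMod m) (f : Γ d m → ℂ) :
    ∑ x, ‖locOp a f x‖ ^ 2 ≤ (2 / (addOrderOf a : ℝ)) ^ d * ∑ x, ‖f x‖ ^ 2 := by
  refine (sum_sq_conv_le (locK a) f).trans ?_
  rw [sum_locK_autocorr]
  have := card_two_mul_mul_eq_zero_le a
  gcongr

lemma sum_locOp_le (a : ZMod m) (f : Γ d m → ℂ) :
    ∑ x, ‖locOp a f x‖ ≤ ∑ x, ‖f x‖ := by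
  have hm : (m : ℝ) ≠ 0 := mod_cast NeZero.ne m
  have h1 : ∀ x, ‖locOp a f x‖ ≤ ((m : ℝ)⁻¹) ^ d * ∑ y, ‖f y‖ := by
    intro x
    refine (norm_sum_le _ _).trans ?_
    simp only [norm_mul, norm_locK]
    rw [← mul_sum]
    refine le_of_eq ?_
    congr 1
    exact sum_equiv (Equiv.subLeft x) _ _ fun y => by simp
  refine (sum_le_sum fun x _ => h1 x).trans (le_of_eq ?_)
  rw [sum_const, card_univ, card_pi, nsmul_eq_mul]
  simp only [ZMod.card, prod_const, card_univ, card_fin]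
  push_cast
  rw [← mul_assoc, ← mul_pow, mul_inv_cancel₀ hm, one_pow, one_mul]

lemma card_addOrderOf_eq_le {q : ℕ} (hq : 0 < q) :
    (univ.filter fun a : ZMod m => addOrderOf a = q).card ≤ q := by
  refine le_trans (card_le_card fun a ha => ?_)
    (IsAddCyclic.card_nsmul_eq_zero_le (α := ZMod m) (n := q) hq)
  simp only [mem_filter, mem_univ, true_and] at ha ⊢
  rw [← ha]
  exact addOrderOf_nsmul_eq_zero a

lemma sum_rpow_sum_le {X ι : Type*} [Fintype X] {u F : ℝ} (hu : 1 ≤ u) (hF : 0 ≤ F)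
    (I : Finset ι) (f : ι → X → ℝ) (B : ι → ℝ) (hB : ∀ i ∈ I, 0 ≤ B i)
    (h : ∀ i ∈ I, ∑ x, |f i x| ^ u ≤ B i ^ u * F) :
    ∑ x, |∑ i ∈ I, f i x| ^ u ≤ (∑ i ∈ I, B i) ^ u * F := by
  classical
  have hu0 : 0 < u := by linarith
  have key : (∑ x, |∑ i ∈ I, f i x| ^ u) ^ (1 / u) ≤ (∑ i ∈ I, B i) * F ^ (1 / u) := by
    induction I using induction_on with
    | empty => simp [zero_rpow hu0.ne', zero_rpow (inv_pos.2 hu0).ne']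
    | insert i I hi ih =>
      have h1 := ih (fun j hj => hB j (Finset.mem_insert_of_mem hj))
        (fun j hj => h j (Finset.mem_insert_of_mem hj))
      have h2 : (∑ x, |f i x| ^ u) ^ (1 / u) ≤ B i * F ^ (1 / u) := by
        have hb := hB i (Finset.mem_insert_self _ _)
        have := Real.rpow_le_rpow (by positivity) (h i (Finset.mem_insert_self _ _))
          (by positivity : 0 ≤ 1 / u)
        rwa [mul_rpow (by positivity) hF, ← rpow_mul hb, mul_one_div_cancel hu0.ne',
          rpow_one] at this
      have h3 := Real.Lp_add_le univ (f i) (fun x => ∑ j ∈ I, f j x) hu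
      simp only [sum_insert hi]
      linarith
  have hBs : 0 ≤ ∑ i ∈ I, B i := sum_nonneg hB
  have := Real.rpow_le_rpow (by positivity) key hu0.le
  rwa [← rpow_mul (by positivity), one_div_mul_cancel hu0.ne', rpow_one,
    mul_rpow hBs (by positivity), ← rpow_mul hF, one_div_mul_cancel hu0.ne',
    rpow_one] at this

lemma sum_rpow_addOrderOf_le {s : ℝ} (T : Finset (ZMod m)) (T' : Finset ℕ)
    (h : ∀ a ∈ T, addOrderOf a ∈ T') :
    ∑ a ∈ T, (addOrderOf a : ℝ) ^ (-s) ≤ ∑ q ∈ T', (q : ℝ) ^ (1 - s) := by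
  rw [← Finset.sum_fiberwise_of_maps_to h]
  refine sum_le_sum fun q _ => ?_
  rcases Nat.eq_zero_or_pos q with rfl | hq
  · rw [sum_eq_zero]
    · positivity
    · intro a ha
      exact absurd (mem_filter.1 ha).2 (addOrderOf_pos a).ne'
  have hq' : (0 : ℝ) < q := mod_cast hq
  rw [sum_congr rfl (g := fun _ => (q : ℝ) ^ (-s))
    (fun a ha => by rw [(mem_filter.1 ha).2]), sum_const, nsmul_eq_mul]
  have h1 : ((T.filter fun a => addOrderOf a = q).card : ℝ) ≤ q := by
    exact_mod_cast (card_le_card (Finset.filter_subset_filter _ (Finset.subset_univ T))).trans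
      (card_addOrderOf_eq_le hq)
  calc _ ≤ (q : ℝ) * (q : ℝ) ^ (-s) := by gcongr
    _ = (q : ℝ) ^ (1 - s) := by
      rw [sub_eq_add_neg, rpow_add hq', rpow_one]

lemma sum_rpow_addOrderOf_prime_pow_le {p K : ℕ} (hp : p.Prime) [NeZero (p ^ K)] {s : ℝ}
    (hs : 1 < s) :
    ∑ a : ZMod (p ^ K) with a ≠ 0, (addOrderOf a : ℝ) ^ (-s) ≤
      (1 - (2 : ℝ) ^ (1 - s))⁻¹ * (p : ℝ) ^ (1 - s) := by
  have hp2 : (2 : ℝ) ≤ p := mod_cast hp.two_le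
  have hinj : Function.Injective fun i : ℕ => p ^ (i + 1) := fun i j h => by
    have := Nat.pow_right_injective hp.two_le h
    simpa using this
  have h1 := sum_rpow_addOrderOf_le (s := s) (univ.filter fun a : ZMod (p ^ K) => a ≠ 0)
    ((range K).map ⟨fun i => p ^ (i + 1), hinj⟩) (by
      intro a ha
      have ha0 := (mem_filter.1 ha).2
      have h2 : addOrderOf a ∣ p ^ K := by
        rw [addOrderOf_dvd_iff_nsmul_eq_zero, nsmul_eq_mul, CharP.cast_eq_zero, zero_mul]
      obtain ⟨i, hi, h3⟩ := (Nat.dvd_prime_pow hp).1 h2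
      have : i ≠ 0 := by
        rintro rfl
        rw [pow_zero, AddMonoid.addOrderOf_eq_one_iff] at h3
        exact ha0 h3
      rw [Finset.mem_map]
      exact ⟨i - 1, mem_range.2 (by omega), by
        simp only [coeFn_mk]; rw [h3]; congr 1; omega⟩)
  refine h1.trans ?_
  rw [Finset.sum_map]
  set x : ℝ := (p : ℝ) ^ (1 - s) with hx
  have hx0 : 0 < x := by positivity
  have hx2 : x ≤ (2 : ℝ) ^ (1 - s) := rpow_le_rpow_of_nonpos (by norm_num) hp2 (by linarith)
  have h21 : (2 : ℝ) ^ (1 - s) < 1 :=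
    Real.rpow_lt_one_of_one_lt_of_neg (by norm_num) (by linarith)
  have h4 : ∀ i ∈ range K, (((⟨fun i => p ^ (i + 1), hinj⟩ : ℕ ↪ ℕ) i : ℕ) : ℝ) ^ (1 - s) =
      x * x ^ i := by
    intro i _
    simp only [coeFn_mk]
    rw [← pow_succ', hx]
    push_cast
    rw [← rpow_natCast, ← rpow_natCast, ← rpow_mul (by positivity),
      ← rpow_mul (by positivity), mul_comm]
  rw [sum_congr rfl h4, ← mul_sum, mul_comm]
  gcongr
  have hx1 : x < 1 := by linarith
  have h5 : ∑ i ∈ range K, x ^ i ≤ (1 - x)⁻¹ := by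
    rw [← tsum_geometric_of_lt_one hx0.le hx1]
    exact (summable_geometric_of_lt_one hx0.le hx1).sum_le_tsum _ fun i _ => by positivity
  refine h5.trans ?_
  gcongr

lemma locOp_add (a : ZMod m) (f g : Γ d m → ℂ)
    (x : Γ d m) : locOp a (f + g) x = locOp a f x + locOp a g x := by
  simp [locOp, mul_add, sum_add_distrib]

lemma exists_sum_locOp_rpow_le {u v : ℝ} (hu : 1 < u) (hu2 : u < 2) (huv : v.HolderConjugate u) :
    ∃ C : ℝ, 0 < C ∧ ∀ {d m : ℕ} [NeZero m] (a : ZMod m) (f : Γ d m → ℂ),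
      ∑ x, ‖locOp a f x‖ ^ u ≤ (C * (2 / (addOrderOf a : ℝ)) ^ (d / v)) ^ u * ∑ x, ‖f x‖ ^ u := by
  have hu0 : 0 < u := by linarith
  have hm := mC_pos one_pos hu hu2
  refine ⟨mC 1 u 2 ^ (1 / u), by positivity, fun {d m} _ a f => ?_⟩
  have ho : (0 : ℝ) < addOrderOf a := mod_cast addOrderOf_pos a
  have hA1 : 0 < (2 / (addOrderOf a : ℝ)) ^ ((d : ℝ) / 2) := by positivity
  have conv0 : ∀ {q A : ℝ} (hq : 0 < q) (hA : 0 ≤ A) (g : Γ d m → ℂ),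
      nP q (fun x => ((‖locOp a g x‖₊ : ℝ≥0) : ℝ≥0∞)) ≤ ofReal A * nP q (fun x => ‖g x‖ₑ) ↔
      ∑ x, ‖locOp a g x‖ ^ q ≤ A ^ q * ∑ x, ‖g x‖ ^ q := by
    intro q A hq hA g
    rw [nP_le_iff hq hA, tsum_fintype, tsum_fintype]
    have h1 : ∀ x, ((‖locOp a g x‖₊ : ℝ≥0) : ℝ≥0∞) ^ q = ofReal (‖locOp a g x‖ ^ q) :=
      fun x => coe_rpow_eq hq.le
    have h2 : ∀ x, ‖g x‖ₑ ^ q = ofReal (‖g x‖ ^ q) := fun x => enorm_rpow_eq hq.le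
    simp only [h1, h2]
    rw [← ofReal_sum_of_nonneg (fun x _ => by positivity),
      ← ofReal_sum_of_nonneg (fun x _ => by positivity),
      ← ofReal_mul (by positivity), ENNReal.ofReal_le_ofReal_iff (by positivity)]
  have key := nP_interp one_pos hu hu2 one_pos hA1
    (fun (g : Γ d m → ℂ) x => ‖locOp a g x‖₊)
    (fun g g' _ _ x => by
      rw [locOp_add]
      exact nnnorm_add_le _ _)
    (fun g _ => by
      rw [conv0 one_pos zero_le_one]
      simpa using sum_locOp_le a g)
    (fun g _ => by
      rw [conv0 two_pos hA1.le]
      have h1 := sum_sq_locOp_le a g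
      have h2 : ((2 / (addOrderOf a : ℝ)) ^ ((d : ℝ) / 2)) ^ (2 : ℝ) = (2 / (addOrderOf a : ℝ)) ^ d := by
        rw [← rpow_mul (by positivity), div_mul_cancel₀ _ (by norm_num), rpow_natCast]
      rw [h2]
      exact_mod_cast h1) rfl f (Set.toFinite _)
  rw [conv0 hu0 (by positivity)] at key
  convert key using 4
  rw [one_rpow, one_mul, ← rpow_mul (by positivity)]
  congr 1
  have h := huv.inv_add_inv_eq_one
  have h3 : v⁻¹ = 1 - u⁻¹ := by linarith
  rw [div_eq_mul_inv, h3]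
  field_simp
  ring

/-- The spherical averages of level `N` over a finite commutative ring. -/
def locAvg {R : Type} [CommRing R] [Fintype R] [DecidableEq R] (N : R)
    (f : (Fin d → R) → ℝ≥0∞) (x : Fin d → R) : ℝ≥0∞ :=
  (card R : ℝ≥0∞) * ((card R : ℝ≥0∞) ^ d)⁻¹ *
    ∑ y, if ∑ i, y i ^ 2 = N then f (x - y) else 0

lemma addChar_map_sum {ι A M : Type*} [AddCommMonoid A] [CommMonoid M] (ψ : AddChar A M)
    (s : Finset ι) (f : ι → A) : ψ (∑ i ∈ s, f i) = ∏ i ∈ s, ψ (f i) :=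
  map_prod ψ.toMonoidHom (fun i => Multiplicative.ofAdd (f i)) s

lemma locK_eq (a : ZMod m) (y : Γ d m) :
    locK a y = ((m : ℂ)⁻¹) ^ d * stdAddChar (a * ∑ i, y i ^ 2) := by
  rw [locK, prod_mul_distrib, prod_const, card_univ, card_fin,
    mul_sum, addChar_map_sum]

lemma sum_stdAddChar_mul (t : ZMod m) :
    ∑ a : ZMod m, stdAddChar (a * t) = if t = 0 then (m : ℂ) else 0 := by
  rw [AddChar.sum_mulShift _ (ZMod.isPrimitive_stdAddChar m), ZMod.card]
  split_ifs <;> simp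

lemma locAvg_real_eq (N : ZMod m) (g : Γ d m → ℝ)
    (x : Γ d m) :
    (((m : ℝ) * ((m : ℝ) ^ d)⁻¹ * ∑ y, if ∑ i, y i ^ 2 = N then g (x - y) else 0 : ℝ) : ℂ) =
      ∑ a : ZMod m, stdAddChar (-(a * N)) * locOp a (fun y => (g y : ℂ)) x := by
  have h1 : ∀ a : ZMod m, stdAddChar (-(a * N)) * locOp a (fun y => (g y : ℂ)) x =
      ∑ y, ((m : ℂ)⁻¹) ^ d * (g (x - y) : ℂ) * stdAddChar (a * (∑ i, y i ^ 2 - N)) := by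
    intro a
    rw [locOp, mul_sum]
    refine sum_congr rfl fun y _ => ?_
    have : a * (∑ i, y i ^ 2 - N) = -(a * N) + a * ∑ i, y i ^ 2 := by ring
    rw [locK_eq, this, AddChar.map_add_eq_mul]
    ring
  simp only [h1]
  rw [sum_comm]
  simp only [← mul_sum, sum_stdAddChar_mul, sub_eq_zero]
  push_cast
  rw [mul_sum]
  refine sum_congr rfl fun y _ => ?_
  split_ifs
  · rw [inv_pow]; ring
  · simp

lemma locAvg_real_le (N : ZMod m) (g : Γ d m → ℝ)
    (x : Γ d m) :
    (m : ℝ) * ((m : ℝ) ^ d)⁻¹ * ∑ y, (if ∑ i, y i ^ 2 = N then g (x - y) else 0) ≤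
      (card Γ d m : ℝ)⁻¹ * ∑ y, g y +
        ∑ a : ZMod m with a ≠ 0, ‖locOp a (fun y => (g y : ℂ)) x‖ := by
  have h1 := locAvg_real_eq N g x
  have h0 : locOp 0 (fun y => (g y : ℂ)) x =
      (((card Γ d m : ℝ)⁻¹ * ∑ y, g y : ℝ) : ℂ) := by
    rw [locOp, card_pi]
    simp only [locK_eq, zero_mul, AddChar.map_zero_eq_one, mul_one, ← mul_sum, ZMod.card,
      prod_const, card_univ, card_fin]
    push_cast
    rw [inv_pow]
    congr 1
    exact sum_equiv (Equiv.subLeft x) _ _ fun y => by simp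
  rw [← add_sum_erase _ _ (mem_univ (0 : ZMod m)), zero_mul, neg_zero,
    AddChar.map_zero_eq_one, one_mul, h0, ← sub_eq_iff_eq_add'] at h1
  rw [← sub_le_iff_le_add']
  refine (le_abs_self _).trans ?_
  rw [← norm_eq_abs, ← norm_real, ofReal_sub, h1]
  refine (norm_sum_le _ _).trans (le_of_eq ?_)
  rw [Finset.filter_ne']
  exact sum_congr rfl fun a _ => by rw [norm_mul, norm_stdAddChar, one_mul]

/-- The maximal function of the spherical averages over the ring `R` is bounded on `L^u`,
with constant `B` in power form. -/
def LocBd (d : ℕ) (u : ℝ) (R : Type) [CommRing R] [Fintype R] [DecidableEq R] (B : ℝ≥0∞) : Prop :=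
  ∀ f : (Fin d → R) → ℝ≥0∞, ∑ x, (⨆ N, locAvg N f x) ^ u ≤ B * ∑ x, f x ^ u

lemma locAvg_comp_ringEquiv {R S : Type} [CommRing R] [Fintype R] [DecidableEq R]
    [CommRing S] [Fintype S] [DecidableEq S] (e : R ≃+* S) (N : R) (f : (Fin d → S) → ℝ≥0∞)
    (x : Fin d → R) :
    locAvg N (fun y => f (fun i => e (y i))) x = locAvg (e N) f (fun i => e (x i)) := by
  rw [locAvg, locAvg, Fintype.card_congr e.toEquiv]
  congr 1
  refine sum_equiv (Equiv.arrowCongr (Equiv.refl _) e.toEquiv) _ _ fun y => ?_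
  have h1 : (∑ i, y i ^ 2 = N) ↔
      ∑ i, (Equiv.arrowCongr (Equiv.refl (Fin d)) e.toEquiv y) i ^ 2 = e N := by
    rw [← e.injective.eq_iff, map_sum]
    simp
  have h2 : (fun i => e ((x - y) i)) =
      (fun i => e (x i)) - Equiv.arrowCongr (Equiv.refl (Fin d)) e.toEquiv y := by
    ext i
    simp
  simp only [h1, h2]

lemma LocBd.ringEquiv {u : ℝ} {R S : Type} [CommRing R] [Fintype R] [DecidableEq R]
    [CommRing S] [Fintype S] [DecidableEq S] (e : R ≃+* S) {B : ℝ≥0∞} (h : LocBd d u R B) :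
    LocBd d u S B := by
  intro f
  have h1 := h fun y => f fun i => e (y i)
  have h2 : ∀ F : (Fin d → S) → ℝ≥0∞, ∑ x : Fin d → R, F (fun i => e (x i)) = ∑ x, F x := fun F =>
    sum_equiv (Equiv.arrowCongr (Equiv.refl _) e.toEquiv) _ _ fun y => rfl
  rw [h2 fun y => f y ^ u] at h1
  refine le_trans (le_of_eq ?_) h1
  rw [← h2 fun x => (⨆ N, locAvg N f x) ^ u]
  refine sum_congr rfl fun x _ => ?_
  congr 1
  simp only [locAvg_comp_ringEquiv]
  exact (e.toEquiv.iSup_comp (g := fun N => locAvg N f fun i => e (x i))).symm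

lemma locAvg_prod {R S : Type} [CommRing R] [Fintype R] [DecidableEq R]
    [CommRing S] [Fintype S] [DecidableEq S] (N : R × S) (f : (Fin d → R × S) → ℝ≥0∞)
    (x : (Fin d → R) × (Fin d → S)) :
    locAvg N f (fun i => (x.1 i, x.2 i)) =
      locAvg N.1 (fun a => locAvg N.2 (fun b => f fun i => (a i, b i)) x.2) x.1 := by
  have hc : (card (R × S) : ℝ≥0∞) * ((card (R × S) : ℝ≥0∞) ^ d)⁻¹ =
      (card R : ℝ≥0∞) * ((card R : ℝ≥0∞) ^ d)⁻¹ *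
        ((card S : ℝ≥0∞) * ((card S : ℝ≥0∞) ^ d)⁻¹) := by
    rw [Fintype.card_prod]
    push_cast
    rw [mul_pow, ENNReal.mul_inv (Or.inr (pow_ne_top (natCast_ne_top _)))
      (Or.inl (pow_ne_top (natCast_ne_top _)))]
    ring
  rw [locAvg, hc, locAvg, mul_assoc]
  congr 1
  rw [← (Equiv.arrowProdEquivProdArrow (Fin d) (fun _ => R) (fun _ => S)).symm.sum_comp,
    Fintype.sum_prod_type, mul_sum]
  refine sum_congr rfl fun a _ => ?_
  have h1 : ∀ b : Fin d → S, (∑ i, ((Equiv.arrowProdEquivProdArrow (Fin d) (fun _ => R)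
      (fun _ => S)).symm (a, b)) i ^ 2 = N) ↔ (∑ i, a i ^ 2 = N.1 ∧ ∑ i, b i ^ 2 = N.2) := by
    intro b
    rw [Prod.ext_iff, Prod.fst_sum, Prod.snd_sum]
    rfl
  simp only [h1]
  by_cases ha : ∑ i, a i ^ 2 = N.1
  · rw [if_pos ha, locAvg]
    congr 1
    refine sum_congr rfl fun b _ => ?_
    simp only [ha, true_and]
    rfl
  · simp [ha]

lemma locAvg_mono {R : Type} [CommRing R] [Fintype R] [DecidableEq R] (N : R)
    {f g : (Fin d → R) → ℝ≥0∞} (h : ∀ y, f y ≤ g y) (x : Fin d → R) :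
    locAvg N f x ≤ locAvg N g x := by
  unfold locAvg
  gcongr with y
  split_ifs
  · exact h _
  · exact le_rfl

lemma LocBd.prod {u : ℝ} (hu : 0 ≤ u) {R S : Type} [CommRing R] [Fintype R] [DecidableEq R]
    [CommRing S] [Fintype S] [DecidableEq S] {A B : ℝ≥0∞} (hR : LocBd d u R A)
    (hS : LocBd d u S B) : LocBd d u (R × S) (A * B) := by
  intro f
  set e := (Equiv.arrowProdEquivProdArrow (Fin d) (fun _ => R) (fun _ => S)).symm with he
  rw [← e.sum_comp, ← e.sum_comp, Fintype.sum_prod_type_right, Fintype.sum_prod_type]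
  set H : (Fin d → R) → (Fin d → S) → ℝ≥0∞ := fun a b =>
    ⨆ N : S, locAvg N (fun b => f fun i => (a i, b i)) b with hH
  calc ∑ b, ∑ a, (⨆ N, locAvg N f (e (a, b))) ^ u
      ≤ ∑ b, ∑ a, (⨆ N, locAvg N (fun a => H a b) a) ^ u := by
        refine sum_le_sum fun b _ => sum_le_sum fun a _ => ?_
        refine rpow_le_rpow (iSup_le fun N => ?_) hu
        refine le_trans ?_ (le_iSup (fun N => locAvg N (fun a => H a b) a) N.1)
        refine (locAvg_prod N f (a, b)).le.trans ?_
        exact locAvg_mono _ (fun y => le_iSup (fun N => locAvg N (fun b => f fun i => (y i, b i)) b)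
          N.2) _
    _ ≤ ∑ b, A * ∑ a, H a b ^ u := sum_le_sum fun b _ => hR _
    _ = A * ∑ a, ∑ b, H a b ^ u := by rw [← mul_sum, sum_comm]
    _ ≤ A * ∑ a : Fin d → R, B * ∑ b : Fin d → S, f (fun i => (a i, b i)) ^ u := by
        refine mul_le_mul_right (sum_le_sum fun a _ => hS _) A
    _ = A * B * ∑ a, ∑ b, f (e (a, b)) ^ u := by
        rw [← mul_sum, mul_assoc]
        rfl

lemma locBd_of_real {u : ℝ} (hu : 0 < u) {B : ℝ} (hB : 0 < B)
    (h : ∀ f : Γ d m → ℝ, (∀ x, 0 ≤ f x) →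
      ∑ x, ((card Γ d m : ℝ)⁻¹ * ∑ y, f y +
        ∑ a : ZMod m with a ≠ 0, ‖locOp a (fun y => (f y : ℂ)) x‖) ^ u ≤ B * ∑ x, f x ^ u) :
    LocBd d u (ZMod m) (ofReal B) := by
  intro f
  by_cases hf : ∃ x, f x = ⊤
  · obtain ⟨x, hx⟩ := hf
    have : ∑ x, f x ^ u = ⊤ := by
      rw [ENNReal.sum_eq_top]
      exact ⟨x, mem_univ _, by rw [hx, ENNReal.top_rpow_of_pos hu]⟩
    rw [this, mul_top (by simpa using hB)]
    exact le_top
  push Not at hf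
  have hg : ∀ x, f x = ofReal (f x).toReal := fun x => (ENNReal.ofReal_toReal (hf x)).symm
  set g : Γ d m → ℝ := fun x => (f x).toReal with hgdef
  have hg0 : ∀ x, 0 ≤ g x := fun x => toReal_nonneg
  have hm : (0 : ℝ) < m := mod_cast Nat.pos_of_ne_zero (NeZero.ne m)
  have h1 : ∀ x N, locAvg N f x ≤ ofReal ((card Γ d m : ℝ)⁻¹ * ∑ y, g y +
        ∑ a : ZMod m with a ≠ 0, ‖locOp a (fun y => (g y : ℂ)) x‖) := by
    intro x N
    refine le_trans (le_of_eq ?_) (ofReal_le_ofReal (locAvg_real_le N g x))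
    rw [locAvg, ZMod.card, ofReal_mul (by positivity), ofReal_mul hm.le,
      ENNReal.ofReal_inv_of_pos (by positivity), ofReal_pow hm.le, ofReal_natCast,
      ofReal_sum_of_nonneg]
    · congr 1
      refine sum_congr rfl fun y _ => ?_
      split_ifs
      · exact hg _
      · simp
    · intro y _
      split_ifs
      · exact hg0 _
      · exact le_rfl
  have hnn : ∀ x, 0 ≤ (card Γ d m : ℝ)⁻¹ * ∑ y, g y +
        ∑ a : ZMod m with a ≠ 0, ‖locOp a (fun y => (g y : ℂ)) x‖ := fun x =>
    add_nonneg (mul_nonneg (by positivity) (sum_nonneg fun y _ => hg0 y))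
      (sum_nonneg fun a _ => norm_nonneg _)
  calc ∑ x, (⨆ N, locAvg N f x) ^ u
      ≤ ∑ x, (ofReal ((card Γ d m : ℝ)⁻¹ * ∑ y, g y +
        ∑ a : ZMod m with a ≠ 0, ‖locOp a (fun y => (g y : ℂ)) x‖)) ^ u := by
        gcongr with x
        exact iSup_le fun N => h1 x N
    _ = ofReal (∑ x, ((card Γ d m : ℝ)⁻¹ * ∑ y, g y +
        ∑ a : ZMod m with a ≠ 0, ‖locOp a (fun y => (g y : ℂ)) x‖) ^ u) := by
        rw [ofReal_sum_of_nonneg fun x _ => rpow_nonneg (hnn x) _]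
        exact sum_congr rfl fun x _ => ofReal_rpow_of_nonneg (hnn x) hu.le
    _ ≤ ofReal (B * ∑ x, g x ^ u) := ofReal_le_ofReal (h g hg0)
    _ = ofReal B * ∑ x, f x ^ u := by
        rw [ofReal_mul hB.le, ofReal_sum_of_nonneg fun x _ =>
          rpow_nonneg (hg0 x) _]
        congr 1
        refine sum_congr rfl fun x _ => ?_
        rw [← ofReal_rpow_of_nonneg (hg0 x) hu.le, ← hg x]

lemma exists_locBd_prime_pow (hd : 5 ≤ d) {u v : ℝ} (hu : 1 < u) (hu2 : u < 2)
    (huv : v.HolderConjugate u) (hv : v < d - 1) :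
    ∃ C : ℝ, 0 < C ∧ ∃ e : ℝ, 1 < e ∧ ∀ (p K : ℕ) (_ : p.Prime) [NeZero (p ^ K)],
      LocBd d u (ZMod (p ^ K)) (ofReal (1 + C * (p : ℝ) ^ (-e))) := by
  have hu0 : 0 < u := by linarith
  have hv0 : 0 < v := huv.pos
  have hd' : (5 : ℝ) ≤ d := mod_cast hd
  obtain ⟨C0, hC0, hloc⟩ := exists_sum_locOp_rpow_le hu hu2 huv
  set s1 : ℝ := d / 2 with hs1
  set s2 : ℝ := d / v with hs2
  have h1s1 : 1 < s1 := by rw [hs1]; linarith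
  have h1s2 : 1 < s2 := by rw [hs2, lt_div_iff₀ hv0]; linarith
  have hgeo : ∀ s : ℝ, 1 < s → 0 < (1 - (2 : ℝ) ^ (1 - s))⁻¹ := fun s hs => by
    have : (2 : ℝ) ^ (1 - s) < 1 :=
      Real.rpow_lt_one_of_one_lt_of_neg (by norm_num) (by linarith)
    exact inv_pos.2 (by linarith)
  set C1 : ℝ := 2 ^ s1 * (1 - (2 : ℝ) ^ (1 - s1))⁻¹ with hC1
  set C2 : ℝ := C0 * 2 ^ s2 * (1 - (2 : ℝ) ^ (1 - s2))⁻¹ with hC2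
  have hC1p : 0 < C1 := mul_pos (by positivity) (hgeo s1 h1s1)
  have hC2p : 0 < C2 := mul_pos (by positivity) (hgeo s2 h1s2)
  obtain ⟨C, hC, hmean⟩ := exists_mean_add_le hu hu2.le huv (A := C1 + C2) (by positivity)
  set e : ℝ := min (s1 - 1) (d - v) with he
  refine ⟨C * (C1 + C2 ^ v), by positivity, e, lt_min (by rw [hs1]; linarith) (by linarith),
    fun p K hp _ => locBd_of_real hu0 (by positivity) fun f hf => ?_⟩
  have hp2 : (2 : ℝ) ≤ p := mod_cast hp.two_le
  have hp1 : (1 : ℝ) ≤ p := by linarith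
  have hp0 : (0 : ℝ) < p := by linarith
  have hle1 : ∀ s : ℝ, 1 < s → (p : ℝ) ^ (1 - s) ≤ 1 := fun s hs =>
    Real.rpow_le_one_of_one_le_of_nonpos hp1 (by linarith)
  have hord : ∀ a : ZMod (p ^ K), (0 : ℝ) < addOrderOf a := fun a => by
    exact_mod_cast addOrderOf_pos a
  have hsum : ∀ s : ℝ, 1 < s → ∑ a : ZMod (p ^ K) with a ≠ 0, (2 / (addOrderOf a : ℝ)) ^ s ≤
      2 ^ s * (1 - (2 : ℝ) ^ (1 - s))⁻¹ * (p : ℝ) ^ (1 - s) := by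
    intro s hs
    rw [mul_assoc]
    refine le_trans (le_of_eq ?_) (mul_le_mul_of_nonneg_left
      (sum_rpow_addOrderOf_prime_pow_le (K := K) hp hs) (by positivity : (0 : ℝ) ≤ 2 ^ s))
    rw [mul_sum]
    refine sum_congr rfl fun a _ => ?_
    rw [div_rpow (by norm_num) (hord a).le, rpow_neg (hord a).le, div_eq_mul_inv]
  set a : ℝ := C1 * (p : ℝ) ^ (1 - s1) with ha
  set b : ℝ := C2 * (p : ℝ) ^ (1 - s2) with hb
  have hmain := hmean (X := Γ d (p ^ K)) a b (by positivity)
    (by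
      have := hle1 s1 h1s1
      rw [ha]; nlinarith)
    (by positivity)
    (by
      have := hle1 s2 h1s2
      rw [hb]; nlinarith)
    (fun g x => ∑ a : ZMod (p ^ K) with a ≠ 0, ‖locOp a (fun y => (g y : ℂ)) x‖)
    (fun g x => sum_nonneg fun a _ => norm_nonneg _)
    (fun g g' x => by
      rw [← sum_add_distrib]
      refine sum_le_sum fun a _ => ?_
      have : (fun y => ((g + g') y : ℂ)) = (fun y => (g y : ℂ)) + fun y => (g' y : ℂ) := by
        ext y; simp
      simp only [this, locOp_add]
      exact norm_add_le _ _)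
    (fun g => by
      have h1 := sum_rpow_sum_le (u := 2) (F := ∑ x, g x ^ 2) one_le_two (by positivity)
        (univ.filter fun a : ZMod (p ^ K) => a ≠ 0)
        (fun a x => ‖locOp a (fun y => (g y : ℂ)) x‖) (fun a => (2 / (addOrderOf a : ℝ)) ^ s1)
        (fun a _ => by positivity) (fun a _ => by
          have h2 := sum_sq_locOp_le a fun y => (g y : ℂ)
          have h3 : ((2 / (addOrderOf a : ℝ)) ^ s1) ^ (2 : ℝ) = (2 / (addOrderOf a : ℝ)) ^ d := by
            rw [← rpow_mul (by positivity), hs1, div_mul_cancel₀ _ (by norm_num),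
              rpow_natCast]
          rw [h3]
          simpa using h2)
      have h4 := hsum s1 h1s1
      simp only [rpow_two, sq_abs] at h1
      refine h1.trans ?_
      gcongr)
    (fun g => by
      have h1 := sum_rpow_sum_le (u := u) (F := ∑ x, |g x| ^ u) hu.le (by positivity)
        (univ.filter fun a : ZMod (p ^ K) => a ≠ 0)
        (fun a x => ‖locOp a (fun y => (g y : ℂ)) x‖)
        (fun a => C0 * (2 / (addOrderOf a : ℝ)) ^ s2)
        (fun a _ => by positivity) (fun a _ => by
          have h2 := hloc a fun y => (g y : ℂ)
          simpa using h2)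
      have h4 := hsum s2 h1s2
      have h5 : ∑ a : ZMod (p ^ K) with a ≠ 0, C0 * (2 / (addOrderOf a : ℝ)) ^ s2 ≤ b := by
        rw [← mul_sum]
        calc _ ≤ _ := mul_le_mul_of_nonneg_left h4 hC0.le
          _ = b := by rw [hb, hC2]; ring
      have h7 : ∀ x, |∑ a : ZMod (p ^ K) with a ≠ 0, ‖locOp a (fun y => (g y : ℂ)) x‖| =
          ∑ a : ZMod (p ^ K) with a ≠ 0, ‖locOp a (fun y => (g y : ℂ)) x‖ := fun x =>
        abs_of_nonneg (sum_nonneg fun a _ => norm_nonneg _)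
      simp only [h7] at h1
      refine h1.trans ?_
      gcongr)
    f hf
  refine hmain.trans ?_
  have hF : 0 ≤ ∑ x, f x ^ u := sum_nonneg fun x _ => rpow_nonneg (hf x) _
  refine mul_le_mul_of_nonneg_right ?_ hF
  have h8 : (p : ℝ) ^ (1 - s1) ≤ (p : ℝ) ^ (-e) := by
    apply rpow_le_rpow_of_exponent_le hp1
    have := min_le_left (s1 - 1) (d - v)
    rw [he]; linarith
  have h9 : b ^ v ≤ C2 ^ v * (p : ℝ) ^ (-e) := by
    rw [hb, mul_rpow hC2p.le (by positivity), ← rpow_mul hp0.le]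
    gcongr
    have h10 := min_le_right (s1 - 1) (d - v)
    rw [hs2, he, sub_mul, div_mul_cancel₀ _ hv0.ne']
    linarith
  have h11 : a ≤ C1 * (p : ℝ) ^ (-e) := by rw [ha]; gcongr
  have : C * (a + b ^ v) ≤ C * (C1 * (p : ℝ) ^ (-e) + C2 ^ v * (p : ℝ) ^ (-e)) := by gcongr
  linarith

lemma exists_locBd (hd : 5 ≤ d) {u v : ℝ} (hu : 1 < u) (hu2 : u < 2)
    (huv : v.HolderConjugate u) (hv : v < d - 1) :
    ∃ C : ℝ, 0 < C ∧ ∀ (M : ℕ) [NeZero M], LocBd d u (ZMod M) (ofReal C) := by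
  obtain ⟨C, hC, e, he, h⟩ := exists_locBd_prime_pow hd hu hu2 huv hv
  have hu0 : 0 < u := by linarith
  have hprod : ∀ M : ℕ, M ≠ 0 → ∀ [NeZero M],
      LocBd d u (ZMod M) (ofReal (∏ p ∈ M.primeFactors, (1 + C * (p : ℝ) ^ (-e)))) := by
    intro M
    induction M using Nat.recOnPosPrimePosCoprime with
    | prime_pow p n hp hn =>
      intro _ _
      have := h p n hp
      rwa [Nat.primeFactors_prime_pow hn.ne' hp, Finset.prod_singleton]
    | zero => exact fun h => absurd rfl h
    | one =>
      intro _ _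
      refine locBd_of_real hu0 (by simp) fun f hf => ?_
      have hs : ∀ a : ZMod 1, a = 0 := fun a => Subsingleton.elim _ _
      simp [hs]
    | coprime a b ha hb hab iha ihb =>
      intro _ _
      have : NeZero a := ⟨by omega⟩
      have : NeZero b := ⟨by omega⟩
      have h1 := LocBd.ringEquiv (ZMod.chineseRemainder hab).symm
        (LocBd.prod hu0.le (iha (by omega)) (ihb (by omega)))
      rw [← ofReal_mul (Finset.prod_nonneg fun p _ => by positivity)] at h1
      rwa [hab.primeFactors_mul, Finset.prod_union hab.disjoint_primeFactors]
  have hsum : Summable fun n : ℕ => C * (n : ℝ) ^ (-e) :=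
    (Real.summable_nat_rpow.2 (by linarith)).mul_left C
  refine ⟨exp (∑' n : ℕ, C * (n : ℝ) ^ (-e)), exp_pos _, fun M _ f =>
    (hprod M (NeZero.ne M) f).trans ?_⟩
  gcongr
  calc ∏ p ∈ M.primeFactors, (1 + C * (p : ℝ) ^ (-e))
      ≤ ∏ p ∈ M.primeFactors, exp (C * (p : ℝ) ^ (-e)) := by
        refine prod_le_prod (fun p _ => by positivity) fun p _ => ?_
        rw [add_comm]
        exact add_one_le_exp _
    _ = exp (∑ p ∈ M.primeFactors, C * (p : ℝ) ^ (-e)) := (Real.exp_sum _ _).symm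
    _ ≤ _ := exp_le_exp.2 (hsum.sum_le_tsum _ fun n _ => by positivity)

lemma tsum_mul_rpow_le {α : Type*} {p : ℝ} (hp : 1 ≤ p) (k F : α → ℝ≥0∞) :
    (∑' y, k y * F y) ^ p ≤ (∑' y, k y) ^ (p - 1) * ∑' y, k y * F y ^ p := by
  have hp0 : 0 < p := by linarith
  have h1 : ∑' y, k y * F y ≤ (∑' y, k y) ^ (1 - p⁻¹) * (∑' y, k y * F y ^ p) ^ p⁻¹ := by
    refine (ENNReal.tsum_eq_iSup_sum (f := fun y => k y * F y)).le.trans (iSup_le fun s => ?_)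
    refine (ENNReal.inner_le_weight_mul_Lp_of_nonneg s hp k F).trans ?_
    have : 0 ≤ 1 - p⁻¹ := by
      rw [sub_nonneg]
      exact inv_le_one_of_one_le₀ hp
    gcongr
    · exact sum_le_tsum s
    · exact sum_le_tsum s
  refine (rpow_le_rpow h1 hp0.le).trans (le_of_eq ?_)
  rw [mul_rpow_of_nonneg _ _ hp0.le, ← ENNReal.rpow_mul, ← ENNReal.rpow_mul,
    inv_mul_cancel₀ hp0.ne', ENNReal.rpow_one, sub_mul, inv_mul_cancel₀ hp0.ne', one_mul]

lemma sum_rpow_le_card_mul {α : Type*} {p : ℝ} (hp : 1 ≤ p) (s : Finset α) (F : α → ℝ≥0∞) :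
    (∑ y ∈ s, F y) ^ p ≤ (s.card : ℝ≥0∞) ^ (p - 1) * ∑ y ∈ s, F y ^ p := by
  have hp0 : 0 < p := by linarith
  have h1 := ENNReal.inner_le_weight_mul_Lp_of_nonneg s hp (fun _ => 1) F
  simp only [one_mul, sum_const, nsmul_eq_mul, mul_one] at h1
  refine (rpow_le_rpow h1 hp0.le).trans (le_of_eq ?_)
  rw [mul_rpow_of_nonneg _ _ hp0.le, ← ENNReal.rpow_mul, ← ENNReal.rpow_mul,
    inv_mul_cancel₀ hp0.ne', ENNReal.rpow_one, sub_mul, inv_mul_cancel₀ hp0.ne', one_mul]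

/-- Young's inequality. -/
lemma nP_conv_le {p : ℝ} (hp : 1 ≤ p) (k f : Λ d → ℂ) :
    nP p (fun x => ‖conv k f x‖ₑ) ≤ (∑' z, ‖k z‖ₑ) * nP p fun x => ‖f x‖ₑ := by
  have hp0 : 0 < p := by linarith
  have h0 : ∀ x, ∑' y, ‖k (x - y)‖ₑ = ∑' z, ‖k z‖ₑ := fun x =>
    (Equiv.subLeft x).tsum_eq fun z => ‖k z‖ₑ
  have h1 : ∀ x, ‖conv k f x‖ₑ ^ p ≤
      (∑' z, ‖k z‖ₑ) ^ (p - 1) * ∑' y, ‖k (x - y)‖ₑ * ‖f y‖ₑ ^ p := by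
    intro x
    refine (rpow_le_rpow (enorm_conv_le k f x) hp0.le).trans ?_
    simp only [mul_comm ‖f _‖ₑ]
    refine (tsum_mul_rpow_le hp (fun y => ‖k (x - y)‖ₑ) fun y => ‖f y‖ₑ).trans (le_of_eq ?_)
    rw [h0 x]
  have h2 : ∑' x, ‖conv k f x‖ₑ ^ p ≤ (∑' z, ‖k z‖ₑ) ^ p * ∑' y, ‖f y‖ₑ ^ p := by
    refine (tsum_le_tsum h1).trans (le_of_eq ?_)
    rw [ENNReal.tsum_mul_left, tsum_comm]
    have h3 : ∀ y, ∑' x, ‖k (x - y)‖ₑ * ‖f y‖ₑ ^ p = (∑' z, ‖k z‖ₑ) * ‖f y‖ₑ ^ p := by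
      intro y
      rw [ENNReal.tsum_mul_right]
      congr 1
      exact (Equiv.subRight y).tsum_eq fun z => ‖k z‖ₑ
    simp only [h3]
    rw [ENNReal.tsum_mul_left, ← mul_assoc]
    congr 1
    have h4 := ENNReal.rpow_add_of_nonneg (x := ∑' z, ‖k z‖ₑ) (p - 1) 1 (by linarith) zero_le_one
    rw [sub_add_cancel, ENNReal.rpow_one] at h4
    exact h4.symm
  have := rpow_le_rpow h2 (by positivity : 0 ≤ 1 / p)
  rwa [mul_rpow_of_nonneg _ _ (by positivity), ← ENNReal.rpow_mul,
    mul_one_div_cancel hp0.ne', ENNReal.rpow_one] at this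

/-- The decomposition of `ℤ^d` into cosets of `Lℤ^d`. -/
def boxEquiv (d L : ℕ) [NeZero L] : Λ d ≃ Λ d × (Fin d → Fin L) :=
  (Equiv.arrowCongr (Equiv.refl _) (Int.divModEquiv L)).trans
    (Equiv.arrowProdEquivProdArrow (Fin d) (fun _ => ℤ) (fun _ => Fin L))

lemma boxEquiv_symm_apply {L : ℕ} [NeZero L] (z : Λ d) (b : Fin d → Fin L) :
    (boxEquiv d L).symm (z, b) = fun i => (L : ℤ) * z i + ((b i : ℕ) : ℤ) := by
  ext i
  simp [boxEquiv, mul_comm]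

lemma tsum_eq_sum_box (L : ℕ) [NeZero L] (G : Λ d → ℝ≥0∞) :
    ∑' x, G x = ∑ b : Fin d → Fin L, ∑' z : Λ d, G fun i => (L : ℤ) * z i + ((b i : ℕ) : ℤ) := by
  rw [← (boxEquiv d L).symm.tsum_eq,
    ENNReal.tsum_prod' (f := fun c => G ((boxEquiv d L).symm c)), tsum_comm, tsum_fintype]
  simp only [boxEquiv_symm_apply]

/-- The box `[a, b)^d` in `ℤ^d`. -/
def boxF (d : ℕ) (a b : ℤ) : Finset Λ d := piFinset fun _ => Finset.Ico a b

lemma mem_boxF {a b : ℤ} {x : Λ d} : x ∈ boxF d a b ↔ ∀ i, a ≤ x i ∧ x i < b := by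
  simp [boxF]

lemma card_boxF (d : ℕ) (a b : ℤ) : (boxF d a b).card = (b - a).toNat ^ d := by
  simp [boxF]

/-- Reduction modulo `M`. -/
def redM (M : ℕ) (x : Λ d) : Γ d M := fun i => (x i : ZMod M)

lemma card_Ico_filter_zmod {M k : ℕ} [NeZero M] (a : ℤ) (c : ZMod M) :
    ((Finset.Ico a (a + M * k)).filter fun x : ℤ => (x : ZMod M) = c).card = k := by
  have hM : 0 < M := Nat.pos_of_ne_zero (NeZero.ne M)
  have hM' : (M : ℚ) ≠ 0 := mod_cast hM.ne'
  have h1 := Int.Ico_filter_modEq_card a (a + M * k) (r := M) (mod_cast hM) (c.val : ℤ)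
  have h2 : ((a + M * k : ℤ) - ((c.val : ℤ) : ℚ)) / ((M : ℤ) : ℚ) =
      ((a : ℚ) - ((c.val : ℤ) : ℚ)) / ((M : ℤ) : ℚ) + (k : ℤ) := by
    push_cast
    field_simp
    ring
  rw [h2, Int.ceil_add_intCast, add_sub_cancel_left, max_eq_left (by positivity)] at h1
  have h3 : ∀ x : ℤ, (x : ZMod M) = c ↔ x ≡ (c.val : ℤ) [ZMOD M] := by
    intro x
    rw [← ZMod.intCast_eq_intCast_iff]
    simp
  simp only [h3]
  exact_mod_cast h1

lemma card_boxF_filter {M k : ℕ} [NeZero M] (a : ℤ) (c : Γ d M) :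
    ((boxF d a (a + M * k)).filter fun x => redM M x = c).card = k ^ d := by
  have : (boxF d a (a + M * k)).filter (fun x => redM M x = c) =
      piFinset fun i => (Finset.Ico a (a + M * k)).filter fun x : ℤ => (x : ZMod M) = c i := by
    ext x
    simp [boxF, redM, funext_iff, forall_and]
  rw [this, card_piFinset]
  simp [card_Ico_filter_zmod]

lemma cast_normSqZ {M : ℕ} (x : Λ d) :
    ((normSqZ x : ℤ) : ZMod M) = ∑ i, redM M x i ^ 2 := by
  simp [normSqZ, redM]

/-- The average over the box `[0, L)^d` of the local density at level `M`. -/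
def boxAvg (L M : ℕ) (N : ℤ) (F : Λ d → ℝ≥0∞) (x : Λ d) : ℝ≥0∞ :=
  ((L : ℝ≥0∞) ^ d)⁻¹ * ∑ b ∈ boxF d 0 L,
    if (M : ℤ) ∣ normSqZ b - N then (M : ℝ≥0∞) * F (x - b) else 0

lemma dvd_normSqZ_sub_iff {M : ℕ} (x : Λ d) (N : ℤ) :
    (M : ℤ) ∣ normSqZ x - N ↔ ∑ i, redM M x i ^ 2 = (N : ZMod M) := by
  rw [← cast_normSqZ, ← ZMod.intCast_zmod_eq_zero_iff_dvd, Int.cast_sub, sub_eq_zero]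

lemma boxAvg_le_locAvg {L M : ℕ} [NeZero M] (N : ℤ) (F : Λ d → ℝ≥0∞)
    (w b : Λ d) (hb : b ∈ boxF d 0 L) :
    boxAvg L M N F (w + b) ≤ locAvg (N : ZMod M) (fun c => (M : ℝ≥0∞) ^ d * ((L : ℝ≥0∞) ^ d)⁻¹ *
      ∑ y ∈ boxF d (-L) L, if redM M y = c then F (w + y) else 0) (redM M b) := by
  have hM : (M : ℝ≥0∞) ^ d ≠ 0 := by
    exact_mod_cast pow_ne_zero d (NeZero.ne M)
  have hM' : (M : ℝ≥0∞) ^ d ≠ ⊤ := pow_ne_top (natCast_ne_top _)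
  have h1 : locAvg (N : ZMod M) (fun c => (M : ℝ≥0∞) ^ d * ((L : ℝ≥0∞) ^ d)⁻¹ *
      ∑ y ∈ boxF d (-L) L, if redM M y = c then F (w + y) else 0) (redM M b) =
      ((L : ℝ≥0∞) ^ d)⁻¹ * ∑ y ∈ boxF d (-L) L,
        if (M : ℤ) ∣ normSqZ (b - y) - N then (M : ℝ≥0∞) * F (w + y) else 0 := by
    rw [locAvg, ZMod.card]
    have h2 : ∀ c : Γ d M, (if ∑ i, c i ^ 2 = (N : ZMod M) then
        (M : ℝ≥0∞) ^ d * ((L : ℝ≥0∞) ^ d)⁻¹ *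
          ∑ y ∈ boxF d (-L) L, (if redM M y = redM M b - c then F (w + y) else 0) else 0) =
        (M : ℝ≥0∞) ^ d * ((L : ℝ≥0∞) ^ d)⁻¹ * ∑ y ∈ boxF d (-L) L,
          if c = redM M (b - y) then
            (if (M : ℤ) ∣ normSqZ (b - y) - N then F (w + y) else 0) else 0 := by
      intro c
      have h3 : ∀ y, (redM M y = redM M b - c) ↔ c = redM M (b - y) := by
        intro y
        have : redM M (b - y) = redM M b - redM M y := by
          ext i; simp [redM]
        rw [this]
        constructor
        · intro h; rw [h]; abel
        · intro h; rw [h]; abel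
      split_ifs with h
      · congr 1
        refine sum_congr rfl fun y _ => ?_
        simp only [h3]
        by_cases hc : c = redM M (b - y)
        · rw [if_pos hc, if_pos hc, if_pos]
          rw [dvd_normSqZ_sub_iff, ← hc, h]
        · rw [if_neg hc, if_neg hc]
      · rw [sum_eq_zero, mul_zero]
        intro y _
        by_cases hc : c = redM M (b - y)
        · rw [if_pos hc, if_neg]
          rwa [dvd_normSqZ_sub_iff, ← hc]
        · rw [if_neg hc]
    simp only [h2]
    rw [← mul_sum, sum_comm]
    simp only [Finset.sum_ite_eq', mem_univ, if_true]
    have h4 : ∀ y, (if (M : ℤ) ∣ normSqZ (b - y) - N then (M : ℝ≥0∞) * F (w + y) else 0) =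
        (M : ℝ≥0∞) * if (M : ℤ) ∣ normSqZ (b - y) - N then F (w + y) else 0 := by
      intro y
      split_ifs <;> simp
    simp only [h4]
    rw [← mul_sum]
    generalize (∑ y ∈ boxF d (-L) L, if (M : ℤ) ∣ normSqZ (b - y) - N then F (w + y) else 0) = T
    calc (M : ℝ≥0∞) * ((M : ℝ≥0∞) ^ d)⁻¹ * ((M : ℝ≥0∞) ^ d * ((L : ℝ≥0∞) ^ d)⁻¹ * T)
        = (((M : ℝ≥0∞) ^ d)⁻¹ * (M : ℝ≥0∞) ^ d) * (((L : ℝ≥0∞) ^ d)⁻¹ * ((M : ℝ≥0∞) * T)) := by ring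
      _ = _ := by rw [ENNReal.inv_mul_cancel hM hM', one_mul]
  rw [h1, boxAvg]
  gcongr
  have hinj : Set.InjOn (fun b' : Λ d => b - b') (boxF d 0 L : Set Λ d) :=
    fun x _ y _ h => sub_right_injective h
  have h5 : ∑ b' ∈ boxF d 0 L, (if (M : ℤ) ∣ normSqZ b' - N then (M : ℝ≥0∞) * F (w + b - b') else 0) =
      ∑ y ∈ (boxF d 0 L).image (fun b' => b - b'),
        if (M : ℤ) ∣ normSqZ (b - y) - N then (M : ℝ≥0∞) * F (w + y) else 0 := by
    rw [sum_image hinj]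
    refine sum_congr rfl fun y _ => ?_
    rw [sub_sub_cancel, add_sub_assoc]
  rw [h5]
  refine Finset.sum_le_sum_of_subset fun y hy => ?_
  obtain ⟨b', hb', rfl⟩ := mem_image.1 hy
  rw [mem_boxF] at hb hb' ⊢
  intro i
  have := hb i
  have := hb' i
  simp only [Pi.sub_apply]
  omega

lemma locAvg_box_sum_le {L M k : ℕ} [NeZero M] (hL : L = M * k) (hk : 0 < k) {u C : ℝ}
    (hu : 1 ≤ u) (hC : LocBd d u (ZMod M) (ofReal C)) (F : Λ d → ℝ≥0∞)
    (w : Λ d) :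
    ∑ b ∈ boxF d 0 L, (⨆ N : ℤ, boxAvg L M N F (w + b)) ^ u ≤
      ofReal C * (2 ^ d : ℝ≥0∞) ^ (u - 1) * ∑ y ∈ boxF d (-L) L, F (w + y) ^ u := by
  have hu0 : 0 ≤ u := by linarith
  set Fw : Γ d M → ℝ≥0∞ := fun c => (M : ℝ≥0∞) ^ d * ((L : ℝ≥0∞) ^ d)⁻¹ *
      ∑ y ∈ boxF d (-L) L, if redM M y = c then F (w + y) else 0 with hFw
  set a : ℝ≥0∞ := (k : ℝ≥0∞) ^ d with ha
  have ha0 : a ≠ 0 := pow_ne_zero _ (mod_cast hk.ne')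
  have hat : a ≠ ⊤ := pow_ne_top (natCast_ne_top _)
  have hM0 : (M : ℝ≥0∞) ^ d ≠ 0 := pow_ne_zero _ (mod_cast NeZero.ne M)
  have hMt : (M : ℝ≥0∞) ^ d ≠ ⊤ := pow_ne_top (natCast_ne_top _)
  have h1 : ∑ b ∈ boxF d 0 L, (⨆ N : ℤ, boxAvg L M N F (w + b)) ^ u ≤
      ∑ b ∈ boxF d 0 L, (⨆ N : ZMod M, locAvg N Fw (redM M b)) ^ u := by
    refine sum_le_sum fun b hb => rpow_le_rpow (iSup_le fun N => ?_) hu0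
    exact (boxAvg_le_locAvg N F w b hb).trans
      (le_iSup (fun N : ZMod M => locAvg N Fw (redM M b)) (N : ZMod M))
  have h2 : ∑ b ∈ boxF d 0 L, (⨆ N : ZMod M, locAvg N Fw (redM M b)) ^ u =
      a * ∑ c, (⨆ N : ZMod M, locAvg N Fw c) ^ u := by
    rw [← Finset.sum_fiberwise' (boxF d 0 L) (redM M)
      fun c => (⨆ N : ZMod M, locAvg N Fw c) ^ u, mul_sum]
    refine sum_congr rfl fun c _ => ?_
    have h3 := card_boxF_filter (k := k) 0 c
    rw [show (0 : ℤ) + M * k = L by rw [hL]; push_cast; ring] at h3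
    rw [sum_const, h3, nsmul_eq_mul, ha]
    push_cast
    rfl
  have h4 : ∀ c, Fw c ^ u ≤ (a⁻¹) ^ u * ((2 ^ d * a) ^ (u - 1) *
      ∑ y ∈ boxF d (-L) L with redM M y = c, F (w + y) ^ u) := by
    intro c
    have h5 : (M : ℝ≥0∞) ^ d * ((L : ℝ≥0∞) ^ d)⁻¹ = a⁻¹ := by
      rw [hL, cast_mul, mul_pow, ENNReal.mul_inv (Or.inl hM0) (Or.inl hMt), ← mul_assoc,
        ENNReal.mul_inv_cancel hM0 hMt, one_mul]
    have h6 := card_boxF_filter (k := 2 * k) (-L : ℤ) c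
    rw [show (-L : ℤ) + M * (2 * k : ℕ) = L by rw [hL]; push_cast; ring] at h6
    rw [hFw]
    simp only
    rw [h5, ← sum_filter, mul_rpow_of_nonneg _ _ hu0]
    gcongr
    refine (sum_rpow_le_card_mul hu _ _).trans (le_of_eq ?_)
    rw [h6, ha, ← mul_pow]
    push_cast
    rfl
  have h7 : a * (a⁻¹ ^ u * (2 ^ d * a) ^ (u - 1)) = (2 ^ d : ℝ≥0∞) ^ (u - 1) := by
    rw [mul_rpow_of_nonneg _ _ (by linarith), ENNReal.inv_rpow]
    have h8 : a ^ u = a * a ^ (u - 1) := by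
      conv_rhs => rw [← ENNReal.rpow_one a]
      rw [← ENNReal.rpow_mul, one_mul, ← ENNReal.rpow_add _ _ ha0 hat]
      congr 1
      ring
    calc a * ((a ^ u)⁻¹ * ((2 ^ d) ^ (u - 1) * a ^ (u - 1)))
        = ((a ^ u)⁻¹ * (a * a ^ (u - 1))) * (2 ^ d) ^ (u - 1) := by ring
      _ = _ := by
        rw [← h8, ENNReal.inv_mul_cancel, one_mul]
        · exact (ENNReal.rpow_pos (pos_iff_ne_zero.2 ha0) hat).ne'
        · exact ENNReal.rpow_ne_top_of_nonneg hu0 hat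
  calc _ ≤ a * ∑ c, (⨆ N : ZMod M, locAvg N Fw c) ^ u := h1.trans h2.le
    _ ≤ a * (ofReal C * ∑ c, Fw c ^ u) := by gcongr; exact hC Fw
    _ ≤ a * (ofReal C * ∑ c, (a⁻¹) ^ u * ((2 ^ d * a) ^ (u - 1) *
          ∑ y ∈ boxF d (-L) L with redM M y = c, F (w + y) ^ u)) := by
        gcongr with c _
        exact h4 c
    _ = a * (a⁻¹ ^ u * (2 ^ d * a) ^ (u - 1)) * ofReal C *
          ∑ y ∈ boxF d (-L) L, F (w + y) ^ u := by
        rw [← mul_sum, ← mul_sum, Finset.sum_fiberwise]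
        ring
    _ = _ := by rw [h7]; ring

lemma exists_boxAvg_le (hd : 5 ≤ d) {u v : ℝ} (hu : 1 < u) (hu2 : u < 2)
    (huv : v.HolderConjugate u) (hv : v < d - 1) :
    ∃ C : ℝ, 0 < C ∧ ∀ (L M : ℕ) [NeZero L] [NeZero M], M ∣ L → ∀ F : Λ d → ℝ≥0∞,
      ∑' x, (⨆ N : ℤ, boxAvg L M N F x) ^ u ≤ ofReal C * ∑' x, F x ^ u := by
  obtain ⟨C, hC0, hC⟩ := exists_locBd hd hu hu2 huv hv
  refine ⟨C * ((2 ^ d : ℝ) ^ (u - 1) * 2 ^ d), by positivity, ?_⟩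
  intro L M _ _ hML F
  obtain ⟨k, hk⟩ := hML
  have hk0 : 0 < k := by
    rcases Nat.eq_zero_or_pos k with h | h
    · exact absurd hk (by rw [h, mul_zero]; exact NeZero.ne L)
    · exact h
  have hl0 : (L : ℝ≥0∞) ^ d ≠ 0 := pow_ne_zero _ (mod_cast NeZero.ne L)
  have hlt : (L : ℝ≥0∞) ^ d ≠ ⊤ := pow_ne_top (natCast_ne_top _)
  have hbox : ∀ (s : Finset Λ d) (G : Λ d → ℝ≥0∞),
      ∑' w, ∑ b ∈ s, G (w + b) = s.card * ∑' x, G x := by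
    intro s G
    rw [tsum_finsetSum fun _ _ => summable]
    have : ∀ b : Λ d, ∑' w, G (w + b) = ∑' x, G x := fun b => (Equiv.addRight b).tsum_eq G
    simp only [this, sum_const, nsmul_eq_mul]
  have h1 := hbox (boxF d 0 L) fun x => (⨆ N : ℤ, boxAvg L M N F x) ^ u
  have h2 := hbox (boxF d (-L) L) fun x => F x ^ u
  rw [card_boxF] at h1 h2
  have h3 := tsum_le_tsum fun w =>
    locAvg_box_sum_le hk hk0 hu.le (hC M) F w
  rw [h1, ENNReal.tsum_mul_left, h2] at h3
  have h4 : (((L : ℤ) - 0).toNat ^ d : ℕ) = L ^ d := by simp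
  have h5 : (((L : ℤ) - -L).toNat ^ d : ℕ) = 2 ^ d * L ^ d := by
    rw [← mul_pow]
    congr 1
    omega
  rw [h4, h5] at h3
  push_cast at h3
  rw [← ENNReal.mul_le_mul_iff_right hl0 hlt]
  refine h3.trans (le_of_eq ?_)
  rw [ofReal_mul hC0.le, ofReal_mul (by positivity),
    ← ENNReal.ofReal_rpow_of_pos (by positivity), ofReal_pow (by norm_num),
    ENNReal.ofReal_ofNat]
  ring

lemma norm_sum_stdAddChar_Ico_le {t : ZMod m} (ht : t ≠ 0) (s e : ℤ) :
    ‖∑ b ∈ Finset.Ico s e, stdAddChar (t * (b : ZMod m))‖ ≤ m := by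
  have hm : (0 : ℤ) < m := mod_cast Nat.pos_of_ne_zero (NeZero.ne m)
  have key : ∀ e : ℤ, s ≤ e → (∑ b ∈ Finset.Ico s e, stdAddChar (t * (b : ZMod m))) *
      (stdAddChar t - 1) = stdAddChar (t * (e : ZMod m)) - stdAddChar (t * (s : ZMod m)) := by
    intro e he
    induction e, he using Int.leInduction with
    | base => simp
    | succ n hn ih =>
      rw [← Finset.insert_Ico_right_eq_Ico_add_one hn, sum_insert (by simp), add_mul, ih]
      push_cast
      rw [mul_add, mul_one, AddChar.map_add_eq_mul]
      ring
  have hne : (stdAddChar t - 1 : ℂ) ≠ 0 := by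
    rw [sub_ne_zero]
    intro h
    apply ht
    apply ZMod.injective_stdAddChar
    rw [h, AddChar.map_zero_eq_one]
  rcases le_total e s with h | h
  · rw [Finset.Ico_eq_empty (by omega)]
    simp
  · have h0 := Int.emod_nonneg (e - s) hm.ne'
    have h1 := Int.emod_lt_of_pos (e - s) hm
    have h2 : ∑ b ∈ Finset.Ico s e, stdAddChar (t * (b : ZMod m)) =
        ∑ b ∈ Finset.Ico s (s + (e - s) % m), stdAddChar (t * (b : ZMod m)) := by
      apply mul_right_cancel₀ hne
      rw [key e h, key _ (by omega)]
      congr 3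
      have h3 : (e : ZMod m) = ((s + (e - s) % m : ℤ) : ZMod m) := by
        rw [ZMod.intCast_eq_intCast_iff]
        have := (Int.mod_modEq (e - s) m).symm.add_left s
        rwa [add_sub_cancel] at this
      rw [h3]
    rw [h2]
    refine (norm_sum_le _ _).trans ?_
    simp only [norm_stdAddChar, sum_const, Int.card_Ico, nsmul_eq_mul, mul_one]
    have : ((s + (e - s) % m - s).toNat : ℤ) ≤ m := by omega
    exact_mod_cast this

lemma norm_sum_sq_le_autocorr (L : ℕ) (c : ℤ → ℂ) :
    ‖∑ b ∈ Finset.Ico (0 : ℤ) L, c b‖ ^ 2 ≤ ∑ w ∈ Finset.Ico (-L : ℤ) L,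
      ‖∑ b ∈ Finset.Ico (max 0 (-w)) (min (L : ℤ) (L - w)), c (b + w) * starRingEnd ℂ (c b)‖ := by
  have h1 : ((∑ b ∈ Finset.Ico (0 : ℤ) L, c b) * starRingEnd ℂ (∑ b ∈ Finset.Ico (0 : ℤ) L, c b)) =
      ∑ w ∈ Finset.Ico (-L : ℤ) L,
      ∑ b ∈ Finset.Ico (max 0 (-w)) (min (L : ℤ) (L - w)), c (b + w) * starRingEnd ℂ (c b) := by
    rw [map_sum, mul_sum, Finset.sum_comm' (s' := fun b => (Finset.Ico (-b) (L - b)))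
      (t' := Finset.Ico (0 : ℤ) L)]
    · refine sum_congr rfl fun b _ => ?_
      rw [← sum_mul]
      congr 1
      refine Finset.sum_nbij' (fun x => x - b) (fun x => b + x) ?_ ?_ ?_ ?_ ?_ <;>
        simp; intros; omega
    · intro x y
      simp only [Finset.mem_Ico, max_le_iff, lt_min_iff]
      omega
  rw [← normSq_eq_norm_sq]
  have h2 : normSq (∑ b ∈ Finset.Ico (0 : ℤ) L, c b) =
      ‖(∑ b ∈ Finset.Ico (0 : ℤ) L, c b) * starRingEnd ℂ (∑ b ∈ Finset.Ico (0 : ℤ) L, c b)‖ := by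
    rw [mul_conj, norm_real, norm_of_nonneg (Complex.normSq_nonneg _)]
  rw [h2, h1]
  exact norm_sum_le _ _

lemma norm_sum_quad_le (a : ZMod m) (x : ℝ) :
    ‖∑ b ∈ Finset.Ico (0 : ℤ) (m ^ 2 : ℕ), stdAddChar (a * (b : ZMod m) ^ 2) * eC ((b : ℝ) * x)‖ ^ 2
      ≤ 6 / addOrderOf a * ((m : ℝ) ^ 2) ^ 2 := by
  have hm : 0 < m := Nat.pos_of_ne_zero (NeZero.ne m)
  have hmR : (0 : ℝ) < m := mod_cast hm
  have hq : 0 < addOrderOf a := addOrderOf_pos a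
  have hqR : (0 : ℝ) < addOrderOf a := mod_cast hq
  refine (norm_sum_sq_le_autocorr _ _).trans ?_
  have h1 : ∀ w ∈ Finset.Ico (-(m ^ 2 : ℕ) : ℤ) (m ^ 2 : ℕ),
      ‖∑ b ∈ Finset.Ico (max 0 (-w)) (min ((m ^ 2 : ℕ) : ℤ) ((m ^ 2 : ℕ) - w)),
        stdAddChar (a * ((b + w : ℤ) : ZMod m) ^ 2) * eC (((b + w : ℤ) : ℝ) * x) *
        starRingEnd ℂ (stdAddChar (a * (b : ZMod m) ^ 2) * eC ((b : ℝ) * x))‖ ≤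
      m + if 2 * a * (w : ZMod m) = 0 then (m : ℝ) ^ 2 else 0 := by
    intro w hw
    have h2 : ∀ b : ℤ, stdAddChar (a * ((b + w : ℤ) : ZMod m) ^ 2) *
        eC (((b + w : ℤ) : ℝ) * x) *
        starRingEnd ℂ (stdAddChar (a * (b : ZMod m) ^ 2) * eC ((b : ℝ) * x)) =
        stdAddChar (a * (w : ZMod m) ^ 2) * eC ((w : ℝ) * x) *
          stdAddChar (2 * a * (w : ZMod m) * (b : ZMod m)) := by
      intro b
      have h3 : a * ((b + w : ℤ) : ZMod m) ^ 2 = a * (b : ZMod m) ^ 2 +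
          (a * (w : ZMod m) ^ 2 + 2 * a * (w : ZMod m) * (b : ZMod m)) := by push_cast; ring
      have h4 : ((b + w : ℤ) : ℝ) * x = b * x + w * x := by push_cast; ring
      rw [h3, h4, AddChar.map_add_eq_mul, AddChar.map_add_eq_mul, eC_add, map_mul (starRingEnd ℂ)]
      have h5 := mul_conj (stdAddChar (a * (b : ZMod m) ^ 2))
      have h6 := mul_conj (eC ((b : ℝ) * x))
      rw [normSq_eq_norm_sq, norm_stdAddChar] at h5
      rw [normSq_eq_norm_sq, norm_eC] at h6
      norm_num at h5 h6
      linear_combination (stdAddChar (a * (w : ZMod m) ^ 2) * eC ((w : ℝ) * x) *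
          stdAddChar (2 * a * (w : ZMod m) * (b : ZMod m))) *
          (eC (b * x) * starRingEnd ℂ (eC (b * x)) * h5 + h6)
    simp only [h2]
    rw [← mul_sum, norm_mul, norm_mul, norm_stdAddChar, norm_eC, one_mul, one_mul]
    split_ifs with h
    · refine (norm_sum_le _ _).trans ?_
      simp only [norm_stdAddChar, sum_const, Int.card_Ico, nsmul_eq_mul, mul_one]
      have : ((min ((m ^ 2 : ℕ) : ℤ) ((m ^ 2 : ℕ) - w) - max 0 (-w)).toNat : ℤ) ≤ (m ^ 2 : ℕ) := by
        omega
      have : (((min ((m ^ 2 : ℕ) : ℤ) ((m ^ 2 : ℕ) - w) - max 0 (-w)).toNat : ℕ) : ℝ) ≤ (m : ℝ) ^ 2 := by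
        exact_mod_cast this
      linarith
    · rw [add_zero]
      exact norm_sum_stdAddChar_Ico_le h _ _
  refine (sum_le_sum h1).trans ?_
  have h3 : ((Finset.Ico (-(m ^ 2 : ℕ) : ℤ) (m ^ 2 : ℕ)).filter
      fun w : ℤ => 2 * a * (w : ZMod m) = 0).card =
      (2 * m) * (univ.filter fun c : ZMod m => 2 * a * c = 0).card := by
    rw [Finset.card_eq_sum_card_fiberwise (f := fun w : ℤ => (w : ZMod m))
      (t := univ.filter fun c : ZMod m => 2 * a * c = 0)]
    · rw [sum_congr rfl (g := fun _ => 2 * m), sum_const, smul_eq_mul, mul_comm]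
      intro c hc
      rw [filter_filter]
      have h4 := card_Ico_filter_zmod (k := 2 * m) (-(m ^ 2 : ℕ) : ℤ) c
      rw [show (-(m ^ 2 : ℕ) : ℤ) + m * (2 * m : ℕ) = (m ^ 2 : ℕ) by push_cast; ring] at h4
      rw [← h4]
      congr 1
      refine Finset.filter_congr fun w _ => ⟨fun h => h.2, fun h => ⟨?_, h⟩⟩
      rw [h]
      exact (mem_filter.1 hc).2
    · intro w hw
      simpa using (mem_filter.1 (mem_coe.1 hw)).2
  have h5 := card_two_mul_mul_eq_zero_le a
  rw [div_le_iff₀ hmR] at h5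
  have h6 : (m : ℝ) ≤ (m : ℝ) ^ 2 / addOrderOf a := by
    have : addOrderOf a ≤ m := by
      have := addOrderOf_le_card_univ (x := a)
      rwa [ZMod.card] at this
    have : (addOrderOf a : ℝ) ≤ m := mod_cast this
    rw [le_div_iff₀ hqR]
    nlinarith
  rw [sum_add_distrib, ← sum_filter, sum_const, sum_const, h3,
    Int.card_Ico, nsmul_eq_mul, nsmul_eq_mul]
  have h7 : ((((m ^ 2 : ℕ) : ℤ) - -((m ^ 2 : ℕ) : ℤ)).toNat : ℝ) = 2 * (m : ℝ) ^ 2 := by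
    have : (((m ^ 2 : ℕ) : ℤ) - -((m ^ 2 : ℕ) : ℤ)).toNat = 2 * m ^ 2 := by omega
    rw [this]
    push_cast
    rfl
  rw [h7]
  push_cast
  calc 2 * (m : ℝ) ^ 2 * m + 2 * m * ((univ.filter fun c : ZMod m => 2 * a * c = 0).card : ℝ) * (m : ℝ) ^ 2
      ≤ 2 * (m : ℝ) ^ 2 * ((m : ℝ) ^ 2 / addOrderOf a) + 2 * m * (2 / addOrderOf a * m) * (m : ℝ) ^ 2 := by
        gcongr
    _ = _ := by ring

/-- The quadratic character of frequency `a`, averaged over a box. -/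
def boxK (a : ZMod m) (y : Λ d) : ℂ :=
  if y ∈ boxF d 0 (m ^ 2 : ℕ) then
    (((m ^ 2 : ℕ) : ℂ) ^ d)⁻¹ * stdAddChar (a * (normSqZ y : ZMod m)) else 0

lemma support_boxK (a : ZMod m) :
    (Function.support (boxK (d := d) a)).Finite := by
  refine (boxF d 0 (m ^ 2 : ℕ)).finite_toSet.subset fun y hy => ?_
  by_contra h
  exact hy (if_neg h)

lemma norm_ftZ_boxK_sq_le (a : ZMod m) (ξ : Ξ d) :
    ‖ftZ (boxK a) ξ‖ ^ 2 ≤ (6 / addOrderOf a) ^ d := by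
  have h1 : ftZ (boxK a) ξ = ∏ i, (((m ^ 2 : ℕ) : ℂ)⁻¹ * ∑ b ∈ Finset.Ico (0 : ℤ) (m ^ 2 : ℕ),
      stdAddChar (a * (b : ZMod m) ^ 2) * eC ((b : ℝ) * ξ i)) := by
    rw [ftZ, tsum_eq_sum (s := boxF d 0 (m ^ 2 : ℕ)) fun y hy => by rw [boxK, if_neg hy, zero_mul],
      prod_mul_distrib, prod_univ_sum, mul_sum]
    refine sum_congr rfl fun y hy => ?_
    rw [boxK, if_pos (show y ∈ boxF d 0 (m ^ 2 : ℕ) from hy), prod_mul_distrib, eC_sum, prod_const, card_univ,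
      card_fin, cast_normSqZ, mul_sum, addChar_map_sum, inv_pow]
    simp only [redM]
    ring
  rw [h1, norm_prod, ← Finset.prod_pow]
  refine (prod_le_prod (fun _ _ => by positivity) (g := fun _ => (6 / addOrderOf a : ℝ))
    fun i _ => ?_).trans (le_of_eq (by rw [prod_const, card_univ, card_fin]))
  rw [norm_mul, mul_pow, norm_inv, Complex.norm_natCast]
  have := norm_sum_quad_le a (ξ i)
  have hm' := NeZero.pos m
  rw [inv_pow, inv_mul_le_iff₀ (by positivity)]
  refine this.trans (le_of_eq ?_)
  push_cast
  ring

/-- The density at level `M` of the sphere `|y|² ≡ N mod M`. -/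
def gden (M : ℕ) (N : ℤ) (y : Λ d) : ℝ :=
  if (M : ℤ) ∣ normSqZ y - N then (M : ℝ) else 0

lemma gden_nonneg (M : ℕ) (N : ℤ) (y : Λ d) : 0 ≤ gden M N y := by
  unfold gden
  split_ifs <;> positivity

lemma gden_le (M : ℕ) (N : ℤ) (y : Λ d) : gden M N y ≤ M := by
  unfold gden
  split_ifs
  · rfl
  · positivity

lemma card_mul_natCast_eq_zero {M : ℕ} (hMm : M ∣ m) :
    (univ.filter fun w : ZMod m => (M : ZMod m) * w = 0).card = M := by
  have h1 := card_mul_eq_zero (M : ZMod m)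
  have hm : 0 < m := NeZero.pos m
  rw [ZMod.addOrderOf_coe M (NeZero.ne m), Nat.gcd_eq_right hMm] at h1
  obtain ⟨k, rfl⟩ := hMm
  have hM : 0 < M := Nat.pos_of_mul_pos_right hm
  have hk : 0 < k := Nat.pos_of_mul_pos_left hm
  rw [Nat.mul_div_cancel_left k hM] at h1
  exact Nat.eq_of_mul_eq_mul_right hk h1

lemma sum_stdAddChar_filter {M : ℕ} (hMm : M ∣ m) (t : ℤ) :
    ∑ a : ZMod m with (M : ZMod m) * a = 0, stdAddChar (a * (t : ZMod m)) =
      if (M : ℤ) ∣ t then (M : ℂ) else 0 := by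
  have hm : (m : ℂ) ≠ 0 := mod_cast NeZero.ne m
  have h1 : ∀ a : ZMod m, (if (M : ZMod m) * a = 0 then (m : ℂ) else 0) * stdAddChar (a * (t : ZMod m)) =
      ∑ b : ZMod m, stdAddChar (a * ((t : ZMod m) + (M : ZMod m) * b)) := by
    intro a
    rw [← sum_stdAddChar_mul, sum_mul]
    refine sum_congr rfl fun b _ => ?_
    rw [← AddChar.map_add_eq_mul]
    congr 1
    ring
  have h2 : (m : ℂ) * ∑ a : ZMod m with (M : ZMod m) * a = 0, stdAddChar (a * (t : ZMod m)) =
      m * (univ.filter fun b : ZMod m => (t : ZMod m) + (M : ZMod m) * b = 0).card := by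
    rw [sum_filter, mul_sum]
    simp only [mul_ite, mul_zero]
    simp only [ite_mul, zero_mul] at h1
    simp only [h1]
    rw [sum_comm]
    simp only [sum_stdAddChar_mul]
    rw [← sum_filter, sum_const, nsmul_eq_mul, mul_comm]
  rw [mul_left_cancel₀ hm h2]
  split_ifs with h
  · obtain ⟨s, rfl⟩ := h
    refine Eq.trans ?_ (congrArg (Nat.cast (R := ℂ)) (card_mul_natCast_eq_zero hMm))
    norm_cast
    refine Finset.card_bij (fun b _ => (s : ZMod m) + b) ?_ ?_ ?_
    · intro b hb
      simpa [mul_add] using hb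
    · intro b _ b' _ h
      exact add_left_cancel h
    · intro b hb
      refine ⟨b - s, ?_, by ring⟩
      simp only [mem_filter, mem_univ, true_and] at hb ⊢
      push_cast
      linear_combination hb
  · rw [Finset.filter_eq_empty_iff.2]
    · simp
    · intro b _ hb
      apply h
      have h3 : ((t + M * b.val : ℤ) : ZMod m) = 0 := by
        push_cast
        rw [natCast_zmod_val]
        exact hb
      rw [ZMod.intCast_zmod_eq_zero_iff_dvd] at h3
      have := (Int.natCast_dvd_natCast.2 hMm).trans h3
      exact (Int.dvd_add_left (Dvd.intro _ rfl)).1 this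

/-- The difference of the densities at levels `m` and `M`, averaged over a box. -/
def boxD (M m : ℕ) (N : ℤ) (y : Λ d) : ℂ :=
  if y ∈ boxF d 0 (m ^ 2 : ℕ) then
    (((m ^ 2 : ℕ) : ℂ) ^ d)⁻¹ * ((gden m N y - gden M N y : ℝ) : ℂ) else 0

lemma boxD_eq_sum {M : ℕ} (hMm : M ∣ m) (N : ℤ) (y : Λ d) :
    boxD M m N y = ∑ a : ZMod m with ¬ (M : ZMod m) * a = 0,
      stdAddChar (-(a * (N : ZMod m))) * boxK a y := by
  unfold boxD boxK
  split_ifs with h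
  · have h1 := sum_stdAddChar_filter hMm (normSqZ y - N)
    have h2 := sum_stdAddChar_filter (dvd_refl m) (normSqZ y - N)
    simp only [CharP.cast_eq_zero, zero_mul, Finset.filter_true] at h2
    have h3 := Finset.sum_filter_add_sum_filter_not univ (fun a : ZMod m => (M : ZMod m) * a = 0)
      fun a => (stdAddChar (a * ((normSqZ y - N : ℤ) : ZMod m)) : ℂ)
    rw [h1, h2] at h3
    have h4 : ((gden m N y - gden M N y : ℝ) : ℂ) = ∑ a : ZMod m with ¬ (M : ZMod m) * a = 0,
        stdAddChar (a * ((normSqZ y - N : ℤ) : ZMod m)) := by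
      have h5 : ∀ k : ℕ, ((gden k N y : ℝ) : ℂ) = if (k : ℤ) ∣ normSqZ y - N then (k : ℂ) else 0 := by
        intro k
        rw [gden]
        split_ifs <;> simp
      rw [ofReal_sub, h5, h5, ← h3, add_sub_cancel_left]
    rw [h4, mul_sum]
    refine sum_congr rfl fun a _ => ?_
    rw [show a * ((normSqZ y - N : ℤ) : ZMod m) = -(a * (N : ZMod m)) + a * (normSqZ y : ZMod m) by
      push_cast; ring, AddChar.map_add_eq_mul]
    ring
  · simp

lemma nP_conv_boxK_le (a : ZMod m) (f : Λ d → ℂ)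
    (hf : f.support.Finite) :
    nP 2 (fun x => ‖conv (boxK a) f x‖ₑ) ≤
      ofReal ((6 : ℝ) ^ ((d : ℝ) / 2) * (addOrderOf a : ℝ) ^ (-((d : ℝ) / 2))) *
        nP 2 fun x => ‖f x‖ₑ := by
  have hq : (0 : ℝ) < addOrderOf a := mod_cast addOrderOf_pos a
  have h := sum_conv_sq_le (d := d) {()} (fun _ => boxK a)
    (fun _ _ => summable_of_finite_support' (support_boxK a)) (B := (6 / addOrderOf a) ^ d)
    (by positivity) (fun ξ => by simpa using norm_ftZ_boxK_sq_le a ξ) f (summable_of_finite_support' hf)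
  rw [nP_le_iff (by norm_num) (by positivity)]
  rw [sum_singleton] at h
  refine h.trans (le_of_eq ?_)
  congr 2
  rw [mul_rpow (by positivity) (by positivity), ← rpow_mul (by norm_num),
    ← rpow_mul hq.le, div_pow, neg_mul, div_mul_cancel₀ _ (by norm_num), rpow_neg hq.le,
    rpow_natCast, rpow_natCast]
  rfl

lemma exists_sum_rpow_tail_le_rpow : ∃ C : ℝ, 0 < C ∧ ∀ (d n m : ℕ), 5 ≤ d → 1 ≤ n →
    ∑ q ∈ Finset.Ioc n m, (q : ℝ) ^ (1 - (d : ℝ) / 2) ≤ C * (n : ℝ) ^ (21 / 10 - (d : ℝ) / 2) := by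
  have hs : Summable fun q : ℕ => (q : ℝ) ^ (-(11 / 10) : ℝ) := Real.summable_nat_rpow.2 (by norm_num)
  refine ⟨∑' q : ℕ, (q : ℝ) ^ (-(11 / 10) : ℝ) + 1, ?_, ?_⟩
  · have : 0 ≤ ∑' q : ℕ, (q : ℝ) ^ (-(11 / 10) : ℝ) := tsum_nonneg fun q => by positivity
    linarith
  intro d n m hd hn
  have hd' : (5 : ℝ) ≤ d := mod_cast hd
  have hn' : (1 : ℝ) ≤ n := mod_cast hn
  have h1 : ∀ q ∈ Finset.Ioc n m, (q : ℝ) ^ (1 - (d : ℝ) / 2) ≤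
      (q : ℝ) ^ (-(11 / 10) : ℝ) * (n : ℝ) ^ (21 / 10 - (d : ℝ) / 2) := by
    intro q hq
    have hq' : (n : ℝ) ≤ q := mod_cast (mem_Ioc.1 hq).1.le
    have hq1 : (1 : ℝ) ≤ q := hn'.trans hq'
    calc (q : ℝ) ^ (1 - (d : ℝ) / 2) = (q : ℝ) ^ (-(11 / 10) + (21 / 10 - (d : ℝ) / 2)) := by
          ring_nf
      _ = (q : ℝ) ^ (-(11 / 10) : ℝ) * (q : ℝ) ^ (21 / 10 - (d : ℝ) / 2) :=
          rpow_add (by linarith) _ _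
      _ ≤ _ := by
        refine mul_le_mul_of_nonneg_left ?_ (by positivity)
        exact rpow_le_rpow_of_nonpos (by linarith) hq' (by linarith)
  refine (sum_le_sum h1).trans ?_
  rw [← sum_mul]
  gcongr
  have := hs.sum_le_tsum (Finset.Ioc n m) fun q _ => by positivity
  linarith

lemma exists_sum_rpow_tail_le : ∃ C : ℝ, 0 < C ∧ ∀ (d n m : ℕ), 5 ≤ d → 1 ≤ n →
    ∑ q ∈ Finset.Ioc n m, (q : ℝ) ^ (1 - (d : ℝ) / 2) ≤ C * (n : ℝ) ^ (-(1 / 4) : ℝ) := by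
  obtain ⟨C, hC0, hC⟩ := exists_sum_rpow_tail_le_rpow
  refine ⟨C, hC0, fun d n m hd hn => (hC d n m hd hn).trans ?_⟩
  have hd' : (5 : ℝ) ≤ d := mod_cast hd
  refine mul_le_mul_of_nonneg_left ?_ hC0.le
  exact rpow_le_rpow_of_exponent_le (mod_cast hn) (by linarith)

lemma exists_maxConv_boxD_two_le (hd : 5 ≤ d) : ∃ C : ℝ, 0 < C ∧
    ∀ (M m n : ℕ) [NeZero m], M ∣ m → 1 ≤ n → (∀ q, 1 ≤ q → q ≤ n → q ∣ M) →
    ∀ {ι : Type} (I : Finset ι) (N : ι → ℤ) (f : Λ d → ℂ), f.support.Finite →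
      nP 2 (fun x => (maxConv I (fun i => boxD M m (N i)) f x : ℝ≥0∞)) ≤
        ofReal (C * (n : ℝ) ^ (-(1 / 4) : ℝ)) * nP 2 fun x => ‖f x‖ₑ := by
  obtain ⟨C, hC0, hC⟩ := exists_sum_rpow_tail_le
  refine ⟨6 ^ ((d : ℝ) / 2) * C, by positivity, ?_⟩
  intro M m n _ hMm hn hnM ι I N f hf
  set T := univ.filter fun a : ZMod m => ¬ (M : ZMod m) * a = 0 with hT
  have h1 : ∀ x, (maxConv I (fun i => boxD M m (N i)) f x : ℝ≥0∞) ≤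
      ∑ a ∈ T, ‖conv (boxK a) f x‖ₑ := by
    intro x
    refine coe_maxConv_le fun i _ => ?_
    have : boxD (d := d) M m (N i) = fun y => ∑ a ∈ T,
        stdAddChar (-(a * (N i : ZMod m))) * boxK a y := funext fun y => boxD_eq_sum hMm _ y
    rw [this, conv_sum_left _ _ hf]
    refine (enorm_sum_le _ _).trans (sum_le_sum fun a _ => ?_)
    rw [conv_const_mul_left, enorm_mul, ← ofReal_norm (stdAddChar _ : ℂ),
      norm_stdAddChar, ofReal_one, one_mul]
  have h2 : ∀ a ∈ T, addOrderOf a ∈ Finset.Ioc n m := by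
    intro a ha
    rw [mem_Ioc]
    constructor
    · by_contra hle
      obtain ⟨k, hk⟩ := hnM _ (addOrderOf_pos a) (not_lt.1 hle)
      apply (mem_filter.1 ha).2
      rw [hk, ← nsmul_eq_mul, mul_comm, mul_smul, addOrderOf_nsmul_eq_zero, smul_zero]
    · have := addOrderOf_le_card_univ (x := a)
      rwa [ZMod.card] at this
  have h3 := sum_rpow_addOrderOf_le (s := (d : ℝ) / 2) T (Finset.Ioc n m) h2
  refine (nP_mono (by norm_num) h1).trans ((nP_sum_le (by norm_num) T _).trans ?_)
  refine (sum_le_sum fun a _ => nP_conv_boxK_le a f hf).trans ?_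
  rw [← sum_mul, ← ofReal_sum_of_nonneg fun a _ => by positivity, ← mul_sum]
  refine mul_le_mul_left (ofReal_le_ofReal ?_) _
  rw [mul_assoc]
  refine mul_le_mul_of_nonneg_left ?_ (by positivity)
  exact h3.trans (hC d n m hd hn)

lemma enorm_conv_boxD_le (M m : ℕ) (N : ℤ) (f : Λ d → ℂ) (x : Λ d) [NeZero m] :
    ‖conv (boxD M m N) f x‖ₑ ≤ boxAvg (m ^ 2) m N (fun y => ‖f y‖ₑ) x +
      boxAvg (m ^ 2) M N (fun y => ‖f y‖ₑ) x := by
  refine (enorm_conv_le _ _ _).trans ?_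
  rw [← (Equiv.subLeft x).tsum_eq, tsum_eq_sum (s := boxF d 0 (m ^ 2 : ℕ))]
  · unfold boxAvg
    rw [← mul_add, ← sum_add_distrib, mul_sum]
    refine sum_le_sum fun y hy => ?_
    simp only [Equiv.subLeft_apply, sub_sub_cancel]
    rw [boxD, if_pos hy, enorm_mul]
    have h1 : ‖(((m ^ 2 : ℕ) : ℂ) ^ d)⁻¹‖ₑ = (((m ^ 2 : ℕ) : ℝ≥0∞) ^ d)⁻¹ := by
      rw [enorm_inv, enorm_pow]
      · congr 2
        rw [← ofReal_norm, Complex.norm_natCast, ofReal_natCast]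
      · exact pow_ne_zero _ (mod_cast pow_ne_zero 2 (NeZero.ne m))
    have h2 : ‖((gden m N y - gden M N y : ℝ) : ℂ)‖ₑ ≤
        (if (m : ℤ) ∣ normSqZ y - N then (m : ℝ≥0∞) else 0) +
        (if (M : ℤ) ∣ normSqZ y - N then (M : ℝ≥0∞) else 0) := by
      have h3 : ∀ k : ℕ, ‖(gden k N y : ℂ)‖ₑ = if (k : ℤ) ∣ normSqZ y - N then (k : ℝ≥0∞) else 0 := by
        intro k
        rw [← ofReal_norm, norm_real, norm_of_nonneg (gden_nonneg _ _ _), gden]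
        split_ifs <;> simp
      rw [ofReal_sub, ← h3, ← h3]
      exact enorm_sub_le
    rw [h1, mul_left_comm]
    gcongr
    refine (mul_le_mul_right h2 _).trans (le_of_eq ?_)
    rw [mul_add, mul_ite, mul_ite, mul_zero]
    simp only [mul_comm ‖f _‖ₑ]
  · intro y hy
    simp only [Equiv.subLeft_apply, sub_sub_cancel]
    rw [boxD, if_neg hy, enorm_zero, mul_zero]

lemma exists_maxConv_boxD_le (hd : 5 ≤ d) {p : ℝ} (hp : ((d : ℝ) - 1) / (d - 2) < p)
    (hp2 : p < 2) : ∃ C : ℝ, 0 < C ∧ ∃ η : ℝ, 0 < η ∧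
    ∀ (M m n : ℕ) [NeZero M] [NeZero m], M ∣ m → 1 ≤ n → (∀ q, 1 ≤ q → q ≤ n → q ∣ M) →
    ∀ {ι : Type} (I : Finset ι) (N : ι → ℤ) (f : Λ d → ℂ), f.support.Finite →
      nP p (fun x => (maxConv I (fun i => boxD M m (N i)) f x : ℝ≥0∞)) ≤
        ofReal (C * (n : ℝ) ^ (-η)) * nP p fun x => ‖f x‖ₑ := by
  have hd' : (5 : ℝ) ≤ d := mod_cast hd
  obtain ⟨u, hu1, hup⟩ := exists_between hp
  have hd2 : (0 : ℝ) < d - 2 := by linarith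
  rw [div_lt_iff₀ hd2] at hu1
  have hu : 1 < u := by nlinarith
  have hv : u / (u - 1) < d - 1 := by
    rw [div_lt_iff₀ (by linarith)]
    nlinarith
  obtain ⟨C0, hC0, h0⟩ := exists_boxAvg_le hd hu (hup.trans hp2)
    (conjExponent hu).symm hv
  obtain ⟨C1, hC1, h1⟩ := exists_maxConv_boxD_two_le hd
  set θ := u * (2 - p) / ((2 - u) * p) with hθ
  have hθ1 : 0 < 1 - θ := by
    rw [hθ, sub_pos, div_lt_one (by nlinarith)]
    nlinarith
  refine ⟨mC u p 2 ^ (1 / p) * ((2 * C0 ^ (1 / u)) ^ θ * C1 ^ (1 - θ)), ?_, 1 / 4 * (1 - θ), by positivity, ?_⟩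
  · have := mC_pos (p0 := u) (p := p) (p1 := 2) (by linarith) hup hp2
    positivity
  intro M m n _ _ hMm hn hnM ι I N f hf
  have hn' : (0 : ℝ) < n := mod_cast hn
  have h2 : ∀ f : Λ d → ℂ, nP u (fun x => (maxConv I (fun i => boxD M m (N i)) f x : ℝ≥0∞)) ≤
      ofReal (2 * C0 ^ (1 / u)) * nP u fun x => ‖f x‖ₑ := by
    intro f
    have h3 : ∀ k : ℕ, NeZero k → k ∣ m ^ 2 →
        nP u (fun x => ⨆ N : ℤ, boxAvg (m ^ 2) k N (fun y => ‖f y‖ₑ) x) ≤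
          ofReal (C0 ^ (1 / u)) * nP u fun x => ‖f x‖ₑ := by
      intro k _ hk
      rw [nP_le_iff (by linarith) (by positivity), ← rpow_mul hC0.le,
        one_div_mul_cancel (by linarith), rpow_one]
      exact h0 _ _ hk _
    rw [two_mul, ofReal_add (by positivity) (by positivity), add_mul]
    refine le_trans (nP_mono (by linarith) fun x => ?_) ((nP_add_le hu.le _ _).trans
      (add_le_add (h3 m inferInstance (Dvd.intro_left _ (pow_two m).symm))
        (h3 M inferInstance (hMm.mul_left m |>.trans (by rw [pow_two])))))
    refine coe_maxConv_le fun i _ => (enorm_conv_boxD_le M m (N i) f x).trans ?_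
    exact add_le_add (le_iSup (fun N : ℤ => boxAvg (m ^ 2) m N (fun y => ‖f y‖ₑ) x) (N i))
      (le_iSup (fun N : ℤ => boxAvg (m ^ 2) M N (fun y => ‖f y‖ₑ) x) (N i))
  have h4 := nP_interp (by linarith) hup hp2 (A0 := 2 * C0 ^ (1 / u)) (by positivity)
    (A1 := C1 * (n : ℝ) ^ (-(1 / 4) : ℝ)) (by positivity)
    (fun f => maxConv I (fun i => boxD M m (N i)) f) (maxConv_add_le I _) (fun f _ => h2 f)
    (fun f hf => h1 M m n hMm hn hnM I N f hf) hθ f hf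
  refine h4.trans (le_of_eq ?_)
  congr 2
  rw [mul_rpow hC1.le (by positivity), ← rpow_mul hn'.le]
  ring_nf

/-- The corner of the cell of `Lℤ^d` containing `y`. -/
def flr (L : ℕ) (y : Λ d) : Λ d := fun i => (L : ℤ) * (y i / L)

lemma abs_exp_mul_sub_le {g g' s s' t K K' : ℝ} (hg : |g| ≤ K)
    (hgg : |g - g'| ≤ K' * |s - s'|) (h1 : t ≤ s) (h2 : t ≤ s') :
    |exp (-s) * g - exp (-s') * g'| ≤ exp (-t) * ((K + K') * |s - s'|) := by
  have h3 : |exp (-s) - exp (-s')| ≤ exp (-t) * |s - s'| := by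
    have key : ∀ a b : ℝ, t ≤ a → a ≤ b → exp (-a) - exp (-b) ≤ exp (-t) * (b - a) := by
      intro a b ha hab
      have h4 := add_one_le_exp (a - b)
      have h5 : exp (-b) = exp (-a) * exp (a - b) := by
        rw [← exp_add]; ring_nf
      have h6 : exp (-a) ≤ exp (-t) := exp_le_exp.2 (by linarith)
      have h7 := exp_pos (-a)
      rw [h5]
      nlinarith
    rcases le_total s s' with h | h
    · rw [abs_of_nonneg (sub_nonneg.2 (exp_le_exp.2 (by linarith))), abs_of_nonpos (by linarith)]
      have := key s s' h1 h
      linarith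
    · rw [abs_of_nonpos (sub_nonpos.2 (exp_le_exp.2 (by linarith))), abs_of_nonneg (by linarith)]
      have := key s' s h2 h
      linarith
  have h4 : exp (-s) * g - exp (-s') * g' =
      (exp (-s) - exp (-s')) * g + exp (-s') * (g - g') := by ring
  rw [h4]
  refine (abs_add_le _ _).trans ?_
  rw [abs_mul (exp (-s) - _), abs_mul (exp _), abs_of_pos (exp_pos _)]
  have h5 : |exp (-s) - exp (-s')| * |g| ≤ exp (-t) * |s - s'| * K :=
    mul_le_mul h3 hg (abs_nonneg _) (by positivity)
  have h6 : exp (-s') * |g - g'| ≤ exp (-t) * (K' * |s - s'|) :=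
    mul_le_mul (exp_le_exp.2 (by linarith)) hgg (abs_nonneg _) (by positivity)
  linarith

lemma abs_shell_sub_flr_le {L : ℕ} {r κ : ℝ} (hL : 0 < L) (hLr : (L : ℝ) ≤ r) (hκ : 1 ≤ κ)
    (y : Λ d) :
    |shell r κ y - shell r κ (flr L y)| ≤ (r ^ d)⁻¹ * exp d * (16 * κ ^ 2 * L / r ^ 2) *
      (exp (-(normSqZ y : ℝ) / (sqrt 2 * r) ^ 2) * (d * r + 2 * ∑ i, |(y i : ℝ)|)) := by
  have hL' : (0 : ℝ) < L := mod_cast hL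
  have hr : 0 < r := by linarith
  have hκ0 : 0 < κ := by linarith
  set s := (normSqZ y : ℝ) / r ^ 2 with hs
  set s' := (normSqZ (flr L y) : ℝ) / r ^ 2 with hs'
  have hb : ∀ i, (0 : ℝ) ≤ y i - flr L y i ∧ (y i : ℝ) - flr L y i ≤ L := by
    intro i
    have h1 := Int.emod_nonneg (y i) (show (L : ℤ) ≠ 0 by omega)
    have h2 := Int.emod_lt_of_pos (y i) (show (0 : ℤ) < L by omega)
    have h3 := Int.mul_ediv_add_emod (y i) L
    have h4 : (y i : ℤ) - flr L y i = y i % L := by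
      rw [flr]; linarith
    constructor
    · exact_mod_cast (by omega : (0 : ℤ) ≤ y i - flr L y i)
    · exact_mod_cast (by omega : (y i - flr L y i : ℤ) ≤ L)
  have hsq : ∀ v : Λ d, (normSqZ v : ℝ) = ∑ i, (v i : ℝ) ^ 2 := fun v => by simp [normSqZ]
  have h1 : |s - s'| ≤ L / r ^ 2 * (d * r + 2 * ∑ i, |(y i : ℝ)|) := by
    rw [hs, hs', ← sub_div, abs_div, abs_of_pos (by positivity : 0 < r ^ 2), hsq, hsq,
      ← sum_sub_distrib, div_mul_eq_mul_div]
    gcongr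
    refine (Finset.abs_sum_le_sum_abs _ _).trans ?_
    have : (L : ℝ) * (d * r + 2 * ∑ i, |(y i : ℝ)|) = ∑ i, L * (r + 2 * |(y i : ℝ)|) := by
      rw [← mul_sum, sum_add_distrib, sum_const, card_univ,
        card_fin, nsmul_eq_mul, ← mul_sum]
    rw [this]
    refine sum_le_sum fun i _ => ?_
    obtain ⟨h2, h3⟩ := hb i
    have h4 : (y i : ℝ) ^ 2 - (flr L y i : ℝ) ^ 2 = (y i - flr L y i) * (2 * y i - (y i - flr L y i)) := by
      ring
    rw [h4, abs_mul, abs_of_nonneg h2]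
    refine mul_le_mul h3 ?_ (abs_nonneg _) (by positivity)
    refine (abs_sub _ _).trans ?_
    rw [abs_mul, abs_two, abs_of_nonneg h2]
    linarith
  have h2 : s / 2 - d ≤ s' := by
    have : s / 2 - d = (∑ i, ((y i : ℝ) ^ 2 / 2 - r ^ 2)) / r ^ 2 := by
      rw [sum_sub_distrib, sum_const, card_univ, card_fin, nsmul_eq_mul,
        ← sum_div, ← hsq, hs]
      field_simp
    rw [this, hs', hsq]
    gcongr with i
    obtain ⟨h2, h3⟩ := hb i
    have h5 : ((y i : ℝ) - flr L y i) ^ 2 ≤ r ^ 2 := by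
      gcongr
      linarith
    nlinarith [sq_nonneg ((y i : ℝ) - 2 * flr L y i)]
  have hs0 : 0 ≤ s := by
    rw [hs, hsq]
    positivity
  have h3 := abs_exp_mul_sub_le (t := s / 2 - d) (K := 2 * κ) (K' := 4 * pi * κ ^ 2)
    (g := fej κ (s - 1)) (g' := fej κ (s' - 1)) (s := s) (s' := s')
    (by rw [abs_of_nonneg (fej_nonneg hκ0 _)]; exact fej_le hκ0 _)
    ((abs_fej_sub_le hκ0 _ _).trans (le_of_eq (by rw [sub_sub_sub_cancel_right])))
    (by linarith [d.cast_nonneg (α := ℝ)]) h2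
  have h4 : shell r κ y - shell r κ (flr L y) =
      (r ^ d)⁻¹ * (exp (-s) * fej κ (s - 1) - exp (-s') * fej κ (s' - 1)) := by
    rw [shell, shell, gam, gam, hs, hs', neg_div, neg_div]
    ring
  have h5 : exp (-(s / 2 - d)) = exp d * exp (-(normSqZ y : ℝ) / (sqrt 2 * r) ^ 2) := by
    rw [← exp_add, mul_pow, sq_sqrt (by norm_num), hs]
    congr 1
    field_simp
    ring
  have h6 : 2 * κ + 4 * pi * κ ^ 2 ≤ 16 * κ ^ 2 := by
    have := Real.pi_lt_d2
    nlinarith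
  rw [h4, abs_mul, abs_of_pos (by positivity : 0 < (r ^ d)⁻¹)]
  calc _ ≤ (r ^ d)⁻¹ * (exp (-(s / 2 - d)) * (16 * κ ^ 2 * (L / r ^ 2 * (d * r + 2 * ∑ i, |(y i : ℝ)|)))) := by
        gcongr
        refine h3.trans ?_
        gcongr
    _ = _ := by rw [h5]; ring

lemma exists_tsum_shell_sub_le (d : ℕ) : ∃ C : ℝ, 0 < C ∧ ∀ (L : ℕ) (r κ : ℝ), 0 < L →
    (L : ℝ) ≤ r → 1 ≤ κ → ∑' y : Λ d, ofReal |shell r κ y - shell r κ (flr L y)| ≤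
      ofReal (C * (κ ^ 2 * L / r)) := by
  obtain ⟨C1, hC1, h1⟩ := exists_tsum_gauss_le d
  obtain ⟨C2, hC2, h2⟩ := exists_tsum_gauss_mul_le d
  have hs2 : (1 : ℝ) ≤ sqrt 2 := Real.one_le_sqrt.2 (by norm_num)
  refine ⟨exp d * 16 * (d * C1 * sqrt 2 ^ d + 2 * C2 * sqrt 2 ^ d * sqrt 2), by positivity, ?_⟩
  intro L r κ hL hLr hκ
  have hL' : (1 : ℝ) ≤ L := mod_cast hL
  have hr : 1 ≤ r := by linarith
  have hρ : 1 ≤ sqrt 2 * r := by nlinarith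
  obtain ⟨hsum, h2⟩ := h2 _ hρ
  have h1 := h1 _ hρ
  have hsum1 := summable_gauss (d := d) (ρ := sqrt 2 * r) (by linarith)
  set E : Λ d → ℝ := fun y => exp (-(normSqZ y : ℝ) / (sqrt 2 * r) ^ 2) with hE
  set A := (r ^ d)⁻¹ * exp d * (16 * κ ^ 2 * L / r ^ 2) with hA
  have h3 : Summable fun y => A * (d * r * E y + 2 * (E y * ∑ i, |(y i : ℝ)|)) :=
    ((hsum1.mul_left _).add (hsum.mul_left _)).mul_left _
  calc _ ≤ ∑' y : Λ d, ofReal (A * (d * r * E y + 2 * (E y * ∑ i, |(y i : ℝ)|))) := by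
        refine tsum_le_tsum fun y => ofReal_le_ofReal ?_
        refine (abs_shell_sub_flr_le hL hLr hκ y).trans (le_of_eq ?_)
        simp only [hE, hA]
        ring
    _ = ofReal (A * (d * r * ∑' y, E y + 2 * ∑' y, E y * ∑ i, |(y i : ℝ)|)) := by
        rw [← ofReal_tsum_of_nonneg (fun y => by positivity) h3, tsum_mul_left,
          Summable.tsum_add (hsum1.mul_left _) (hsum.mul_left _), tsum_mul_left, tsum_mul_left]
    _ ≤ ofReal (A * (d * r * (C1 * (sqrt 2 * r) ^ d) +
          2 * (C2 * (sqrt 2 * r) ^ d * (sqrt 2 * r)))) := by gcongr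
    _ = _ := by
        congr 1
        rw [hA, mul_pow]
        field_simp

lemma support_conv_finite {k f : Λ d → ℂ} (hk : k.support.Finite)
    (hf : f.support.Finite) : (conv k f).support.Finite := by
  refine ((hf.prod hk).image fun a => a.1 + a.2).subset fun x hx => ?_
  by_contra h
  refine hx ((tsum_congr fun y => ?_).trans tsum_zero)
  by_contra h1
  exact h ⟨(y, x - y), ⟨left_ne_zero_of_mul h1, right_ne_zero_of_mul h1⟩, by simp⟩

lemma conv_cell_le {M : ℕ} (hMm : M ∣ m) (N : ℤ) {σ : Λ d → ℝ}
    (hσ : ∀ z, 0 ≤ σ z) {f : Λ d → ℂ} (hf : f.support.Finite) (x : Λ d) :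
    ‖conv (fun y => (((((m ^ 2 : ℕ) : ℝ) ^ d)⁻¹ * (gden m N y - gden M N y) *
        σ (fun i => y i / (m ^ 2 : ℕ)) : ℝ) : ℂ)) f x‖ₑ ≤
      ∑' z, ofReal (σ z) *
        ‖conv (boxD M m N) f (fun i => x i - ((m ^ 2 : ℕ) : ℤ) * z i)‖ₑ := by
  have hm : 0 < ((m ^ 2 : ℕ) : ℤ) := by have := NeZero.pos m; positivity
  have h1 : ∀ v : Λ d, HasSum (fun z : Λ d =>
      (σ z : ℂ) * boxD M m N (fun i => v i - ((m ^ 2 : ℕ) : ℤ) * z i))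
      (((((m ^ 2 : ℕ) : ℝ) ^ d)⁻¹ * (gden m N v - gden M N v) *
        σ (fun i => v i / (m ^ 2 : ℕ)) : ℝ) : ℂ) := by
    intro v
    have h2 := hasSum_single (f := fun z : Λ d =>
      (σ z : ℂ) * boxD M m N (fun i => v i - ((m ^ 2 : ℕ) : ℤ) * z i))
      (fun i => v i / (m ^ 2 : ℕ)) fun z hz => by
        rw [boxD, if_neg, mul_zero]
        rw [mem_boxF]
        refine fun h => hz (funext fun i => ?_)
        have h3 := h i
        exact ((Int.ediv_eq_iff_of_pos hm).2 ⟨by linarith, by linarith⟩).symm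
    convert h2 using 1
    have h4 : (fun i => v i - ((m ^ 2 : ℕ) : ℤ) * (v i / (m ^ 2 : ℕ))) ∈ boxF d 0 (m ^ 2 : ℕ) := by
      rw [mem_boxF]
      intro i
      rw [← Int.emod_def]
      exact ⟨Int.emod_nonneg _ hm.ne', Int.emod_lt_of_pos _ hm⟩
    have h5 : ∀ K : ℕ, K ∣ m → gden K N (fun i => v i - ((m ^ 2 : ℕ) : ℤ) * (v i / (m ^ 2 : ℕ)))
        = gden K N v := by
      intro K hK
      unfold gden
      refine if_congr ?_ rfl rfl
      rw [dvd_normSqZ_sub_iff, dvd_normSqZ_sub_iff]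
      have h6 : (m ^ 2 : ZMod K) = 0 := by
        rw [(ZMod.natCast_eq_zero_iff m K).2 hK]; simp
      simp [redM, h6]
    rw [boxD, if_pos h4, h5 m dvd_rfl, h5 M hMm]
    push_cast
    ring
  set s := hf.toFinset with hs
  have hs' : f.support ⊆ s := by simp [hs]
  have h6 : HasSum (fun z : Λ d => (σ z : ℂ) *
      conv (boxD M m N) f (fun i => x i - ((m ^ 2 : ℕ) : ℤ) * z i)) (conv (fun y => (((((m ^ 2 : ℕ) : ℝ) ^ d)⁻¹ * (gden m N y - gden M N y) *
        σ (fun i => y i / (m ^ 2 : ℕ)) : ℝ) : ℂ)) f x) := by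
    rw [conv_eq_sum _ hs']
    refine (hasSum_sum fun y (_ : y ∈ s) => (h1 (x - y)).mul_left (f y)).congr_fun fun z => ?_
    rw [conv_eq_sum _ hs', mul_sum]
    refine sum_congr rfl fun y _ => ?_
    rw [mul_left_comm]
    congr 3
    funext i
    simp only [Pi.sub_apply]
    ring
  rw [← h6.tsum_eq]
  refine enorm_tsum_le_tsum_enorm.trans (tsum_le_tsum fun z => ?_)
  rw [enorm_mul, ← ofReal_norm, norm_real, norm_of_nonneg (hσ z)]

lemma enorm_conv_of_nonneg {σ : Λ d → ℝ} (hσ : ∀ z, 0 ≤ σ z)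
    {F : Λ d → ℝ≥0} (hF : F.support.Finite) (w : Λ d) :
    ‖conv (fun z => (σ z : ℂ)) (fun y => ((F y : ℝ) : ℂ)) w‖ₑ =
      ∑' z, ofReal (σ z) * (F (w - z) : ℝ≥0∞) := by
  have h1 : Summable fun y => (F y : ℝ) * σ (w - y) :=
    summable_of_hasFiniteSupport (hF.subset fun y hy => by
      rw [mem_support] at hy ⊢
      exact fun h => hy (by simp [h]))
  have h2 : conv (fun z => (σ z : ℂ)) (fun y => ((F y : ℝ) : ℂ)) w =
      ((∑' y, (F y : ℝ) * σ (w - y) : ℝ) : ℂ) := by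
    rw [conv, ofReal_tsum]
    exact tsum_congr fun y => by push_cast; rfl
  rw [h2, ← ofReal_norm, norm_real, norm_of_nonneg
    (tsum_nonneg fun y => mul_nonneg (F y).coe_nonneg (hσ (w - y))),
    ofReal_tsum_of_nonneg (fun y => mul_nonneg (F y).coe_nonneg (hσ (w - y))) h1,
    ← (Equiv.subLeft w).tsum_eq]
  refine tsum_congr fun z => ?_
  rw [Equiv.subLeft_apply, sub_sub_cancel, mul_comm, ofReal_mul (hσ _),
    ofReal_coe_nnreal]

lemma injOn_floor_logb {c : ℝ} (hc : 1 < c) {L : ℝ} (hL : 0 < L) {R' : Finset ℝ}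
    (hpos : ∀ r ∈ R', 0 < r) (hlac : ∀ r ∈ R', ∀ s ∈ R', r < s → c * r ≤ s) :
    Set.InjOn (fun r => ⌊logb c (r / L)⌋) R' := by
  have key : ∀ r ∈ R', ∀ s ∈ R', r < s → ⌊logb c (r / L)⌋ < ⌊logb c (s / L)⌋ := by
    intro r hr s hs h
    have h1 := Real.logb_le_logb_of_le hc (div_pos (mul_pos (by linarith) (hpos r hr)) hL)
      (div_le_div_of_nonneg_right (hlac r hr s hs h) hL.le)
    rw [mul_div_assoc, Real.logb_mul (by linarith) (div_pos (hpos r hr) hL).ne',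
      Real.logb_self_eq_one hc] at h1
    rw [Int.lt_iff_add_one_le, Int.le_floor]
    push_cast
    linarith [Int.floor_le (logb c (r / L))]
  intro r hr s hs h
  rcases lt_trichotomy r s with h' | h' | h'
  · exact absurd h (key r hr s hs h').ne
  · exact h'
  · exact absurd h (key s hs r hr h').ne'

lemma logb_floor_bounds {c ρ : ℝ} (hc : 1 < c) (hρ : 0 < ρ) :
    c ^ ((⌊logb c ρ⌋ : ℤ) : ℝ) ≤ ρ ∧ ρ ≤ c ^ (((⌊logb c ρ⌋ : ℤ) : ℝ) + 1) := by
  have h1 : c ^ logb c ρ = ρ := Real.rpow_logb (by linarith) hc.ne' hρ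
  constructor
  · conv_rhs => rw [← h1]
    exact rpow_le_rpow_of_exponent_le hc.le (Int.floor_le _)
  · conv_lhs => rw [← h1]
    exact rpow_le_rpow_of_exponent_le hc.le (Int.lt_floor_add_one _).le

lemma rpow_eighth_pow {r : ℝ} (hr : 0 ≤ r) : (r ^ (1 / 8 : ℝ)) ^ 8 = r := by
  rw [← rpow_natCast, ← rpow_mul hr]; norm_num

lemma le_div_sq_of_pow_le {κ m r : ℝ} (hm : 1 ≤ m) (hκ : m ≤ κ) (hr : κ ^ 8 = r) :
    1 ≤ r / m ^ 2 ∧ κ ≤ r / m ^ 2 := by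
  have h1 : 1 ≤ κ := hm.trans hκ
  have h2 : κ ≤ r / m ^ 2 := by
    rw [le_div_iff₀ (by positivity), ← hr]
    calc κ * m ^ 2 ≤ κ * κ ^ 2 := by gcongr
      _ = κ ^ 3 := by ring
      _ ≤ κ ^ 8 := pow_le_pow_right₀ h1 (by norm_num)
  exact ⟨h1.trans h2, h2⟩

lemma exists_maxConv_cell_le (hd : 5 ≤ d) {c p : ℝ} (hc : 1 < c)
    (hp : ((d : ℝ) - 1) / (d - 2) < p) (hp2 : p < 2) : ∃ C : ℝ, 0 < C ∧ ∃ η : ℝ, 0 < η ∧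
    ∀ (M m n : ℕ) [NeZero M] [NeZero m], M ∣ m → 1 ≤ n → (∀ q, 1 ≤ q → q ≤ n → q ∣ M) →
    ∀ (R' : Finset ℝ) (N : ℝ → ℤ), (∀ r ∈ R', (m : ℝ) ^ 8 ≤ r) →
    (∀ r ∈ R', ∀ s ∈ R', r < s → c * r ≤ s) →
    ∀ f : Λ d → ℂ, f.support.Finite →
      nP p (fun x => (maxConv R' (fun r y => (((gden m (N r) y - gden M (N r) y) *
        shell r (r ^ (1 / 8 : ℝ)) (flr (m ^ 2) y) : ℝ) : ℂ)) f x : ℝ≥0∞)) ≤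
        ofReal (C * (n : ℝ) ^ (-η)) * nP p fun x => ‖f x‖ₑ := by
  have hd' : (5 : ℝ) ≤ d := mod_cast hd
  obtain ⟨C1, hC1, η, hη, h1⟩ := exists_maxConv_boxD_le hd hp hp2
  have hpd : (d : ℝ) / (d - 1) < p := by
    refine lt_of_le_of_lt ?_ hp
    rw [div_le_div_iff₀ (by linarith) (by linarith)]
    nlinarith
  obtain ⟨C2, hC2, h2⟩ := exists_maxConv_hk_le d (by omega) hc hpd hp2
  have hp0 : 0 < p := lt_trans (div_pos (by linarith) (by linarith)) hpd
  refine ⟨C2 * C1, by positivity, η, hη, ?_⟩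
  intro M m n _ _ hMm hn hq R' N hR hlac f hf
  have hm1 : (1 : ℝ) ≤ m := mod_cast NeZero.pos m
  have hL : NeZero (m ^ 2) := ⟨pow_ne_zero _ (NeZero.ne m)⟩
  have hL0 : (0 : ℝ) < (m ^ 2 : ℕ) := by push_cast; positivity
  have hr1 : ∀ r ∈ R', 1 ≤ r := fun r hr => (one_le_pow₀ hm1).trans (hR r hr)
  have hr8 : ∀ r ∈ R', (m : ℝ) ≤ r ^ (1 / 8 : ℝ) := fun r hr => by
    refine le_of_pow_le_pow_left₀ (n := 8) (by norm_num) (by have := hr1 r hr; positivity) ?_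
    rw [rpow_eighth_pow (by linarith [hr1 r hr])]
    exact hR r hr
  have hκ0 : ∀ r ∈ R', 0 < r ^ (1 / 8 : ℝ) := fun r hr => rpow_pos_of_pos (by linarith [hr1 r hr]) _
  have hρ : ∀ r ∈ R', 1 ≤ r / (m ^ 2 : ℕ) ∧ r ^ (1 / 8 : ℝ) ≤ r / (m ^ 2 : ℕ) := fun r hr => by
    have := le_div_sq_of_pow_le hm1 (hr8 r hr) (rpow_eighth_pow (by linarith [hr1 r hr]))
    push_cast
    exact this
  set K : ℝ → Λ d → ℂ := fun r y => (((gden m (N r) y - gden M (N r) y) *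
        shell r (r ^ (1 / 8 : ℝ)) (flr (m ^ 2) y) : ℝ) : ℂ) with hK
  set S : Λ d → ℝ≥0 := maxConv R' (fun r => boxD M m (N r)) f with hS
  have hSfin : S.support.Finite := by
    have hb : ∀ r, (conv (boxD M m (N r)) f).support.Finite := fun r =>
      support_conv_finite ((boxF d 0 (m ^ 2 : ℕ)).finite_toSet.subset fun y hy => by
        by_contra h
        exact hy (if_neg h)) hf
    refine (R'.finite_toSet.biUnion fun r _ => hb r).subset fun x hx => ?_
    by_contra h
    refine hx (le_antisymm (Finset.sup_le fun r hr => ?_) bot_le)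
    have h3 : conv (boxD M m (N r)) f x = 0 := by
      by_contra h4
      exact h (Set.mem_biUnion (mem_coe.2 hr) h4)
    simp [h3]
  set F : (Fin d → Fin (m ^ 2)) → Λ d → ℂ := fun b y =>
    ((S (fun i => ((m ^ 2 : ℕ) : ℤ) * y i + ((b i : ℕ) : ℤ)) : ℝ) : ℂ) with hF
  have hFfin : ∀ b : Fin d → Fin (m ^ 2), (fun y : Λ d =>
      S (fun i => ((m ^ 2 : ℕ) : ℤ) * y i + ((b i : ℕ) : ℤ))).support.Finite := by
    intro b
    refine hSfin.preimage (f := fun y : Λ d => fun i =>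
      ((m ^ 2 : ℕ) : ℤ) * y i + ((b i : ℕ) : ℤ)) (injOn fun y z h => ?_)
    funext i
    have h3 := congrFun h i
    have h4 : ((m ^ 2 : ℕ) : ℤ) ≠ 0 := mod_cast hL.ne
    exact mul_left_cancel₀ h4 (add_right_cancel h3)
  have hpt : ∀ (b : Fin d → Fin (m ^ 2)) (w : Λ d),
      (maxConv R' K f (fun i => ((m ^ 2 : ℕ) : ℤ) * w i + ((b i : ℕ) : ℤ)) : ℝ≥0∞) ≤
      maxConv R' (fun r => hk (r / (m ^ 2 : ℕ)) (tri (r ^ (1 / 8 : ℝ)))) (F b) w := by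
    intro b w
    refine coe_maxConv_le fun r hr => ?_
    have hr0 : 0 < r := by linarith [hr1 r hr]
    have hσ : ∀ z : Λ d, 0 ≤ shell (r / (m ^ 2 : ℕ)) (r ^ (1 / 8 : ℝ)) z :=
      shell_nonneg (div_pos hr0 hL0) (hκ0 r hr)
    have e1 : K r = fun y => (((((m ^ 2 : ℕ) : ℝ) ^ d)⁻¹ * (gden m (N r) y - gden M (N r) y) *
        shell (r / (m ^ 2 : ℕ)) (r ^ (1 / 8 : ℝ)) (fun i => y i / (m ^ 2 : ℕ)) : ℝ) : ℂ) := by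
      funext y
      have := shell_smul (κ := r ^ (1 / 8 : ℝ)) hr0 (NeZero.pos (m ^ 2))
        (fun i => y i / ((m ^ 2 : ℕ) : ℤ))
      rw [hK]
      simp only
      unfold flr
      rw [this]
      congr 1
      ring
    have e2 := enorm_conv_of_nonneg hσ (hFfin b) w
    have e3 : (fun z => ((shell (r / (m ^ 2 : ℕ)) (r ^ (1 / 8 : ℝ)) z : ℝ) : ℂ)) =
        (hk (r / (m ^ 2 : ℕ)) (tri (r ^ (1 / 8 : ℝ))) : Λ d → ℂ) :=
      funext fun z => (hk_tri _ (hκ0 r hr) z).symm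
    rw [e1]
    refine (conv_cell_le hMm (N r) hσ hf _).trans ?_
    rw [e3] at e2
    refine le_trans (tsum_le_tsum fun z => ?_) (e2.symm.le.trans ?_)
    · refine mul_le_mul_right (le_trans (le_of_eq ?_) (coe_le_coe.2 (le_sup
        (f := fun r => ‖conv (boxD M m (N r)) f
          (fun i => ((m ^ 2 : ℕ) : ℤ) * (w - z) i + ((b i : ℕ) : ℤ))‖₊) hr))) _
      rw [enorm_eq_nnnorm]
      congr 4
      funext i
      simp only [Pi.sub_apply]
      ring
    · exact coe_le_coe.2 (le_sup
        (f := fun r => ‖conv (hk (r / (m ^ 2 : ℕ)) (tri (r ^ (1 / 8 : ℝ)))) (F b) w‖₊) hr)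
  have h3 : nP p (fun x => (maxConv R' K f x : ℝ≥0∞)) ≤
      ofReal C2 * nP p fun x => (S x : ℝ≥0∞) := by
    rw [nP_le_iff hp0 hC2.le, tsum_eq_sum_box (m ^ 2), tsum_eq_sum_box (m ^ 2), mul_sum]
    refine sum_le_sum fun b _ => ?_
    have h4 := h2 R' (fun r => r / (m ^ 2 : ℕ)) (fun r => tri (r ^ (1 / 8 : ℝ)))
      (fun r => ⌊logb c (r / (m ^ 2 : ℕ))⌋)
      (fun r hr => ⟨(hρ r hr).1, (continuous_tri _).measurable, abs_tri_le_one (hκ0 r hr),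
        fun u hu => (abs_le_of_tri_ne_zero (hκ0 r hr) hu).trans (hρ r hr).2⟩)
      (injOn_floor_logb hc hL0 (fun r hr => by linarith [hr1 r hr]) hlac)
      (fun r hr => logb_floor_bounds hc (by linarith [(hρ r hr).1])) (F b)
      ((hFfin b).subset fun y hy => by
        rw [mem_support] at hy ⊢
        exact fun h => hy (by simp only [hF]; rw [h]; simp))
    rw [nP_le_iff hp0 hC2.le] at h4
    refine (tsum_le_tsum fun w => rpow_le_rpow (hpt b w) hp0.le).trans
      (h4.trans (le_of_eq ?_))
    congr 1
    refine tsum_congr fun w => ?_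
    rw [← ofReal_norm, norm_real, norm_of_nonneg (coe_nonneg _),
      ofReal_coe_nnreal]
  refine h3.trans ((mul_le_mul_right (h1 M m n hMm hn hq R' N f hf) _).trans (le_of_eq ?_))
  rw [← mul_assoc, ← ofReal_mul hC2.le, mul_assoc]

lemma exists_sum_rpow_neg_le {c a : ℝ} (hc : 1 < c) (ha : 0 < a) : ∃ C : ℝ, 0 < C ∧
    ∀ R' : Finset ℝ, (∀ r ∈ R', 1 ≤ r) → (∀ r ∈ R', ∀ s ∈ R', r < s → c * r ≤ s) →
    ∑ r ∈ R', r ^ (-a) ≤ C := by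
  obtain ⟨C, hC, h⟩ := exists_lacunary_sum_le hc ha
  refine ⟨C, hC, fun R' h1 hlac => le_trans (sum_le_sum fun r hr => ?_)
    (h R' id (fun r => ⌊logb c (r / 1)⌋)
      (injOn_floor_logb hc one_pos (fun r hr => by linarith [h1 r hr]) hlac)
      (fun r hr => by
        rw [div_one]
        exact logb_floor_bounds hc (by simpa using by linarith [h1 r hr])) 1 one_pos)⟩
  have := h1 r hr
  rw [id, mul_one, min_eq_right ((inv_le_one_of_one_le₀ this).trans this),
    Real.inv_rpow (by linarith), rpow_neg (by linarith)]

lemma maxConv_le_add_sum {ι : Type} (I : Finset ι) (K K0 E : ι → Λ d → ℂ)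
    (h : ∀ i z, K i z = K0 i z + E i z) {f : Λ d → ℂ} (hf : f.support.Finite)
    (x : Λ d) : (maxConv I K f x : ℝ≥0∞) ≤
      maxConv I K0 f x + ∑ i ∈ I, ‖conv (E i) f x‖ₑ := by
  refine coe_maxConv_le fun i hi => ?_
  rw [funext (h i), conv_add_left _ _ hf]
  exact (enorm_add_le _ _).trans (add_le_add (coe_le_coe.2 (le_sup
    (f := fun i => ‖conv (K0 i) f x‖₊) hi)) (single_le_sum
    (f := fun i => ‖conv (E i) f x‖ₑ) (fun _ _ => bot_le) hi))

lemma exists_maxConv_step_le (hd : 5 ≤ d) {c p : ℝ} (hc : 1 < c)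
    (hp : ((d : ℝ) - 1) / (d - 2) < p) (hp2 : p < 2) : ∃ C : ℝ, 0 < C ∧ ∃ η : ℝ, 0 < η ∧
    ∀ (M m n : ℕ) [NeZero M] [NeZero m], M ∣ m → 1 ≤ n → (∀ q, 1 ≤ q → q ≤ n → q ∣ M) →
    ∀ (R' : Finset ℝ) (N : ℝ → ℤ), (∀ r ∈ R', (m : ℝ) ^ 8 ≤ r) →
    (∀ r ∈ R', ∀ s ∈ R', r < s → c * r ≤ s) →
    ∀ f : Λ d → ℂ, f.support.Finite →
      nP p (fun x => (maxConv R' (fun r y => (((gden m (N r) y - gden M (N r) y) *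
        shell r (r ^ (1 / 8 : ℝ)) y : ℝ) : ℂ)) f x : ℝ≥0∞)) ≤
        ofReal (C * ((n : ℝ) ^ (-η) + (m : ℝ)⁻¹)) * nP p fun x => ‖f x‖ₑ := by
  obtain ⟨C1, hC1, η, hη, h1⟩ := exists_maxConv_cell_le hd hc hp hp2
  obtain ⟨C2, hC2, h2⟩ := exists_tsum_shell_sub_le d
  obtain ⟨C3, hC3, h3⟩ := exists_sum_rpow_neg_le hc (a := 1 / 4) (by norm_num)
  have hd' : (5 : ℝ) ≤ d := mod_cast hd
  have hp1 : 1 ≤ p := by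
    rw [div_lt_iff₀ (by linarith)] at hp
    nlinarith
  refine ⟨C1 + C2 * C3, by positivity, η, hη, ?_⟩
  intro M m n _ _ hMm hn hq R' N hR hlac f hf
  have hm1 : (1 : ℝ) ≤ m := mod_cast NeZero.pos m
  have hr1 : ∀ r ∈ R', 1 ≤ r := fun r hr => (one_le_pow₀ hm1).trans (hR r hr)
  set E : ℝ → Λ d → ℂ := fun r y => (((gden m (N r) y - gden M (N r) y) *
    (shell r (r ^ (1 / 8 : ℝ)) y - shell r (r ^ (1 / 8 : ℝ)) (flr (m ^ 2) y)) : ℝ) : ℂ) with hE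
  have hEb : ∀ r ∈ R', ∑' z, ‖E r z‖ₑ ≤ ofReal (C2 * (m : ℝ)⁻¹ * r ^ (-(1 / 4) : ℝ)) := by
    intro r hr
    have hr0 : 0 < r := by linarith [hr1 r hr]
    set κ := r ^ (1 / 8 : ℝ) with hκ
    have hκ8 : κ ^ 8 = r := rpow_eighth_pow hr0.le
    have hκ0 : 0 < κ := rpow_pos_of_pos hr0 _
    have hmκ : (m : ℝ) ≤ κ :=
      le_of_pow_le_pow_left₀ (n := 8) (by norm_num) hκ0.le (by rw [hκ8]; exact hR r hr)
    have hq4 : r ^ (-(1 / 4) : ℝ) = (κ ^ 2)⁻¹ := by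
      rw [rpow_neg hr0.le, hκ, ← rpow_natCast, ← rpow_mul hr0.le]; norm_num
    have h4 : ∀ z, ‖E r z‖ₑ ≤ ofReal m *
        ofReal |shell r κ z - shell r κ (flr (m ^ 2) z)| := by
      intro z
      rw [← ofReal_norm, hE, norm_real, norm_eq_abs, abs_mul,
        ← ofReal_mul (by positivity)]
      refine ofReal_le_ofReal (mul_le_mul_of_nonneg_right ?_ (abs_nonneg _))
      have hMm' : (M : ℝ) ≤ m := mod_cast le_of_dvd (NeZero.pos m) hMm
      rw [abs_le]
      constructor <;> linarith [gden_nonneg m (N r) z, gden_le m (N r) z, gden_nonneg M (N r) z,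
        gden_le M (N r) z]
    have hmr : ((m ^ 2 : ℕ) : ℝ) ≤ r := by
      push_cast
      exact (pow_le_pow_right₀ hm1 (by norm_num)).trans (hR r hr)
    refine (tsum_le_tsum h4).trans ?_
    rw [ENNReal.tsum_mul_left]
    refine (mul_le_mul_right (h2 (m ^ 2) r κ (pow_pos (NeZero.pos m) 2) hmr (hm1.trans hmκ)) _).trans ?_
    rw [← ofReal_mul (by positivity), hq4]
    refine ofReal_le_ofReal ?_
    have h5 : (m : ℝ) ^ 4 ≤ κ ^ 4 := pow_le_pow_left₀ (by positivity) hmκ 4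
    have h6 : (m : ℝ) * (C2 * (κ ^ 2 * ((m ^ 2 : ℕ) : ℝ) / r)) =
        C2 * (m : ℝ)⁻¹ * (κ ^ 2)⁻¹ * ((m : ℝ) ^ 4 / κ ^ 4) := by
      rw [← hκ8]
      push_cast
      field_simp
    rw [h6]
    exact mul_le_of_le_one_right (by positivity) (div_le_one_of_le₀ h5 (by positivity))
  refine (nP_mono (by linarith) fun x => maxConv_le_add_sum R' _ (fun r y =>
    (((gden m (N r) y - gden M (N r) y) * shell r (r ^ (1 / 8 : ℝ)) (flr (m ^ 2) y) : ℝ) : ℂ)) E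
    (fun r z => by rw [hE, ← Complex.ofReal_add]; congr 1; ring) hf x).trans ?_
  refine (nP_add_le hp1 _ _).trans ((add_le_add (h1 M m n hMm hn hq R' N hR hlac f hf)
    ((nP_sum_le hp1 _ _).trans (sum_le_sum fun r hr =>
      (nP_conv_le hp1 _ _).trans (mul_le_mul_left (hEb r hr) _)))).trans ?_)
  rw [← sum_mul, ← add_mul, ← ofReal_sum_of_nonneg fun r hr => by
    have := hr1 r hr
    positivity, ← mul_sum, ← ofReal_add (by positivity) (by
      have : 0 ≤ ∑ r ∈ R', r ^ (-(1 / 4) : ℝ) := sum_nonneg fun r hr => by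
        have := hr1 r hr
        positivity
      positivity)]
  refine mul_le_mul_left (ofReal_le_ofReal ?_) _
  have h7 : C2 * (m : ℝ)⁻¹ * ∑ r ∈ R', r ^ (-(1 / 4) : ℝ) ≤ C2 * (m : ℝ)⁻¹ * C3 :=
    mul_le_mul_of_nonneg_left (h3 R' hr1 hlac) (by positivity)
  have h8 : 0 ≤ C1 * (m : ℝ)⁻¹ := by positivity
  have h9 : 0 ≤ C2 * C3 * (n : ℝ) ^ (-η) := by positivity
  nlinarith

/-- The moduli of the main terms. -/
def Mseq (d J : ℕ) : ℕ := primorial (2 ^ J) ^ (d * J)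

lemma Mseq_zero (d : ℕ) : Mseq d 0 = 1 := by simp [Mseq]

instance Mseq_neZero (d J : ℕ) : NeZero (Mseq d J) := ⟨pow_ne_zero _ (primorial_pos _).ne'⟩

lemma primorial_dvd_primorial {a b : ℕ} (h : a ≤ b) : primorial a ∣ primorial b :=
  Finset.prod_dvd_prod_of_subset _ _ _ (Finset.filter_subset_filter _
    (Finset.range_mono (by omega)))

lemma Mseq_dvd_succ (d J : ℕ) : Mseq d J ∣ Mseq d (J + 1) :=
  (pow_dvd_pow_of_dvd (primorial_dvd_primorial (Nat.pow_le_pow_right two_pos (Nat.le_succ J))) _).trans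
    (pow_dvd_pow _ (Nat.mul_le_mul_left d (Nat.le_succ J)))

lemma dvd_Mseq {J q : ℕ} (hd : 1 ≤ d) (hq : 1 ≤ q) (hqJ : q ≤ 2 ^ J) : q ∣ Mseq d J := by
  rw [← Nat.factorization_prime_le_iff_dvd (by omega) (NeZero.ne _)]
  intro p hp
  by_cases hpq : p ∣ q
  · have h1 : p ∣ primorial (2 ^ J) := by
      refine Finset.dvd_prod_of_mem _ ?_
      have := le_of_dvd (by omega) hpq
      simp only [mem_filter, mem_range]
      exact ⟨by omega, hp⟩
    have h2 : 1 ≤ (primorial (2 ^ J)).factorization p :=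
      (hp.dvd_iff_one_le_factorization (primorial_pos _).ne').1 h1
    rw [Mseq, Nat.factorization_pow]
    calc q.factorization p ≤ J :=
          Nat.factorization_le_of_le_pow (hqJ.trans (Nat.pow_le_pow_left hp.two_le J))
      _ ≤ d * J * 1 := by nlinarith
      _ ≤ _ := Nat.mul_le_mul_left _ h2
  · rw [Nat.factorization_eq_zero_of_not_dvd hpq]
    exact bot_le

lemma exists_maxConv_lam_le (hd : 5 ≤ d) {c p : ℝ} (hc : 1 < c)
    (hp : ((d : ℝ) - 1) / (d - 2) < p) (hp2 : p < 2) : ∃ C : ℝ, 0 < C ∧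
    ∀ (R' : Finset ℝ) (J : ℝ → ℕ) (N : ℝ → ℤ), (∀ r ∈ R', (Mseq d (J r) : ℝ) ^ 8 ≤ r) →
    (∀ r ∈ R', ∀ s ∈ R', r < s → c * r ≤ s) →
    ∀ f : Λ d → ℂ, f.support.Finite →
      nP p (fun x => (maxConv R' (fun r y => ((gden (Mseq d (J r)) (N r) y *
        shell r (r ^ (1 / 8 : ℝ)) y : ℝ) : ℂ)) f x : ℝ≥0∞)) ≤
        ofReal C * nP p fun x => ‖f x‖ₑ := by
  obtain ⟨C1, hC1, η, hη, h1⟩ := exists_maxConv_step_le hd hc hp hp2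
  have hd' : (5 : ℝ) ≤ d := mod_cast hd
  have hpd : (d : ℝ) / (d - 1) < p := by
    refine lt_of_le_of_lt ?_ hp
    rw [div_le_div_iff₀ (by linarith) (by linarith)]
    nlinarith
  obtain ⟨C2, hC2, h2⟩ := exists_maxConv_hk_le d (by omega) hc hpd hp2
  have hp1 : 1 ≤ p := by
    rw [div_lt_iff₀ (by linarith)] at hp
    nlinarith
  set q : ℝ := (2 : ℝ) ^ (-η) with hq
  have hq0 : 0 < q := by positivity
  have hq1 : q < 1 := Real.rpow_lt_one_of_one_lt_of_neg one_lt_two (by linarith)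
  have hS : Summable fun j : ℕ => C1 * (q ^ j + (1 / 2) ^ j) :=
    ((summable_geometric_of_lt_one hq0.le hq1).add
      (summable_geometric_of_lt_one (by norm_num) (by norm_num))).mul_left _
  have hS0 : 0 ≤ ∑' j : ℕ, C1 * (q ^ j + (1 / 2) ^ j) := tsum_nonneg fun j => by positivity
  refine ⟨C2 + ∑' j : ℕ, C1 * (q ^ j + (1 / 2) ^ j), by positivity, ?_⟩
  intro R' J N hR hlac f hf
  have hr1 : ∀ r ∈ R', 1 ≤ r := fun r hr => (one_le_pow₀ (by
    exact_mod_cast NeZero.pos (Mseq d (J r)))).trans (hR r hr)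
  have hκ0 : ∀ r ∈ R', 0 < r ^ (1 / 8 : ℝ) := fun r hr =>
    rpow_pos_of_pos (by linarith [hr1 r hr]) _
  have hκr : ∀ r ∈ R', r ^ (1 / 8 : ℝ) ≤ r := fun r hr => by
    conv_rhs => rw [← rpow_one r]
    exact rpow_le_rpow_of_exponent_le (hr1 r hr) (by norm_num)
  set D : ℕ → ℝ → Λ d → ℂ := fun j r y => (((gden (Mseq d (j + 1)) (N r) y -
    gden (Mseq d j) (N r) y) * shell r (r ^ (1 / 8 : ℝ)) y : ℝ) : ℂ) with hD
  set T := R'.sup J with hT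
  have hpt : ∀ x, (maxConv R' (fun r y => ((gden (Mseq d (J r)) (N r) y *
        shell r (r ^ (1 / 8 : ℝ)) y : ℝ) : ℂ)) f x : ℝ≥0∞) ≤
      maxConv R' (fun r => hk r (tri (r ^ (1 / 8 : ℝ)))) f x +
        ∑ j ∈ range T, (maxConv (R'.filter fun r => j < J r) (D j) f x : ℝ≥0∞) := by
    intro x
    refine coe_maxConv_le fun r hr => ?_
    have e1 : (fun y : Λ d => ((gden (Mseq d (J r)) (N r) y *
        shell r (r ^ (1 / 8 : ℝ)) y : ℝ) : ℂ)) = fun y => hk r (tri (r ^ (1 / 8 : ℝ))) y +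
        ∑ j ∈ range (J r), D j r y := by
      funext y
      rw [hk_tri _ (hκ0 r hr), hD]
      simp only
      rw [← Complex.ofReal_sum, ← sum_mul,
        Finset.sum_range_sub (fun j => gden (Mseq d j) (N r) y), ← Complex.ofReal_add, Mseq_zero]
      congr 1
      rw [show gden 1 (N r) y = 1 by simp [gden]]
      ring
    rw [e1, conv_add_left _ _ hf, conv_sum_left _ _ hf]
    refine (enorm_add_le _ _).trans (add_le_add (coe_le_coe.2 (le_sup
      (f := fun r => ‖conv (hk r (tri (r ^ (1 / 8 : ℝ)))) f x‖₊) hr)) ?_)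
    refine (enorm_sum_le _ _).trans ((sum_le_sum fun j hj => ?_).trans
      (Finset.sum_le_sum_of_subset (Finset.range_mono (le_sup hr))))
    exact coe_le_coe.2 (le_sup (f := fun r => ‖conv (D j r) f x‖₊)
      (mem_filter.2 ⟨hr, mem_range.1 hj⟩))
  have h3 : ∀ j, nP p (fun x => (maxConv (R'.filter fun r => j < J r) (D j) f x : ℝ≥0∞)) ≤
      ofReal (C1 * (q ^ j + (1 / 2) ^ j)) * nP p fun x => ‖f x‖ₑ := by
    intro j
    have hle : ∀ a b, a ≤ b → Mseq d a ≤ Mseq d b := fun a b hab =>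
      le_of_dvd (NeZero.pos _) (Nat.le_induction dvd_rfl
        (fun k _ ih => ih.trans (Mseq_dvd_succ d k)) b hab)
    refine (h1 (Mseq d j) (Mseq d (j + 1)) (2 ^ j) (Mseq_dvd_succ d j) Nat.one_le_two_pow
      (fun q h h' => dvd_Mseq (by omega) h h') _ N (fun r hr => ?_) (fun r hr s hs =>
        hlac r (mem_filter.1 hr).1 s (mem_filter.1 hs).1) f hf).trans
      (mul_le_mul_left (ofReal_le_ofReal (mul_le_mul_of_nonneg_left
        (add_le_add (le_of_eq ?_) ?_) hC1.le)) _)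
    · obtain ⟨hr, hj⟩ := mem_filter.1 hr
      refine le_trans (pow_le_pow_left₀ (by positivity) ?_ 8) (hR r hr)
      exact_mod_cast hle _ _ hj
    · push_cast
      rw [hq, ← rpow_natCast, ← rpow_natCast, ← rpow_mul (by norm_num),
        ← rpow_mul (by norm_num), mul_comm]
    · rw [one_div, inv_pow]
      refine inv_anti₀ (by positivity) ?_
      have := le_of_dvd (NeZero.pos (Mseq d (j + 1)))
        (dvd_Mseq (d := d) (J := j + 1) (q := 2 ^ j) (by omega) Nat.one_le_two_pow
          (Nat.pow_le_pow_right two_pos (Nat.le_succ j)))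
      exact_mod_cast this
  refine (nP_mono (by linarith) hpt).trans ((nP_add_le hp1 _ _).trans ?_)
  rw [ofReal_add hC2.le hS0, add_mul]
  refine add_le_add (h2 R' id (fun r => tri (r ^ (1 / 8 : ℝ)))
      (fun r => ⌊logb c (r / 1)⌋)
      (fun r hr => ⟨hr1 r hr, (continuous_tri _).measurable, abs_tri_le_one (hκ0 r hr),
        fun u hu => (abs_le_of_tri_ne_zero (hκ0 r hr) hu).trans (hκr r hr)⟩)
      (injOn_floor_logb hc one_pos (fun r hr => by linarith [hr1 r hr]) hlac)
      (fun r hr => by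
        rw [div_one]
        exact logb_floor_bounds hc (by simpa using by linarith [hr1 r hr])) f hf)
    ((nP_sum_le hp1 _ _).trans ((sum_le_sum fun j _ => h3 j).trans ?_))
  rw [← sum_mul, ← ofReal_sum_of_nonneg fun j _ => by positivity]
  exact mul_le_mul_left (ofReal_le_ofReal
    (hS.sum_le_tsum _ fun j _ => by positivity)) _

/-- The normalized Gauss sum `m⁻ᵈ ∑_b ψ(a(|b|² - N) - b·ℓ)` on `(ℤ/m)^d`. -/
def gk (N a : ZMod m) (ℓ : Γ d m) : ℂ :=
  stdAddChar (-(a * N)) * ∏ i, gaussSumN a (ℓ i)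

/-- The singular sum of the frequencies killed by `M`. -/
def singSum (M : ℕ) (N : ZMod m) (ℓ : Γ d m) : ℂ :=
  ∑ a : ZMod m with (M : ZMod m) * a = 0, gk N a ℓ

lemma norm_gk_le (N a : ZMod m) (ℓ : Γ d m) :
    ‖gk N a ℓ‖ ≤ 2 ^ ((d : ℝ) / 2) * (addOrderOf a : ℝ) ^ (-((d : ℝ) / 2)) := by
  have h0 : (0 : ℝ) < addOrderOf a := mod_cast addOrderOf_pos a
  have h1 : ∀ x : ZMod m, ‖gaussSumN a x‖ ≤ (2 / addOrderOf a : ℝ) ^ (1 / 2 : ℝ) := by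
    intro x
    rw [← sqrt_eq_rpow]
    exact Real.le_sqrt_of_sq_le ((norm_gaussSumN_sq_le a x).trans (card_two_mul_mul_eq_zero_le a))
  rw [gk, norm_mul, AddChar.norm_apply, one_mul, norm_prod]
  refine (prod_le_prod (fun i _ => norm_nonneg _) fun i _ => h1 (ℓ i)).trans (le_of_eq ?_)
  rw [prod_const, card_univ, card_fin, ← Real.rpow_mul_natCast (by positivity),
    rpow_neg h0.le, ← Real.inv_rpow h0.le, ← mul_rpow zero_le_two (by positivity)]
  congr 1
  ring

lemma gaussSumN_eq_zero {a x : ZMod m} {q : ℕ} (hq : (q : ZMod m) * a = 0)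
    (hx : (q : ZMod m) * x ≠ 0) : gaussSumN a x = 0 := by
  have h1 : gaussSumN a x = stdAddChar (-((q : ZMod m) * x)) * gaussSumN a x := by
    unfold gaussSumN
    rw [mul_left_comm]
    refine congrArg ((m : ℂ)⁻¹ * ·) ?_
    rw [mul_sum]
    refine (Equiv.sum_comp (Equiv.addRight (q : ZMod m))
      (fun b => (stdAddChar (a * b ^ 2 - b * x) : ℂ))).symm.trans ?_
    refine sum_congr rfl fun b _ => ?_
    rw [← AddChar.map_add_eq_mul]
    congr 1
    simp only [Equiv.coe_addRight]
    linear_combination (2 * b + (q : ZMod m)) * hq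
  have h2 : stdAddChar (-((q : ZMod m) * x)) ≠ 1 := by
    intro h
    rw [← AddChar.map_zero_eq_one (stdAddChar (N := m))] at h
    exact hx (neg_eq_zero.1 (ZMod.injective_stdAddChar h))
  by_contra h
  exact h2 (mul_right_cancel₀ h (by rw [one_mul]; exact h1.symm))

lemma gk_eq_zero {N a : ZMod m} {ℓ : Γ d m} {q : ℕ} (hq : (q : ZMod m) * a = 0) (hx : ∃ i, (q : ZMod m) * ℓ i ≠ 0) : gk N a ℓ = 0 := by
  obtain ⟨i, hi⟩ := hx
  rw [gk, Finset.prod_eq_zero (mem_univ i) (gaussSumN_eq_zero hq hi), mul_zero]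

lemma sum_mul_eq_of_periodic {f g : ZMod m → ℂ} (e : ZMod m)
    (hf : ∀ b z, f (b + e * z) = f b) (hg : ∀ b z, g (b + (1 - e) * z) = g b) :
    (m : ℂ) * ∑ b, f b * g b = (∑ b, f b) * ∑ b, g b := by
  calc (m : ℂ) * ∑ b, f b * g b = ∑ z : ZMod m, ∑ b, f b * g b := by
        rw [sum_const, card_univ, ZMod.card, nsmul_eq_mul]
    _ = ∑ z : ZMod m, ∑ b, f (b + e * z) * g (b + e * z) := by
        refine sum_congr rfl fun z _ => ?_
        exact (Equiv.sum_comp (Equiv.addRight (e * z)) fun b => f b * g b).symm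
    _ = ∑ z : ZMod m, ∑ b, f b * g (b + z) := by
        refine sum_congr rfl fun z _ => sum_congr rfl fun b _ => ?_
        rw [hf, ← hg (b + e * z) z]
        ring_nf
    _ = _ := by
        rw [sum_comm, sum_mul]
        refine sum_congr rfl fun b _ => ?_
        rw [← mul_sum]
        congr 1
        exact Equiv.sum_comp (Equiv.addLeft b) g

lemma gk_add {M₁ M₂ : ℕ} (hcop : M₁.Coprime M₂) {N a₁ a₂ : ZMod m}
    {ℓ : Γ d m} (h₁ : (M₁ : ZMod m) * a₁ = 0) (h₂ : (M₂ : ZMod m) * a₂ = 0)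
    (hℓ : ∀ i, (M₁ : ZMod m) * ℓ i = 0) : gk N (a₁ + a₂) ℓ = gk N a₁ ℓ * gk N a₂ (0 : Γ d m) := by
  have hm : (m : ℂ) ≠ 0 := mod_cast NeZero.ne m
  obtain ⟨u, v, huv⟩ := Nat.isCoprime_iff_coprime.2 hcop
  have huv' : (u : ZMod m) * M₁ + v * M₂ = 1 := by
    have := congrArg (Int.cast (R := ZMod m)) huv
    push_cast at this
    exact this
  have h3 : ∀ x : ZMod m, (M₁ : ZMod m) * x = 0 →
      gaussSumN (a₁ + a₂) x = gaussSumN a₁ x * gaussSumN a₂ 0 := by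
    intro x hx
    have h4 := sum_mul_eq_of_periodic (f := fun b => stdAddChar (a₁ * b ^ 2 - b * x))
      (g := fun b => stdAddChar (a₂ * b ^ 2 - b * 0)) (u * M₁ : ZMod m) (by
        intro b z
        congr 1
        linear_combination (2 * b * u * z + u ^ 2 * M₁ * z ^ 2) * h₁ - (u * z) * hx) (by
        intro b z
        rw [← huv']
        congr 1
        linear_combination (2 * b * v * z + v ^ 2 * M₂ * z ^ 2) * h₂)
    have h5 : ∑ b : ZMod m, stdAddChar ((a₁ + a₂) * b ^ 2 - b * x) =
        ∑ b : ZMod m, (stdAddChar (a₁ * b ^ 2 - b * x) *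
          stdAddChar (a₂ * b ^ 2 - b * 0) : ℂ) := by
      refine sum_congr rfl fun b _ => ?_
      rw [← AddChar.map_add_eq_mul]
      ring_nf
    unfold gaussSumN
    rw [h5]
    field_simp
    exact h4
  simp only [gk, Pi.zero_apply]
  rw [prod_congr rfl fun i _ => h3 (ℓ i) (hℓ i), prod_mul_distrib,
    show -((a₁ + a₂) * N) = -(a₁ * N) + -(a₂ * N) by ring, AddChar.map_add_eq_mul]
  ring

lemma singSum_mul {M₁ M₂ : ℕ} (hm : m = M₁ * M₂) (hcop : M₁.Coprime M₂)
    (N : ZMod m) {ℓ : Γ d m} (hℓ : ∀ i, (M₁ : ZMod m) * ℓ i = 0) :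
    singSum m N ℓ = singSum M₁ N ℓ * singSum M₂ N (0 : Γ d m) := by
  obtain ⟨u, v, huv⟩ := Nat.isCoprime_iff_coprime.2 hcop
  have huv' : (u : ZMod m) * M₁ + v * M₂ = 1 := by
    have := congrArg (Int.cast (R := ZMod m)) huv
    push_cast at this
    exact this
  have h0 : (M₁ : ZMod m) * M₂ = 0 := by
    rw [← cast_mul, ← hm, CharP.cast_eq_zero]
  unfold singSum
  rw [sum_mul_sum, ← Finset.sum_product']
  symm
  refine Finset.sum_bij' (fun x _ => x.1 + x.2) (fun a _ => (v * M₂ * a, u * M₁ * a)) ?_ ?_ ?_ ?_ ?_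
  · intro x _
    simp
  · intro a _
    simp only [mem_product, mem_filter, mem_univ, true_and]
    exact ⟨by linear_combination (v * a) * h0, by linear_combination (u * a) * h0⟩
  · rintro ⟨x, y⟩ h
    simp only [mem_product, mem_filter, mem_univ, true_and] at h
    refine Prod.ext ?_ ?_
    · linear_combination v * h.2 + x * huv' - u * h.1
    · linear_combination u * h.1 + y * huv' - v * h.2
  · intro a _
    linear_combination a * huv'
  · rintro ⟨x, y⟩ h
    simp only [mem_product, mem_filter, mem_univ, true_and] at h
    exact (gk_add hcop h.1 h.2 hℓ).symm

lemma gk_eq_sum (N a : ZMod m) :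
    gk N a (0 : Γ d m) =
      ((m : ℂ) ^ d)⁻¹ * ∑ b : Γ d m, stdAddChar (a * (∑ i, b i ^ 2 - N)) := by
  simp only [gk, gaussSumN, Pi.zero_apply, mul_zero, sub_zero]
  rw [prod_mul_distrib, prod_const, card_univ, card_fin,
    prod_univ_sum, inv_pow, piFinset_univ, mul_left_comm, mul_sum]
  congr 1
  refine sum_congr rfl fun b _ => ?_
  rw [mul_sub, sub_eq_neg_add, AddChar.map_add_eq_mul, mul_sum, addChar_map_sum]

lemma natCast_mul_eq_zero_iff {M K : ℕ} (hm : m = M * K) (t : ℤ) :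
    (K : ZMod m) * (t : ZMod m) = 0 ↔ (M : ℤ) ∣ t := by
  have h0 : m ≠ 0 := NeZero.ne m
  have hK : (K : ℤ) ≠ 0 := by
    rintro h
    exact h0 (by rw [hm, Int.natCast_eq_zero.1 h, mul_zero])
  have h1 : (K : ZMod m) * (t : ZMod m) = ((K * t : ℤ) : ZMod m) := by push_cast; rfl
  have h2 : ((m : ℕ) : ℤ) = K * M := by rw [hm]; push_cast; ring
  rw [h1, ZMod.intCast_zmod_eq_zero_iff_dvd, h2, mul_dvd_mul_iff_left hK]

lemma singSum_zero_eq {M K : ℕ} (hm : m = M * K) (N : ZMod m) :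
    singSum M N (0 : Γ d m) = ((((m : ℝ) ^ d)⁻¹ *
      ∑ b : Γ d m, if (K : ZMod m) * (∑ i, b i ^ 2 - N) = 0 then (M : ℝ) else 0 : ℝ) : ℂ) := by
  unfold singSum
  simp only [gk_eq_sum]
  rw [← mul_sum, sum_comm]
  push_cast
  congr 1
  refine sum_congr rfl fun b _ => ?_
  obtain ⟨t, ht⟩ := ZMod.intCast_surjective (∑ i, b i ^ 2 - N)
  rw [← ht, sum_stdAddChar_filter (hm ▸ dvd_mul_right M K) t]
  simp only [natCast_mul_eq_zero_iff hm]
  split_ifs <;> simp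

lemma exists_pow_dvd_sq_sub (a s : ℤ) (k : ℕ) : ∃ x : ℤ, a ^ k ∣ x ^ 2 - (1 + 4 * a * s) := by
  have h : ∀ k : ℕ, ∃ z : ℤ, a ∣ z ∧ a ^ (k + 1) ∣ z ^ 2 + z - a * s := by
    intro k
    induction k with
    | zero => exact ⟨0, dvd_zero _, ⟨-s, by ring⟩⟩
    | succ k ih =>
      obtain ⟨z, ⟨w, hw⟩, v, hv⟩ := ih
      refine ⟨a * s - z ^ 2, ⟨s - w * z, by rw [hw]; ring⟩, ⟨-v * (s - w * z + w), ?_⟩⟩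
      have h1 : a * s - z ^ 2 + z = a * (s - w * z + w) := by rw [hw]; ring
      calc (a * s - z ^ 2) ^ 2 + (a * s - z ^ 2) - a * s
          = -(z ^ 2 + z - a * s) * (a * s - z ^ 2 + z) := by ring
        _ = _ := by rw [h1, hv]; ring
  obtain ⟨z, -, v, hv⟩ := h k
  exact ⟨1 + 2 * z, ⟨4 * v * a, by linear_combination 4 * hv⟩⟩

lemma exists_sum_sq_modEq {K : ℕ} (hd : 5 ≤ d) (hK : 1 ≤ K) (N : ℤ) :
    ∃ (i₀ : Fin d) (y : Λ d), y i₀ = 0 ∧ (K : ℤ) ∣ N - ∑ i, y i ^ 2 - 1 := by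
  obtain ⟨n, rfl⟩ := Nat.exists_eq_add_of_le' hd
  have hK' : (K : ℤ) ≠ 0 := by positivity
  obtain ⟨a, b, c, e, h⟩ := Nat.sum_four_squares ((N - 1) % K).toNat
  refine ⟨0, Fin.cons 0 (Fin.cons a (Fin.cons b (Fin.cons c (Fin.cons e fun _ => 0)))), rfl, ?_⟩
  have h1 : ((N - 1) % K : ℤ) = a ^ 2 + b ^ 2 + c ^ 2 + e ^ 2 := by
    rw [← Int.toNat_of_nonneg (Int.emod_nonneg (N - 1) hK'), ← h]
    push_cast
    rfl
  have h2 : N - ∑ i : Fin (n + 5), (Fin.cons 0 (Fin.cons (a : ℤ) (Fin.cons (b : ℤ)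
      (Fin.cons (c : ℤ) (Fin.cons (e : ℤ) fun _ => 0)))) : Fin (n + 5) → ℤ) i ^ 2 - 1 =
      (N - 1) - (N - 1) % K := by
    rw [h1]
    simp [Fin.sum_univ_succ]
    ring
  rw [h2]
  exact Int.dvd_self_sub_emod

lemma sum_sum_shift (g : Γ d m → ℝ) (i₀ : Fin d) :
    ∑ b : Γ d m, ∑ x : ZMod m, g (b + Pi.single i₀ x) = m * ∑ b, g b := by
  rw [sum_comm]
  have h : ∀ x : ZMod m, ∑ b : Γ d m, g (b + Pi.single i₀ x) = ∑ b, g b := fun x => Equiv.sum_comp 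
    (Equiv.addRight (Pi.single i₀ x : Γ d m)) g
  simp only [h]
  rw [sum_const, card_univ, ZMod.card, nsmul_eq_mul]

lemma card_le_sum_of_le_sum_shift (B : Finset Γ d m)
    (g : Γ d m → ℝ) (i₀ : Fin d) (hg0 : ∀ b, 0 ≤ g b)
    (key : ∀ b ∈ B, (m : ℝ) ≤ ∑ x : ZMod m, g (b + Pi.single i₀ x)) :
    (B.card : ℝ) ≤ ∑ b, g b := by
  have hmR : (0 : ℝ) < m := mod_cast NeZero.pos m
  refine le_of_mul_le_mul_left ?_ hmR
  have h1 := card_nsmul_le_sum B (fun b => ∑ x : ZMod m, g (b + Pi.single i₀ x)) (m:ℝ) key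
  rw [nsmul_eq_mul, mul_comm] at h1
  rw [← sum_sum_shift g i₀]
  refine h1.trans ?_
  exact Finset.sum_le_univ_sum_of_nonneg fun b => sum_nonneg fun x _ => hg0 _

set_option maxHeartbeats 600000 in
lemma norm_singSum_pow_ge {M a k : ℕ} (hd : 5 ≤ d) (ha : 1 ≤ a) (h4 : 4 * a ∣ m)
    (hM : M ∣ m) (hk : M ∣ a ^ k) (N : ℤ) :
    (((4 * a : ℕ) : ℝ) ^ d)⁻¹ ≤ ‖singSum M (N : ZMod m) (0 : Γ d m)‖ := by
  obtain ⟨K, hK⟩ := hM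
  obtain ⟨L, hL⟩ := h4
  have hm : 0 < m := NeZero.pos m
  obtain ⟨i₀, y, hy0, hy⟩ := exists_sum_sq_modEq hd (show 1 ≤ 4 * a by omega) N
  rw [singSum_zero_eq hK, norm_real]
  refine le_trans ?_ (Real.le_norm_self _)
  set D : ZMod m → ℝ := fun t => if (K : ZMod m) * t = 0 then (M : ℝ) else 0 with hD
  have hD0 : ∀ t, 0 ≤ D t := by
    intro t
    simp only [hD]
    split_ifs <;> positivity
  let g : Γ d m → ℝ := fun b => D (∑ i, b i ^ 2 - (N : ZMod m))
  have hg0 : ∀ b, 0 ≤ g b := fun b => hD0 _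
  set B : Finset Γ d m := piFinset fun i =>
    univ.filter fun x : ZMod m => (L : ZMod m) * (x - (y i : ZMod m)) = 0 with hB
  have hBc : (B.card : ℝ) = (L : ℝ) ^ d := by
    have h1 : ∀ i, (univ.filter fun x : ZMod m => (L : ZMod m) * (x - (y i : ZMod m)) = 0).card
        = L := by
      intro i
      refine Eq.trans ?_ (card_mul_natCast_eq_zero (M := L) (m := m) ⟨4 * a, by rw [hL, mul_comm]⟩)
      refine Finset.card_bij (fun x _ => x - (y i : ZMod m)) ?_ ?_ ?_
      · intro x hx
        simpa using hx
      · intro x _ x' _ h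
        exact sub_left_injective h
      · intro x hx
        exact ⟨x + (y i : ZMod m), by simpa using hx, by simp⟩
    rw [hB, card_piFinset]
    simp only [h1, prod_const, card_univ, card_fin]
    push_cast
    rfl
  have key : ∀ b ∈ B, (m : ℝ) ≤ ∑ x : ZMod m, g (b + Pi.single i₀ x) := by
    intro b hb
    have hb' : ∀ i, (4 * a : ℤ) ∣ ((b i).val : ℤ) - y i := by
      intro i
      have h1 := Fintype.mem_piFinset.1 hb i
      rw [mem_filter] at h1
      have h2 := (natCast_mul_eq_zero_iff hL (((b i).val : ℤ) - y i)).1 (by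
        have := h1.2
        push_cast
        rwa [natCast_zmod_val])
      exact_mod_cast h2
    obtain ⟨s, hs⟩ : (4 * a : ℤ) ∣ N - ∑ i ∈ univ.erase i₀, ((b i).val : ℤ) ^ 2 - 1 := by
      have h1 : N - ∑ i ∈ univ.erase i₀, ((b i).val : ℤ) ^ 2 - 1 =
          (N - ∑ i, y i ^ 2 - 1) - ∑ i ∈ univ.erase i₀, (((b i).val : ℤ) ^ 2 - y i ^ 2) := by
        rw [sum_sub_distrib, ← add_sum_erase _ (fun i => y i ^ 2) (mem_univ i₀),
          hy0]
        ring
      rw [h1]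
      refine dvd_sub (mod_cast hy) (Finset.dvd_sum fun i _ => ?_)
      rw [sq_sub_sq]
      exact (hb' i).mul_left _
    obtain ⟨x₀, hx₀⟩ := exists_pow_dvd_sq_sub a s k
    have h3 : (M : ℤ) ∣ x₀ ^ 2 - (1 + 4 * a * s) := dvd_trans (mod_cast hk) hx₀
    have h4 : (K : ZMod m) * ((x₀ : ZMod m) ^ 2 - ((N : ZMod m) -
        ∑ i ∈ univ.erase i₀, b i ^ 2)) = 0 := by
      have h5 := (natCast_mul_eq_zero_iff hK _).2 h3
      have h6 : 1 + 4 * a * s = N - ∑ i ∈ univ.erase i₀, ((b i).val : ℤ) ^ 2 := by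
        linarith
      rw [h6] at h5
      push_cast at h5
      simpa only [natCast_zmod_val] using h5
    have h5 : ∀ w : ZMod m, (K : ZMod m) * w = 0 →
        g (b + Pi.single i₀ (x₀ + w - b i₀)) = M := by
      intro w hw
      simp only [g, hD]
      rw [if_pos]
      rw [← add_sum_erase _ _ (mem_univ i₀),
        sum_congr rfl (g := fun i => b i ^ 2) (fun i hi => by
          rw [Pi.add_apply, Pi.single_eq_of_ne (Finset.ne_of_mem_erase hi), add_zero])]
      rw [Pi.add_apply, Pi.single_eq_same]
      linear_combination h4 + (2 * x₀ + w) * hw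
    rw [← Equiv.sum_comp ((Equiv.addLeft (x₀ : ZMod m)).trans (Equiv.subRight (b i₀)))]
    simp only [Equiv.trans_apply, Equiv.coe_addLeft, Equiv.subRight_apply]
    have h6 : ∑ w ∈ univ.filter (fun w : ZMod m => (K : ZMod m) * w = 0),
        g (b + Pi.single i₀ (x₀ + w - b i₀)) = m := by
      rw [sum_congr rfl fun w hw => h5 w (mem_filter.1 hw).2, sum_const,
        card_mul_natCast_eq_zero ⟨M, by rw [hK, mul_comm]⟩, nsmul_eq_mul, ← cast_mul,
        mul_comm K M, ← hK]
    rw [← h6]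
    exact Finset.sum_le_sum_of_subset_of_nonneg (Finset.filter_subset _ _) fun w _ _ => hg0 _
  have h7 : (L : ℝ) ^ d ≤ ∑ b, g b := by
    rw [← hBc]
    exact card_le_sum_of_le_sum_shift B g i₀ hg0 key
  have hL0 : (0 : ℝ) < L := by
    have : L ≠ 0 := by
      rintro rfl
      omega
    positivity
  calc (((4 * a : ℕ) : ℝ) ^ d)⁻¹ = ((m : ℝ) ^ d)⁻¹ * (L : ℝ) ^ d := by
        have : (m : ℝ) = ((4 * a : ℕ) : ℝ) * L := by rw [hL]; push_cast; ring
        rw [this, mul_pow]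
        field_simp
    _ ≤ _ := mul_le_mul_of_nonneg_left h7 (by positivity)

lemma exists_mul_eq_coprime (a : ℕ) : ∀ m : ℕ, 0 < m →
    ∃ M₁ M₂ k : ℕ, m = M₁ * M₂ ∧ M₁ ∣ a ^ k ∧ M₂.Coprime a := by
  intro m
  induction m using Nat.strong_induction_on with
  | _ m ih =>
    intro hm
    by_cases h : m.Coprime a
    · exact ⟨1, m, 0, by simp, by simp, h⟩
    · have hg : 1 < m.gcd a := by
        have := Nat.gcd_pos_of_pos_left a hm
        unfold Nat.Coprime at h
        omega
      obtain ⟨t, ht⟩ := Nat.gcd_dvd_left m a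
      have ht0 : 0 < t := by
        rcases Nat.eq_zero_or_pos t with rfl | h
        · omega
        · exact h
      obtain ⟨M₁, M₂, k, h1, h2, h3⟩ := ih t (by nlinarith) ht0
      refine ⟨m.gcd a * M₁, M₂, k + 1, by rw [mul_assoc, ← h1]; exact ht, ?_, h3⟩
      rw [pow_succ']
      exact mul_dvd_mul (Nat.gcd_dvd_right m a) h2

lemma dvd_Mseq_of_prime_le {J q : ℕ} (hq : 1 ≤ q) (hqJ : q ≤ 2 ^ (d * J))
    (hp : ∀ p, p.Prime → p ∣ q → p ≤ 2 ^ J) : q ∣ Mseq d J := by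
  rw [← Nat.factorization_prime_le_iff_dvd (by omega) (NeZero.ne _)]
  intro p hp'
  by_cases hpq : p ∣ q
  · have h1 : p ∣ primorial (2 ^ J) := by
      refine Finset.dvd_prod_of_mem _ ?_
      have := hp p hp' hpq
      simp only [mem_filter, mem_range]
      exact ⟨by omega, hp'⟩
    have h2 : 1 ≤ (primorial (2 ^ J)).factorization p :=
      (hp'.dvd_iff_one_le_factorization (primorial_pos _).ne').1 h1
    rw [Mseq, Nat.factorization_pow]
    calc q.factorization p ≤ d * J := by
          exact Nat.factorization_le_of_le_pow (hqJ.trans (Nat.pow_le_pow_left hp'.two_le _))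
      _ = d * J * 1 := (mul_one _).symm
      _ ≤ _ := Nat.mul_le_mul_left _ h2
  · rw [Nat.factorization_eq_zero_of_not_dvd hpq]
    exact bot_le

/-- The singular sum of the frequencies of order at most `Q`. -/
def ordSum (Q : ℕ) (N : ZMod m) (ℓ : Γ d m) : ℂ :=
  ∑ a : ZMod m with addOrderOf a ≤ Q, gk N a ℓ

lemma natCast_mul_eq_zero_iff_addOrderOf_dvd {m : ℕ} (q : ℕ) (a : ZMod m) :
    (q : ZMod m) * a = 0 ↔ addOrderOf a ∣ q := by
  rw [addOrderOf_dvd_iff_nsmul_eq_zero, nsmul_eq_mul]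

lemma addOrderOf_le_modulus (a : ZMod m) : addOrderOf a ≤ m := by
  simpa using addOrderOf_le_card_univ (x := a)

lemma norm_sum_gk_le_sum (T : Finset (ZMod m)) (T' : Finset ℕ)
    (h : ∀ a ∈ T, addOrderOf a ∈ T') (N : ZMod m) (ℓ : Γ d m) :
    ‖∑ a ∈ T, gk N a ℓ‖ ≤ 2 ^ ((d : ℝ) / 2) * ∑ q ∈ T', (q : ℝ) ^ (1 - (d : ℝ) / 2) := by
  refine (norm_sum_le_of_le T fun a _ => norm_gk_le N a ℓ).trans ?_
  rw [← mul_sum]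
  exact mul_le_mul_of_nonneg_left (sum_rpow_addOrderOf_le T T' h) (by positivity)

lemma exists_norm_sum_gk_le (hd : 5 ≤ d) : ∃ C : ℝ, 0 < C ∧
    ∀ (m : ℕ) [NeZero m] (T : Finset (ZMod m)) (n : ℕ) (N : ZMod m) (ℓ : Γ d m),
      1 ≤ n → (∀ a ∈ T, n < addOrderOf a) →
      ‖∑ a ∈ T, gk N a ℓ‖ ≤ C * (n : ℝ) ^ (21 / 10 - (d : ℝ) / 2) := by
  obtain ⟨C, hC0, hC⟩ := exists_sum_rpow_tail_le_rpow
  refine ⟨2 ^ ((d : ℝ) / 2) * C, by positivity, fun m _ T n N ℓ hn h => ?_⟩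
  rw [mul_assoc]
  exact (norm_sum_gk_le_sum T (Finset.Ioc n m) (fun a ha => mem_Ioc.2
    ⟨h a ha, addOrderOf_le_modulus a⟩) N ℓ).trans
    (mul_le_mul_of_nonneg_left (hC d n m hd hn) (by positivity))

lemma exists_norm_sum_gk_le_of_dvd (hd : 5 ≤ d) : ∃ C : ℝ, 0 < C ∧
    ∀ (m : ℕ) [NeZero m] (T : Finset (ZMod m)) (q : ℕ) (N : ZMod m) (ℓ : Γ d m),
      1 ≤ q → (∀ a ∈ T, q ∣ addOrderOf a) →
      ‖∑ a ∈ T, gk N a ℓ‖ ≤ C * (q : ℝ) ^ (1 - (d : ℝ) / 2) := by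
  obtain ⟨C, hC0, hC⟩ := exists_sum_rpow_tail_le_rpow
  refine ⟨2 ^ ((d : ℝ) / 2) * (1 + C), by positivity, fun m _ T q N ℓ hq h => ?_⟩
  have h1 : ∑ j ∈ Finset.Icc 1 m, (j : ℝ) ^ (1 - (d : ℝ) / 2) ≤ 1 + C := by
    have h2 := hC d 1 m hd le_rfl
    rw [cast_one, one_rpow, mul_one] at h2
    rw [← Finset.Ioc_insert_left (NeZero.one_le : 1 ≤ m), sum_insert (by simp), cast_one,
      one_rpow]
    linarith
  have h3 := norm_sum_gk_le_sum T ((Finset.Icc 1 m).image fun j => q * j) (fun a ha => by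
    obtain ⟨j, hj⟩ := h a ha
    have h4 := addOrderOf_pos a
    have h5 := addOrderOf_le_modulus a
    refine mem_image.2 ⟨j, mem_Icc.2 ⟨?_, ?_⟩, hj.symm⟩
    · exact Nat.pos_of_ne_zero (by rintro rfl; omega)
    · exact (Nat.le_mul_of_pos_left j hq).trans (hj ▸ h5)) N ℓ
  rw [sum_image fun a _ b _ hab => Nat.eq_of_mul_eq_mul_left hq hab] at h3
  simp only [cast_mul, mul_rpow (cast_nonneg _) (cast_nonneg _)] at h3
  rw [← mul_sum] at h3
  refine h3.trans ?_
  rw [mul_assoc, mul_comm (1 + C)]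
  exact mul_le_mul_of_nonneg_left (mul_le_mul_of_nonneg_left h1 (by positivity)) (by positivity)

lemma singSum_eq_of_eq {M : ℕ} (hm : m = M) (N : ZMod m) (ℓ : Γ d m) :
    singSum M N ℓ = ∑ a, gk N a ℓ := by
  rw [singSum, Finset.filter_true_of_mem]
  intro a _
  rw [← hm, ZMod.natCast_self, zero_mul]

lemma singSum_self_sub_ordSum (Q : ℕ) (N : ZMod m) (ℓ : Γ d m) :
    singSum m N ℓ - ordSum Q N ℓ = ∑ a : ZMod m with Q < addOrderOf a, gk N a ℓ := by
  rw [singSum_eq_of_eq rfl, ordSum, ← Finset.sum_filter_add_sum_filter_not univ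
    (fun a : ZMod m => addOrderOf a ≤ Q), add_sub_cancel_left]
  simp only [not_le]

lemma singSum_sub_singSum {M M₁ : ℕ} (h : M ∣ M₁) (N : ZMod m)
    (ℓ : Γ d m) : singSum M₁ N ℓ - singSum M N ℓ =
      ∑ a : ZMod m with addOrderOf a ∣ M₁ ∧ ¬ addOrderOf a ∣ M, gk N a ℓ := by
  rw [singSum, singSum]
  simp only [natCast_mul_eq_zero_iff_addOrderOf_dvd]
  rw [sub_eq_iff_eq_add, ← Finset.sum_filter_add_sum_filter_not
    (univ.filter fun a : ZMod m => addOrderOf a ∣ M₁) (fun a : ZMod m => addOrderOf a ∣ M),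
    add_comm, filter_filter, filter_filter]
  congr 2
  ext a
  simp only [mem_filter, mem_univ, true_and]
  exact ⟨fun h' => h'.2, fun h' => ⟨h'.trans h, h'⟩⟩

lemma two_pow_rpow_le (hd : 5 ≤ d) (J : ℕ) :
    (((2 ^ (d * J) : ℕ) : ℝ)) ^ (21 / 10 - (d : ℝ) / 2) ≤ ((2 : ℝ) ^ J) ^ (1 - (d : ℝ) / 2) := by
  have hd' : (5 : ℝ) ≤ d := mod_cast hd
  have h1 : (((2 ^ (d * J) : ℕ) : ℝ)) = ((2 : ℝ) ^ J) ^ (d : ℝ) := by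
    rw [rpow_natCast, ← pow_mul, mul_comm J d]
    push_cast
    rfl
  rw [h1, ← rpow_mul (by positivity)]
  exact rpow_le_rpow_of_exponent_le (one_le_pow₀ one_le_two) (by nlinarith)

lemma two_pow_le_Mseq (d J : ℕ) : 2 ^ (d * J) ≤ Mseq d J := by
  rcases Nat.eq_zero_or_pos J with rfl | hJ
  · simp [Mseq]
  · refine Nat.pow_le_pow_left ?_ _
    have h : 2 ∣ primorial (2 ^ J) := Nat.prime_two.dvd_primorial_iff.2 (by
      simpa using Nat.pow_le_pow_right two_pos hJ)
    exact le_of_dvd (primorial_pos _) h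

lemma exists_singSum_factor (hd : 5 ≤ d) : ∃ C : ℝ, 0 < C ∧
    ∀ (J Q m : ℕ) [NeZero m], m = Q.factorial → Mseq d J ≤ Q → ∀ N : ZMod m,
      ∃ t : ℂ, ‖t‖ ≤ C ∧ ∀ ℓ : Γ d m, (∀ i, (Mseq d J : ZMod m) * ℓ i = 0) →
        ‖ordSum Q N ℓ - singSum (Mseq d J) N ℓ * t‖ ≤ C * ((2 : ℝ) ^ J) ^ (1 - (d : ℝ) / 2) := by
  obtain ⟨C₁, hC₁, h₁⟩ := exists_norm_sum_gk_le hd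
  obtain ⟨C₂, hC₂, h₂⟩ := exists_norm_sum_gk_le_of_dvd hd
  refine ⟨C₁ + C₂ + C₁ * C₂, by positivity, fun J Q m _ hm hQ N => ?_⟩
  obtain ⟨M₁, M₂, k, hM, hk, hcop⟩ := exists_mul_eq_coprime (primorial (2 ^ J)) m (NeZero.pos m)
  have hMm : Mseq d J ∣ m := hm ▸ Nat.dvd_factorial (NeZero.pos _) hQ
  have hM1 : Mseq d J ∣ M₁ :=
    Nat.Coprime.dvd_of_dvd_mul_right (pow_left _ hcop.symm) (hM ▸ hMm)
  have hcop' : M₁.Coprime M₂ :=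
    coprime_dvd_left hk (pow_left _ hcop.symm)
  have ht : ‖singSum M₂ N (0 : Γ d m)‖ ≤ C₂ := by
    simpa [singSum] using h₂ m _ 1 N (0 : Γ d m) le_rfl (fun a _ => one_dvd _)
  set E := ((2 : ℝ) ^ J) ^ (1 - (d : ℝ) / 2)
  have hE : 0 ≤ E := by positivity
  have hQJ : 2 ^ (d * J) ≤ Q := (two_pow_le_Mseq d J).trans hQ
  refine ⟨singSum M₂ N (0 : Γ d m), ht.trans (by nlinarith), fun ℓ hℓ => ?_⟩
  have e1 : ‖singSum m N ℓ - ordSum Q N ℓ‖ ≤ C₁ * E := by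
    rw [singSum_self_sub_ordSum]
    refine (h₁ m _ (2 ^ (d * J)) N ℓ Nat.one_le_two_pow (fun a ha => ?_)).trans
      (mul_le_mul_of_nonneg_left (two_pow_rpow_le hd J) hC₁.le)
    exact hQJ.trans_lt (mem_filter.1 ha).2
  have e2 : ‖singSum M₁ N ℓ - singSum (Mseq d J) N ℓ‖ ≤ C₁ * E := by
    rw [singSum_sub_singSum hM1]
    refine (h₁ m _ (2 ^ (d * J)) N ℓ Nat.one_le_two_pow (fun a ha => ?_)).trans
      (mul_le_mul_of_nonneg_left (two_pow_rpow_le hd J) hC₁.le)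
    obtain ⟨ha1, ha2⟩ := (mem_filter.1 ha).2
    by_contra! hle
    exact ha2 (dvd_Mseq_of_prime_le (addOrderOf_pos a) hle fun p hp hpa =>
      hp.dvd_primorial_iff.1 (hp.dvd_of_dvd_pow (hpa.trans (ha1.trans hk))))
  have e3 := singSum_mul hM hcop' N (ℓ := ℓ) (fun i => by
    obtain ⟨c, hc⟩ := hM1
    rw [hc, cast_mul, mul_comm (Mseq d J : ZMod m), mul_assoc, hℓ i, mul_zero])
  generalize singSum M₂ N (0 : Γ d m) = t at *
  calc ‖ordSum Q N ℓ - singSum (Mseq d J) N ℓ * t‖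
      = ‖-(singSum m N ℓ - ordSum Q N ℓ) + (singSum M₁ N ℓ - singSum (Mseq d J) N ℓ) * t‖ := by
        rw [e3]
        congr 1
        ring
    _ ≤ C₁ * E + C₁ * E * C₂ := by
        refine (norm_add_le _ _).trans (add_le_add ?_ ?_)
        · rwa [norm_neg]
        · rw [norm_mul]
          exact mul_le_mul e2 ht (norm_nonneg _) (by positivity)
    _ ≤ _ := by nlinarith [mul_nonneg hC₂.le hE]

lemma exists_norm_ordSum_le (hd : 5 ≤ d) : ∃ C : ℝ, 0 < C ∧
    ∀ (J Q m : ℕ) [NeZero m] (N : ZMod m) (ℓ : Γ d m), ‖ordSum Q N ℓ‖ ≤ C ∧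
      ‖singSum (Mseq d J) N ℓ‖ ≤ C ∧ ((∃ i, (Mseq d J : ZMod m) * ℓ i ≠ 0) →
        singSum (Mseq d J) N ℓ = 0 ∧
        ‖ordSum Q N ℓ‖ ≤ C * ((2 : ℝ) ^ J) ^ (1 - (d : ℝ) / 2)) := by
  obtain ⟨C, hC, h⟩ := exists_norm_sum_gk_le_of_dvd hd
  have hd' : (5 : ℝ) ≤ d := mod_cast hd
  refine ⟨C, hC, fun J Q m _ N ℓ => ⟨?_, ?_, fun hx => ⟨?_, ?_⟩⟩⟩
  · simpa [ordSum] using h m _ 1 N ℓ le_rfl (fun a _ => one_dvd _)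
  · simpa [singSum] using h m _ 1 N ℓ le_rfl (fun a _ => one_dvd _)
  · exact sum_eq_zero fun a ha => gk_eq_zero (mem_filter.1 ha).2 hx
  · have hq : 2 ^ J ≤ addOrderOf ℓ := by
      by_contra! hlt
      obtain ⟨i, hi⟩ := hx
      have h1 := addOrderOf_dvd_iff_nsmul_eq_zero.1
        (dvd_Mseq (d := d) (by omega) (addOrderOf_pos ℓ) hlt.le)
      apply hi
      simpa using congrFun h1 i
    have h1 : ordSum Q N ℓ = ∑ a ∈ (univ.filter fun a : ZMod m => addOrderOf a ≤ Q).filter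
        (fun a => addOrderOf ℓ ∣ addOrderOf a), gk N a ℓ := by
      rw [ordSum]
      refine (Finset.sum_filter_of_ne fun a _ ha => ?_).symm
      rw [addOrderOf_dvd_iff_nsmul_eq_zero]
      by_contra hne
      refine ha (gk_eq_zero (q := addOrderOf a) ?_ ?_)
      · rw [natCast_mul_eq_zero_iff_addOrderOf_dvd]
      · by_contra! h2
        exact hne (funext fun i => by simpa using h2 i)
    rw [h1]
    refine (h m _ (addOrderOf ℓ) N ℓ (addOrderOf_pos ℓ)
      (fun a ha => (mem_filter.1 ha).2)).trans (mul_le_mul_of_nonneg_left ?_ hC.le)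
    exact rpow_le_rpow_of_nonpos (by positivity) (mod_cast hq) (by linarith)

lemma gk_zero_zero (N : ZMod m) : gk N 0 (0 : Γ d m) = 1 := by
  have : (m : ℂ) ≠ 0 := NeZero.ne _
  simp [gk, gaussSumN, this]

lemma exists_norm_singSum_factorial_ge (hd : 5 ≤ d) : ∃ c : ℝ, 0 < c ∧ ∃ Q₀ : ℕ,
    ∀ (Q m : ℕ) [NeZero m], m = Q.factorial → Q₀ ≤ Q → ∀ N : ℤ,
      c ≤ ‖singSum m (N : ZMod m) (0 : Γ d m)‖ := by
  obtain ⟨C, hC, h⟩ := exists_norm_sum_gk_le hd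
  have hd' : (5 : ℝ) ≤ d := mod_cast hd
  obtain ⟨n, hn1, hn⟩ : ∃ n : ℕ, 1 ≤ n ∧ C * (n : ℝ) ^ (21 / 10 - (d : ℝ) / 2) ≤ 1 / 2 := by
    have h1 : Filter.Tendsto (fun n : ℕ => C * (n : ℝ) ^ (-((d : ℝ) / 2 - 21 / 10)))
        atTop (nhds (C * 0)) :=
      ((tendsto_rpow_neg_atTop (by linarith)).comp tendsto_natCast_atTop_atTop).const_mul C
    rw [mul_zero] at h1
    obtain ⟨n, hn⟩ := ((h1.eventually_le_const (by norm_num : (0 : ℝ) < 1 / 2)).and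
      (Filter.eventually_ge_atTop 1)).exists
    exact ⟨n, hn.2, by simpa only [neg_sub] using hn.1⟩
  have hn0 := Nat.factorial_pos n
  refine ⟨(((4 * n.factorial : ℕ) : ℝ) ^ d)⁻¹ * (1 / 2), by positivity, 4 * n.factorial,
    fun Q m _ hm hQ N => ?_⟩
  obtain ⟨M₁, M₂, k, hM, hk, hcop⟩ := exists_mul_eq_coprime n.factorial m (NeZero.pos m)
  have hcop' : M₁.Coprime M₂ :=
    coprime_dvd_left hk (pow_left _ hcop.symm)
  rw [singSum_mul hM hcop' _ (fun i => by simp), norm_mul]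
  refine mul_le_mul (norm_singSum_pow_ge hd hn0 (hm ▸ Nat.dvd_factorial (by omega) hQ)
    ⟨M₂, hM⟩ hk N) ?_ (by norm_num) (norm_nonneg _)
  have h1 := singSum_sub_singSum (one_dvd M₂) (N : ZMod m) (0 : Γ d m)
  have h2 : singSum 1 (N : ZMod m) (0 : Γ d m) = 1 := by
    rw [singSum, Finset.filter_congr (q := fun a : ZMod m => a = 0) (fun a _ => by simp),
      Finset.filter_eq', if_pos (mem_univ _), sum_singleton, gk_zero_zero]
  have h3 : ‖singSum M₂ (N : ZMod m) (0 : Γ d m) - 1‖ ≤ 1 / 2 := by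
    rw [← h2, h1]
    refine (h m _ n _ _ hn1 fun a ha => ?_).trans hn
    obtain ⟨ha1, ha2⟩ := (mem_filter.1 ha).2
    by_contra! hle
    have h4 : addOrderOf a ∣ n.factorial := Nat.dvd_factorial (addOrderOf_pos a) hle
    exact ha2 (Nat.dvd_one.2 (Nat.eq_one_of_dvd_coprimes hcop ha1 h4))
  have h4 := norm_sub_norm_le (1 : ℂ) (1 - singSum M₂ (N : ZMod m) (0 : Γ d m))
  rw [sub_sub_cancel, norm_one, norm_sub_rev] at h4
  linarith

lemma exists_norm_singSum_ge (hd : 5 ≤ d) : ∃ c : ℝ, 0 < c ∧ ∃ J₀ : ℕ,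
    ∀ (J Q m : ℕ) [NeZero m], m = Q.factorial → Mseq d J ≤ Q → J₀ ≤ J → ∀ N : ℤ,
      c ≤ ‖ordSum Q (N : ZMod m) (0 : Γ d m)‖ ∧
      c ≤ ‖singSum (Mseq d J) (N : ZMod m) (0 : Γ d m)‖ := by
  obtain ⟨c, hc, Q₀, h₀⟩ := exists_norm_singSum_factorial_ge hd
  obtain ⟨C₁, hC₁, h₁⟩ := exists_norm_sum_gk_le hd
  obtain ⟨C₂, hC₂, h₂⟩ := exists_singSum_factor hd
  have hd' : (5 : ℝ) ≤ d := mod_cast hd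
  obtain ⟨J₁, hJ₁⟩ : ∃ J₁ : ℕ, ∀ J ≥ J₁, (C₁ + C₂) * ((2 : ℝ) ^ J) ^ (1 - (d : ℝ) / 2) ≤ c / 4 := by
    have h1 : Filter.Tendsto (fun J : ℕ => (C₁ + C₂) * ((2 : ℝ) ^ J) ^ (-((d : ℝ) / 2 - 1)))
        atTop (nhds ((C₁ + C₂) * 0)) :=
      ((tendsto_rpow_neg_atTop (by linarith)).comp
        (tendsto_pow_atTop_atTop_of_one_lt one_lt_two)).const_mul _
    rw [mul_zero] at h1
    simpa only [neg_sub] using Filter.eventually_atTop.1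
      (h1.eventually_le_const (by positivity : (0 : ℝ) < c / 4))
  refine ⟨min (c / 2) (c / 4 / C₂), by positivity, max Q₀ J₁, fun J Q m _ hm hQ hJ N => ?_⟩
  have hJ' := hJ₁ J ((le_max_right _ _).trans hJ)
  set E := ((2 : ℝ) ^ J) ^ (1 - (d : ℝ) / 2)
  have hE : 0 ≤ E := by positivity
  have hQJ : 2 ^ (d * J) ≤ Q := (two_pow_le_Mseq d J).trans hQ
  have hQ0 : Q₀ ≤ Q := ((le_max_left _ _).trans hJ).trans ((Nat.le_mul_of_pos_left J
    (by omega : 0 < d)).trans (Nat.lt_two_pow_self.le.trans hQJ))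
  have e1 : ‖singSum m (N : ZMod m) (0 : Γ d m) -
      ordSum Q (N : ZMod m) (0 : Γ d m)‖ ≤ C₁ * E := by
    rw [singSum_self_sub_ordSum]
    refine (h₁ m _ (2 ^ (d * J)) _ _ Nat.one_le_two_pow (fun a ha => ?_)).trans
      (mul_le_mul_of_nonneg_left (two_pow_rpow_le hd J) hC₁.le)
    exact hQJ.trans_lt (mem_filter.1 ha).2
  have e0 := h₀ Q m hm hQ0 N
  have h3 := norm_sub_norm_le (singSum m (N : ZMod m) (0 : Γ d m))
    (ordSum Q (N : ZMod m) (0 : Γ d m))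
  have h4 : c / 2 ≤ ‖ordSum Q (N : ZMod m) (0 : Γ d m)‖ := by
    nlinarith [mul_nonneg hC₂.le hE]
  refine ⟨(min_le_left _ _).trans h4, (min_le_right _ _).trans ?_⟩
  obtain ⟨t, ht, h5⟩ := h₂ J Q m hm hQ (N : ZMod m)
  have h6 := (norm_sub_norm_le _ _).trans (h5 0 (fun i => by simp))
  rw [norm_mul] at h6
  rw [div_le_iff₀ hC₂]
  have h7 := mul_le_mul_of_nonneg_left ht
    (norm_nonneg (singSum (Mseq d J) (N : ZMod m) (0 : Γ d m)))
  nlinarith [mul_nonneg hC₁.le hE]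

lemma exists_norm_bracket_le (hd : 5 ≤ d) : ∃ C : ℝ, 0 < C ∧
    ∀ (J Q m : ℕ) [NeZero m], m = Q.factorial → Mseq d J ≤ Q →
      ∀ (N : ZMod m) (ℓ : Γ d m),
      ‖ordSum Q N ℓ * singSum (Mseq d J) N (0 : Γ d m) -
        singSum (Mseq d J) N ℓ * ordSum Q N (0 : Γ d m)‖ ≤
        C * ((2 : ℝ) ^ J) ^ (1 - (d : ℝ) / 2) := by
  obtain ⟨C₁, hC₁, h₁⟩ := exists_norm_ordSum_le hd
  obtain ⟨C₂, hC₂, h₂⟩ := exists_singSum_factor hd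
  refine ⟨C₁ * C₁ + 2 * (C₂ * C₁), by positivity, fun J Q m _ hm hQ N ℓ => ?_⟩
  obtain ⟨t, ht, h5⟩ := h₂ J Q m hm hQ N
  obtain ⟨-, h4, h6⟩ := h₁ J Q m N ℓ
  obtain ⟨-, h4', -⟩ := h₁ J Q m N (0 : Γ d m)
  set E := ((2 : ℝ) ^ J) ^ (1 - (d : ℝ) / 2)
  have hE : 0 ≤ E := by positivity
  by_cases hx : ∃ i, (Mseq d J : ZMod m) * ℓ i ≠ 0
  · obtain ⟨h7, h8⟩ := h6 hx
    rw [h7, zero_mul, sub_zero, norm_mul]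
    refine (mul_le_mul h8 h4' (norm_nonneg _) (by positivity)).trans ?_
    nlinarith [mul_nonneg (mul_nonneg hC₂.le hC₁.le) hE]
  · push Not at hx
    have h7 := h5 ℓ hx
    have h8 := h5 0 (fun i => by simp)
    generalize singSum (Mseq d J) N (0 : Γ d m) = s₀ at *
    generalize singSum (Mseq d J) N ℓ = s at *
    generalize ordSum Q N ℓ = o at *
    generalize ordSum Q N (0 : Γ d m) = o₀ at *
    calc ‖o * s₀ - s * o₀‖ = ‖(o - s * t) * s₀ - (o₀ - s₀ * t) * s‖ := by
          congr 1
          ring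
      _ ≤ C₂ * E * C₁ + C₂ * E * C₁ := by
          refine (norm_sub_le _ _).trans (add_le_add ?_ ?_)
          · rw [norm_mul]
            exact mul_le_mul h7 h4' (norm_nonneg _) (by positivity)
          · rw [norm_mul]
            exact mul_le_mul h8 h4 (norm_nonneg _) (by positivity)
      _ ≤ _ := by nlinarith [mul_nonneg (mul_nonneg hC₁.le hC₁.le) hE]

/-- The shell kernel modulated by the additive character of frequency `a`. -/
def majArc (r κ : ℝ) (N : ℤ) (a : ZMod m) (y : Λ d) : ℂ :=
  stdAddChar (a * ((normSqZ y - N : ℤ) : ZMod m)) * (shell r κ y : ℂ)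

/-- A rational point with denominator `m` attached to a residue vector. -/
def ratPt {m : ℕ} (ℓ : Γ d m) : Ξ d := fun i => ((ℓ i).val : ℝ) / m

lemma one_div_le_abs_div {q : ℕ} (hq : 1 ≤ q) {t : ℤ}
    (h : (q : ZMod m) * (t : ZMod m) = 0) (ht : (t : ZMod m) ≠ 0) : 1 / (q : ℝ) ≤ |(t : ℝ) / m| := by
  have h1 : (m : ℤ) ∣ q * t := by
    rw [← ZMod.intCast_zmod_eq_zero_iff_dvd]
    push_cast
    exact h
  have h2 : t ≠ 0 := by
    rintro rfl
    simp at ht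
  have hq' : (0 : ℝ) < q := mod_cast hq
  have hm : (0 : ℝ) < m := mod_cast NeZero.pos m
  have h3 : (m : ℤ) ≤ |(q : ℤ) * t| := Int.le_of_dvd (abs_pos.2 (mul_ne_zero (by omega) h2))
    ((dvd_abs _ _).2 h1)
  have h4 : (m : ℝ) ≤ q * |(t : ℝ)| := by
    have : (m : ℝ) ≤ ((|(q : ℤ) * t| : ℤ) : ℝ) := mod_cast h3
    rw [Int.cast_abs, Int.cast_mul, abs_mul, Int.cast_natCast, Nat.abs_cast] at this
    exact this
  rw [abs_div, Nat.abs_cast, div_le_div_iff₀ hq' hm]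
  linarith

lemma one_div_sq_le_abs_div {Q : ℕ} {a b : ZMod m} {q q' : ℕ}
    (hq : 1 ≤ q) (hqQ : q ≤ Q) (hq' : 1 ≤ q') (hqQ' : q' ≤ Q) (ha : (q : ZMod m) * a = 0)
    (hb : (q' : ZMod m) * b = 0) {t : ℤ} (ht : (t : ZMod m) = a - b) (hab : a ≠ b) :
    1 / (Q : ℝ) ^ 2 ≤ |(t : ℝ) / m| := by
  have h1 := one_div_le_abs_div (m := m) (q := q * q') (t := t) (Nat.mul_pos hq hq') (by
    rw [ht]
    push_cast
    linear_combination (q' : ZMod m) * ha - (q : ZMod m) * hb) (by rw [ht]; exact sub_ne_zero.2 hab)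
  refine le_trans (one_div_le_one_div_of_le ?_ ?_) h1
  · exact_mod_cast Nat.mul_pos hq hq'
  · rw [sq]
    exact_mod_cast Nat.mul_le_mul hqQ hqQ'

lemma eC_sum_ratPt (y : Λ d) (ℓ : Γ d m) :
    eC (∑ i, (y i : ℝ) * ratPt ℓ i) = ∏ i, stdAddChar (ℓ i * (y i : ZMod m)) := by
  rw [eC_sum]
  refine prod_congr rfl fun i _ => ?_
  have h := eC_div_eq (q := m) (y i * ((ℓ i).val : ℤ))
  push_cast at h
  rw [natCast_zmod_val, mul_comm (y i : ZMod m)] at h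
  rw [← h, ratPt, mul_div_assoc]

lemma stdAddChar_quad_eq_sum (N : ℤ) (a : ZMod m) (y : Λ d) :
    stdAddChar (a * ((normSqZ y - N : ℤ) : ZMod m)) =
      ∑ ℓ : Γ d m, gk (N : ZMod m) a ℓ * eC (∑ i, (y i : ℝ) * ratPt ℓ i) := by
  have h1 : a * ((normSqZ y - N : ℤ) : ZMod m) =
      -(a * (N : ZMod m)) + ∑ i, a * (y i : ZMod m) ^ 2 := by
    rw [Int.cast_sub, normSqZ]
    push_cast
    rw [← mul_sum]
    ring
  rw [h1, AddChar.map_add_eq_mul, addChar_map_sum]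
  simp only [← sum_gaussSumN_mul, eC_sum_ratPt]
  rw [prod_univ_sum, piFinset_univ, mul_sum]
  refine sum_congr rfl fun ℓ _ => ?_
  rw [gk, prod_mul_distrib, mul_assoc]

lemma summable_shellC {r κ : ℝ} (hr : 0 < r) (hκ : 0 < κ) :
    Summable fun y : Λ d => (shell r κ y : ℂ) :=
  summable_ofReal.2 (summable_shell hr hκ)

lemma summable_majArc {r κ : ℝ} (hr : 0 < r) (hκ : 0 < κ) (N : ℤ)
    (a : ZMod m) : Summable (majArc r κ N a : Λ d → ℂ) := by
  refine of_norm_bounded (summable_shell hr hκ) fun y => le_of_eq ?_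
  rw [majArc, norm_mul, AddChar.norm_apply, one_mul, norm_real, norm_of_nonneg
    (shell_nonneg hr hκ y)]

lemma ftZ_majArc {r κ : ℝ} (hr : 0 < r) (hκ : 0 < κ) (N : ℤ) (a : ZMod m)
    (ξ : Ξ d) : ftZ (majArc r κ N a) ξ = ∑ ℓ : Γ d m,
      gk (N : ZMod m) a ℓ * ftZ (fun y => (shell r κ y : ℂ)) (ξ + ratPt ℓ) := by
  simp only [ftZ]
  have h1 : ∀ y : Λ d, majArc r κ N a y * eC (∑ i, (y i : ℝ) * ξ i) =
      ∑ ℓ : Γ d m, gk (N : ZMod m) a ℓ *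
        ((shell r κ y : ℂ) * eC (∑ i, (y i : ℝ) * (ξ + ratPt ℓ) i)) := by
    intro y
    rw [majArc, stdAddChar_quad_eq_sum, sum_mul, sum_mul]
    refine sum_congr rfl fun ℓ _ => ?_
    simp only [Pi.add_apply, mul_add, sum_add_distrib, eC_add]
    ring
  rw [tsum_congr h1, tsum_finsetSum fun ℓ _ =>
    (summable_mul_eC (summable_shellC hr hκ) _).mul_left _]
  exact sum_congr rfl fun ℓ _ => tsum_mul_left

lemma ftZ_shell {r κ : ℝ} (hr : 0 < r) (hκ : 0 < κ) (ξ : Ξ d) :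
    ftZ (fun y => (shell r κ y : ℂ)) ξ =
      ((r ^ d)⁻¹ : ℝ) * ∫ u, (tri κ u : ℂ) * eC (-u) * ∏ i, thetaW r u (ξ i) := by
  rw [← ftZ_hk hr (integrable_tri hκ)]
  simp only [ftZ, hk_tri r hκ]

/-- Away from the integers the transform of the shell kernel is negligible. -/
lemma exists_norm_ftZ_shell_le (hd : 0 < d) : ∃ C : ℝ, 0 < C ∧ ∀ r κ : ℝ, 1 ≤ κ →
    r = κ ^ 8 → ∀ ξ : Ξ d, (∀ n : Λ d, κ ^ 2 / r ≤ ‖fun i => ξ i - n i‖) →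
    ‖ftZ (fun y : Λ d => (shell r κ y : ℂ)) ξ‖ ≤ C * κ * exp (-(κ ^ 2 / 32)) := by
  obtain ⟨C, hC, h⟩ := exists_prod_thetaW_le d hd
  refine ⟨C * 2, by positivity, fun r κ hκ hrκ ξ hξ => ?_⟩
  have hκ0 : 0 < κ := by linarith
  have hr : 0 < r := hrκ ▸ by positivity
  have hκr : κ ≤ r := hrκ ▸ le_self_pow₀ hκ (by norm_num)
  obtain ⟨n, hn⟩ := exists_reduce ξ
  rw [← ftZ_sub_int _ ξ n, ftZ_shell hr hκ0, norm_mul, norm_real,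
    norm_of_nonneg (by positivity)]
  have hx := hξ n
  set x := fun i => ξ i - n i
  have hE : ∀ u, |u| ≤ κ → exp (-(r ^ 2 * ‖x‖ ^ 2 / (8 * (1 + |u|) ^ 2))) ≤
      exp (-(κ ^ 2 / 32)) := by
    intro u hu
    rw [exp_le_exp, neg_le_neg_iff, div_le_div_iff₀ (by norm_num) (by positivity)]
    have h1 : κ ^ 2 ≤ r * ‖x‖ := by
      rw [div_le_iff₀ hr] at hx
      linarith
    have h2 : (1 + |u|) ^ 2 ≤ (2 * κ) ^ 2 := pow_le_pow_left₀ (by positivity) (by linarith) 2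
    have h3 : (κ ^ 2) ^ 2 ≤ (r * ‖x‖) ^ 2 := pow_le_pow_left₀ (by positivity) h1 2
    nlinarith [mul_le_mul_of_nonneg_left h2 (sq_nonneg κ)]
  have hb : ‖∫ u, (tri κ u : ℂ) * eC (-u) * ∏ i, thetaW r u (x i)‖ ≤
      ∫ u, tri κ u * (C * r ^ d * exp (-(κ ^ 2 / 32))) := by
    refine norm_integral_le_of_norm_le ((integrable_tri hκ0).mul_const _)
      (of_forall fun u => ?_)
    rw [norm_mul, norm_mul, norm_eC, mul_one, norm_real, norm_of_nonneg (tri_nonneg _ _)]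
    by_cases hu : tri κ u = 0
    · simp [hu]
    · have hu' := abs_le_of_tri_ne_zero hκ0 hu
      refine mul_le_mul_of_nonneg_left ((h r u x hr (by linarith) hn).trans ?_) (tri_nonneg _ _)
      refine mul_le_mul ?_ (hE u hu') (Real.exp_nonneg _) (by positivity)
      refine mul_le_of_le_one_right (by positivity) (Real.rpow_le_one_of_one_le_of_nonpos ?_ ?_)
      · linarith [abs_nonneg u]
      · rw [neg_nonpos]
        positivity
  refine (mul_le_mul_of_nonneg_left hb (by positivity)).trans ?_
  rw [integral_mul_const]
  have h4 := integral_tri_le hκ0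
  calc (r ^ d)⁻¹ * ((∫ u, tri κ u) * (C * r ^ d * exp (-(κ ^ 2 / 32))))
      = (∫ u, tri κ u) * (C * exp (-(κ ^ 2 / 32))) := by
        field_simp
    _ ≤ 2 * κ * (C * exp (-(κ ^ 2 / 32))) := mul_le_mul_of_nonneg_right h4 (by positivity)
    _ = _ := by ring

lemma card_filter_natCast_mul_eq_zero_le (a : ZMod m) :
    (univ.filter fun ℓ : Γ d m =>
      ∀ i, (addOrderOf a : ZMod m) * ℓ i = 0).card ≤ addOrderOf a ^ d := by
  have h1 : addOrderOf a ∣ m := by simpa using addOrderOf_dvd_card (x := a)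
  have h2 : (univ.filter fun ℓ : Γ d m =>
      ∀ i, (addOrderOf a : ZMod m) * ℓ i = 0) = piFinset fun _ : Fin d =>
        univ.filter fun x : ZMod m => (addOrderOf a : ZMod m) * x = 0 := by
    ext ℓ
    simp [Fintype.mem_piFinset]
  rw [h2, card_piFinset]
  simp [card_mul_natCast_eq_zero h1]

lemma card_filter_addOrderOf_le {Q : ℕ} :
    (univ.filter fun a : ZMod m => addOrderOf a ≤ Q).card ≤ Q * Q := by
  have h1 : (univ.filter fun a : ZMod m => addOrderOf a ≤ Q) ⊆
      (Finset.Icc 1 Q).biUnion fun q => univ.filter fun a : ZMod m => addOrderOf a = q := by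
    intro a ha
    simp only [Finset.mem_biUnion, mem_filter, mem_univ, true_and, mem_Icc] at *
    exact ⟨_, ⟨addOrderOf_pos a, ha⟩, rfl⟩
  refine (card_le_card h1).trans ((Finset.card_biUnion_le).trans ?_)
  refine (Finset.sum_le_card_nsmul _ _ Q fun q hq => ?_).trans (by simp)
  exact (card_addOrderOf_eq_le (mem_Icc.1 hq).1).trans (mem_Icc.1 hq).2

/-- `ℓ₀` is the only rational point of small denominator that is close to `-ξ`. -/
def IsNearest {m : ℕ} (κ r : ℝ) (Q : ℕ) (ξ : Ξ d) (ℓ₀ : Γ d m) : Prop :=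
  ∀ ℓ : Γ d m, ℓ ≠ ℓ₀ → ∀ q : ℕ, 1 ≤ q → q ≤ Q → (∀ i, (q : ZMod m) * ℓ i = 0) →
    ∀ n : Λ d, κ ^ 2 / r ≤ ‖fun i => (ξ + ratPt ℓ) i - n i‖

lemma isNearest_of_near {Q : ℕ} {κ r : ℝ} (hκ : 2 ≤ κ) (hr : r = κ ^ 8)
    (hQ : (Q : ℝ) ≤ κ) {ξ : Ξ d} {ℓ₀ : Γ d m} {q₀ : ℕ} (hq₀ : 1 ≤ q₀) (hq₀Q : q₀ ≤ Q)
    (hℓ₀ : ∀ i, (q₀ : ZMod m) * ℓ₀ i = 0) {n₀ : Λ d}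
    (hn₀ : ‖fun i => (ξ + ratPt ℓ₀) i - n₀ i‖ < κ ^ 2 / r) : IsNearest κ r Q ξ ℓ₀ := by
  intro ℓ hℓ q hq hqQ hqℓ n
  by_contra! hn
  have hm : (0 : ℝ) < m := mod_cast NeZero.pos m
  have hQ0 : (0 : ℝ) < Q := mod_cast (show 0 < Q by omega)
  have hη : 0 < κ ^ 2 / r := by rw [hr]; positivity
  obtain ⟨i, hi⟩ := Function.ne_iff.1 hℓ
  have h1 := (pi_norm_lt_iff hη).1 hn i
  have h2 := (pi_norm_lt_iff hη).1 hn₀ i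
  simp only [Pi.add_apply, ratPt, norm_eq_abs] at h1 h2
  have h3 := one_div_sq_le_abs_div hq hqQ hq₀ hq₀Q (hqℓ i) (hℓ₀ i)
    (t := ((ℓ i).val : ℤ) - (ℓ₀ i).val - m * (n i - n₀ i)) (by push_cast; simp) hi
  have h4 : ((((ℓ i).val : ℤ) - (ℓ₀ i).val - m * (n i - n₀ i) : ℤ) : ℝ) / m =
      (ξ i + (ℓ i).val / m - n i) - (ξ i + (ℓ₀ i).val / m - n₀ i) := by
    push_cast
    field_simp
    ring
  rw [h4] at h3
  have h5 := (h3.trans (abs_sub _ _)).trans_lt (add_lt_add h1 h2)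
  have h6 : 1 / κ ^ 2 ≤ 1 / (Q : ℝ) ^ 2 :=
    one_div_le_one_div_of_le (by positivity) (pow_le_pow_left₀ hQ0.le hQ 2)
  have h7 : κ ^ 2 / r + κ ^ 2 / r ≤ 1 / κ ^ 2 := by
    have h8 : 2 ^ 4 ≤ κ ^ 4 := pow_le_pow_left₀ (by norm_num) hκ 4
    rw [← two_mul, mul_div_assoc', div_le_div_iff₀ (hr ▸ by positivity) (by positivity), hr]
    nlinarith [pow_nonneg (by linarith : (0 : ℝ) ≤ κ) 4]
  linarith

lemma isNearest_zero {Q : ℕ} {κ r : ℝ} (hκ : 2 ≤ κ) (hr : r = κ ^ 8)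
    (hQ : (Q : ℝ) ≤ κ) (hQ1 : 1 ≤ Q) : IsNearest κ r Q (0 : Ξ d) (0 : Γ d m) := by
  refine isNearest_of_near hκ hr hQ le_rfl hQ1 (fun i => by simp) (n₀ := 0) ?_
  have h : (fun i => ((0 : Ξ d) + ratPt (0 : Γ d m)) i - ((0 : Λ d) i : ℝ)) =
      0 := by
    funext i
    simp [ratPt]
  rw [h, norm_zero, hr]
  positivity

lemma exists_isNearest {Q : ℕ} {κ r : ℝ} (hκ : 2 ≤ κ) (hr : r = κ ^ 8)
    (hQ : (Q : ℝ) ≤ κ) (ξ : Ξ d) : ∃ ℓ₀ : Γ d m, IsNearest κ r Q ξ ℓ₀ := by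
  by_cases h : ∃ (ℓ₀ : Γ d m) (q₀ : ℕ) (n₀ : Λ d), 1 ≤ q₀ ∧ q₀ ≤ Q ∧
      (∀ i, (q₀ : ZMod m) * ℓ₀ i = 0) ∧ ‖fun i => (ξ + ratPt ℓ₀) i - n₀ i‖ < κ ^ 2 / r
  · obtain ⟨ℓ₀, q₀, n₀, h1, h2, h3, h4⟩ := h
    exact ⟨ℓ₀, isNearest_of_near hκ hr hQ h1 h2 h3 h4⟩
  · push Not at h
    exact ⟨0, fun ℓ _ q hq hqQ hqℓ n => h ℓ q n hq hqQ hqℓ⟩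

lemma exists_pow_mul_exp_le (n : ℕ) : ∃ C : ℝ, 0 < C ∧ ∀ κ : ℝ, 1 ≤ κ →
    κ ^ n * exp (-(κ ^ 2 / 32)) ≤ C * κ⁻¹ := by
  refine ⟨(n + 1).factorial * 32 ^ (n + 1), by positivity, fun κ hκ => ?_⟩
  have h := Real.pow_div_factorial_le_exp (κ ^ 2 / 32) (by positivity) (n + 1)
  have h0 : 0 < κ := by linarith
  rw [exp_neg, ← div_eq_mul_inv, ← div_eq_mul_inv, div_le_div_iff₀ (exp_pos _) h0]
  have h1 : (κ ^ 2) ^ (n + 1) ≤ (n + 1).factorial * 32 ^ (n + 1) * exp (κ ^ 2 / 32) := by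
    rw [div_pow, div_div, div_le_iff₀ (by positivity)] at h
    linarith
  refine le_trans ?_ h1
  rw [← pow_succ]
  exact pow_le_pow_left₀ h0.le (by nlinarith) _

/-- A sum of major arcs is concentrated at the nearest rational point. -/
lemma exists_norm_sum_ftZ_majArc_sub_le (hd : 0 < d) : ∃ C : ℝ, 0 < C ∧
    ∀ (r κ : ℝ) (Q m : ℕ) [NeZero m] (N : ℤ), 2 ≤ κ → r = κ ^ 8 → (Q : ℝ) ≤ κ →
    ∀ (ξ : Ξ d) (ℓ₀ : Γ d m), IsNearest κ r Q ξ ℓ₀ →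
    ∀ T : Finset (ZMod m), (∀ a ∈ T, addOrderOf a ≤ Q) →
    ‖∑ a ∈ T, ftZ (majArc r κ N a) ξ - (∑ a ∈ T, gk (N : ZMod m) a ℓ₀) *
      ftZ (fun y => (shell r κ y : ℂ)) (ξ + ratPt ℓ₀)‖ ≤ C * κ⁻¹ := by
  obtain ⟨C₁, hC₁, h₁⟩ := exists_norm_ftZ_shell_le hd
  obtain ⟨C₂, hC₂, h₂⟩ := exists_pow_mul_exp_le (d + 3)
  refine ⟨2 ^ ((d : ℝ) / 2) * C₁ * C₂, by positivity,
    fun r κ Q m _ N hκ hr hQ ξ ℓ₀ hℓ₀ T hT => ?_⟩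
  have hκ0 : 0 < κ := by linarith
  have hr0 : 0 < r := hr ▸ by positivity
  set S := fun ξ : Ξ d => ftZ (fun y : Λ d => (shell r κ y : ℂ)) ξ
  set ε := 2 ^ ((d : ℝ) / 2) * (C₁ * κ * exp (-(κ ^ 2 / 32)))
  have hε : 0 ≤ ε := by positivity
  have key : ∀ a ∈ T, ‖ftZ (majArc r κ N a) ξ - gk (N : ZMod m) a ℓ₀ * S (ξ + ratPt ℓ₀)‖ ≤
      κ ^ d * ε := by
    intro a ha
    have haQ := hT a ha
    have ho := addOrderOf_pos a
    rw [ftZ_majArc hr0 hκ0, ← add_sum_erase _ _ (mem_univ ℓ₀), add_sub_cancel_left]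
    have h3 : ∑ ℓ ∈ univ.erase ℓ₀, gk (N : ZMod m) a ℓ * S (ξ + ratPt ℓ) =
        ∑ ℓ ∈ (univ.erase ℓ₀).filter (fun ℓ => ∀ i, (addOrderOf a : ZMod m) * ℓ i = 0),
          gk (N : ZMod m) a ℓ * S (ξ + ratPt ℓ) := by
      refine (Finset.sum_filter_of_ne fun ℓ _ h => ?_).symm
      by_contra! hx
      exact h (by rw [gk_eq_zero ((natCast_mul_eq_zero_iff_addOrderOf_dvd _ a).2 dvd_rfl) hx,
        zero_mul])
    rw [h3]
    refine (norm_sum_le_of_le (f := fun ℓ => gk (N : ZMod m) a ℓ * S (ξ + ratPt ℓ)) _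
      (n := fun _ => ε) fun ℓ hℓ => ?_).trans ?_
    · obtain ⟨h4, h5⟩ := mem_filter.1 hℓ
      rw [norm_mul]
      refine mul_le_mul ((norm_gk_le _ a ℓ).trans (mul_le_of_le_one_right (by positivity)
        (Real.rpow_le_one_of_one_le_of_nonpos (mod_cast ho) ?_))) ?_ (norm_nonneg _)
        (by positivity)
      · rw [neg_nonpos]
        positivity
      · exact h₁ r κ (by linarith) hr _ fun n =>
          hℓ₀ ℓ (Finset.ne_of_mem_erase h4) (addOrderOf a) ho haQ h5 n
    · rw [sum_const, nsmul_eq_mul]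
      refine mul_le_mul_of_nonneg_right ?_ hε
      have h6 := (card_le_card (Finset.filter_subset_filter
        (fun ℓ : Γ d m => ∀ i, (addOrderOf a : ZMod m) * ℓ i = 0)
        (Finset.erase_subset ℓ₀ univ))).trans (card_filter_natCast_mul_eq_zero_le (d := d) a)
      have h7 : (addOrderOf a : ℝ) ≤ κ := le_trans (mod_cast haQ) hQ
      calc _ ≤ ((addOrderOf a ^ d : ℕ) : ℝ) := mod_cast h6
        _ ≤ κ ^ d := by
            rw [Nat.cast_pow]
            exact pow_le_pow_left₀ (cast_nonneg _) h7 d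
  rw [sum_mul, ← sum_sub_distrib]
  refine (norm_sum_le_of_le T key).trans ?_
  rw [sum_const, nsmul_eq_mul]
  have hT2 : (T.card : ℝ) ≤ κ ^ 2 := by
    have h8 : T.card ≤ Q * Q := (card_le_card fun a ha =>
      mem_filter.2 ⟨mem_univ a, hT a ha⟩).trans card_filter_addOrderOf_le
    calc (T.card : ℝ) ≤ (Q : ℝ) * Q := mod_cast h8
      _ ≤ κ ^ 2 := by
          rw [sq]
          exact mul_le_mul hQ hQ (cast_nonneg _) hκ0.le
  calc (T.card : ℝ) * (κ ^ d * ε) ≤ κ ^ 2 * (κ ^ d * ε) :=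
        mul_le_mul_of_nonneg_right hT2 (by positivity)
    _ = 2 ^ ((d : ℝ) / 2) * C₁ * (κ ^ (d + 3) * exp (-(κ ^ 2 / 32))) := by
        simp only [ε]
        ring
    _ ≤ 2 ^ ((d : ℝ) / 2) * C₁ * (C₂ * κ⁻¹) :=
        mul_le_mul_of_nonneg_left (h₂ κ (by linarith)) (by positivity)
    _ = _ := by ring

/-- The sum of the triangular weights on the major arcs. -/
def arcW (m Q : ℕ) [NeZero m] (κ N u : ℝ) : ℝ :=
  ∑ a : ZMod m with addOrderOf a ≤ Q, tri κ (u - N * ((a.val : ℝ) / m))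

section Arcs

variable {m Q : ℕ} [NeZero m] {κ N : ℝ}

lemma eq_of_mem_arcs (hκ : 0 < κ) (hN : 2 * κ * Q ^ 2 < N) {a b : ZMod m}
    (ha : addOrderOf a ≤ Q) (hb : addOrderOf b ≤ Q) {u : ℝ}
    (hua : |u - N * ((a.val : ℝ) / m)| ≤ κ) (hub : |u - N * ((b.val : ℝ) / m)| ≤ κ) : a = b := by
  by_contra hab
  have hN0 : 0 < N := lt_of_le_of_lt (by positivity) hN
  have h1 := one_div_sq_le_abs_div (addOrderOf_pos a) ha (addOrderOf_pos b) hb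
    ((natCast_mul_eq_zero_iff_addOrderOf_dvd _ _).2 dvd_rfl)
    ((natCast_mul_eq_zero_iff_addOrderOf_dvd _ _).2 dvd_rfl)
    (t := (a.val : ℤ) - b.val) (by push_cast; simp) hab
  have hQ : (0 : ℝ) < Q := mod_cast (addOrderOf_pos a).trans_le ha
  have h2 : |N * ((((a.val : ℤ) - b.val : ℤ) : ℝ) / m)| ≤ κ + κ := by
    refine le_trans (le_of_eq ?_) ((abs_sub _ _).trans (add_le_add hub hua))
    congr 1
    push_cast
    ring
  rw [abs_mul, abs_of_pos hN0] at h2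
  rw [div_le_iff₀ (by positivity)] at h1
  nlinarith [mul_le_mul_of_nonneg_right h2 (sq_nonneg (Q : ℝ))]

lemma arcW_eq (hκ : 0 < κ) (hN : 2 * κ * Q ^ 2 < N) {a : ZMod m} (ha : addOrderOf a ≤ Q) {u : ℝ}
    (hua : |u - N * ((a.val : ℝ) / m)| ≤ κ) :
    arcW m Q κ N u = tri κ (u - N * ((a.val : ℝ) / m)) := by
  refine Finset.sum_eq_single a (fun b hb hba => ?_) fun h => absurd (by simpa using ha) h
  by_contra h0
  exact hba (eq_of_mem_arcs hκ hN (mem_filter.1 hb).2 ha (abs_le_of_tri_ne_zero hκ h0) hua)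

lemma arcW_eq_zero_or (hκ : 0 < κ) (hN : 2 * κ * Q ^ 2 < N) (u : ℝ) :
    arcW m Q κ N u = 0 ∨ ∃ a : ZMod m, addOrderOf a ≤ Q ∧ |u - N * ((a.val : ℝ) / m)| ≤ κ ∧
      arcW m Q κ N u = tri κ (u - N * ((a.val : ℝ) / m)) := by
  by_cases h : ∃ a : ZMod m, addOrderOf a ≤ Q ∧ tri κ (u - N * ((a.val : ℝ) / m)) ≠ 0
  · obtain ⟨a, ha, h⟩ := h
    have h1 := abs_le_of_tri_ne_zero hκ h
    exact Or.inr ⟨a, ha, h1, arcW_eq hκ hN ha h1⟩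
  · push Not at h
    exact Or.inl (sum_eq_zero fun a ha => h a (mem_filter.1 ha).2)

lemma arcW_mem_Icc (hκ : 0 < κ) (hN : 2 * κ * Q ^ 2 < N) (u : ℝ) :
    arcW m Q κ N u ∈ Set.Icc (0 : ℝ) 1 := by
  obtain h | ⟨a, -, -, h⟩ := arcW_eq_zero_or (m := m) hκ hN u <;> rw [h]
  · simp
  · exact ⟨tri_nonneg _ _, tri_le_one hκ _⟩

lemma le_div_two_mul (hκ : 0 < κ) (hQ : 1 ≤ Q) (hN : 2 * κ * Q ^ 2 < N) : κ < N / (2 * Q) := by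
  have hQ' : (1 : ℝ) ≤ Q := mod_cast hQ
  rw [lt_div_iff₀ (by positivity)]
  nlinarith [mul_le_mul_of_nonneg_left hQ' (by positivity : 0 ≤ κ * Q)]

lemma arcW_eq_zero (hκ : 0 < κ) (hQ : 1 ≤ Q) (hN : 2 * κ * Q ^ 2 < N) {u : ℝ}
    (hu : u ∉ Set.Ioc (-(N / (2 * Q))) (-(N / (2 * Q)) + N)) : arcW m Q κ N u = 0 := by
  obtain h | ⟨a, ha, h, -⟩ := arcW_eq_zero_or (m := m) hκ hN u
  · exact h
  refine absurd ?_ hu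
  have hQ' : (0 : ℝ) < Q := mod_cast hQ
  have hm : (0 : ℝ) < m := mod_cast NeZero.pos m
  have hN0 : 0 < N := lt_of_le_of_lt (by positivity) hN
  have h1 := le_div_two_mul hκ hQ hN
  have h2 : (a.val : ℝ) / m ≤ 1 - 1 / Q := by
    by_cases ha0 : a = 0
    · rw [ha0, ZMod.val_zero, Nat.cast_zero, zero_div, sub_nonneg, div_le_one hQ']
      exact_mod_cast hQ
    have h3 := one_div_le_abs_div (m := m) (t := (m : ℤ) - a.val) (addOrderOf_pos a) (by
      have := (natCast_mul_eq_zero_iff_addOrderOf_dvd _ a).2 dvd_rfl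
      push_cast
      simp [this]) (by push_cast; simpa using ha0)
    have h4 : (a.val : ℝ) ≤ m := mod_cast (ZMod.val_lt a).le
    have h5 : 1 / (Q : ℝ) ≤ 1 / (addOrderOf a : ℝ) :=
      one_div_le_one_div_of_le (mod_cast addOrderOf_pos a) (mod_cast ha)
    push_cast at h3
    rw [abs_of_nonneg (div_nonneg (by linarith) hm.le), sub_div, div_self hm.ne'] at h3
    linarith
  have h3 : N * ((a.val : ℝ) / m) ≤ N - 2 * (N / (2 * Q)) := by
    refine (mul_le_mul_of_nonneg_left h2 hN0.le).trans (le_of_eq ?_)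
    field_simp
  have h4 : 0 ≤ N * ((a.val : ℝ) / m) := by positivity
  rw [abs_le] at h
  constructor <;> linarith

lemma arcW_eq_of_near (hκ : 0 < κ) (hN : 2 * κ * Q ^ 2 < N) {u : ℝ}
    (hu : u ∈ Set.Ioc (-(N / (2 * Q))) (-(N / (2 * Q)) + N)) {q : ℕ} (hq : 1 ≤ q) (hqQ : q ≤ Q)
    (hqm : q ∣ m) {b : ℤ} (hb : |u - N * ((b : ℝ) / q)| ≤ κ) :
    arcW m Q κ N u = tri κ (u - N * ((b : ℝ) / q)) := by
  have hq0 : (0 : ℝ) < q := mod_cast hq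
  have hQ0 : (0 : ℝ) < Q := mod_cast hq.trans hqQ
  have hqQ' : (q : ℝ) ≤ Q := mod_cast hqQ
  have hN0 : 0 < N := lt_of_le_of_lt (by positivity) hN
  have h1 := le_div_two_mul hκ (hq.trans hqQ) hN
  have hb' := abs_le.1 hb
  have hNq : N * ((b : ℝ) / q) * q = N * b := by field_simp
  have hNQ : N / (2 * Q) * q ≤ N / 2 := by
    rw [div_mul_eq_mul_div, div_le_div_iff₀ (by positivity) (by norm_num)]
    nlinarith
  have hb0 : 0 ≤ b := by
    have h2 : -(N / (2 * Q)) - N / (2 * Q) < N * ((b : ℝ) / q) := by linarith [hu.1]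
    have h3 := mul_lt_mul_of_pos_right h2 hq0
    have h4 : N * (-1) < N * b := by linarith
    have h5 : (-1 : ℝ) < b := lt_of_mul_lt_mul_left h4 hN0.le
    have : (-1 : ℤ) < b := mod_cast h5
    omega
  have hbq : b < q := by
    have h2 : N * ((b : ℝ) / q) < N := by linarith [hu.2]
    have h3 : N * b < N * q := by nlinarith
    exact_mod_cast lt_of_mul_lt_mul_left h3 hN0.le
  lift b to ℕ using hb0
  obtain ⟨k, rfl⟩ := hqm
  have hk : 0 < k := Nat.pos_of_ne_zero fun h => NeZero.ne (q * k) (by simp [h])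
  have hv : (((b * k : ℕ) : ZMod (q * k))).val = b * k :=
    ZMod.val_cast_of_lt (Nat.mul_lt_mul_of_pos_right (mod_cast hbq) hk)
  have hvd : (((b * k : ℕ) : ZMod (q * k)).val : ℝ) / (q * k : ℕ) = ((b : ℤ) : ℝ) / q := by
    rw [hv]
    push_cast
    field_simp
  rw [← hvd] at hb ⊢
  refine arcW_eq hκ hN (le_trans (le_of_dvd hq ?_) hqQ) hb
  rw [← natCast_mul_eq_zero_iff_addOrderOf_dvd]
  have := ZMod.natCast_self (q * k)
  push_cast at this ⊢
  linear_combination (b : ZMod (q * k)) * this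

end Arcs

/-- The kernel of the spherical average, normalized by the Gaussian weight. -/
def sphK (r : ℝ) (N : ℤ) (y : Λ d) : ℝ :=
  if normSqZ y = N then r ^ 2 * gam r y else 0

lemma integral_indicator_eC {N : ℝ} (hN : 0 < N) (A : ℝ) (k : ℤ) :
    ∫ u, (((Set.Ioc A (A + N)).indicator (fun _ => (1 : ℝ)) u : ℝ) : ℂ) * eC (u * (k / N)) =
      if k = 0 then (N : ℂ) else 0 := by
  have h1 : ∀ u : ℝ, (((Set.Ioc A (A + N)).indicator (fun _ => (1 : ℝ)) u : ℝ) : ℂ) * eC (u * (k / N)) =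
      (Set.Ioc A (A + N)).indicator (fun u => eC (u * (k / N))) u := by
    intro u
    by_cases hu : u ∈ Set.Ioc A (A + N) <;> simp [hu]
  rw [integral_congr_ae (of_forall h1), integral_indicator measurableSet_Ioc,
    ← intervalIntegral.integral_of_le (by linarith)]
  split_ifs with hk
  · simp [hk, eC_zero]
  have hc : 2 * (pi : ℂ) * Complex.I * (k / N) ≠ 0 := by
    simp [Complex.I_ne_zero, Real.pi_ne_zero, hk, hN.ne']
  have h2 : ∀ u : ℝ, eC (u * (k / N)) = Complex.exp (2 * pi * Complex.I * (k / N) * u) := by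
    intro u
    rw [eC]
    push_cast
    ring_nf
  rw [intervalIntegral.integral_congr fun u _ => h2 u, integral_exp_mul_complex hc, ← h2, ← h2,
    add_mul, mul_div_cancel₀ _ hN.ne', eC_add, eC_int, mul_one, sub_self, zero_div]

lemma integral_tri_sub_eC {κ : ℝ} (hκ : 0 < κ) (c s : ℝ) :
    ∫ u, (tri κ (u - c) : ℂ) * eC (u * s) = eC (c * s) * fej κ s := by
  rw [← integral_tri_eC hκ, ← integral_const_mul,
    ← integral_sub_right_eq_self (fun u => eC (c * s) * ((tri κ u : ℂ) * eC (u * s))) c]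
  refine integral_congr_ae (of_forall fun u => ?_)
  dsimp only
  rw [show u * s = c * s + (u - c) * s by ring, eC_add]
  ring

/-- The error weight of the circle method. -/
def errW (m Q : ℕ) [NeZero m] (κ N u : ℝ) : ℝ :=
  (Set.Ioc (-(N / (2 * Q))) (-(N / (2 * Q)) + N)).indicator (fun _ => (1 : ℝ)) u - arcW m Q κ N u

section

variable {d m Q : ℕ} [NeZero m] {κ r : ℝ} {N : ℕ}

lemma integrable_arcW (hκ : 0 < κ) (N : ℝ) : Integrable (arcW m Q κ N) :=
  integrable_finsetSum _ fun _ _ => (integrable_tri hκ).comp_sub_right _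

lemma integrable_errW (hκ : 0 < κ) (N : ℝ) : Integrable (errW m Q κ N) :=
  ((integrableOn_const measure_Ioc_lt_top.ne).integrable_indicator measurableSet_Ioc).sub
    (integrable_arcW hκ N)

lemma normSqZ_div_sub_one (hr : 0 < r) (hN : r ^ 2 = N) (y : Λ d) :
    (normSqZ y : ℝ) / r ^ 2 - 1 = ((normSqZ y - N : ℤ) : ℝ) / N := by
  have : (0 : ℝ) < N := hN ▸ by positivity
  rw [hN]
  push_cast
  field_simp

lemma hk_arcW (hκ : 0 < κ) (hr : 0 < r) (hN : r ^ 2 = N) (y : Λ d) :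
    hk r (arcW m Q κ N) y = ∑ a : ZMod m with addOrderOf a ≤ Q, majArc r κ N a y := by
  have hN0 : (0 : ℝ) < N := hN ▸ by positivity
  refine (hk_sum _ (fun a _ => (integrable_tri hκ).comp_sub_right _) y).trans
    (sum_congr rfl fun a _ => ?_)
  rw [hk, integral_tri_sub_eC hκ, majArc, shell, normSqZ_div_sub_one hr hN]
  have h : (N : ℝ) * ((a.val : ℝ) / m) * (((normSqZ y - N : ℤ) : ℝ) / N) =
      (((a.val : ℤ) * (normSqZ y - N) : ℤ) : ℝ) / m := by
    push_cast
    field_simp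
  rw [h, eC_div_eq]
  push_cast
  rw [natCast_zmod_val]
  ring

lemma hk_errW (hκ : 0 < κ) (hr : 0 < r) (hN : r ^ 2 = N) (y : Λ d) :
    hk r (errW m Q κ N) y + hk r (arcW m Q κ N) y = sphK r N y := by
  have hN0 : (0 : ℝ) < N := hN ▸ by positivity
  rw [← hk_add (integrable_errW hκ _) (integrable_arcW hκ _)]
  simp only [errW, sub_add_cancel]
  rw [hk, normSqZ_div_sub_one hr hN, integral_indicator_eC hN0, sphK]
  simp only [sub_eq_zero, hN]
  split_ifs <;> push_cast <;> ring

lemma ftZ_sphK_sub (hκ : 0 < κ) (hr : 0 < r) (hN : r ^ 2 = N) (ξ : Ξ d) :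
    ftZ (fun y => (sphK r N y : ℂ)) ξ - ∑ a : ZMod m with addOrderOf a ≤ Q, ftZ (majArc r κ N a) ξ =
      ((r ^ d)⁻¹ : ℝ) * ∫ u, (errW m Q κ N u : ℂ) * eC (-u) * ∏ i, thetaW r u (ξ i) := by
  have h1 : ∑ a : ZMod m with addOrderOf a ≤ Q, ftZ (majArc r κ N a) ξ =
      ftZ (hk r (arcW m Q κ N)) ξ := by
    rw [show hk r (arcW m Q κ N) = _ from funext (hk_arcW hκ hr hN)]
    simp only [ftZ, sum_mul]
    exact (tsum_finsetSum fun a _ => summable_mul_eC (summable_majArc hr hκ _ a) ξ).symm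
  rw [h1, ← ftZ_hk hr (integrable_errW hκ _), sub_eq_iff_eq_add]
  simp only [ftZ, ← hk_errW (m := m) (Q := Q) hκ hr hN, add_mul]
  exact (summable_mul_eC (summable_hk hr) ξ).tsum_add (summable_mul_eC (summable_hk hr) ξ)

lemma abs_errW_le (hκ : 0 < κ) {N : ℝ} (hN : 2 * κ * Q ^ 2 < N) (u : ℝ) :
    |errW m Q κ N u| ≤ 1 := by
  have h := arcW_mem_Icc (m := m) hκ hN u
  have h1 : 0 ≤ (Set.Ioc (-(N / (2 * Q))) (-(N / (2 * Q)) + N)).indicator (fun _ => (1 : ℝ)) u ∧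
    (Set.Ioc (-(N / (2 * Q))) (-(N / (2 * Q)) + N)).indicator (fun _ => (1 : ℝ)) u ≤ 1 := by
    rw [Set.indicator_apply]
    split_ifs <;> simp
  rw [errW, abs_le]
  constructor <;> linarith [h.1, h.2, h1.1, h1.2]

lemma abs_errW_le_of_near (hκ : 0 < κ) {N : ℝ} (hN : 2 * κ * Q ^ 2 < N) {u : ℝ}
    (hu : u ∈ Set.Ioc (-(N / (2 * Q))) (-(N / (2 * Q)) + N)) {q : ℕ} (hq : 1 ≤ q)
    (hm : q ≤ Q → q ∣ m) (b : ℤ) : |errW m Q κ N u| ≤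
      (if q ≤ Q then κ⁻¹ else 1) * (1 + |u - N * ((b : ℝ) / q)|) := by
  have h1 := abs_errW_le (m := m) hκ hN u
  set v := |u - N * ((b : ℝ) / q)| with hv
  have hv0 : 0 ≤ v := abs_nonneg _
  split_ifs with hqQ
  swap
  · linarith
  by_cases hvκ : v ≤ κ
  · have h2 : 1 - v / κ ≤ tri κ (u - N * ((b : ℝ) / q)) := le_max_right _ _
    rw [errW, arcW_eq_of_near hκ hN hu hq hqQ (hm hqQ) hvκ, Set.indicator_of_mem hu,
      abs_of_nonneg (sub_nonneg.2 (tri_le_one hκ _))]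
    have h3 : κ⁻¹ * v = v / κ := by ring
    have h4 : 0 < κ⁻¹ := inv_pos.2 hκ
    linarith
  · refine h1.trans ?_
    rw [inv_mul_eq_div, le_div_iff₀ hκ]
    linarith

end

lemma exists_errW_mul_prod_le (d : ℕ) (hd : 5 ≤ d) : ∃ C : ℝ, 0 < C ∧
    ∀ (r κ : ℝ) (N Q m : ℕ) [NeZero m], 0 < κ → 1 ≤ r → r ^ 2 = N → 1 ≤ Q →
    2 * κ * Q ^ 2 < (N : ℝ) → (∀ q, 1 ≤ q → q ≤ Q → q ∣ m) → ∀ (ξ : Ξ d) (u : ℝ),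
    |errW m Q κ N u| * ‖∏ i, thetaW r u (ξ i)‖ ≤ C * r ^ d * ∑ q ∈ Finset.Icc 1 ⌊r⌋₊,
      ∑ b ∈ Finset.Icc (-(2 * q : ℤ)) (2 * q), (if q ≤ Q then κ⁻¹ else 1) *
        (q : ℝ) ^ (-(d / 2 : ℝ)) * (1 + ‖u - N * ((b : ℝ) / q)‖) ^ (-(3 / 2 : ℝ)) := by
  obtain ⟨C, hC, h⟩ := exists_norm_thetaW_arc_le
  refine ⟨C ^ d, by positivity, fun r κ N Q m _ hκ hr hN hQ hQN hm ξ u => ?_⟩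
  have hN0 : (0 : ℝ) < N := hN ▸ by positivity
  have hr0 : 0 < r := by linarith
  have hterm : ∀ (q : ℕ) (b : ℤ), 0 ≤ (if q ≤ Q then κ⁻¹ else 1) *
      (q : ℝ) ^ (-(d / 2 : ℝ)) * (1 + ‖u - N * ((b : ℝ) / q)‖) ^ (-(3 / 2 : ℝ)) := fun q b => by
    positivity
  by_cases hu : u ∈ Set.Ioc (-((N : ℝ) / (2 * Q))) (-((N : ℝ) / (2 * Q)) + N)
  swap
  · rw [errW, Set.indicator_of_notMem hu, arcW_eq_zero hκ hQ hQN hu, sub_zero, abs_zero, zero_mul]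
    exact mul_nonneg (by positivity) (sum_nonneg fun q _ => sum_nonneg fun b _ =>
      hterm q b)
  obtain ⟨x, hx, hxd⟩ := Real.exists_rat_abs_sub_le_and_den_le (u / N) (floor_pos.2 hr)
  obtain ⟨q, hq⟩ : ∃ q, q = x.den := ⟨_, rfl⟩
  obtain ⟨b, hb⟩ : ∃ b, b = x.num := ⟨_, rfl⟩
  have hcop : IsCoprime b (q : ℤ) := by
    rw [hb, hq, Int.isCoprime_iff_gcd_eq_one]
    exact x.reduced
  rw [Rat.cast_def, ← hq, ← hb] at hx
  rw [← hq] at hxd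
  have hq1 : 1 ≤ q := hq ▸ x.den_pos
  have hq1' : (1 : ℝ) ≤ q := mod_cast hq1
  have hfl := Nat.lt_floor_add_one r
  set v := u - N * ((b : ℝ) / q) with hv
  have hvN : |u / N - b / q| = |v| / N := by
    rw [← abs_of_pos hN0, ← abs_div, abs_of_pos hN0, hv]
    congr 1
    field_simp
  have hv1 : (q : ℝ) * |v| ≤ r := by
    rw [hvN, div_le_div_iff₀ hN0 (by positivity), ← hN, one_mul] at hx
    refine le_of_mul_le_mul_right (a := r) ?_ hr0
    nlinarith [mul_le_mul_of_nonneg_left hfl.le (by positivity : 0 ≤ (q : ℝ) * |v|)]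
  have hqr : (q : ℝ) ≤ r := (Nat.cast_le.2 hxd).trans (floor_le hr0.le)
  have hb2 : b ∈ Finset.Icc (-(2 * q : ℤ)) (2 * q) := by
    have hQ' : (1 : ℝ) ≤ Q := mod_cast hQ
    have h1 : |u / N| ≤ 1 := by
      rw [abs_div, abs_of_pos hN0, div_le_one hN0, abs_le]
      have : (N : ℝ) / (2 * Q) ≤ N := div_le_self hN0.le (by linarith)
      have : 0 ≤ (N : ℝ) / (2 * Q) := by positivity
      constructor <;> linarith [hu.1, hu.2]
    have h2 : |u / N - b / q| ≤ 1 := hx.trans (div_le_one_of_le₀ (by nlinarith) (by positivity))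
    have h3 : |(b : ℝ) / q| ≤ 2 := by
      have := abs_sub (u / N) (u / N - b / q)
      rw [sub_sub_cancel] at this
      linarith
    rw [abs_div, Nat.abs_cast, div_le_iff₀ (by positivity)] at h3
    have h4 := abs_le.1 h3
    rw [mem_Icc]
    exact ⟨mod_cast h4.1, mod_cast h4.2⟩
  have h1 := abs_errW_le_of_near hκ hQN hu hq1 (hm q hq1) b
  rw [← hv] at h1
  have h2 : ‖∏ i, thetaW r u (ξ i)‖ ≤ C ^ d * r ^ d * ((q : ℝ) ^ (-(d / 2 : ℝ)) *
      (1 + |v|) ^ (-(d / 2 : ℝ))) := by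
    have : NeZero q := ⟨by omega⟩
    have hpow : ∀ t : ℝ, 0 < t → t ^ (-(d / 2 : ℝ)) = (t ^ (-(1 / 2 : ℝ))) ^ d := by
      intro t ht
      rw [← rpow_natCast, ← rpow_mul ht.le]
      ring_nf
    rw [hpow q (by positivity), hpow (1 + |v|) (by positivity), ← mul_pow, ← mul_pow, ← mul_pow,
      norm_prod]
    refine (prod_le_prod (g := fun _ => C * r * ((q : ℝ) ^ (-(1 / 2 : ℝ)) *
      (1 + |v|) ^ (-(1 / 2 : ℝ)))) (fun _ _ => norm_nonneg _) fun i _ => ?_).trans_eq (by simp)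
    have h3 := h r v (ξ i) q b hr0 (by linarith)
      ((ZMod.coe_int_isUnit_iff_isCoprime b q).2 hcop.symm)
    rw [hN, show (N : ℝ) * (b / q) + v = u by rw [hv]; ring] at h3
    exact h3.trans (by apply le_of_eq; ring)
  have h3 : (1 + |v|) * (1 + |v|) ^ (-(d / 2 : ℝ)) ≤ (1 + |v|) ^ (-(3 / 2 : ℝ)) := by
    have hv0 := abs_nonneg v
    rw [← Real.rpow_one_add' (by positivity) (by
      have : (5 : ℝ) ≤ d := mod_cast hd
      linarith)]
    refine rpow_le_rpow_of_exponent_le (by linarith) ?_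
    have : (5 : ℝ) ≤ d := mod_cast hd
    linarith
  have hmem : q ∈ Finset.Icc 1 ⌊r⌋₊ := mem_Icc.2 ⟨hq1, hxd⟩
  have h4 := (single_le_sum (fun b _ => hterm q b) hb2).trans
    (single_le_sum (f := fun q : ℕ => ∑ b ∈ Finset.Icc (-(2 * q : ℤ)) (2 * q), _)
      (fun q _ => sum_nonneg fun b _ => hterm q b) hmem)
  refine le_trans ?_ (mul_le_mul_of_nonneg_left h4 (by positivity))
  rw [← hv, norm_eq_abs]
  refine (mul_le_mul h1 h2 (norm_nonneg _) ((abs_nonneg _).trans h1)).trans ?_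
  have h5 : 0 ≤ if q ≤ Q then κ⁻¹ else 1 := by split_ifs <;> positivity
  generalize (if q ≤ Q then κ⁻¹ else 1) = c at *
  calc c * (1 + |v|) * (C ^ d * r ^ d * ((q : ℝ) ^ (-(d / 2 : ℝ)) * (1 + |v|) ^ (-(d / 2 : ℝ))))
      = C ^ d * r ^ d * (c * (q : ℝ) ^ (-(d / 2 : ℝ))) *
        ((1 + |v|) * (1 + |v|) ^ (-(d / 2 : ℝ))) := by ring
    _ ≤ C ^ d * r ^ d * (c * (q : ℝ) ^ (-(d / 2 : ℝ))) * (1 + |v|) ^ (-(3 / 2 : ℝ)) :=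
        mul_le_mul_of_nonneg_left h3 (by positivity)
    _ = _ := by ring

/-- The circle method: only the major arcs contribute to the transform of the spherical kernel. -/
lemma exists_norm_ftZ_sphK_sub_le (d : ℕ) (hd : 5 ≤ d) : ∃ C : ℝ, 0 < C ∧
    ∀ (r κ : ℝ) (N Q m : ℕ) [NeZero m], 0 < κ → 1 ≤ r → r ^ 2 = N → 1 ≤ Q →
    2 * κ * Q ^ 2 < (N : ℝ) → (∀ q, 1 ≤ q → q ≤ Q → q ∣ m) → ∀ ξ : Ξ d,
    ‖ftZ (fun y => (sphK r N y : ℂ)) ξ -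
      ∑ a : ZMod m with addOrderOf a ≤ Q, ftZ (majArc r κ N a) ξ‖ ≤
      C * (κ⁻¹ + (Q : ℝ) ^ (21 / 10 - d / 2 : ℝ)) := by
  obtain ⟨C, hC, h⟩ := exists_errW_mul_prod_le d hd
  obtain ⟨C', hC', h'⟩ := exists_sum_rpow_tail_le_rpow
  have hint : Integrable fun u : ℝ => (1 + ‖u‖) ^ (-(3 / 2 : ℝ)) :=
    integrable_one_add_norm (by rw [Module.finrank_self]; norm_num)
  set K := ∫ u : ℝ, (1 + ‖u‖) ^ (-(3 / 2 : ℝ)) with hK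
  refine ⟨C * (5 * K * (1 + C')) + 1, by positivity, fun r κ N Q m _ hκ hr hN hQ hQN hm ξ => ?_⟩
  have hr0 : 0 < r := by linarith
  rw [ftZ_sphK_sub hκ hr0 hN, norm_mul, norm_real, norm_of_nonneg (by positivity)]
  set c : ℕ → ℝ := fun q => (if q ≤ Q then κ⁻¹ else 1) with hc
  have hc0 : ∀ q, 0 ≤ c q := fun q => by
    simp only [hc]
    split_ifs <;> positivity
  have hi : ∀ (q : ℕ) (b : ℤ), Integrable fun u : ℝ => c q *
        (q : ℝ) ^ (-(d / 2 : ℝ)) * (1 + ‖u - N * ((b : ℝ) / q)‖) ^ (-(3 / 2 : ℝ)) := fun q b =>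
    (hint.comp_sub_right (N * ((b : ℝ) / q))).const_mul _
  have h1 : ‖∫ u, (errW m Q κ N u : ℂ) * eC (-u) * ∏ i, thetaW r u (ξ i)‖ ≤
      ∫ u, C * r ^ d * ∑ q ∈ Finset.Icc 1 ⌊r⌋₊, ∑ b ∈ Finset.Icc (-(2 * q : ℤ)) (2 * q), c q *
        (q : ℝ) ^ (-(d / 2 : ℝ)) * (1 + ‖u - N * ((b : ℝ) / q)‖) ^ (-(3 / 2 : ℝ)) := by
    refine norm_integral_le_of_norm_le ((integrable_finsetSum _ fun q _ =>
      integrable_finsetSum _ fun b _ => hi q b).const_mul _) (of_forall fun u => ?_)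
    rw [norm_mul, norm_mul, norm_eC, mul_one, norm_real]
    exact h r κ N Q m hκ hr hN hQ hQN hm ξ u
  have h2 : ∀ q ∈ Finset.Icc 1 ⌊r⌋₊, ∑ b ∈ Finset.Icc (-(2 * q : ℤ)) (2 * q),
      ∫ u : ℝ, c q * (q : ℝ) ^ (-(d / 2 : ℝ)) * (1 + ‖u - N * ((b : ℝ) / q)‖) ^ (-(3 / 2 : ℝ)) ≤
      5 * K * (c q * (q : ℝ) ^ (1 - d / 2 : ℝ)) := by
    intro q hq
    have hq1 : (1 : ℝ) ≤ q := mod_cast (mem_Icc.1 hq).1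
    have h3 : ∀ b : ℤ, ∫ u : ℝ, c q * (q : ℝ) ^ (-(d / 2 : ℝ)) *
        (1 + ‖u - N * ((b : ℝ) / q)‖) ^ (-(3 / 2 : ℝ)) = c q * (q : ℝ) ^ (-(d / 2 : ℝ)) * K := by
      intro b
      rw [integral_const_mul, integral_sub_right_eq_self (fun u : ℝ => (1 + ‖u‖) ^ (-(3 / 2 : ℝ)))]
    rw [sum_congr rfl fun b _ => h3 b, sum_const, nsmul_eq_mul, Int.card_Icc]
    have h4 : ((((2 * q : ℤ) + 1 - -(2 * q : ℤ)).toNat : ℕ) : ℝ) ≤ 5 * q := by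
      have : ((2 * q : ℤ) + 1 - -(2 * q : ℤ)).toNat ≤ 5 * q := by
        have := (mem_Icc.1 hq).1
        omega
      exact_mod_cast this
    have h5 : (q : ℝ) ^ (1 - d / 2 : ℝ) = q * (q : ℝ) ^ (-(d / 2 : ℝ)) := by
      rw [sub_eq_add_neg, rpow_add (by linarith), rpow_one]
    rw [h5]
    refine (mul_le_mul_of_nonneg_right h4 (by positivity)).trans (le_of_eq (by ring))
  have h3 : ∑ q ∈ Finset.Icc 1 ⌊r⌋₊, c q * (q : ℝ) ^ (1 - d / 2 : ℝ) ≤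
      (1 + C') * (κ⁻¹ + (Q : ℝ) ^ (21 / 10 - d / 2 : ℝ)) := by
    have h4 : ∑ q ∈ Finset.Icc 1 Q, (q : ℝ) ^ (1 - d / 2 : ℝ) ≤ 1 + C' := by
      rw [← Finset.Ioc_insert_left hQ, sum_insert (by simp), cast_one,
        one_rpow]
      have := h' d 1 Q hd le_rfl
      rw [cast_one, one_rpow, mul_one] at this
      linarith
    have h5 : ∑ q ∈ Finset.Icc 1 ⌊r⌋₊, c q * (q : ℝ) ^ (1 - d / 2 : ℝ) ≤
        κ⁻¹ * ∑ q ∈ Finset.Icc 1 Q, (q : ℝ) ^ (1 - d / 2 : ℝ) +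
          ∑ q ∈ Finset.Ioc Q ⌊r⌋₊, (q : ℝ) ^ (1 - d / 2 : ℝ) := by
      rw [mul_sum, ← Finset.sum_filter_add_sum_filter_not _ (· ≤ Q)]
      refine add_le_add ?_ ?_
      · refine (Finset.sum_le_sum_of_subset_of_nonneg (t := Finset.Icc 1 Q) ?_ ?_).trans
          (sum_le_sum fun q hq => ?_)
        · intro q hq
          simp only [mem_filter, mem_Icc] at hq ⊢
          omega
        · intro q _ _
          exact mul_nonneg (hc0 q) (by positivity)
        · simp [hc, (mem_Icc.1 hq).2]
      · refine (sum_le_sum fun q hq => ?_).trans (Finset.sum_le_sum_of_subset_of_nonneg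
          (t := Finset.Ioc Q ⌊r⌋₊) ?_ fun q _ _ => by positivity)
        · simp [hc, (mem_filter.1 hq).2]
        · intro q hq
          simp only [mem_filter, mem_Icc, mem_Ioc] at hq ⊢
          omega
    have h6 := h' d Q ⌊r⌋₊ hd hQ
    have h7 : 0 < κ⁻¹ := inv_pos.2 hκ
    have h8 : 0 ≤ (Q : ℝ) ^ (21 / 10 - d / 2 : ℝ) := by positivity
    nlinarith [mul_le_mul_of_nonneg_left h4 h7.le]
  rw [integral_const_mul, integral_finsetSum _ fun q _ => integrable_finsetSum _ fun b _ => hi q b,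
    sum_congr rfl fun q _ => integral_finsetSum _ fun b _ => hi q b] at h1
  have h4 := (sum_le_sum h2).trans_eq (mul_sum _ _ _).symm
  have hX : 0 ≤ κ⁻¹ + (Q : ℝ) ^ (21 / 10 - d / 2 : ℝ) := by positivity
  refine (mul_le_mul_of_nonneg_left (h1.trans (mul_le_mul_of_nonneg_left
    (h4.trans (mul_le_mul_of_nonneg_left h3 (by positivity))) (by positivity)))
    (by positivity : 0 ≤ (r ^ d)⁻¹)).trans ?_
  rw [mul_comm C (r ^ d), mul_assoc (r ^ d), inv_mul_cancel_left₀ (by positivity)]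
  nlinarith

lemma exists_norm_ftZ_shell_le_const (d : ℕ) (hd : 5 ≤ d) : ∃ C : ℝ, 0 < C ∧ ∀ r κ : ℝ, 1 ≤ κ →
    κ ≤ r → ∀ ξ : Ξ d, ‖ftZ (fun y : Λ d => (shell r κ y : ℂ)) ξ‖ ≤ C := by
  obtain ⟨C, hC, h⟩ := exists_prod_thetaW_le d (by omega)
  have hint : Integrable fun u : ℝ => (1 + ‖u‖) ^ (-(d / 2 : ℝ)) := integrable_one_add_norm (by
    have : (5 : ℝ) ≤ d := mod_cast hd
    rw [Module.finrank_self]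
    push_cast
    linarith)
  refine ⟨C * (∫ u : ℝ, (1 + ‖u‖) ^ (-(d / 2 : ℝ))) + 1, by positivity, fun r κ hκ hκr ξ => ?_⟩
  have hr : 0 < r := by linarith
  obtain ⟨n, hn⟩ := exists_reduce ξ
  rw [← ftZ_sub_int _ ξ n, ftZ_shell hr (by linarith), norm_mul, norm_real,
    norm_of_nonneg (by positivity)]
  refine (mul_le_mul_of_nonneg_left (norm_integral_le_of_norm_le (hint.const_mul (C * r ^ d))
    (of_forall fun u => ?_)) (by positivity)).trans ?_
  · rw [norm_mul, norm_mul, norm_eC, mul_one, norm_real,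
      norm_of_nonneg (tri_nonneg _ _)]
    by_cases hu : tri κ u = 0
    · rw [hu, zero_mul]
      positivity
    have hu' := abs_le_of_tri_ne_zero (by linarith) hu
    refine (mul_le_of_le_one_left (norm_nonneg _) (tri_le_one (by linarith) u)).trans
      ((h r u _ hr (by linarith) hn).trans (mul_le_of_le_one_right (by positivity) ?_))
    rw [exp_le_one_iff, neg_nonpos]
    positivity
  · rw [integral_const_mul, mul_comm C, mul_assoc, inv_mul_cancel_left₀ (by positivity)]
    linarith

lemma normSqZ_cons {n : ℕ} (a : ℤ) (y : Λ n) :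
    normSqZ (Fin.cons a y : Fin (n + 1) → ℤ) = a ^ 2 + normSqZ y := by
  simp [normSqZ, Fin.sum_univ_succ]

/-- The transform of the shell kernel at `0` is bounded below. -/
lemma exists_le_norm_ftZ_shell (d : ℕ) (hd : 0 < d) : ∃ c : ℝ, 0 < c ∧ ∀ r κ : ℝ, 2 ≤ κ →
    r = κ ^ 8 → c ≤ ‖ftZ (fun y : Λ d => (shell r κ y : ℂ)) 0‖ := by
  obtain ⟨n, rfl⟩ := Nat.exists_eq_succ_of_ne_zero hd.ne'
  refine ⟨exp (-2) / (96 * (2 * (n + 1)) ^ n), by positivity, fun r κ hκ hrκ => ?_⟩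
  have hκ0 : 0 < κ := by linarith
  have hr : 0 < r := hrκ ▸ by positivity
  obtain ⟨t, ht⟩ : ∃ t, t = r / (24 * κ) := ⟨_, rfl⟩
  have htr : t * (24 * κ) = r := by rw [ht]; field_simp
  have ht1 : 1 ≤ t := by
    rw [ht, hrκ, one_le_div (by positivity)]
    nlinarith [pow_le_pow_left₀ (by norm_num) hκ 7]
  have htr' : t ≤ r := by nlinarith
  obtain ⟨A, hA⟩ : ∃ A, A = ⌊r / (2 * (n + 1))⌋₊ := ⟨_, rfl⟩
  have hAr : (A : ℝ) ≤ r / (2 * (n + 1)) := hA ▸ floor_le (by positivity)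
  have hAr' : r / (2 * (n + 1)) ≤ (A + 1 : ℕ) := by
    rw [hA]
    exact_mod_cast (Nat.lt_floor_add_one _).le
  let s : Λ n → ℝ := fun y => √(r ^ 2 - normSqZ y)
  let g : ℕ × Λ n → Fin (n + 1) → ℤ := fun x => Fin.cons (⌈s x.2⌉ + x.1) x.2
  let S : Finset (ℕ × Λ n) := range ⌊t⌋₊ ×ˢ boxF n 0 (A + 1 : ℕ)
  have hg : Function.Injective g := by
    rintro ⟨j, y⟩ ⟨j', y'⟩ h
    obtain ⟨h1, rfl⟩ := Fin.cons_inj.1 h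
    simpa using h1
  have hS : ∀ x ∈ S, (r ^ (n + 1))⁻¹ * exp (-2) * (κ / 2) ≤ shell r κ (g x) := by
    rintro ⟨j, y⟩ hx
    obtain ⟨hj, hy⟩ := mem_product.1 hx
    have hy : ∀ i, 0 ≤ y i ∧ y i < (A + 1 : ℕ) := mem_boxF.1 hy
    have hy2 : (normSqZ y : ℝ) ≤ r ^ 2 / 4 := by
      have h1 : normSqZ y ≤ ∑ _i : Fin n, (A : ℤ) ^ 2 := sum_le_sum fun i _ =>
        pow_le_pow_left₀ (hy i).1 (by have := (hy i).2; push_cast at this; omega) 2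
      rw [sum_const, card_univ, card_fin, nsmul_eq_mul] at h1
      have h2 : (normSqZ y : ℝ) ≤ n * (A : ℝ) ^ 2 := mod_cast h1
      rw [le_div_iff₀ (by positivity)] at hAr
      have h3 := pow_le_pow_left₀ (by positivity) hAr 2
      have h4 : (n : ℝ) * A ^ 2 ≤ ((n : ℝ) + 1) ^ 2 * A ^ 2 :=
        mul_le_mul_of_nonneg_right (by nlinarith [cast_nonneg (α := ℝ) n]) (by positivity)
      nlinarith
    have hs2 : s y ^ 2 = r ^ 2 - normSqZ y := sq_sqrt (by nlinarith)
    have hs0 : 0 ≤ s y := Real.sqrt_nonneg _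
    have hy0 : (0 : ℝ) ≤ normSqZ y := by
      exact_mod_cast (sum_nonneg fun i _ => sq_nonneg _ : (0 : ℤ) ≤ normSqZ y)
    have hsr : s y ≤ r := abs_le_of_sq_le_sq' (by linarith) hr.le |>.2
    have hz1 : s y ≤ ((⌈s y⌉ + j : ℤ) : ℝ) := by
      push_cast
      linarith [Int.le_ceil (s y), cast_nonneg (α := ℝ) j]
    have hz2 : ((⌈s y⌉ + j : ℤ) : ℝ) ≤ s y + t := by
      have h1 : (j : ℝ) + 1 ≤ ⌊t⌋₊ := mod_cast mem_range.1 hj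
      push_cast
      linarith [Int.ceil_lt_add_one (s y), floor_le (by linarith : 0 ≤ t)]
    have hN : (normSqZ (g (j, y)) : ℝ) = ((⌈s y⌉ + j : ℤ) : ℝ) ^ 2 + normSqZ y := by
      rw [normSqZ_cons]
      push_cast
      rfl
    generalize ((⌈s y⌉ + j : ℤ) : ℝ) = z at hz1 hz2 hN
    have h0 : 0 ≤ (normSqZ (g (j, y)) : ℝ) / r ^ 2 - 1 := by
      rw [hN, sub_nonneg, one_le_div (by positivity)]
      nlinarith
    have h1 : (normSqZ (g (j, y)) : ℝ) / r ^ 2 - 1 ≤ 1 / (8 * κ) := by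
      rw [hN, sub_le_iff_le_add, div_le_iff₀ (by positivity)]
      have h2 : z ^ 2 ≤ s y ^ 2 + t * (3 * r) := by nlinarith
      have h3 : (1 / (8 * κ) + 1) * r ^ 2 = t * (3 * r) + r ^ 2 := by
        rw [ht]
        field_simp
        ring
      linarith
    have h2 : 1 / (8 * κ) ≤ 1 := div_le_one_of_le₀ (by linarith) (by positivity)
    rw [shell, gam]
    refine mul_le_mul (mul_le_mul_of_nonneg_left (exp_le_exp.2 ?_) (by positivity))
      (le_fej hκ0 (abs_le.2 ⟨by linarith [div_pos one_pos (by positivity : 0 < 8 * κ)], h1⟩))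
      (by positivity) (by positivity)
    rw [neg_div]
    linarith
  have h1 : ftZ (fun y : Fin (n + 1) → ℤ => (shell r κ y : ℂ)) 0 =
      ((∑' y : Fin (n + 1) → ℤ, shell r κ y : ℝ) : ℂ) := by
    rw [ofReal_tsum]
    simp [ftZ, eC_zero]
  have hsum := summable_shell (d := n + 1) hr hκ0
  rw [h1, norm_real, norm_of_nonneg (tsum_nonneg fun y => shell_nonneg hr hκ0 y)]
  have h4 := (card_nsmul_le_sum (S.image g) (shell r κ)
    ((r ^ (n + 1))⁻¹ * exp (-2) * (κ / 2)) fun y hy => by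
      obtain ⟨x, hx, rfl⟩ := mem_image.1 hy
      exact hS x hx).trans (hsum.sum_le_tsum _ fun y _ => shell_nonneg hr hκ0 y)
  rw [Finset.card_image_of_injective _ hg, Finset.card_product, Finset.card_range, card_boxF,
    nsmul_eq_mul] at h4
  refine le_trans ?_ h4
  have h2 : t / 2 ≤ ⌊t⌋₊ := by
    have h3 : (1 : ℝ) ≤ ⌊t⌋₊ := mod_cast floor_pos.2 ht1
    linarith [Nat.lt_floor_add_one t]
  have h3 : t / 2 * (r / (2 * (n + 1))) ^ n ≤ ((⌊t⌋₊ * (A + 1) ^ n : ℕ) : ℝ) := by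
    push_cast at hAr' ⊢
    exact mul_le_mul h2 (pow_le_pow_left₀ (by positivity) hAr' n) (by positivity) (by positivity)
  refine le_trans (le_of_eq ?_) (mul_le_mul_of_nonneg_right (h3.trans_eq (by simp))
    (by positivity))
  have h5 : (0 : ℝ) < 2 * (n + 1) := by positivity
  rw [ht]
  generalize (2 : ℝ) * (n + 1) = w at h5 ⊢
  rw [div_pow]
  field_simp
  ring

/-- The approximating kernel to the spherical measure. -/
def lamK (M : ℕ) (r : ℝ) (N : ℤ) (y : Λ d) : ℝ := gden M N y * shell r (r ^ (1 / 8 : ℝ)) y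

lemma ftZ_lamK {M : ℕ} (hM : M ∣ m) {r : ℝ} (hr : 0 < r) (N : ℤ) (ξ : Ξ d) :
    ftZ (fun y => (lamK M r N y : ℂ)) ξ =
      ∑ a : ZMod m with (M : ZMod m) * a = 0, ftZ (majArc r (r ^ (1 / 8 : ℝ)) N a) ξ := by
  simp only [ftZ]
  rw [← tsum_finsetSum fun a _ =>
    summable_mul_eC (summable_majArc hr (rpow_pos_of_pos hr _) N a) ξ]
  refine tsum_congr fun y => ?_
  rw [← sum_mul]
  simp only [majArc]
  rw [← sum_mul, sum_stdAddChar_filter hM, lamK, gden]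
  split_ifs <;> simp

lemma norm_mul_sub_mul_le {x y x₀ y₀ h h₀ A L A₀ L₀ : ℂ} {B δ : ℝ} (hx : ‖x‖ ≤ B) (hy : ‖y‖ ≤ B)
    (hx₀ : ‖x₀‖ ≤ B) (hy₀ : ‖y₀‖ ≤ B) (hh : ‖h‖ ≤ B) (hh₀ : ‖h₀‖ ≤ B) (hA : ‖A - x * h‖ ≤ δ)
    (hL : ‖L - y * h‖ ≤ δ) (hA₀ : ‖A₀ - x₀ * h₀‖ ≤ δ) (hL₀ : ‖L₀ - y₀ * h₀‖ ≤ δ)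
    (hb : ‖x * y₀ - y * x₀‖ ≤ δ) : ‖A * L₀ - L * A₀‖ ≤ (5 * B ^ 2 + 2 * δ) * δ := by
  have hm : ∀ {u v : ℂ} {s t : ℝ}, ‖u‖ ≤ s → ‖v‖ ≤ t → ‖u * v‖ ≤ s * t := fun hu hv =>
    (norm_mul _ _).trans_le (mul_le_mul hu hv (norm_nonneg _) ((norm_nonneg _).trans hu))
  have h1 : A * L₀ - L * A₀ = (x * y₀ - y * x₀) * (h * h₀) + x * h * (L₀ - y₀ * h₀) +
      (A - x * h) * (y₀ * h₀ + (L₀ - y₀ * h₀)) - y * h * (A₀ - x₀ * h₀) -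
      (L - y * h) * (x₀ * h₀ + (A₀ - x₀ * h₀)) := by ring
  rw [h1]
  refine (norm_sub_le_of_le (norm_sub_le_of_le (norm_add_le_of_le (norm_add_le_of_le
    (hm hb (hm hh hh₀)) (hm (hm hx hh) hL₀)) (hm hA (norm_add_le_of_le (hm hy₀ hh₀) hL₀)))
    (hm (hm hy hh) hA₀)) (hm hL (norm_add_le_of_le (hm hx₀ hh₀) hA₀))).trans_eq ?_
  ring

/-- Comparison of the multipliers of the spherical measure and of its approximation. -/
lemma exists_norm_ftZ_sphK_mul_sub_le (d : ℕ) (hd : 5 ≤ d) : ∃ c : ℝ, 0 < c ∧ ∃ C : ℝ, 0 < C ∧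
    ∃ J₀ : ℕ, ∀ (r : ℝ) (N J : ℕ), J₀ ≤ J → 0 < r → r ^ 2 = N → (Mseq d J : ℝ) ^ 8 ≤ r →
    c ≤ ‖ftZ (fun y : Λ d => (sphK r N y : ℂ)) 0‖ ∧
    c ≤ ‖ftZ (fun y : Λ d => (lamK (Mseq d J) r N y : ℂ)) 0‖ ∧
    ∀ ξ : Ξ d, ‖ftZ (fun y => (sphK r N y : ℂ)) ξ *
      ftZ (fun y : Λ d => (lamK (Mseq d J) r N y : ℂ)) 0 -
      ftZ (fun y => (lamK (Mseq d J) r N y : ℂ)) ξ *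
      ftZ (fun y : Λ d => (sphK r N y : ℂ)) 0‖ ≤
      C * ((2 : ℝ) ^ J) ^ (1 - (d : ℝ) / 2) := by
  obtain ⟨C₁, hC₁, h₁⟩ := exists_norm_ftZ_sphK_sub_le d hd
  obtain ⟨C₂, hC₂, h₂⟩ := exists_norm_sum_ftZ_majArc_sub_le (d := d) (by omega)
  obtain ⟨C₃, hC₃, h₃⟩ := exists_norm_bracket_le hd
  obtain ⟨C₄, hC₄, h₄⟩ := exists_norm_ordSum_le hd
  obtain ⟨C₅, hC₅, h₅⟩ := exists_norm_ftZ_shell_le_const d hd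
  obtain ⟨c₁, hc₁, J₁, h₆⟩ := exists_norm_singSum_ge hd
  obtain ⟨c₂, hc₂, h₇⟩ := exists_le_norm_ftZ_shell d (by omega)
  have hd5 : (5 : ℝ) ≤ d := mod_cast hd
  obtain ⟨K, hK⟩ : ∃ K, K = 2 * C₁ + C₂ + C₃ := ⟨_, rfl⟩
  have hK0 : 0 < K := hK ▸ by positivity
  have hlim : Filter.Tendsto (fun J : ℕ => K * ((2 : ℝ) ^ J) ^ (1 - (d : ℝ) / 2)) atTop
      (nhds 0) := by
    have h := ((tendsto_rpow_neg_atTop (by linarith : 0 < (d : ℝ) / 2 - 1)).comp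
      (tendsto_pow_atTop_atTop_of_one_lt (one_lt_two : (1 : ℝ) < 2))).const_mul K
    simpa [Function.comp_def] using h
  obtain ⟨J₂, hJ₂⟩ := Filter.eventually_atTop.1 (hlim.eventually
    (gt_mem_nhds (by positivity : 0 < c₁ * c₂ / 2)))
  refine ⟨c₁ * c₂ / 2, by positivity, (5 * (C₄ + C₅) ^ 2 + c₁ * c₂) * K, by positivity,
    J₁ + J₂ + 1, fun r N J hJ hr hN hM => ?_⟩
  obtain ⟨κ, hκ⟩ : ∃ κ, κ = r ^ (1 / 8 : ℝ) := ⟨_, rfl⟩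
  have hrκ : r = κ ^ 8 := by rw [hκ, rpow_eighth_pow hr.le]
  have hMκ : (Mseq d J : ℝ) ≤ κ := by
    rw [hrκ] at hM
    exact le_of_pow_le_pow_left₀ (by norm_num) (hκ ▸ by positivity) hM
  have hMd : ((2 ^ (d * J) : ℕ) : ℝ) ≤ Mseq d J := mod_cast two_pow_le_Mseq d J
  have hκ2 : 2 ≤ κ := by
    refine le_trans ?_ (hMd.trans hMκ)
    exact_mod_cast Nat.le_self_pow (Nat.mul_ne_zero (by omega) (by omega)) 2
  have hκ0 : 0 < κ := by linarith
  have hQκ : ((⌊κ⌋₊ : ℕ) : ℝ) ≤ κ := floor_le hκ0.le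
  have hMQ : Mseq d J ≤ ⌊κ⌋₊ := Nat.le_floor hMκ
  have hM1 : 1 ≤ Mseq d J := NeZero.one_le
  obtain ⟨Q, hQ⟩ : ∃ Q, Q = ⌊κ⌋₊ := ⟨_, rfl⟩
  rw [← hQ] at hMQ hQκ
  have hQ1 : 1 ≤ Q := hM1.trans hMQ
  obtain ⟨m, hm⟩ : ∃ m, m = Q.factorial := ⟨_, rfl⟩
  have : NeZero m := ⟨hm ▸ Q.factorial_ne_zero⟩
  have hdvd : ∀ q, 1 ≤ q → q ≤ Q → q ∣ m := fun q h h' => hm ▸ Nat.dvd_factorial h h'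
  obtain ⟨δ, hδ⟩ : ∃ δ, δ = K * ((2 : ℝ) ^ J) ^ (1 - (d : ℝ) / 2) := ⟨_, rfl⟩
  have hδc : δ < c₁ * c₂ / 2 := hδ ▸ hJ₂ J (by omega)
  have hε : 0 < ((2 : ℝ) ^ J) ^ (1 - (d : ℝ) / 2) := by positivity
  have he1 : κ⁻¹ ≤ ((2 : ℝ) ^ J) ^ (1 - (d : ℝ) / 2) := by
    refine (inv_anti₀ (by positivity) (hMd.trans hMκ)).trans ?_
    push_cast
    rw [mul_comm d, pow_mul, ← rpow_natCast (2 ^ J : ℝ) d, ← rpow_neg (by positivity)]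
    exact rpow_le_rpow_of_exponent_le (one_le_pow₀ one_le_two) (by linarith)
  have he2 : (Q : ℝ) ^ (21 / 10 - d / 2 : ℝ) ≤ ((2 : ℝ) ^ J) ^ (1 - (d : ℝ) / 2) :=
    (rpow_le_rpow_of_nonpos (by positivity) (hMd.trans (mod_cast hMQ))
      (by linarith)).trans (two_pow_rpow_le hd J)
  have hN' : 2 * κ * Q ^ 2 < (N : ℝ) := by
    rw [← hN, hrκ]
    calc 2 * κ * Q ^ 2 ≤ κ * κ * κ ^ 2 := by gcongr
      _ = κ ^ 4 * 1 := by ring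
      _ < κ ^ 4 * κ ^ 12 := mul_lt_mul_of_pos_left (one_lt_pow₀ (by linarith) (by norm_num))
        (by positivity)
      _ = (κ ^ 8) ^ 2 := by ring
  have hκr : κ ≤ r := hrκ ▸ le_self_pow₀ (by linarith) (by norm_num)
  have ha : ∀ ξ ℓ₀, IsNearest κ r Q ξ ℓ₀ → ‖ftZ (fun y : Λ d => (sphK r N y : ℂ)) ξ -
      ordSum Q ((N : ℤ) : ZMod m) ℓ₀ * ftZ (fun y => (shell r κ y : ℂ)) (ξ + ratPt ℓ₀)‖ ≤ δ := by
    intro ξ ℓ₀ hℓ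
    refine (norm_sub_le_norm_sub_add_norm_sub _ _ _).trans ((add_le_add
      (h₁ r κ N Q m hκ0 (by linarith) hN hQ1 hN' hdvd ξ) (h₂ r κ Q m N hκ2 hrκ hQκ ξ ℓ₀ hℓ
      (univ.filter fun a : ZMod m => addOrderOf a ≤ Q) fun a ha =>
        (mem_filter.1 ha).2)).trans ?_)
    rw [hδ, hK]
    nlinarith
  have hl : ∀ ξ ℓ₀, IsNearest κ r Q ξ ℓ₀ → ‖ftZ (fun y : Λ d => (lamK (Mseq d J) r N y : ℂ)) ξ -
      singSum (Mseq d J) ((N : ℤ) : ZMod m) ℓ₀ * ftZ (fun y => (shell r κ y : ℂ)) (ξ + ratPt ℓ₀)‖ ≤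
      δ := by
    intro ξ ℓ₀ hℓ
    rw [ftZ_lamK (hdvd _ hM1 hMQ) hr, ← hκ]
    refine (h₂ r κ Q m N hκ2 hrκ hQκ ξ ℓ₀ hℓ
      (univ.filter fun a : ZMod m => (Mseq d J : ZMod m) * a = 0) fun a ha =>
        (le_of_dvd hM1 ((natCast_mul_eq_zero_iff_addOrderOf_dvd _ _).1
          (mem_filter.1 ha).2)).trans hMQ).trans ?_
    rw [hδ, hK]
    nlinarith
  have hz := isNearest_zero (d := d) (m := m) hκ2 hrκ hQκ hQ1
  have hz0 : (0 : Ξ d) + ratPt (0 : Γ d m) = 0 := by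
    funext i
    simp [ratPt]
  have ha0 := ha 0 0 hz
  have hl0 := hl 0 0 hz
  rw [hz0] at ha0 hl0
  have hge := h₆ J Q m hm hMQ (by omega) N
  have hsh := h₇ r κ hκ2 hrκ
  have hlow : ∀ {u v w : ℂ}, c₁ ≤ ‖u‖ → c₂ ≤ ‖v‖ → ‖w - u * v‖ ≤ δ → c₁ * c₂ / 2 ≤ ‖w‖ := by
    intro u v w hu hv hw
    have h1 := mul_le_mul hu hv hc₂.le (norm_nonneg _)
    rw [← norm_mul] at h1
    have h2 := norm_sub_norm_le (u * v) (u * v - w)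
    rw [sub_sub_cancel, norm_sub_rev] at h2
    linarith
  refine ⟨hlow hge.1 hsh ha0, hlow hge.2 hsh hl0, fun ξ => ?_⟩
  obtain ⟨ℓ₀, hℓ⟩ := exists_isNearest (d := d) (m := m) hκ2 hrκ hQκ ξ
  refine (norm_mul_sub_mul_le (B := C₄ + C₅) ((h₄ J Q m _ _).1.trans (by linarith))
    ((h₄ J Q m _ _).2.1.trans (by linarith)) ((h₄ J Q m _ _).1.trans (by linarith))
    ((h₄ J Q m _ _).2.1.trans (by linarith)) ((h₅ r κ (by linarith) hκr _).trans (by linarith))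
    ((h₅ r κ (by linarith) hκr 0).trans (by linarith)) (ha ξ ℓ₀ hℓ) (hl ξ ℓ₀ hℓ) ha0 hl0
    ((h₃ J Q m hm hMQ _ _).trans ?_)).trans ?_
  · rw [hδ, hK]
    nlinarith
  · rw [mul_assoc, ← hδ]
    have : 0 ≤ δ := hδ ▸ by positivity
    exact mul_le_mul_of_nonneg_right (by linarith) this

lemma finite_normSqZ_eq (d : ℕ) (N : ℤ) : {y : Λ d | normSqZ y = N}.Finite := by
  refine (Set.finite_Icc (fun _ => -N) (fun _ => N)).subset fun y hy => ?_
  have h : ∀ i, y i ^ 2 ≤ N := fun i => hy ▸ single_le_sum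
    (f := fun i => y i ^ 2) (fun i _ => sq_nonneg _) (mem_univ i)
  exact ⟨fun i => by simpa using neg_le_neg ((Int.le_self_sq (-y i)).trans (by simpa using h i)),
    fun i => (Int.le_self_sq _).trans (h i)⟩

lemma sphK_nonneg (r : ℝ) (hr : 0 < r) (N : ℤ) (y : Λ d) : 0 ≤ sphK r N y := by
  unfold sphK gam
  split_ifs <;> positivity

lemma summable_sphK (r : ℝ) (N : ℤ) : Summable (sphK r N : Λ d → ℝ) :=
  summable_of_hasFiniteSupport ((finite_normSqZ_eq d N).subset fun y hy => by
    by_contra h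
    exact hy (if_neg h))

lemma lamK_nonneg {M : ℕ} {r : ℝ} (hr : 0 < r) (N : ℤ) (y : Λ d) : 0 ≤ lamK M r N y :=
  mul_nonneg (gden_nonneg _ _ _) (shell_nonneg hr (by positivity) y)

lemma summable_lamK {M : ℕ} {r : ℝ} (hr : 0 < r) (N : ℤ) :
    Summable (lamK M r N : Λ d → ℝ) :=
  of_nonneg_of_le (lamK_nonneg hr N) (fun y => mul_le_mul_of_nonneg_right (gden_le M N y)
    (shell_nonneg hr (by positivity) y)) ((summable_shell hr (by positivity)).mul_left _)

lemma ftZ_ofReal_zero (k : Λ d → ℝ) :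
    ftZ (fun y => (k y : ℂ)) 0 = ((∑' y, k y : ℝ) : ℂ) := by
  rw [ofReal_tsum]
  simp [ftZ, eC_zero]

lemma tsum_enorm_normalized_le {k : Λ d → ℝ} (hk0 : ∀ y, 0 ≤ k y)
    (hk : Summable k) : ∑' y, ‖(ftZ (fun y => (k y : ℂ)) 0)⁻¹ * (k y : ℂ)‖ₑ ≤ 1 := by
  have h0 : 0 ≤ ∑' y, k y := tsum_nonneg hk0
  have h1 : ∀ y, ‖(ftZ (fun y => (k y : ℂ)) 0)⁻¹ * (k y : ℂ)‖ₑ =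
      ofReal ((∑' y, k y)⁻¹ * k y) := fun y => by
    rw [ftZ_ofReal_zero, ← Complex.ofReal_inv, ← Complex.ofReal_mul, ← ofReal_norm,
      norm_real, norm_of_nonneg (mul_nonneg (inv_nonneg.2 h0) (hk0 y))]
  rw [tsum_congr h1, ← ofReal_tsum_of_nonneg (fun y => mul_nonneg (inv_nonneg.2 h0) (hk0 y))
    (hk.mul_left _), tsum_mul_left, ← ofReal_one]
  exact ofReal_le_ofReal inv_mul_le_one

/-- The difference of the normalized spherical measure and its normalized approximation. -/
def errK (J : ℕ) (r : ℝ) (N : ℤ) (y : Λ d) : ℂ :=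
  (ftZ (fun y : Λ d => (sphK r N y : ℂ)) 0)⁻¹ * (sphK r N y : ℂ) -
    (ftZ (fun y : Λ d => (lamK (Mseq d J) r N y : ℂ)) 0)⁻¹ * (lamK (Mseq d J) r N y : ℂ)

lemma exists_nP_conv_errK_le (d : ℕ) (hd : 5 ≤ d) {p : ℝ} (hp : 1 < p) (hp2 : p < 2) :
    ∃ c : ℝ, 0 < c ∧ ∃ C : ℝ, 0 < C ∧
    ∃ J₀ : ℕ, ∀ (r : ℝ) (N J : ℕ), J₀ ≤ J → 0 < r → r ^ 2 = N → (Mseq d J : ℝ) ^ 8 ≤ r →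
    c ≤ ‖ftZ (fun y : Λ d => (lamK (Mseq d J) r N y : ℂ)) 0‖ ∧
    ∀ f : Λ d → ℂ, f.support.Finite → ∑' x, ‖conv (errK J r N) f x‖ₑ ^ p ≤
      ofReal (C * ((2 : ℝ) ^ J) ^ (-((d - 2) * (p - 1) : ℝ))) * ∑' x, ‖f x‖ₑ ^ p := by
  obtain ⟨c, hc, C, hC, J₀, h⟩ := exists_norm_ftZ_sphK_mul_sub_le d hd
  have hm := mC_pos one_pos hp hp2
  refine ⟨c, hc, mC 1 p 2 * (2 ^ (2 - p) * (C / c ^ 2) ^ (2 * (p - 1))), by positivity, J₀,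
    fun r N J hJ hr hN hM => ?_⟩
  obtain ⟨ha, hl, hal⟩ := h r N J hJ hr hN hM
  refine ⟨hl, fun f hf => ?_⟩
  obtain ⟨ε, hε⟩ : ∃ ε, ε = ((2 : ℝ) ^ J) ^ (1 - (d : ℝ) / 2) := ⟨_, rfl⟩
  have hε0 : 0 < ε := hε ▸ by positivity
  have hsa := summable_ofReal.2 (summable_sphK (d := d) r N)
  have hsl := summable_ofReal.2 (summable_lamK (d := d) (M := Mseq d J) hr N)
  have hs1 := hsa.mul_left (ftZ (fun y : Λ d => (sphK r N y : ℂ)) 0)⁻¹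
  have hs2 := hsl.mul_left (ftZ (fun y : Λ d => (lamK (Mseq d J) r N y : ℂ)) 0)⁻¹
  have h1 : ∀ ξ : Ξ d, ‖ftZ (errK J r N) ξ‖ ≤ C / c ^ 2 * ε := fun ξ => by
    have e1 : ftZ (errK J r N) ξ = _ := ftZ_sub hs1 hs2 ξ
    rw [e1, ftZ_const_mul, ftZ_const_mul]
    have hξ := hal ξ
    rw [← hε] at hξ
    generalize ftZ (fun y : Λ d => (sphK r N y : ℂ)) 0 = A at *
    generalize ftZ (fun y : Λ d => (lamK (Mseq d J) r N y : ℂ)) 0 = L at *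
    have hA : A ≠ 0 := norm_pos_iff.1 (hc.trans_le ha)
    have hL : L ≠ 0 := norm_pos_iff.1 (hc.trans_le hl)
    have e2 : ∀ u v : ℂ, A⁻¹ * u - L⁻¹ * v = (u * L - v * A) / (A * L) := fun u v => by
      field_simp
    rw [e2, norm_div, norm_mul, div_mul_eq_mul_div]
    exact div_le_div₀ (by positivity) hξ (by positivity) (by
      rw [pow_two]
      exact mul_le_mul ha hl hc.le (norm_nonneg _))
  have key := nP_interp one_pos hp hp2 two_pos (A1 := C / c ^ 2 * ε) (by positivity)
    (fun f x => ‖conv (errK J r N) f x‖₊)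
    (fun f g hf hg x => by
      have h2 := maxConv_add_le ({0} : Finset ℕ) (fun _ => errK J r N) f g hf hg x
      simpa only [maxConv, Finset.sup_singleton] using h2)
    (fun f hf => (nP_conv_le le_rfl _ f).trans (mul_le_mul_left ((tsum_le_tsum fun y =>
      enorm_sub_le).trans (by
        rw [tsum_add]
        refine (add_le_add (tsum_enorm_normalized_le (sphK_nonneg r hr N) (summable_sphK r N))
          (tsum_enorm_normalized_le (lamK_nonneg hr N) (summable_lamK hr N))).trans_eq ?_
        norm_num)) _))
    (fun f hf => (nP_le_iff two_pos (by positivity) _ _).2 (by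
      have h2 := sum_conv_sq_le ({0} : Finset ℕ) (fun _ => errK J r N) (fun _ _ => hs1.sub hs2)
        (B := (C / c ^ 2 * ε) ^ (2 : ℝ)) (by positivity) (fun ξ => by
          rw [sum_singleton, rpow_two]
          exact pow_le_pow_left₀ (norm_nonneg _) (h1 ξ) 2) f (summable_of_finite_support' hf)
      simpa [enorm_eq_nnnorm] using h2)) rfl f hf
  refine ((nP_le_iff (by linarith) (by positivity) _ _).1 key).trans_eq ?_
  congr 2
  have hp0 : p ≠ 0 := by linarith
  rw [mul_rpow (by positivity) (by positivity), ← rpow_mul hm.le, one_div_mul_cancel hp0,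
    rpow_one, mul_rpow (by positivity) (by positivity), ← rpow_mul (by positivity),
    ← rpow_mul (by positivity), mul_assoc (mC 1 p 2), mul_assoc (_ ^ (2 - p))]
  have e1 : 1 * (2 - p) / ((2 - 1) * p) * p = 2 - p := by field_simp; norm_num
  have e2 : (1 - 1 * (2 - p) / ((2 - 1) * p)) * p = 2 * (p - 1) := by
    rw [sub_mul, e1]
    ring
  rw [e1, e2, mul_rpow (by positivity) hε0.le, hε, ← rpow_mul (by positivity)]
  congr 4
  ring

/-- The largest `J` for which the modulus `Mseq d J` is admissible for the radius `r`. -/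
def maxIdx (d : ℕ) (r : ℝ) : ℕ := Nat.findGreatest (fun J => Mseq d J ^ 8 ≤ ⌊r⌋₊) ⌊r⌋₊

lemma le_Mseq (hd : 0 < d) (J : ℕ) : J ≤ Mseq d J ^ 8 :=
  ((Nat.le_mul_of_pos_left J hd).trans (Nat.lt_two_pow_self.le.trans (two_pow_le_Mseq d J))).trans
    (Nat.le_self_pow (by norm_num) _)

lemma Mseq_maxIdx_le (d : ℕ) {r : ℝ} (hr : 1 ≤ r) : (Mseq d (maxIdx d r) : ℝ) ^ 8 ≤ r := by
  have h : Mseq d (maxIdx d r) ^ 8 ≤ ⌊r⌋₊ := Nat.findGreatest_spec (P := fun J => Mseq d J ^ 8 ≤ ⌊r⌋₊)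
    (m := 0) (Nat.zero_le _) (by simpa [Mseq_zero] using hr)
  exact (mod_cast h : (Mseq d (maxIdx d r) : ℝ) ^ 8 ≤ ⌊r⌋₊).trans
    (floor_le (by linarith))

lemma le_maxIdx (hd : 0 < d) {J : ℕ} {r : ℝ} (hr : (Mseq d J : ℝ) ^ 8 ≤ r) :
    J ≤ maxIdx d r := by
  have h : Mseq d J ^ 8 ≤ ⌊r⌋₊ := Nat.le_floor (mod_cast hr)
  exact Nat.le_findGreatest ((le_Mseq hd J).trans h) h

lemma log_le_maxIdx (hd : 0 < d) {r : ℝ} (hr : 1 ≤ r) :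
    log r ≤ 16 * d * log 4 * ((maxIdx d r + 1) * 2 ^ maxIdx d r) := by
  obtain ⟨J, hJ⟩ : ∃ J, J = maxIdx d r := ⟨_, rfl⟩
  rw [← hJ]
  have h1 : ⌊r⌋₊ < Mseq d (J + 1) ^ 8 := by
    by_contra! h
    have := le_maxIdx hd (r := r) (J := J + 1) (by
      exact_mod_cast (Nat.cast_le.2 h).trans (floor_le (by linarith : (0 : ℝ) ≤ r)))
    omega
  have h2 : Mseq d (J + 1) ≤ (4 ^ 2 ^ (J + 1)) ^ (d * (J + 1)) :=
    Nat.pow_le_pow_left (primorial_le_four_pow _) _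
  have h3 : r ≤ ((4 : ℝ) ^ 2 ^ (J + 1)) ^ (d * (J + 1) * 8) := by
    refine (Nat.lt_floor_add_one r).le.trans ?_
    rw [pow_mul _ _ 8]
    exact_mod_cast h1.trans_le (Nat.pow_le_pow_left h2 8)
  refine (Real.log_le_log (by linarith) h3).trans_eq ?_
  rw [Real.log_pow, Real.log_pow]
  push_cast
  ring

lemma exists_sum_maxIdx_le (hd : 0 < d) {c β : ℝ} (hc : 1 < c) (hβ : 1 < β) :
    ∃ C : ℝ, 0 < C ∧ ∀ R' : Finset ℝ, (∀ r ∈ R', c ≤ r) →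
    (∀ r ∈ R', ∀ s ∈ R', r < s → c * r ≤ s) → ∑ r ∈ R', ((2 : ℝ) ^ maxIdx d r) ^ (-β) ≤ C := by
  obtain ⟨η, hη⟩ : ∃ η, η = (β - 1) / 2 := ⟨_, rfl⟩
  have hη0 : 0 < η := by linarith
  obtain ⟨A, hA⟩ : ∃ A, A = 1 + (log 2 * η)⁻¹ := ⟨_, rfl⟩
  have hl2 : 0 < log 2 * η := mul_pos (log_pos one_lt_two) hη0
  have hA0 : 0 < A := hA ▸ by positivity
  have hJ : ∀ J : ℕ, (J : ℝ) + 1 ≤ A * ((2 : ℝ) ^ J) ^ η := fun J => by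
    have h1 := add_one_le_exp (log 2 * η * J)
    have h2 : ((2 : ℝ) ^ J) ^ η = exp (log 2 * η * J) := by
      rw [← rpow_natCast, ← rpow_mul two_pos.le, Real.rpow_def_of_pos two_pos]
      ring_nf
    rw [h2]
    refine le_trans ?_ (mul_le_mul_of_nonneg_left h1 hA0.le)
    have h3 : (log 2 * η)⁻¹ * (log 2 * η * J) = J := inv_mul_cancel_left₀ hl2.ne' _
    rw [hA]
    nlinarith [inv_pos.2 hl2, mul_nonneg hl2.le (cast_nonneg (α := ℝ) J)]
  have hlc : 0 < log c := log_pos hc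
  obtain ⟨b, hb⟩ : ∃ b, b = log c / (16 * d * log 4 * A) := ⟨_, rfl⟩
  have hK0 : 0 < 16 * d * log 4 * A := by
    positivity
  have hb0 : 0 < b := hb ▸ by positivity
  have hβ' : 1 < β / (1 + η) := by
    rw [one_lt_div (by linarith)]
    linarith
  have hsum := Real.summable_nat_rpow.2 (by linarith : -(β / (1 + η)) < -1)
  refine ⟨b ^ (-(β / (1 + η))) * ∑' n : ℕ, (n : ℝ) ^ (-(β / (1 + η))) + 1, by positivity,
    fun R' hR hlac => ?_⟩
  have hinj : Set.InjOn (fun r => ⌊logb c r⌋₊) R' := fun r hr s hs h => by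
    refine injOn_floor_logb hc one_pos (fun r hr => by linarith [hR r hr]) hlac hr hs ?_
    have h1 : ∀ r ∈ R', 0 ≤ logb c r := fun r hr =>
      Real.logb_nonneg hc (by linarith [hR r hr])
    simp only [div_one]
    rw [← Int.natCast_floor_eq_floor (h1 r hr), ← Int.natCast_floor_eq_floor (h1 s hs)]
    exact congrArg _ h
  have hterm : ∀ r ∈ R', ((2 : ℝ) ^ maxIdx d r) ^ (-β) ≤
      b ^ (-(β / (1 + η))) * (⌊logb c r⌋₊ : ℝ) ^ (-(β / (1 + η))) := fun r hr => by
    have hcr := hR r hr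
    have h1 : 1 ≤ ⌊logb c r⌋₊ := floor_pos.2 ((Real.le_logb_iff_rpow_le hc (by linarith)).2
      (by rwa [rpow_one]))
    have h2 : (⌊logb c r⌋₊ : ℝ) * log c ≤ log r := by
      rw [← le_div_iff₀ hlc]
      exact floor_le (Real.logb_nonneg hc (by linarith))
    have h3 : b * ⌊logb c r⌋₊ ≤ ((2 : ℝ) ^ maxIdx d r) ^ (1 + η) := by
      rw [hb, div_mul_eq_mul_div, div_le_iff₀ hK0, mul_comm (log c)]
      refine h2.trans ((log_le_maxIdx hd (by linarith)).trans ?_)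
      rw [rpow_add (by positivity), rpow_one]
      have h4 := mul_le_mul_of_nonneg_right (hJ (maxIdx d r)) (by positivity : (0 : ℝ) ≤ 2 ^ maxIdx d r)
      have h5 := mul_le_mul_of_nonneg_left h4 (by positivity : 0 ≤ 16 * d * log 4)
      linarith
    rw [← mul_rpow hb0.le (by positivity)]
    refine le_trans (le_of_eq ?_) (rpow_le_rpow_of_nonpos (by positivity) h3 (by linarith))
    rw [← rpow_mul (by positivity)]
    congr 1
    field_simp
  refine (sum_le_sum hterm).trans ?_
  rw [← mul_sum, ← sum_image (f := fun n : ℕ => (n : ℝ) ^ (-(β / (1 + η)))) hinj]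
  have := mul_le_mul_of_nonneg_left (hsum.sum_le_tsum (R'.image fun r => ⌊logb c r⌋₊)
    fun n _ => by positivity) (by positivity : 0 ≤ b ^ (-(β / (1 + η))))
  linarith

/-- The kernel of the spherical average of radius `r`. -/
def avgK (d : ℕ) (r : ℝ) (y : Λ d) : ℝ :=
  if normSqZ y = (radSq r : ℤ) then (sphereCount d r : ℝ)⁻¹ else 0

lemma avgK_nonneg (d : ℕ) (r : ℝ) (y : Λ d) : 0 ≤ avgK d r y := by
  unfold avgK
  split_ifs <;> positivity

lemma avgK_eq {r : ℝ} (hr : 0 < r) (y : Λ d) : (avgK d r y : ℂ) =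
    (ftZ (fun y : Λ d => (sphK r (radSq r) y : ℂ)) 0)⁻¹ * (sphK r (radSq r) y : ℂ) := by
  obtain ⟨v, hv⟩ : ∃ v, v = r ^ 2 * ((r ^ d)⁻¹ * exp (-((radSq r : ℤ) : ℝ) / r ^ 2)) := ⟨_, rfl⟩
  have hv0 : v ≠ 0 := hv ▸ by positivity
  have h1 : ∀ z : Λ d, sphK r (radSq r) z =
      {z : Λ d | normSqZ z = (radSq r : ℤ)}.indicator (fun _ => v) z := fun z => by
    unfold sphK gam indicator
    simp only [Set.mem_ofPred_eq]
    split_ifs with h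
    · rw [h, hv]
    · rfl
  rw [ftZ_ofReal_zero, tsum_congr h1, ← tsum_subtype, tsum_const, h1, ← Complex.ofReal_inv,
    ← Complex.ofReal_mul, nsmul_eq_mul, mul_inv, avgK, indicator]
  simp only [Set.mem_ofPred_eq]
  split_ifs
  · rw [inv_mul_cancel_right₀ hv0]
    rfl
  · rw [mul_zero]

lemma tsum_enorm_avgK_le {r : ℝ} (hr : 0 < r) : ∑' y, ‖(avgK d r y : ℂ)‖ₑ ≤ 1 := by
  simp_rw [avgK_eq hr]
  exact tsum_enorm_normalized_le (sphK_nonneg r hr _) (summable_sphK r _)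

lemma sq_eq_radSq {r : ℝ} (h : IsAdmissible r) : r ^ 2 = radSq r := by
  obtain ⟨-, n, hn⟩ := h
  rw [radSq, hn, Nat.floor_natCast]

lemma one_le_of_isAdmissible {r : ℝ} (h : IsAdmissible r) : 1 ≤ r := by
  have h1 : (0 : ℝ) < radSq r := sq_eq_radSq h ▸ pow_pos h.1 2
  have h2 : (1 : ℝ) ≤ radSq r := mod_cast h1
  rw [← sq_eq_radSq h] at h2
  nlinarith [h.1]

lemma exists_maxConv_avgK_le (hd : 5 ≤ d) {c p : ℝ} (hc : 1 < c)
    (hp : ((d : ℝ) - 1) / (d - 2) < p) (hp2 : p < 2) : ∃ C : ℝ, 0 < C ∧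
    ∀ R' : Finset ℝ, (∀ r ∈ R', IsAdmissible r) →
    (∀ r ∈ R', ∀ s ∈ R', r < s → c * r ≤ s) →
    ∀ f : Λ d → ℂ, f.support.Finite →
      nP p (fun x => (maxConv R' (fun r y => (avgK d r y : ℂ)) f x : ℝ≥0∞)) ≤
        ofReal C * nP p (fun x => ‖f x‖ₑ) := by
  have hd' : (5 : ℝ) ≤ d := mod_cast hd
  have hpd : (d : ℝ) - 1 < p * (d - 2) := (div_lt_iff₀ (by linarith)).1 hp
  have hp1 : 1 < p := lt_of_lt_of_le' hp ((one_le_div (by linarith)).2 (by linarith))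
  have hβ : 1 < ((d : ℝ) - 2) * (p - 1) := by linarith
  have hp0 : 0 < p := by linarith
  obtain ⟨c₀, hc₀, C₁, hC₁, J₀, hE⟩ := exists_nP_conv_errK_le d hd hp1 hp2
  obtain ⟨C₂, hC₂, hS⟩ := exists_sum_maxIdx_le (d := d) (by linarith) hc hβ
  obtain ⟨C₃, hC₃, hL⟩ := exists_maxConv_lam_le hd hc hp hp2
  obtain ⟨C₄, hC₄, hR⟩ := exists_sum_rpow_neg_le hc one_pos
  obtain ⟨X, hX⟩ : ∃ X, X = max ((Mseq d J₀ : ℝ) ^ 8) c := ⟨_, rfl⟩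
  have hX0 : 0 < X := hX ▸ lt_max_of_lt_right (by linarith)
  refine ⟨X * C₄ + (C₁ * C₂) ^ (1 / p) + c₀⁻¹ * C₃, by positivity, fun R' hadm hlac f hf => ?_⟩
  have hlac' : ∀ P : ℝ → Prop, ∀ _ : DecidablePred P, ∀ r ∈ R'.filter P, ∀ s ∈ R'.filter P,
      r < s → c * r ≤ s := fun P _ r hr s hs => hlac r (mem_filter.1 hr).1 s (mem_filter.1 hs).1
  obtain ⟨R1, hR1⟩ : ∃ R1, R1 = R'.filter (X ≤ ·) := ⟨_, rfl⟩
  obtain ⟨R2, hR2⟩ : ∃ R2, R2 = R'.filter (¬ X ≤ ·) := ⟨_, rfl⟩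
  have hmem1 : ∀ r ∈ R1, r ∈ R' ∧ (Mseq d J₀ : ℝ) ^ 8 ≤ r ∧ c ≤ r := fun r hr => by
    rwa [hR1, mem_filter, hX, max_le_iff] at hr
  have hmem2 : ∀ r ∈ R2, r ∈ R' ∧ r ≤ X := fun r hr => by
    rw [hR2, mem_filter] at hr
    exact ⟨hr.1, (not_le.1 hr.2).le⟩
  have hM : ∀ r ∈ R1, (Mseq d (maxIdx d r) : ℝ) ^ 8 ≤ r := fun r hr =>
    Mseq_maxIdx_le d (one_le_of_isAdmissible (hadm r (hmem1 r hr).1))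
  have hE' := fun r hr => hE r (radSq r) (maxIdx d r) (le_maxIdx (by linarith) (hmem1 r hr).2.1)
    (hadm r (hmem1 r hr).1).1 (sq_eq_radSq (hadm r (hmem1 r hr).1)) (hM r hr)
  obtain ⟨A, hA⟩ : ∃ A : Λ d → ℝ≥0∞, A = fun x => ∑ r ∈ R2, ‖conv (fun y => (avgK d r y : ℂ)) f x‖ₑ :=
    ⟨_, rfl⟩
  obtain ⟨B, hB⟩ : ∃ B : Λ d → ℝ≥0∞, B = fun x =>
      R1.sup fun r => ‖conv (errK (maxIdx d r) r (radSq r)) f x‖ₑ := ⟨_, rfl⟩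
  obtain ⟨D, hD⟩ : ∃ D : Λ d → ℝ≥0∞, D = fun x => (maxConv R1 (fun r y =>
    (lamK (Mseq d (maxIdx d r)) r (radSq r) y : ℂ)) f x : ℝ≥0∞) := ⟨_, rfl⟩
  have hpt : ∀ x, (maxConv R' (fun r y => (avgK d r y : ℂ)) f x : ℝ≥0∞) ≤
      A x + B x + ofReal c₀⁻¹ * D x := fun x => coe_maxConv_le fun r hr => by
    by_cases hrX : X ≤ r
    · have h1 : r ∈ R1 := hR1 ▸ mem_filter.2 ⟨hr, hrX⟩
      have h2 : (fun y => (avgK d r y : ℂ)) = fun y => errK (maxIdx d r) r (radSq r) y +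
          (ftZ (fun y : Λ d => (lamK (Mseq d (maxIdx d r)) r (radSq r) y : ℂ)) 0)⁻¹ *
            (lamK (Mseq d (maxIdx d r)) r (radSq r) y : ℂ) := funext fun y => by
        rw [avgK_eq (hadm r hr).1, errK, sub_add_cancel]
      rw [h2, conv_add_left _ _ hf, conv_const_mul_left]
      refine (enorm_add_le _ _).trans (add_le_add (le_add_of_nonneg_of_le zero_le ?_) ?_)
      · exact hB ▸ le_sup (f := fun r => ‖conv (errK (maxIdx d r) r (radSq r)) f x‖ₑ) h1
      · rw [enorm_mul, hD]
        refine mul_le_mul' ?_ (coe_le_coe.2 (le_sup (f := fun r => ‖conv (fun y =>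
          (lamK (Mseq d (maxIdx d r)) r (radSq r) y : ℂ)) f x‖₊) h1))
        rw [← ofReal_norm, norm_inv]
        exact ofReal_le_ofReal (inv_anti₀ hc₀ (hE' r h1).1)
    · rw [hA, add_assoc]
      exact le_add_of_le_of_nonneg (single_le_sum
        (f := fun r => ‖conv (fun y => (avgK d r y : ℂ)) f x‖ₑ) (fun _ _ => zero_le)
        (hR2 ▸ mem_filter.2 ⟨hr, hrX⟩)) zero_le
  have hAle : nP p A ≤ ofReal (X * C₄) * nP p (fun x => ‖f x‖ₑ) := by
    rw [hA]
    refine (nP_sum_le hp1.le R2 _).trans ((sum_le_sum (g := fun _ => nP p fun x => ‖f x‖ₑ)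
      fun r hr => (nP_conv_le hp1.le _ f).trans ?_).trans ?_)
    · exact mul_le_of_le_one_left' (tsum_enorm_avgK_le (hadm r (hmem2 r hr).1).1)
    · rw [sum_const, nsmul_eq_mul]
      refine mul_le_mul_left ?_ _
      rw [← ofReal_natCast]
      refine ofReal_le_ofReal ?_
      have h1 := hR R2 (fun r hr => one_le_of_isAdmissible (hadm r (hmem2 r hr).1)) (hR2 ▸ hlac' _ _)
      have h2 : (R2.card : ℝ) * X⁻¹ ≤ ∑ r ∈ R2, r ^ (-1 : ℝ) := by
        rw [← nsmul_eq_mul]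
        refine card_nsmul_le_sum _ _ _ fun r hr => ?_
        rw [Real.rpow_neg_one]
        exact inv_anti₀ (hadm r (hmem2 r hr).1).1 (hmem2 r hr).2
      have h3 := h2.trans h1
      rwa [← div_eq_mul_inv, div_le_iff₀ hX0, mul_comm] at h3
  have hBle : nP p B ≤ ofReal ((C₁ * C₂) ^ (1 / p)) * nP p (fun x => ‖f x‖ₑ) := by
    refine (nP_le_iff hp0 (by positivity) _ _).2 ?_
    rw [← rpow_mul (by positivity), one_div_mul_cancel hp0.ne', rpow_one]
    refine (tsum_sup_rpow_le hp0 R1 _ B fun x => (congrFun hB x).le).trans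
      ((sum_le_sum fun r hr => (hE' r hr).2 f hf).trans ?_)
    rw [← sum_mul, ← ofReal_sum_of_nonneg (fun r _ => by positivity), ← mul_sum]
    exact mul_le_mul_left (ofReal_le_ofReal (mul_le_mul_of_nonneg_left
      (hS R1 (fun r hr => (hmem1 r hr).2.2) (hR1 ▸ hlac' _ _)) hC₁.le)) _
  have hDle := hL R1 (maxIdx d) (fun r => radSq r) hM (hR1 ▸ hlac' _ _) f hf
  refine (nP_mono hp0.le hpt).trans ((nP_add_le hp1.le _ _).trans ?_)
  rw [nP_const_mul hp0, ofReal_add (by positivity) (by positivity),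
    ofReal_add (by positivity) (by positivity), add_mul, add_mul,
    ofReal_mul (inv_pos.2 hc₀).le, mul_assoc (ofReal c₀⁻¹)]
  exact add_le_add ((nP_add_le hp1.le _ _).trans (add_le_add hAle hBle))
    (mul_le_mul_right (hD ▸ hDle) _)

/-- The spherical average of a nonnegative function, valued in `ℝ≥0∞`. -/
def avgE (d : ℕ) (r : ℝ) (F : Λ d → ℝ≥0) (x : Λ d) : ℝ≥0∞ :=
  ∑' z, ofReal (avgK d r z) * F (x - z)

lemma exists_sup_avgE_le (hd : 5 ≤ d) {c p : ℝ} (hc : 1 < c)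
    (hp : ((d : ℝ) - 1) / (d - 2) < p) : ∃ C : ℝ, 0 < C ∧
    ∀ R' : Finset ℝ, (∀ r ∈ R', IsAdmissible r) → (∀ r ∈ R', ∀ s ∈ R', r < s → c * r ≤ s) →
    ∀ F : Λ d → ℝ≥0, F.support.Finite →
      ∑' x, (R'.sup fun r => avgE d r F x) ^ p ≤ ofReal C * ∑' x, (F x : ℝ≥0∞) ^ p := by
  have hd' : (5 : ℝ) ≤ d := mod_cast hd
  have hpc : ((d : ℝ) - 1) / (d - 2) < 2 := (div_lt_iff₀ (by linarith)).2 (by linarith)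
  have hpc0 : 0 < ((d : ℝ) - 1) / (d - 2) := div_pos (by linarith) (by linarith)
  obtain ⟨q, hq1, hq2⟩ := exists_between (lt_min hp hpc)
  obtain ⟨hqp, hq2⟩ := lt_min_iff.1 hq2
  have hq0 := hpc0.trans hq1
  obtain ⟨C, hC, h⟩ := exists_maxConv_avgK_le hd hc hq1 hq2
  refine ⟨C ^ q, by positivity, fun R' hadm hlac F hF => ?_⟩
  obtain ⟨m, hm⟩ : ∃ m, m = p / q := ⟨_, rfl⟩
  have hm1 : 1 ≤ m := hm ▸ (one_le_div hq0).2 hqp.le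
  have hm0 : 0 < m := by linarith
  have hmq : m * q = p := by rw [hm, div_mul_cancel₀ _ hq0.ne']
  have hG : (fun y => F y ^ m).support.Finite := hF.subset fun y hy hFy => hy (by
    simp only [Function.notMem_support.1 (fun h => h hFy), NNReal.zero_rpow hm0.ne'])
  have hJ : ∀ r ∈ R', ∀ x, avgE d r F x ^ m ≤ avgE d r (fun y => F y ^ m) x := fun r hr x => by
    refine (tsum_mul_rpow_le hm1 _ _).trans ?_
    have h1 : ∑' z, ofReal (avgK d r z) ≤ 1 := by
      refine le_of_eq_of_le (tsum_congr fun z => ?_) (tsum_enorm_avgK_le (d := d) (hadm r hr).1)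
      rw [← ofReal_norm, norm_real, norm_of_nonneg (avgK_nonneg d r z)]
    refine (mul_le_of_le_one_left' (ENNReal.rpow_le_one h1 (by linarith))).trans_eq
      (tsum_congr fun z => ?_)
    rw [ENNReal.coe_rpow_of_nonneg _ hm0.le]
  have hsup : ∀ x, (R'.sup fun r => avgE d r F x) ^ p ≤
      (R'.sup fun r => avgE d r (fun y => F y ^ m) x) ^ q := fun x => by
    rw [← hmq, ENNReal.rpow_mul]
    refine rpow_le_rpow ?_ hq0.le
    rw [← ENNReal.le_rpow_inv_iff hm0]
    refine Finset.sup_le fun r hr => ?_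
    rw [ENNReal.le_rpow_inv_iff hm0]
    exact (hJ r hr x).trans (le_sup (f := fun r => avgE d r (fun y => F y ^ m) x) hr)
  refine (tsum_le_tsum hsup).trans ?_
  have h1 := (nP_le_iff hq0 hC.le _ _).1 (h R' hadm hlac (fun y => (((F y ^ m : ℝ≥0) : ℝ) : ℂ))
    (hG.subset fun y hy hGy => hy (by simp only [hGy, NNReal.coe_zero, Complex.ofReal_zero])))
  refine (le_of_eq ?_).trans (h1.trans_eq ?_)
  · refine tsum_congr fun x => ?_
    rw [maxConv, coe_finset_sup]
    refine congrArg (· ^ q) (Finset.sup_congr rfl fun r _ => ?_)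
    exact (enorm_conv_of_nonneg (avgK_nonneg d r) hG x).symm
  · refine congrArg _ (tsum_congr fun x => ?_)
    rw [← ofReal_norm, norm_real, norm_of_nonneg (coe_nonneg _),
      ofReal_coe_nnreal, ENNReal.coe_rpow_of_nonneg _ hm0.le, ← ENNReal.rpow_mul, hmq]

lemma enorm_sphAvg_le {r : ℝ} {f : Λ d → ℂ} {F : Λ d → ℝ≥0}
    {x : Λ d} (h : ∀ y, normSqZ y = (radSq r : ℤ) → ‖f (x - y)‖₊ ≤ F (x - y)) :
    ‖sphAvg d r f x‖ₑ ≤ avgE d r F x := by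
  rw [sphAvg, enorm_mul]
  refine (mul_le_mul_right (enorm_tsum_le_tsum_enorm) _).trans ?_
  rw [← ENNReal.tsum_mul_left]
  refine tsum_le_tsum fun y => ?_
  unfold avgK
  split_ifs with hy
  · refine mul_le_mul' (le_of_eq ?_) (coe_le_coe.2 (h y hy))
    rw [← ofReal_norm, norm_inv, Complex.norm_natCast]
  · simp

lemma exists_sphAvg_le (hd : 5 ≤ d) {R : Set ℝ} (hadm : ∀ r ∈ R, IsAdmissible r)
    (hlac : Lacunary R) {p : ℝ} (hp : ((d : ℝ) - 1) / (d - 2) < p) :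
    ∃ C : ℝ, 0 < C ∧ ∀ f : Λ d → ℂ,
      ∑' x, (⨆ r : R, ‖sphAvg d r f x‖ₑ) ^ p ≤ ofReal C * ∑' x, ‖f x‖ₑ ^ p := by
  obtain ⟨c, hc, hlac⟩ := hlac
  obtain ⟨C, hC, h⟩ := exists_sup_avgE_le hd hc hp
  have hd' : (5 : ℝ) ≤ d := mod_cast hd
  have hp0 : 0 < p := (div_pos (by linarith) (by linarith)).trans hp
  refine ⟨C, hC, fun f => ?_⟩
  rw [ENNReal.tsum_eq_iSup_sum]
  refine iSup_le fun X => ?_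
  have hsup : ∀ x, (⨆ r : R, ‖sphAvg d r f x‖ₑ) ^ p =
      ⨆ S : Finset R, (S.sup fun r => ‖sphAvg d r f x‖ₑ) ^ p := fun x => by
    rw [iSup_eq_iSup_finset]
    simp_rw [Finset.sup_eq_iSup]
    exact (ENNReal.orderIsoRpow p hp0).map_iSup _
  simp_rw [hsup]
  rw [ENNReal.finsetSum_iSup_of_monotone
    (f := fun x (S : Finset R) => (S.sup fun r => ‖sphAvg d r f x‖ₑ) ^ p)
    fun x S T hST => rpow_le_rpow (Finset.sup_mono hST) hp0.le]
  refine iSup_le fun S => ?_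
  obtain ⟨W, hW⟩ : ∃ W : Set Λ d, W = ⋃ x ∈ X, ⋃ r ∈ S,
    (fun y => x - y) '' {y | normSqZ y = (radSq r : ℤ)} := ⟨_, rfl⟩
  have hWf : W.Finite := hW ▸ X.finite_toSet.biUnion fun x _ => S.finite_toSet.biUnion fun r _ =>
    (finite_normSqZ_eq d _).image _
  have h1 := h (S.map ⟨Subtype.val, Subtype.val_injective⟩) (by simpa using fun r hr _ => hadm r hr)
    (by simpa using fun r hr _ s hs _ => hlac r hr s hs) (W.indicator fun y => ‖f y‖₊)
    (hWf.subset Set.support_indicator_subset)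
  refine le_trans ?_ (h1.trans (mul_le_mul_right (tsum_le_tsum fun x =>
    rpow_le_rpow (coe_le_coe.2 (Set.indicator_le_self' (fun _ _ => zero_le) x))
    hp0.le) _))
  refine (sum_le_sum fun x hx => rpow_le_rpow (Finset.sup_le fun r hr => ?_)
    hp0.le).trans (sum_le_tsum X)
  rw [Finset.sup_map]
  refine (enorm_sphAvg_le fun y hy => ?_).trans
    (le_sup (f := (fun r => avgE d r (W.indicator fun y => ‖f y‖₊) x) ∘
      (⟨Subtype.val, Subtype.val_injective⟩ : R ↪ ℝ)) hr)
  rw [Set.indicator_of_mem]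
  exact hW ▸ Set.mem_biUnion hx (Set.mem_biUnion hr ⟨y, hy, rfl⟩)

end LSph

theorem statement0 (d : ℕ) (hd : 5 ≤ d) (R : Set ℝ)
    (hadm : ∀ r ∈ R, IsAdmissible r) (hlac : Lacunary R)
    (G B : Set ℕ) (s : ℝ) (hs0 : 0 < s) (hs1 : s ≤ 1)
    (hGB : GoodBadDichotomy R G B s)
    (p : ℝ) (hp1 : (d : ℝ) / ((d : ℝ) - (1 + s)) ≤ p)
    (hp2 : ((d : ℝ) - 1) / ((d : ℝ) - 2) < p) :
    ∃ C : ℝ, 0 < C ∧ ∀ f : (Fin d → ℤ) → ℂ, lpNorm d p f < ⊤ →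
      (∑' x : Fin d → ℤ, (⨆ r : R, ((‖sphAvg d (r : ℝ) f x‖₊ : ℝ≥0∞))) ^ p) ^ (1 / p)
        ≤ ENNReal.ofReal C * lpNorm d p f := by
  obtain ⟨C, hC, h⟩ := LSph.exists_sphAvg_le hd hadm hlac hp2
  have hd' : (5 : ℝ) ≤ d := by exact_mod_cast hd
  have hp0 : 0 < p := (div_pos (by linarith) (by linarith)).trans hp2
  refine ⟨C ^ (1 / p), by positivity, fun f _ => (LSph.nP_le_iff hp0 (by positivity) _ _).2 ?_⟩
  rw [← Real.rpow_mul hC.le, one_div_mul_cancel hp0.ne', Real.rpow_one]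
  exact h f

end
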